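/- The sequence of optimal rectangular shapes for the k-th Dirichlet biharmonic eigenvalue converges to the square as k → ∞: for any sequence (a_k) with a_k ≥ 1 and λ_k(a_k) = inf_{a ≥ 1} λ_k(a) for every k, one has lim_{k→∞} a_k = 1; equivalently, the quotient q_k* = a_k² between the lengths of the largest and smallest sides of a minimising rectangle tends to 1. -/

import Mathlib

open MeasureTheory Real Filter

noncomputable section

/-- Directional (partial) derivative of `u : ℝ × ℝ → ℝ` in direction `v`. -/
def pd (v : ℝ × ℝ) (u : ℝ × ℝ → ℝ) : ℝ × ℝ → ℝ := fun p => fderiv ℝ u p v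

/-- Second partial derivative `∂²u/∂x²`. -/
def uxx (u : ℝ × ℝ → ℝ) : ℝ × ℝ → ℝ := pd (1, 0) (pd (1, 0) u)

/-- Second partial derivative `∂²u/∂y²`. -/
def uyy (u : ℝ × ℝ → ℝ) : ℝ × ℝ → ℝ := pd (0, 1) (pd (0, 1) u)

/-- Mixed second partial derivative `∂²u/∂x∂y`. -/
def uxy (u : ℝ × ℝ → ℝ) : ℝ × ℝ → ℝ := pd (0, 1) (pd (1, 0) u)

/-- The Laplacian `Δu = u_xx + u_yy`. -/
def lap (u : ℝ × ℝ → ℝ) : ℝ × ℝ → ℝ := fun p => uxx u p + uyy u p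

/-- The open rectangle `R_a = (0,a) × (0,1/a)` of unit area. -/
def Rect (a : ℝ) : Set (ℝ × ℝ) := Set.Ioo 0 a ×ˢ Set.Ioo 0 (1 / a)

/-- Admissible test functions: smooth, compactly supported inside `Ω`. -/
def Adm (Ω : Set (ℝ × ℝ)) (u : ℝ × ℝ → ℝ) : Prop :=
  ContDiff ℝ (⊤ : ℕ∞) u ∧ HasCompactSupport u ∧ tsupport u ⊆ Ω

/-- First Dirichlet eigenvalue of the biharmonic operator on `R_a`,
characterized variationally as the infimum of the Rayleigh quotient. -/
def lam1 (a : ℝ) : ℝ :=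
  sInf { μ | ∃ u : ℝ × ℝ → ℝ, Adm (Rect a) u ∧ u ≠ 0 ∧
    μ = (∫ p, (lap u p) ^ 2) / (∫ p, (u p) ^ 2) }

/-- `k`-th Dirichlet eigenvalue of the biharmonic operator on `R_a`:
infimum over linearly independent `k`-tuples of admissible functions of the
maximum of the Rayleigh quotient over nonzero linear combinations. -/
def lamk (k : ℕ) (a : ℝ) : ℝ :=
  sInf { μ | ∃ u : Fin k → (ℝ × ℝ → ℝ), (∀ i, Adm (Rect a) (u i)) ∧
    LinearIndependent ℝ u ∧
    μ = sSup { r | ∃ c : Fin k → ℝ, c ≠ 0 ∧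
      r = (∫ p, (lap (fun q => ∑ i, c i * u i q) p) ^ 2) /
          (∫ p, (∑ i, c i * u i p) ^ 2) } }

/-- The `L²(0, L)` pairing of continuous functions. -/
def ip (L : ℝ) : C(ℝ, ℝ) →ₗ[ℝ] C(ℝ, ℝ) →ₗ[ℝ] ℝ :=
  LinearMap.mk₂ ℝ (fun f g => ∫ x in (0 : ℝ)..L, f x * g x)
    (fun f f' g => by
      rw [← intervalIntegral.integral_add]
      · simp [add_mul]
      all_goals exact Continuous.intervalIntegrable (by fun_prop) _ _)
    (fun c f g => by
      rw [smul_eq_mul, ← intervalIntegral.integral_const_mul]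
      simp [mul_assoc])
    (fun f g g' => by
      rw [← intervalIntegral.integral_add]
      · simp [mul_add]
      all_goals exact Continuous.intervalIntegrable (by fun_prop) _ _)
    (fun c f g => by
      rw [smul_eq_mul, ← intervalIntegral.integral_const_mul]
      simp [mul_left_comm])

theorem ip_apply (L : ℝ) (f g : C(ℝ, ℝ)) : ip L f g = ∫ x in (0 : ℝ)..L, f x * g x := rfl

theorem ip_comm (L : ℝ) (f g : C(ℝ, ℝ)) : ip L f g = ip L g f := by
  simp [ip_apply, mul_comm]

theorem ip_self_nonneg {L : ℝ} (hL : 0 ≤ L) (f : C(ℝ, ℝ)) : 0 ≤ ip L f f := by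
  rw [ip_apply]
  exact intervalIntegral.integral_nonneg hL fun x _ => mul_self_nonneg _

theorem ip_self_pos {L : ℝ} (hL : 0 < L) (f : C(ℝ, ℝ)) (h0 : f 0 ≠ 0) : 0 < ip L f f := by
  rw [ip_apply]
  refine intervalIntegral.integral_pos hL (by fun_prop) (fun x _ => mul_self_nonneg _)
    ⟨0, ⟨le_refl _, hL.le⟩, mul_self_pos.2 h0⟩

theorem ip_mul_self_le {L : ℝ} (hL : 0 ≤ L) (f g : C(ℝ, ℝ)) :
    (ip L f g) ^ 2 ≤ ip L f f * ip L g g := by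
  have h := discrim_le_zero (a := ip L g g) (b := 2 * ip L f g) (c := ip L f f) (fun t => by
    have := ip_self_nonneg hL (f + t • g)
    simp only [map_add, map_smul, LinearMap.add_apply, LinearMap.smul_apply, smul_eq_mul,
      ip_comm L g f] at this
    linarith)
  unfold discrim at h
  nlinarith

theorem abs_ip_le {L A B : ℝ} (hL : 0 ≤ L) {f g : C(ℝ, ℝ)} (hA : 0 ≤ A) (hB : 0 ≤ B)
    (hf : ip L f f ≤ A ^ 2) (hg : ip L g g ≤ B ^ 2) : |ip L f g| ≤ A * B := by
  refine abs_le_of_sq_le_sq ?_ (by positivity)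
  calc _ ≤ _ := ip_mul_self_le hL f g
    _ ≤ A ^ 2 * B ^ 2 := mul_le_mul hf hg (ip_self_nonneg hL g) (by positivity)
    _ = _ := by ring

/-- `f` has derivative `f'` everywhere. -/
def Der (f f' : C(ℝ, ℝ)) : Prop := ∀ x, HasDerivAt f (f' x) x

theorem Der.add {f f' g g' : C(ℝ, ℝ)} (hf : Der f f') (hg : Der g g') : Der (f + g) (f' + g') :=
  fun x => (hf x).add (hg x)

theorem Der.sub {f f' g g' : C(ℝ, ℝ)} (hf : Der f f') (hg : Der g g') : Der (f - g) (f' - g') :=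
  fun x => (hf x).sub (hg x)

theorem Der.smul {f f' : C(ℝ, ℝ)} (c : ℝ) (hf : Der f f') : Der (c • f) (c • f') :=
  fun x => (hf x).const_smul c

theorem Der.sum {ι : Type*} (s : Finset ι) {f f' : ι → C(ℝ, ℝ)}
    (h : ∀ i ∈ s, Der (f i) (f' i)) : Der (∑ i ∈ s, f i) (∑ i ∈ s, f' i) := by
  intro x
  simp only [ContinuousMap.coe_sum, ContinuousMap.sum_apply]
  exact HasDerivAt.sum fun i hi => h i hi x

theorem ip_parts {L : ℝ} {f f' g g' : C(ℝ, ℝ)} (hf : Der f f') (hg : Der g g') :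
    ip L f' g = f L * g L - f 0 * g 0 - ip L f g' := by
  have := intervalIntegral.integral_mul_deriv_eq_deriv_mul (a := 0) (b := L)
    (fun x _ => hf x) (fun x _ => hg x)
    (f'.continuous.intervalIntegrable _ _) (g'.continuous.intervalIntegrable _ _)
  rw [ip_apply, ip_apply]
  linarith

/-- A pair of solutions of `c'' = -k² c` and `e'' = (2 - k²) e` on `[0, L]` of common parity `σ`
under the reflection of the interval, normalised to take the value `1` at `0`. -/
structure Prof (L k σ : ℝ) where
  c : C(ℝ, ℝ)
  c1 : C(ℝ, ℝ)
  e : C(ℝ, ℝ)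
  e1 : C(ℝ, ℝ)
  hc : Der c c1
  hc1 : Der c1 (-k ^ 2 • c)
  he : Der e e1
  he1 : Der e1 ((2 - k ^ 2) • e)
  c0 : c 0 = 1
  cL : c L = σ
  e0 : e 0 = 1
  c1L : c1 L = -σ * c1 0
  e1L : e1 L = -σ * e1 0
  e1_lb : -3 ≤ e1 0
  e_refl : ∀ x, e (L - x) = σ * e x
  c_smooth : ContDiff ℝ (⊤ : ℕ∞) c
  e_smooth : ContDiff ℝ (⊤ : ℕ∞) e

namespace Prof

variable {L k σ k' σ' : ℝ}

/-- The combination vanishing at both end points. -/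
def g (P : Prof L k σ) : C(ℝ, ℝ) := P.c - P.e

/-- First derivative of `g`. -/
def g1 (P : Prof L k σ) : C(ℝ, ℝ) := P.c1 - P.e1

/-- Second derivative of `g`. -/
def g2 (P : Prof L k σ) : C(ℝ, ℝ) := -k ^ 2 • P.c - (2 - k ^ 2) • P.e

/-- Slope of `g` at the left end point. -/
def s (P : Prof L k σ) : ℝ := P.c1 0 - P.e1 0

theorem eL (P : Prof L k σ) : P.e L = σ := by
  have := P.e_refl 0
  simpa [P.e0] using this

theorem der_g (P : Prof L k σ) : Der P.g P.g1 := P.hc.sub P.he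

theorem der_g1 (P : Prof L k σ) : Der P.g1 P.g2 := P.hc1.sub P.he1

theorem g_zero (P : Prof L k σ) : P.g 0 = 0 := by simp [g, P.c0, P.e0]

theorem g_L (P : Prof L k σ) : P.g L = 0 := by simp [g, P.cL, P.eL]

theorem g1_zero (P : Prof L k σ) : P.g1 0 = P.s := rfl

theorem g1_L (P : Prof L k σ) : P.g1 L = -σ * P.s := by
  simp [g1, P.c1L, P.e1L, s]; ring

theorem g2_eq (P : Prof L k σ) : P.g2 = -k ^ 2 • P.g - (2 : ℝ) • P.e := by
  ext x; simp [g2, g]; ring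

theorem g_smooth (P : Prof L k σ) : ContDiff ℝ (⊤ : ℕ∞) P.g := P.c_smooth.sub P.e_smooth

theorem norm_e (P : Prof L k σ) (hL : 0 ≤ L) (hσ : σ ^ 2 = 1) (hk : k ^ 2 ≤ 1) :
    ip L P.e P.e ≤ 6 := by
  have h := ip_parts (L := L) P.he1 P.he
  have h1 := ip_self_nonneg hL P.e
  have h2 := ip_self_nonneg hL P.e1
  have h3 := P.e1_lb
  simp only [map_smul, LinearMap.smul_apply, smul_eq_mul, P.e1L, P.eL, P.e0] at h
  nlinarith

theorem ip_e_c (P : Prof L k σ) (P' : Prof L k' σ') :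
    (2 - k ^ 2 + k' ^ 2) * ip L P.e P'.c = (1 + σ * σ') * (P'.c1 0 - P.e1 0) := by
  have h1 := ip_parts (L := L) P.he1 P'.hc
  have h2 := ip_parts (L := L) P'.hc1 P.he
  simp only [map_smul, LinearMap.smul_apply, smul_eq_mul, P.e1L,
    P.eL, P.e0, P'.c1L, P'.cL, P'.c0, ip_comm L P'.c P.e, ip_comm L P'.c1 P.e1] at h1 h2
  linarith

theorem ip_e_c_self (P : Prof L k σ) (hσ : σ ^ 2 = 1) : ip L P.e P.c = P.s := by
  have := P.ip_e_c P
  have h2 : σ * σ = 1 := by rw [← hσ]; ring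
  rw [h2] at this
  unfold s
  linarith

theorem ip_e_g_self (P : Prof L k σ) (hσ : σ ^ 2 = 1) :
    ip L P.e P.g = P.s - ip L P.e P.e := by
  rw [g, map_sub, ip_e_c_self P hσ]

theorem ip_e_e_opp (P : Prof L k σ) (P' : Prof L k' (-σ)) (hσ : σ ^ 2 = 1) :
    ip L P.e P'.e = 0 := by
  have h : ip L P.e P'.e = -ip L P.e P'.e := by
    conv_lhs => rw [ip_apply]
    have := intervalIntegral.integral_comp_sub_left (a := 0) (b := L)
      (fun x => P.e x * P'.e x) L
    simp only [sub_self, sub_zero] at this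
    rw [← this, ip_apply, ← intervalIntegral.integral_neg]
    congr 1; ext x
    rw [P.e_refl, P'.e_refl]
    linear_combination (-(P.e x * P'.e x)) * hσ
  linarith

theorem ip_e_g_opp (P : Prof L k σ) (P' : Prof L k (-σ)) (hσ : σ ^ 2 = 1) :
    ip L P.e P'.g = 0 := by
  have := P.ip_e_c P'
  have h2 : σ * -σ = -1 := by rw [← hσ]; ring
  rw [h2] at this
  rw [g, map_sub, ip_e_e_opp P P' hσ]
  linarith

theorem norm_e_sub (P : Prof L k σ) (P' : Prof L k' σ) (hL : 0 ≤ L) (hσ : σ ^ 2 = 1)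
    (hk : k ^ 2 ≤ 1) (hk' : k' ^ 2 ≤ 1) :
    ip L (P.e - P'.e) (P.e - P'.e) ≤ 6 * (k ^ 2 - k' ^ 2) ^ 2 := by
  have h := ip_parts (L := L) (P.he1.sub P'.he1) (P.he.sub P'.he)
  set D := P.e - P'.e with hD
  have e1 : (2 - k ^ 2) • P.e - (2 - k' ^ 2) • P'.e
      = (2 - k ^ 2) • D + (k' ^ 2 - k ^ 2) • P'.e := by
    ext x; simp [hD]; ring
  have d0 : D 0 = 0 := by simp [hD, P.e0, P'.e0]
  have dL : D L = 0 := by simp [hD, P.eL, P'.eL]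
  rw [e1, d0, dL] at h
  simp only [map_add, map_smul, LinearMap.add_apply, LinearMap.smul_apply, smul_eq_mul] at h
  have h1 := ip_self_nonneg hL D
  have h2 := ip_self_nonneg hL (P.e1 - P'.e1)
  have h3 := ip_mul_self_le hL P'.e D
  have h4 := P'.norm_e hL hσ hk'
  set d := ip L D D
  set t := ip L P'.e D
  have h5 : d ≤ (k ^ 2 - k' ^ 2) * t := by nlinarith
  have h6 : d ^ 2 ≤ (k ^ 2 - k' ^ 2) ^ 2 * (6 * d) := by
    calc d ^ 2 ≤ ((k ^ 2 - k' ^ 2) * t) ^ 2 := by gcongr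
      _ = (k ^ 2 - k' ^ 2) ^ 2 * t ^ 2 := by ring
      _ ≤ _ := by gcongr; nlinarith
  by_contra hcon
  push Not at hcon
  nlinarith

theorem norm_c (P : Prof L k σ) (hσ : σ ^ 2 = 1) :
    2 * k ^ 2 * ip L P.c P.c = (P.c1 0 ^ 2 + k ^ 2) * L + 2 * P.c1 0 := by
  have h := ip_parts (L := L) P.hc1 P.hc
  simp only [map_smul, LinearMap.smul_apply, smul_eq_mul, P.c1L,
    P.cL, P.c0] at h
  have hconst : ∀ x, P.c1 x ^ 2 + k ^ 2 * P.c x ^ 2 = P.c1 0 ^ 2 + k ^ 2 := by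
    have hd : ∀ x, HasDerivAt (fun x => P.c1 x ^ 2 + k ^ 2 * P.c x ^ 2) 0 x := by
      intro x
      refine (((P.hc1 x).pow 2).add (((P.hc x).pow 2).const_mul (k ^ 2))).congr_deriv ?_
      simp; ring
    intro x
    have := is_const_of_deriv_eq_zero (fun x => (hd x).differentiableAt)
      (fun x => (hd x).deriv) x 0
    simpa [P.c0] using this
  have h2 : ip L P.c1 P.c1 + k ^ 2 * ip L P.c P.c = (P.c1 0 ^ 2 + k ^ 2) * L := by
    rw [ip_apply, ip_apply, ← intervalIntegral.integral_const_mul,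
      ← intervalIntegral.integral_add]
    · calc _ = ∫ x in (0 : ℝ)..L, (P.c1 0 ^ 2 + k ^ 2) := by
            congr 1; ext x; rw [← hconst x]; ring
        _ = _ := by rw [intervalIntegral.integral_const]; simp [mul_comm]
    all_goals exact Continuous.intervalIntegrable (by fun_prop) _ _
  linear_combination h2 - h + P.c1 0 * hσ

/-- Third derivative of `g`. -/
def g3 (P : Prof L k σ) : C(ℝ, ℝ) := -k ^ 2 • P.c1 - (2 - k ^ 2) • P.e1

theorem der_g2 (P : Prof L k σ) : Der P.g2 P.g3 :=
  (P.hc.smul _).sub (P.he.smul _)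

theorem der_g3 (P : Prof L k σ) : Der P.g3
    ((2 * (1 - k ^ 2)) • P.g2 + (1 - (1 - k ^ 2) ^ 2) • P.g) := by
  have h : (2 * (1 - k ^ 2)) • P.g2 + (1 - (1 - k ^ 2) ^ 2) • P.g
      = -k ^ 2 • (-k ^ 2 • P.c) - (2 - k ^ 2) • ((2 - k ^ 2) • P.e) := by
    ext x; simp [g2, g]; ring
  rw [h]
  exact (P.hc1.smul (-k ^ 2)).sub (P.he1.smul (2 - k ^ 2))

/-! Clamped modes: profiles of zero slope. -/

theorem clamped_left (P : Prof L k σ) (P' : Prof L k' σ') (h' : P'.s = 0) :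
    ip L P.g2 P'.g2 = -2 * (1 - k ^ 2) * ip L P.g1 P'.g1
      + (1 - (1 - k ^ 2) ^ 2) * ip L P.g P'.g := by
  have h1 := ip_parts (L := L) P.der_g3 P'.der_g
  have h2 := ip_parts (L := L) P.der_g2 P'.der_g1
  have h3 := ip_parts (L := L) P.der_g1 P'.der_g
  simp only [map_add, map_smul, LinearMap.add_apply, LinearMap.smul_apply, smul_eq_mul,
    g_zero, g_L, g1_zero, g1_L, h'] at h1 h2 h3
  linear_combination h2 - h1 + 2 * (1 - k ^ 2) * h3

theorem clamped_g1 (P : Prof L k σ) (P' : Prof L k' σ') (h : P.s = 0) (h' : P'.s = 0)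
    (hk : k ^ 2 ≠ k' ^ 2) :
    2 * ip L P.g1 P'.g1 = -((1 - k ^ 2) + (1 - k' ^ 2)) * ip L P.g P'.g := by
  have h1 := P.clamped_left P' h'
  have h2 := P'.clamped_left P h
  rw [ip_comm L P'.g2, ip_comm L P'.g1, ip_comm L P'.g] at h2
  have h3 : k ^ 2 - k' ^ 2 ≠ 0 := sub_ne_zero.2 hk
  apply mul_left_cancel₀ h3
  linear_combination h2 - h1

theorem clamped_g2 (P : Prof L k σ) (P' : Prof L k' σ') (h : P.s = 0) (h' : P'.s = 0)
    (hk : k ^ 2 ≠ k' ^ 2) :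
    ip L P.g2 P'.g2 = (1 + (1 - k ^ 2) * (1 - k' ^ 2)) * ip L P.g P'.g := by
  have h1 := P.clamped_left P' h'
  have h2 := P.clamped_g1 P' h h' hk
  linear_combination h1 - (1 - k ^ 2) * h2

theorem ip_g2_g (P : Prof L k σ) (P' : Prof L k' σ') :
    ip L P.g2 P'.g = -ip L P.g1 P'.g1 := by
  have h3 := ip_parts (L := L) P.der_g1 P'.der_g
  simp only [g_zero, g_L] at h3
  linear_combination h3

theorem clamped_e_g (P : Prof L k σ) (P' : Prof L k' σ') (h : P.s = 0) (h' : P'.s = 0)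
    (hk : k ^ 2 ≠ k' ^ 2) :
    4 * ip L P.e P'.g = -(2 - (1 - k ^ 2) + (1 - k' ^ 2)) * ip L P.g P'.g := by
  have h2 := P.clamped_g1 P' h h' hk
  have h3 := P.ip_g2_g P'
  rw [g2_eq] at h3
  simp only [map_sub, map_smul, LinearMap.sub_apply, LinearMap.smul_apply,
    smul_eq_mul] at h3
  linear_combination -2 * h3 + h2

/-- The weight of a clamped mode in the energy identities. -/
def C (P : Prof L k σ) : ℝ := 2 * ip L P.g P.g - 4 * ip L P.e P.e

theorem clamped_g1_self (P : Prof L k σ) (hσ : σ ^ 2 = 1) (h : P.s = 0) :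
    2 * ip L P.g1 P.g1 = P.C - 2 * (1 - k ^ 2) * ip L P.g P.g := by
  have h3 := P.ip_g2_g P
  have h4 := P.ip_e_g_self hσ
  rw [h] at h4
  rw [g2_eq] at h3
  simp only [map_sub, map_smul, LinearMap.sub_apply, LinearMap.smul_apply,
    smul_eq_mul] at h3
  unfold C
  linear_combination 2 * h3 + 4 * h4

theorem clamped_g2_self (P : Prof L k σ) (hσ : σ ^ 2 = 1) (h : P.s = 0) :
    ip L P.g2 P.g2 = (1 + (1 - k ^ 2) ^ 2) * ip L P.g P.g - (1 - k ^ 2) * P.C := by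
  have h1 := P.clamped_left P h
  have h2 := P.clamped_g1_self hσ h
  linear_combination h1 - (1 - k ^ 2) * h2

theorem C_pos (P : Prof L k σ) (hL : 0 < L) (hσ : σ ^ 2 = 1) (h : P.s = 0) (hk : k ^ 2 < 1) :
    0 < P.C := by
  have h2 := P.clamped_g1_self hσ h
  have h3 := ip_self_nonneg hL.le P.g1
  have h4 := ip_mul_self_le hL.le P.e P.g
  rw [P.ip_e_g_self hσ, h] at h4
  have h5 := ip_self_pos hL P.e (by simp [P.e0])
  have h6 : 0 < ip L P.g P.g := by nlinarith
  nlinarith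

end Prof

theorem sinh_div_cosh_bounds {x : ℝ} (hx : 0 < x) :
    1 - 1 / x ≤ sinh x / cosh x ∧ sinh x / cosh x ≤ 1 := by
  have hc := cosh_pos x
  have h1 : cosh x - sinh x = exp (-x) := by rw [cosh_eq, sinh_eq]; ring
  have h2 : x + 1 ≤ exp x := add_one_le_exp x
  have h4 : 1 ≤ cosh x := one_le_cosh x
  have h5 : x * exp (-x) ≤ 1 := by
    rw [exp_neg, ← div_eq_mul_inv, div_le_one (exp_pos x)]; linarith
  refine ⟨?_, ?_⟩
  · rw [le_div_iff₀ hc]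
    have : (1 / x) * cosh x ≥ exp (-x) := by
      rw [ge_iff_le, one_div, inv_mul_eq_div, le_div_iff₀ hx]; linarith
    linarith
  · rw [div_le_one hc]; linarith [exp_pos (-x)]

theorem cosh_div_sinh_bounds {x : ℝ} (hx : 0 < x) :
    1 ≤ cosh x / sinh x ∧ cosh x / sinh x ≤ 1 + 1 / x := by
  have hs : 0 < sinh x := sinh_pos_iff.2 hx
  have h1 : cosh x - sinh x = exp (-x) := by rw [cosh_eq, sinh_eq]; ring
  have h6 : x ≤ sinh x := self_le_sinh_iff.2 hx.le
  have h7 : exp (-x) ≤ 1 := exp_le_one_iff.2 (by linarith)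
  refine ⟨?_, ?_⟩
  · rw [le_div_iff₀ hs]; linarith [exp_pos (-x)]
  · rw [div_le_iff₀ hs]
    have : (1 / x) * sinh x ≥ 1 := by
      rw [ge_iff_le, one_div, inv_mul_eq_div, le_div_iff₀ hx]; linarith
    linarith

theorem one_le_kap {k : ℝ} (hk : k ^ 2 ≤ 1) : 1 ≤ √(2 - k ^ 2) := by
  rw [one_le_sqrt]; linarith

theorem exists_prof_even {L k : ℝ} (hL : 4 ≤ L) (hk : k ^ 2 ≤ 1) (hc : cos (k * L / 2) ≠ 0) :
    ∃ P : Prof L k 1, P.s = k * (sin (k * L / 2) / cos (k * L / 2)) +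
      √(2 - k ^ 2) * (sinh (√(2 - k ^ 2) * L / 2) / cosh (√(2 - k ^ 2) * L / 2)) := by
  have hκ := one_le_kap hk
  have hκ2 : √(2 - k ^ 2) ^ 2 = 2 - k ^ 2 := sq_sqrt (by linarith)
  set κ := √(2 - k ^ 2)
  have hch := (cosh_pos (κ * L / 2)).ne'
  have hlin : ∀ (b x : ℝ), HasDerivAt (fun x : ℝ => b * (x - L / 2)) b x := fun b x => by
    simpa using ((hasDerivAt_id x).sub_const (L / 2)).const_mul b
  have e1 : k * (L - L / 2) = k * L / 2 := by ring
  have e2 : k * (0 - L / 2) = -(k * L / 2) := by ring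
  have e3 : κ * (L - L / 2) = κ * L / 2 := by ring
  have e4 : κ * (0 - L / 2) = -(κ * L / 2) := by ring
  refine ⟨{
    c := ⟨fun x => cos (k * (x - L / 2)) / cos (k * L / 2), by fun_prop⟩
    c1 := ⟨fun x => -sin (k * (x - L / 2)) * k / cos (k * L / 2), by fun_prop⟩
    e := ⟨fun x => cosh (κ * (x - L / 2)) / cosh (κ * L / 2), by fun_prop⟩
    e1 := ⟨fun x => sinh (κ * (x - L / 2)) * κ / cosh (κ * L / 2), by fun_prop⟩
    hc := fun x => (hlin k x).cos.div_const _
    hc1 := fun x => by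
      refine (((hlin k x).sin.neg.mul_const k).div_const _).congr_deriv ?_
      simp; ring
    he := fun x => (hlin κ x).cosh.div_const _
    he1 := fun x => by
      refine (((hlin κ x).sinh.mul_const κ).div_const _).congr_deriv ?_
      simp only [ContinuousMap.smul_apply, ContinuousMap.coe_mk, smul_eq_mul, ← hκ2]; ring
    c0 := ?_, cL := ?_, e0 := ?_, c1L := ?_, e1L := ?_, e1_lb := ?_, e_refl := ?_
    c_smooth := ?_, e_smooth := ?_ }, ?_⟩
  all_goals simp only [ContinuousMap.coe_mk, e1, e2, e3, e4, cos_neg, sin_neg, cosh_neg,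
    sinh_neg, Prof.s]
  · exact div_self hc
  · exact div_self hc
  · exact div_self hch
  · ring
  · ring
  · have h1 := (sinh_div_cosh_bounds (x := κ * L / 2) (by positivity)).2
    have h2 : κ ≤ 3 := by nlinarith [sq_nonneg k]
    have : -sinh (κ * L / 2) * κ / cosh (κ * L / 2)
        = -(κ * (sinh (κ * L / 2) / cosh (κ * L / 2))) := by ring
    rw [this]
    nlinarith
  · intro x
    rw [one_mul, show κ * (L - x - L / 2) = -(κ * (x - L / 2)) by ring, cosh_neg]
  · fun_prop
  · fun_prop
  · ring

theorem exists_prof_odd {L k : ℝ} (hL : 4 ≤ L) (hk : k ^ 2 ≤ 1) (hc : sin (k * L / 2) ≠ 0) :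
    ∃ P : Prof L k (-1), P.s = -k * (cos (k * L / 2) / sin (k * L / 2)) +
      √(2 - k ^ 2) * (cosh (√(2 - k ^ 2) * L / 2) / sinh (√(2 - k ^ 2) * L / 2)) := by
  have hκ := one_le_kap hk
  have hκ2 : √(2 - k ^ 2) ^ 2 = 2 - k ^ 2 := sq_sqrt (by linarith)
  set κ := √(2 - k ^ 2)
  have hch : sinh (κ * L / 2) ≠ 0 := (sinh_pos_iff.2 (by positivity)).ne'
  have hlin : ∀ (b x : ℝ), HasDerivAt (fun x : ℝ => b * (x - L / 2)) b x := fun b x => by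
    simpa using ((hasDerivAt_id x).sub_const (L / 2)).const_mul b
  have e1 : k * (L - L / 2) = k * L / 2 := by ring
  have e2 : k * (0 - L / 2) = -(k * L / 2) := by ring
  have e3 : κ * (L - L / 2) = κ * L / 2 := by ring
  have e4 : κ * (0 - L / 2) = -(κ * L / 2) := by ring
  refine ⟨{
    c := ⟨fun x => -(sin (k * (x - L / 2)) / sin (k * L / 2)), by fun_prop⟩
    c1 := ⟨fun x => -(cos (k * (x - L / 2)) * k / sin (k * L / 2)), by fun_prop⟩
    e := ⟨fun x => -(sinh (κ * (x - L / 2)) / sinh (κ * L / 2)), by fun_prop⟩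
    e1 := ⟨fun x => -(cosh (κ * (x - L / 2)) * κ / sinh (κ * L / 2)), by fun_prop⟩
    hc := fun x => ((hlin k x).sin.div_const _).neg
    hc1 := fun x => by
      refine (((hlin k x).cos.mul_const k).div_const _).neg.congr_deriv ?_
      simp; ring
    he := fun x => ((hlin κ x).sinh.div_const _).neg
    he1 := fun x => by
      refine (((hlin κ x).cosh.mul_const κ).div_const _).neg.congr_deriv ?_
      simp only [ContinuousMap.smul_apply, ContinuousMap.coe_mk, smul_eq_mul, ← hκ2]; ring
    c0 := ?_, cL := ?_, e0 := ?_, c1L := ?_, e1L := ?_, e1_lb := ?_, e_refl := ?_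
    c_smooth := ?_, e_smooth := ?_ }, ?_⟩
  all_goals simp only [ContinuousMap.coe_mk, e1, e2, e3, e4, cos_neg, sin_neg, cosh_neg,
    sinh_neg, Prof.s]
  · rw [neg_div, neg_neg]; exact div_self hc
  · rw [div_self hc]
  · rw [neg_div, neg_neg]; exact div_self hch
  · ring
  · ring
  · have h1 := (cosh_div_sinh_bounds (x := κ * L / 2) (by positivity)).2
    have h4 : κ * (1 / (κ * L / 2)) ≤ 1 := by
      rw [show κ * (1 / (κ * L / 2)) = 2 / L by field_simp, div_le_one (by linarith)]; linarith
    have : -(cosh (κ * L / 2) * κ / sinh (κ * L / 2))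
        = -(κ * (cosh (κ * L / 2) / sinh (κ * L / 2))) := by ring
    rw [this]
    have h5 := mul_le_mul_of_nonneg_left h1 (by linarith : 0 ≤ κ)
    nlinarith
  · intro x
    rw [show κ * (L - x - L / 2) = -(κ * (x - L / 2)) by ring, sinh_neg]; ring
  · fun_prop
  · fun_prop
  · ring

/-- Slope of the profile of frequency `k` on the branch `j π ≤ k L ≤ (j + 1) π`. -/
def bslope (L : ℝ) (j : ℕ) (k : ℝ) : ℝ :=
  -k * (cos (k * L / 2 - j * (π / 2)) / sin (k * L / 2 - j * (π / 2))) +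
    √(2 - k ^ 2) * if Even j
      then cosh (√(2 - k ^ 2) * L / 2) / sinh (√(2 - k ^ 2) * L / 2)
      else sinh (√(2 - k ^ 2) * L / 2) / cosh (√(2 - k ^ 2) * L / 2)

/-- The limiting phase at which the bslope vanishes. -/
def theta (k : ℝ) : ℝ := 2 / π * arcsin (k / √2)

theorem sin_cos_shift_even (a : ℝ) (i : ℕ) :
    sin (a + (i + i : ℕ) * (π / 2)) = (-1) ^ i * sin a ∧
    cos (a + (i + i : ℕ) * (π / 2)) = (-1) ^ i * cos a := by
  have : a + (i + i : ℕ) * (π / 2) = a + i * π := by push_cast; ring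
  rw [this]
  exact ⟨sin_add_nat_mul_pi _ _, cos_add_nat_mul_pi _ _⟩

theorem sin_cos_shift_odd (a : ℝ) (i : ℕ) :
    sin (a + (2 * i + 1 : ℕ) * (π / 2)) = (-1) ^ i * cos a ∧
    cos (a + (2 * i + 1 : ℕ) * (π / 2)) = -((-1) ^ i * sin a) := by
  have : a + (2 * i + 1 : ℕ) * (π / 2) = (a + i * π) + π / 2 := by push_cast; ring
  rw [this, sin_add_pi_div_two, cos_add_pi_div_two]
  exact ⟨cos_add_nat_mul_pi _ _, by rw [sin_add_nat_mul_pi]⟩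

theorem exists_prof_branch {L k : ℝ} (hL : 4 ≤ L) (hk : k ^ 2 ≤ 1) (j : ℕ)
    (hs : sin (k * L / 2 - j * (π / 2)) ≠ 0) :
    ∃ P : Prof L k ((-1) ^ (j + 1)), P.s = bslope L j k := by
  set a := k * L / 2 - j * (π / 2) with ha
  have hkL : k * L / 2 = a + j * (π / 2) := by rw [ha]; ring
  rcases Nat.even_or_odd j with ⟨i, hi⟩ | ⟨i, hi⟩
  · obtain ⟨h1, h2⟩ := sin_cos_shift_even a i
    rw [← hi, ← hkL] at h1 h2
    have hp : ((-1 : ℝ) ^ i) ≠ 0 := by positivity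
    obtain ⟨P, hP⟩ := exists_prof_odd hL hk (by rw [h1]; positivity)
    have hσ : (-1 : ℝ) ^ (j + 1) = -1 := by rw [hi, pow_succ, ← two_mul, pow_mul]; norm_num
    rw [hσ]
    refine ⟨P, ?_⟩
    rw [hP, bslope, if_pos ⟨i, hi⟩, ← ha, h1, h2, mul_div_mul_left _ _ hp]
  · obtain ⟨h1, h2⟩ := sin_cos_shift_odd a i
    rw [← hi, ← hkL] at h1 h2
    have hp : ((-1 : ℝ) ^ i) ≠ 0 := by positivity
    obtain ⟨P, hP⟩ := exists_prof_even hL hk (by rw [h2]; simpa using hs)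
    have hσ : (-1 : ℝ) ^ (j + 1) = 1 := by
      rw [hi, show 2 * i + 1 + 1 = 2 * (i + 1) by ring, pow_mul]; norm_num
    rw [hσ]
    refine ⟨P, ?_⟩
    rw [hP, bslope, if_neg (by rw [Nat.not_even_iff_odd]; exact ⟨i, hi⟩), ← ha, h1, h2, div_neg,
      mul_div_mul_left _ _ hp]
    ring

theorem exists_prof_other {L k : ℝ} (hL : 4 ≤ L) (hk0 : 0 ≤ k) (hk : k ^ 2 ≤ 1) (j : ℕ)
    (h0 : 0 ≤ k * L / 2 - j * (π / 2)) (h1 : k * L / 2 - j * (π / 2) < π / 2) :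
    ∃ P : Prof L k (-(-1) ^ (j + 1)), 1 / 2 ≤ P.s := by
  set a := k * L / 2 - j * (π / 2) with ha
  have hkL : k * L / 2 = a + j * (π / 2) := by rw [ha]; ring
  have hκ := one_le_kap hk
  have hcos : 0 < cos a := cos_pos_of_mem_Ioo ⟨by linarith [pi_pos], h1⟩
  have hsin : 0 ≤ sin a := sin_nonneg_of_nonneg_of_le_pi h0 (by linarith [pi_pos])
  have htan : 0 ≤ k * (sin a / cos a) := by positivity
  set κ := √(2 - k ^ 2) with hκdef
  have hx : 2 ≤ κ * L / 2 := by nlinarith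
  rcases Nat.even_or_odd j with ⟨i, hi⟩ | ⟨i, hi⟩
  · obtain ⟨h1, h2⟩ := sin_cos_shift_even a i
    rw [← hi, ← hkL] at h1 h2
    have hp : ((-1 : ℝ) ^ i) ≠ 0 := by positivity
    obtain ⟨P, hP⟩ := exists_prof_even hL hk (by rw [h2]; positivity)
    have hσ : -(-1 : ℝ) ^ (j + 1) = 1 := by rw [hi, pow_succ, ← two_mul, pow_mul]; norm_num
    rw [hσ]
    refine ⟨P, ?_⟩
    rw [hP, h1, h2, mul_div_mul_left _ _ hp, ← hκdef]
    have h3 := (sinh_div_cosh_bounds (x := κ * L / 2) (by linarith)).1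
    have h4 : 1 / (κ * L / 2) ≤ 1 / 2 := one_div_le_one_div_of_le (by norm_num) hx
    nlinarith
  · obtain ⟨h1, h2⟩ := sin_cos_shift_odd a i
    rw [← hi, ← hkL] at h1 h2
    have hp : ((-1 : ℝ) ^ i) ≠ 0 := by positivity
    obtain ⟨P, hP⟩ := exists_prof_odd hL hk (by rw [h1]; positivity)
    have hσ : -(-1 : ℝ) ^ (j + 1) = -1 := by
      rw [hi, show 2 * i + 1 + 1 = 2 * (i + 1) by ring, pow_mul]; norm_num
    rw [hσ]
    refine ⟨P, ?_⟩
    rw [hP, h1, h2, neg_div, mul_div_mul_left _ _ hp, ← hκdef]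
    have h3 := (cosh_div_sinh_bounds (x := κ * L / 2) (by linarith)).1
    nlinarith

theorem theta_nonneg {k : ℝ} (hk : 0 ≤ k) : 0 ≤ theta k := by
  have : 0 ≤ arcsin (k / √2) := arcsin_nonneg.2 (by positivity)
  unfold theta; positivity

theorem theta_le_half {k : ℝ} (hk1 : k ≤ 1) : theta k ≤ 1 / 2 := by
  have h : arcsin (k / √2) ≤ π / 4 := by
    have : k / √2 ≤ sin (π / 4) := by
      rw [sin_pi_div_four, div_le_iff₀ (by positivity)]
      nlinarith [sq_sqrt (show (0 : ℝ) ≤ 2 by norm_num)]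
    exact (arcsin_le_iff_le_sin' ⟨by linarith [pi_pos], by linarith [pi_pos]⟩).2 this
  unfold theta
  calc 2 / π * arcsin (k / √2) ≤ 2 / π * (π / 4) := by gcongr
    _ = 1 / 2 := by field_simp; norm_num

theorem bslope_near {L k : ℝ} (hL : 4 ≤ L) (hk0 : 0 ≤ k) (hk : k ≤ 1) (j : ℕ) (f : ℝ)
    (hf : k * L / π = j + f) (hf0 : 0 < f) (hf1 : f ≤ 1) :
    |bslope L j k - √2 * (sin (π / 2 * (f - theta k)) / sin (π / 2 * f))| ≤ 2 / L := by
  have hk2 : k ^ 2 ≤ 1 := by nlinarith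
  have hκ := one_le_kap hk2
  have hπ := pi_pos
  have ha : k * L / 2 - j * (π / 2) = π / 2 * f := by
    field_simp at hf; linarith
  have hsin : 0 < sin (π / 2 * f) := sin_pos_of_pos_of_lt_pi (by positivity) (by nlinarith)
  have hk2' : k / √2 ≤ 1 := by
    rw [div_le_one (by positivity)]; exact hk.trans (one_le_sqrt.2 (by norm_num))
  have hα : π / 2 * theta k = arcsin (k / √2) := by unfold theta; field_simp
  have h2 : √2 ^ 2 = (2 : ℝ) := sq_sqrt (by norm_num)
  have hsα : √2 * sin (π / 2 * theta k) = k := by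
    rw [hα, sin_arcsin (by linarith [show 0 ≤ k / √2 by positivity]) hk2']; field_simp
  have hcα : √2 * cos (π / 2 * theta k) = √(2 - k ^ 2) := by
    rw [hα, cos_arcsin, ← sqrt_mul (by norm_num)]
    congr 1; rw [div_pow, h2]; ring
  set κ := √(2 - k ^ 2) with hκdef
  have hmain : √2 * (sin (π / 2 * (f - theta k)) / sin (π / 2 * f))
      = κ - k * (cos (π / 2 * f) / sin (π / 2 * f)) := by
    rw [mul_sub, sin_sub]
    generalize sin (π / 2 * f) = S at hsin
    generalize cos (π / 2 * f) = T
    generalize sin (π / 2 * theta k) = s at hsα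
    generalize cos (π / 2 * theta k) = c at hcα
    rw [← hcα, ← hsα]
    field_simp
  have hxx : κ * (1 / (κ * L / 2)) = 2 / L := by field_simp
  have hx0 : 0 < κ * L / 2 := by positivity
  rw [hmain, bslope, ha, ← hκdef]
  split_ifs
  · obtain ⟨h3, h4⟩ := cosh_div_sinh_bounds hx0
    rw [← hxx, abs_le]; constructor
    · nlinarith
    · nlinarith
  · obtain ⟨h3, h4⟩ := sinh_div_cosh_bounds hx0
    rw [← hxx, abs_le]; constructor
    · nlinarith
    · nlinarith [show 0 < 1 / (κ * L / 2) by positivity]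

theorem le_abs_sin_half_pi {x : ℝ} (h0 : 0 ≤ x) (h1 : x ≤ 1) : x ≤ sin (π / 2 * x) := by
  have := mul_le_sin (x := π / 2 * x) (by positivity) (by nlinarith [pi_pos])
  calc x = 2 / π * (π / 2 * x) := by field_simp
    _ ≤ _ := this

theorem bslope_pos_of {L k ε : ℝ} (hL : 4 ≤ L) (hk0 : 0 ≤ k) (hk : k ≤ 1) (j : ℕ) (f : ℝ)
    (hf : k * L / π = j + f) (hf0 : 0 < f) (hf1 : f ≤ 1) (hε : 0 ≤ ε) (hLε : 2 / L ≤ ε)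
    (h : theta k + 2 * ε ≤ f) : ε ≤ bslope L j k := by
  have h1 := bslope_near hL hk0 hk j f hf hf0 hf1
  have hθ := theta_nonneg hk0
  have hsin : 0 < sin (π / 2 * f) :=
    sin_pos_of_pos_of_lt_pi (by positivity) (by nlinarith [pi_pos])
  have h2 := le_abs_sin_half_pi (x := f - theta k) (by linarith) (by linarith)
  have h3 : 2 * ε ≤ sin (π / 2 * (f - theta k)) / sin (π / 2 * f) := by
    rw [le_div_iff₀ hsin]
    nlinarith [sin_le_one (π / 2 * f)]
  have h4 : 1 ≤ √2 := one_le_sqrt.2 (by norm_num)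
  have h5 := (abs_le.1 h1).1
  nlinarith

theorem bslope_neg_of {L k ε : ℝ} (hL : 4 ≤ L) (hk0 : 0 ≤ k) (hk : k ≤ 1) (j : ℕ) (f : ℝ)
    (hf : k * L / π = j + f) (hf0 : 0 < f) (hε : 0 ≤ ε) (hLε : 2 / L ≤ ε)
    (h : f ≤ theta k - 2 * ε) : bslope L j k ≤ -ε := by
  have hθ := theta_le_half hk
  have hf1 : f ≤ 1 := by linarith
  have h1 := bslope_near hL hk0 hk j f hf hf0 hf1
  have hsin : 0 < sin (π / 2 * f) :=
    sin_pos_of_pos_of_lt_pi (by positivity) (by nlinarith [pi_pos])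
  have h2 := le_abs_sin_half_pi (x := theta k - f) (by linarith) (by linarith)
  have h3 : sin (π / 2 * (f - theta k)) / sin (π / 2 * f) ≤ -(2 * ε) := by
    rw [div_le_iff₀ hsin, show π / 2 * (f - theta k) = -(π / 2 * (theta k - f)) by ring, sin_neg]
    nlinarith [sin_le_one (π / 2 * f)]
  have h4 : 1 ≤ √2 := one_le_sqrt.2 (by norm_num)
  have h5 := (abs_le.1 h1).2
  nlinarith

theorem bslope_zero_phase {L k : ℝ} (hL : 4 ≤ L) (hk0 : 0 ≤ k) (hk : k ≤ 1) (j : ℕ) (f : ℝ)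
    (hf : k * L / π = j + f) (hf0 : 0 < f) (hf1 : f ≤ 1) (h : bslope L j k = 0) :
    |f - theta k| ≤ 4 / L := by
  have e : (4 : ℝ) / L = 2 * (2 / L) := by ring
  have hp : 0 < 2 / L := by positivity
  by_contra hcon
  push Not at hcon
  rw [e] at hcon
  rcases lt_abs.1 hcon with h1 | h1
  · have := bslope_pos_of hL hk0 hk j f hf hf0 hf1 hp.le le_rfl (by linarith)
    linarith
  · have := bslope_neg_of hL hk0 hk j f hf hf0 hp.le le_rfl (by linarith)
    linarith

theorem bilin_sum_sum {V ι κ : Type*} [AddCommGroup V] [Module ℝ V] (B : V →ₗ[ℝ] V →ₗ[ℝ] ℝ)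
    (s : Finset ι) (t : Finset κ) (a : ι → ℝ) (b : κ → ℝ) (f : ι → V) (g : κ → V) :
    B (∑ i ∈ s, a i • f i) (∑ j ∈ t, b j • g j)
      = ∑ i ∈ s, ∑ j ∈ t, a i * b j * B (f i) (g j) := by
  simp only [map_sum, map_smul, LinearMap.sum_apply, LinearMap.smul_apply, smul_eq_mul,
    Finset.mul_sum]
  rw [Finset.sum_comm]
  exact Finset.sum_congr rfl fun i _ => Finset.sum_congr rfl fun j _ => by ring

/-- A finite family of clamped modes of distinct frequencies on `[0, L]`. -/
structure YFam (L : ℝ) (N : Type*) where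
  η : N → ℝ
  σ : N → ℝ
  P : ∀ n, Prof L (η n) (σ n)
  hσ : ∀ n, σ n ^ 2 = 1
  hs : ∀ n, (P n).s = 0
  η0 : ∀ n, 0 < η n
  η1 : ∀ n, η n < 1
  inj : Function.Injective η

namespace YFam

variable {L : ℝ} {N : Type*} (Y : YFam L N)

/-- The squared transversal frequency. -/
def τ (n : N) : ℝ := 1 - Y.η n ^ 2

/-- The clamped mode. -/
def y (n : N) : C(ℝ, ℝ) := (Y.P n).g

theorem η_sq (n : N) : Y.η n ^ 2 = 1 - Y.τ n := by unfold τ; ring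

theorem η_sq_lt (n : N) : Y.η n ^ 2 < 1 := by nlinarith [Y.η0 n, Y.η1 n]

theorem τ_pos (n : N) : 0 < Y.τ n := by have := Y.η_sq_lt n; unfold τ; linarith

theorem τ_lt (n : N) : Y.τ n < 1 := by have := Y.η0 n; unfold τ; nlinarith

theorem η_sq_ne {n m : N} (h : n ≠ m) : Y.η n ^ 2 ≠ Y.η m ^ 2 := by
  intro h2
  exact h (Y.inj ((pow_left_inj₀ (Y.η0 n).le (Y.η0 m).le (by norm_num)).1 h2))

theorem C_pos (hL : 0 < L) (n : N) : 0 < (Y.P n).C :=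
  (Y.P n).C_pos hL (Y.hσ n) (Y.hs n) (Y.η_sq_lt n)

theorem ip_g1 [DecidableEq N] (n m : N) : 2 * ip L (Y.P n).g1 (Y.P m).g1
    = -(Y.τ n + Y.τ m) * ip L (Y.y n) (Y.y m) + if n = m then (Y.P n).C else 0 := by
  split_ifs with h
  · subst h
    have := (Y.P n).clamped_g1_self (Y.hσ n) (Y.hs n)
    unfold τ y; linear_combination this
  · have := (Y.P n).clamped_g1 (Y.P m) (Y.hs n) (Y.hs m) (Y.η_sq_ne h)
    unfold τ y; linear_combination this

theorem ip_g2 [DecidableEq N] (n m : N) : ip L (Y.P n).g2 (Y.P m).g2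
    = (1 + Y.τ n * Y.τ m) * ip L (Y.y n) (Y.y m) - if n = m then Y.τ n * (Y.P n).C else 0 := by
  split_ifs with h
  · subst h
    have := (Y.P n).clamped_g2_self (Y.hσ n) (Y.hs n)
    unfold τ y; linear_combination this
  · have := (Y.P n).clamped_g2 (Y.P m) (Y.hs n) (Y.hs m) (Y.η_sq_ne h)
    unfold τ y; linear_combination this

theorem ip_g2_y [DecidableEq N] (n m : N) : 2 * ip L (Y.P n).g2 (Y.y m)
    = (Y.τ n + Y.τ m) * ip L (Y.y n) (Y.y m) - if n = m then (Y.P n).C else 0 := by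
  have h1 := Y.ip_g1 n m
  have h2 := (Y.P n).ip_g2_g (Y.P m)
  unfold y at *
  linear_combination 2 * h2 - h1

theorem ip_y_g2 [DecidableEq N] (n m : N) : 2 * ip L (Y.y n) (Y.P m).g2
    = (Y.τ n + Y.τ m) * ip L (Y.y n) (Y.y m) - if n = m then (Y.P n).C else 0 := by
  have h := Y.ip_g2_y m n
  rw [ip_comm L (Y.P m).g2, ip_comm L (Y.y m), add_comm (Y.τ m)] at h
  rw [h]
  by_cases hnm : n = m
  · subst hnm; rfl
  · rw [if_neg hnm, if_neg (Ne.symm hnm)]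

theorem ip_e_y [DecidableEq N] (n m : N) : 4 * ip L (Y.P n).e (Y.y m)
    = -(2 - Y.τ n + Y.τ m) * if n = m then 2 * ip L (Y.P n).e (Y.P n).e
        else ip L (Y.y n) (Y.y m) := by
  split_ifs with h
  · subst h
    have := (Y.P n).ip_e_g_self (Y.hσ n)
    rw [Y.hs] at this
    unfold y; linear_combination 4 * this
  · have := (Y.P n).clamped_e_g (Y.P m) (Y.hs n) (Y.hs m) (Y.η_sq_ne h)
    unfold τ y; linear_combination this

variable [Fintype N]

theorem sum_sq_le (f : N → ℝ) :
    ∑ n, ∑ m, f n * f m * ((Y.τ n + Y.τ m) * ip L (Y.y n) (Y.y m))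
      ≤ (∑ n, (Y.P n).C * f n ^ 2) - 2 * ip L (∑ n, f n • (Y.P n).g1) (∑ n, f n • (Y.P n).g1) := by
  classical
  rw [bilin_sum_sum, Finset.mul_sum]
  simp_rw [Finset.mul_sum]
  have : ∀ n m, 2 * (f n * f m * ip L (Y.P n).g1 (Y.P m).g1)
      = -(f n * f m * ((Y.τ n + Y.τ m) * ip L (Y.y n) (Y.y m)))
        + if n = m then (Y.P n).C * f n ^ 2 else 0 := by
    intro n m
    have h := Y.ip_g1 n m
    split_ifs at h ⊢ with hnm
    · subst hnm; linear_combination f n * f n * h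
    · linear_combination f n * f m * h
  simp_rw [this, Finset.sum_add_distrib, Finset.sum_ite_eq, Finset.mem_univ, if_true,
    Finset.sum_neg_distrib]
  linarith

/-- Bound of the Gram matrix of the clamped modes by its diagonal weights. -/
theorem gram_le (hL : 0 ≤ L) (f : N → ℝ) :
    ∑ n, ∑ m, f n * f m * ip L (Y.y n) (Y.y m) ≤ ∑ n, (Y.P n).C * f n ^ 2 / (2 * Y.τ n) := by
  set Φ : ℝ → ℝ := fun s =>
    (∑ n, ∑ m, f n * f m * ip L (Y.y n) (Y.y m) * exp (-(Y.τ n + Y.τ m) * s))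
      - ∑ n, (Y.P n).C * f n ^ 2 / (2 * Y.τ n) * exp (-(2 * Y.τ n) * s) with hΦ
  have hE : ∀ a s : ℝ, HasDerivAt (fun s => exp (a * s)) (exp (a * s) * a) s := fun a s => by
    simpa using ((hasDerivAt_id s).const_mul a).exp
  have hd : ∀ s, HasDerivAt Φ
      ((∑ n, ∑ m, f n * f m * ip L (Y.y n) (Y.y m) *
          (exp (-(Y.τ n + Y.τ m) * s) * -(Y.τ n + Y.τ m)))
      - ∑ n, (Y.P n).C * f n ^ 2 / (2 * Y.τ n) *
          (exp (-(2 * Y.τ n) * s) * -(2 * Y.τ n))) s := fun s =>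
    (HasDerivAt.fun_sum fun n _ => HasDerivAt.fun_sum fun m _ => (hE _ s).const_mul _).sub
      (HasDerivAt.fun_sum fun n _ => (hE _ s).const_mul _)
  have hmono : Monotone Φ := by
    refine monotone_of_deriv_nonneg (fun s => (hd s).differentiableAt) fun s => ?_
    rw [(hd s).deriv]
    have h1 := Y.sum_sq_le (fun n => f n * exp (-Y.τ n * s))
    have h2 := ip_self_nonneg hL (∑ n, (f n * exp (-Y.τ n * s)) • (Y.P n).g1)
    have e1 : ∑ n, ∑ m, f n * f m * ip L (Y.y n) (Y.y m) *
          (exp (-(Y.τ n + Y.τ m) * s) * -(Y.τ n + Y.τ m))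
        = -∑ n, ∑ m, f n * exp (-Y.τ n * s) * (f m * exp (-Y.τ m * s)) *
            ((Y.τ n + Y.τ m) * ip L (Y.y n) (Y.y m)) := by
      simp_rw [← Finset.sum_neg_distrib]
      refine Finset.sum_congr rfl fun n _ => Finset.sum_congr rfl fun m _ => ?_
      rw [show -(Y.τ n + Y.τ m) * s = -Y.τ n * s + -Y.τ m * s by ring, exp_add]; ring
    have e2 : ∑ n, (Y.P n).C * f n ^ 2 / (2 * Y.τ n) *
          (exp (-(2 * Y.τ n) * s) * -(2 * Y.τ n))
        = -∑ n, (Y.P n).C * (f n * exp (-Y.τ n * s)) ^ 2 := by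
      rw [← Finset.sum_neg_distrib]
      refine Finset.sum_congr rfl fun n _ => ?_
      have := (Y.τ_pos n).ne'
      rw [show -(2 * Y.τ n) * s = -Y.τ n * s + -Y.τ n * s by ring, exp_add]; field_simp
    rw [e1, e2]
    linarith
  have hlim : Tendsto Φ atTop (nhds 0) := by
    have hE0 : ∀ a : ℝ, 0 < a → Tendsto (fun s => exp (-a * s)) atTop (nhds 0) := fun a ha =>
      tendsto_exp_atBot.comp ((tendsto_const_mul_atBot_of_neg (by linarith)).2 tendsto_id)
    have : Tendsto Φ atTop (nhds ((∑ n, ∑ m, f n * f m * ip L (Y.y n) (Y.y m) * 0)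
        - ∑ n, (Y.P n).C * f n ^ 2 / (2 * Y.τ n) * 0)) := by
      refine (tendsto_finsetSum _ fun n _ => tendsto_finsetSum _ fun m _ => ?_).sub
        (tendsto_finsetSum _ fun n _ => ?_)
      · exact (hE0 _ (add_pos (Y.τ_pos n) (Y.τ_pos m))).const_mul _
      · exact (hE0 _ (mul_pos two_pos (Y.τ_pos n))).const_mul _
    simpa using this
  have := hmono.ge_of_tendsto hlim 0
  simp only [hΦ, mul_zero, exp_zero, mul_one] at this
  linarith

/-- Negativity of the separated energy on combinations of clamped modes. -/
theorem energy_neg (hL : 0 < L) (ξ : ℝ) (c : N → ℝ) (hc : ∀ n, c n ≠ 0 → ξ ^ 2 < Y.τ n)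
    (hc0 : c ≠ 0) :
    ip L (∑ n, c n • ((Y.P n).g2 - ξ ^ 2 • Y.y n)) (∑ n, c n • ((Y.P n).g2 - ξ ^ 2 • Y.y n))
      - ip L (∑ n, c n • Y.y n) (∑ n, c n • Y.y n) < 0 := by
  classical
  have key : ip L (∑ n, c n • ((Y.P n).g2 - ξ ^ 2 • Y.y n))
        (∑ n, c n • ((Y.P n).g2 - ξ ^ 2 • Y.y n)) - ip L (∑ n, c n • Y.y n) (∑ n, c n • Y.y n)
      = (∑ n, ∑ m, ((ξ ^ 2 - Y.τ n) * c n) * ((ξ ^ 2 - Y.τ m) * c m) * ip L (Y.y n) (Y.y m))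
        + ∑ n, (Y.P n).C * (ξ ^ 2 - Y.τ n) * c n ^ 2 := by
    rw [bilin_sum_sum, bilin_sum_sum, ← Finset.sum_sub_distrib, ← Finset.sum_add_distrib]
    refine Finset.sum_congr rfl fun n _ => ?_
    rw [← Finset.sum_sub_distrib]
    have : ∀ m, c n * c m * ip L ((Y.P n).g2 - ξ ^ 2 • Y.y n) ((Y.P m).g2 - ξ ^ 2 • Y.y m)
        - c n * c m * ip L (Y.y n) (Y.y m)
        = ((ξ ^ 2 - Y.τ n) * c n) * ((ξ ^ 2 - Y.τ m) * c m) * ip L (Y.y n) (Y.y m)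
          + if n = m then (Y.P n).C * (ξ ^ 2 - Y.τ n) * c n ^ 2 else 0 := by
      intro m
      have h1 := Y.ip_g2 n m
      have h2 := Y.ip_g2_y n m
      have h3 := Y.ip_y_g2 n m
      simp only [map_sub, map_smul, LinearMap.sub_apply, LinearMap.smul_apply, smul_eq_mul]
      split_ifs at h1 h2 h3 ⊢ with hnm
      · subst hnm
        linear_combination c n * c n * h1 - c n * c n * ξ ^ 2 / 2 * h2
          - c n * c n * ξ ^ 2 / 2 * h3
      · linear_combination c n * c m * h1 - c n * c m * ξ ^ 2 / 2 * h2
          - c n * c m * ξ ^ 2 / 2 * h3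
    simp_rw [this, Finset.sum_add_distrib, Finset.sum_ite_eq, Finset.mem_univ, if_true]
  rw [key]
  have h1 := Y.gram_le hL.le (fun n => (ξ ^ 2 - Y.τ n) * c n)
  refine lt_of_le_of_lt (add_le_add_left h1 _) ?_
  rw [← Finset.sum_add_distrib]
  have hterm : ∀ n, (Y.P n).C * ((ξ ^ 2 - Y.τ n) * c n) ^ 2 / (2 * Y.τ n)
      + (Y.P n).C * (ξ ^ 2 - Y.τ n) * c n ^ 2
      = (Y.P n).C * c n ^ 2 * (ξ ^ 2 - Y.τ n) * (ξ ^ 2 + Y.τ n) / (2 * Y.τ n) := by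
    intro n
    have := (Y.τ_pos n).ne'
    field_simp; ring
  simp_rw [hterm]
  obtain ⟨n, hn⟩ := Function.ne_iff.1 hc0
  have hneg : ∀ n, c n ≠ 0 →
      (Y.P n).C * c n ^ 2 * (ξ ^ 2 - Y.τ n) * (ξ ^ 2 + Y.τ n) / (2 * Y.τ n) < 0 := by
    intro n hn
    have h1 := Y.τ_pos n
    have h2 := hc n hn
    have h3 := Y.C_pos hL n
    have h5 : 0 < (Y.P n).C * c n ^ 2 * (Y.τ n - ξ ^ 2) * (ξ ^ 2 + Y.τ n) / (2 * Y.τ n) := by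
      positivity
    have : (Y.P n).C * c n ^ 2 * (ξ ^ 2 - Y.τ n) * (ξ ^ 2 + Y.τ n) / (2 * Y.τ n)
      = -((Y.P n).C * c n ^ 2 * (Y.τ n - ξ ^ 2) * (ξ ^ 2 + Y.τ n) / (2 * Y.τ n)) := by ring
    linarith
  refine Finset.sum_neg' (fun n _ => ?_) ⟨n, Finset.mem_univ _, hneg n hn⟩
  by_cases h : c n = 0
  · simp [h]
  · exact (hneg n h).le

end YFam

/-- The `L²` pairing over the rectangle `[0, L₁] × [0, L₂]`. -/
def ip2 (L₁ L₂ : ℝ) : C(ℝ × ℝ, ℝ) →ₗ[ℝ] C(ℝ × ℝ, ℝ) →ₗ[ℝ] ℝ :=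
  have hi : ∀ f : ℝ × ℝ → ℝ, Continuous f →
      IntegrableOn f (Set.Icc 0 L₁ ×ˢ Set.Icc 0 L₂) := fun f hf =>
    hf.continuousOn.integrableOn_compact (isCompact_Icc.prod isCompact_Icc)
  LinearMap.mk₂ ℝ (fun f g => ∫ p in Set.Icc 0 L₁ ×ˢ Set.Icc 0 L₂, f p * g p)
    (fun f f' g => by
      rw [← integral_add]
      · simp [add_mul]
      all_goals exact hi _ (by fun_prop))
    (fun c f g => by
      rw [smul_eq_mul, ← integral_const_mul]
      simp [mul_assoc])
    (fun f g g' => by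
      rw [← integral_add]
      · simp [mul_add]
      all_goals exact hi _ (by fun_prop))
    (fun c f g => by
      rw [smul_eq_mul, ← integral_const_mul]
      simp [mul_left_comm])

theorem ip2_apply (L₁ L₂ : ℝ) (f g : C(ℝ × ℝ, ℝ)) :
    ip2 L₁ L₂ f g = ∫ p in Set.Icc 0 L₁ ×ˢ Set.Icc 0 L₂, f p * g p := rfl

theorem ip2_comm (L₁ L₂ : ℝ) (f g : C(ℝ × ℝ, ℝ)) : ip2 L₁ L₂ f g = ip2 L₁ L₂ g f := by
  simp [ip2_apply, mul_comm]

theorem ip2_self_nonneg (L₁ L₂ : ℝ) (f : C(ℝ × ℝ, ℝ)) : 0 ≤ ip2 L₁ L₂ f f :=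
  integral_nonneg fun _ => mul_self_nonneg _

theorem two_ip2_le (L₁ L₂ : ℝ) {δ : ℝ} (hδ : 0 < δ) (f g : C(ℝ × ℝ, ℝ)) :
    2 * ip2 L₁ L₂ f g ≤ δ * ip2 L₁ L₂ f f + ip2 L₁ L₂ g g / δ := by
  have := ip2_self_nonneg L₁ L₂ (δ • f - g)
  simp only [map_sub, map_smul, LinearMap.sub_apply, LinearMap.smul_apply, smul_eq_mul,
    ip2_comm L₁ L₂ g f] at this
  rw [← sub_le_iff_le_add', le_div_iff₀ hδ]
  linarith

/-- The product function `(x, y) ↦ f x * g y`. -/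
def tens : C(ℝ, ℝ) →ₗ[ℝ] C(ℝ, ℝ) →ₗ[ℝ] C(ℝ × ℝ, ℝ) :=
  LinearMap.mk₂ ℝ (fun f g => ⟨fun p => f p.1 * g p.2, by fun_prop⟩)
    (fun f f' g => by ext; simp [add_mul])
    (fun c f g => by ext; simp [mul_assoc])
    (fun f g g' => by ext; simp [mul_add])
    (fun c f g => by ext; simp [mul_left_comm])

@[simp]
theorem tens_apply (f g : C(ℝ, ℝ)) (p : ℝ × ℝ) : tens f g p = f p.1 * g p.2 := rfl

theorem ip2_tens {L₁ L₂ : ℝ} (h₁ : 0 ≤ L₁) (h₂ : 0 ≤ L₂) (f g f' g' : C(ℝ, ℝ)) :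
    ip2 L₁ L₂ (tens f g) (tens f' g') = ip L₁ f f' * ip L₂ g g' := by
  rw [ip2_apply, ip_apply, ip_apply, intervalIntegral.integral_of_le h₁,
    intervalIntegral.integral_of_le h₂, ← integral_Icc_eq_integral_Ioc,
    ← integral_Icc_eq_integral_Ioc,
    ← setIntegral_prod_mul (fun x => f x * f' x) (fun y => g y * g' y)]
  simp only [tens_apply]
  congr 1; ext p; ring

theorem sum_mul_sum_le {W : Type*} [Fintype W] (c : W → ℝ) (F : W → W → ℝ) {K : ℝ}
    (hF : ∀ i j, |F i j| ≤ K) :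
    |∑ i, ∑ j, c i * c j * F i j| ≤ K * (Fintype.card W * ∑ i, c i ^ 2) := by
  rcases isEmpty_or_nonempty W with h | ⟨⟨i0⟩⟩
  · simp
  have hK : 0 ≤ K := (abs_nonneg _).trans (hF i0 i0)
  calc |∑ i, ∑ j, c i * c j * F i j| ≤ ∑ i, ∑ j, |c i| * |c j| * K := by
        refine (Finset.abs_sum_le_sum_abs _ _).trans (Finset.sum_le_sum fun i _ => ?_)
        refine (Finset.abs_sum_le_sum_abs _ _).trans (Finset.sum_le_sum fun j _ => ?_)
        rw [abs_mul, abs_mul]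
        exact mul_le_mul_of_nonneg_left (hF i j) (by positivity)
    _ = K * (∑ i, |c i|) ^ 2 := by
        simp_rw [← Finset.sum_mul, ← Finset.mul_sum, ← Finset.sum_mul]; ring
    _ ≤ K * (Fintype.card W * ∑ i, |c i| ^ 2) :=
        mul_le_mul_of_nonneg_left (sq_sum_le_card_mul_sum_sq) hK
    _ = _ := by simp_rw [sq_abs]

theorem sum_rep_eq_zero {W M : Type*} [Fintype W] [DecidableEq W] [AddCommGroup M] [Module ℝ M]
    (c : W → ℝ) (r : W → W) (hc : ∀ j, ∑ i with r i = j, c i = 0) (F : W → M) :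
    ∑ i, c i • F (r i) = 0 := by
  rw [← Finset.sum_fiberwise Finset.univ r]
  refine Finset.sum_eq_zero fun j _ => ?_
  rw [Finset.sum_congr rfl (g := fun i => c i • F j), ← Finset.sum_smul, hc, zero_smul]
  intro i hi
  rw [(Finset.mem_filter.1 hi).2]

/-- A finite family of profiles in the first variable at the frequencies complementary to those
of a family of clamped modes in the second variable. -/
structure XFam {L₂ : ℝ} {N : Type*} (Y : YFam L₂ N) (L₁ : ℝ) (W : Type*) where
  n : W → N
  σ : W → ℝ
  X : ∀ i, Prof L₁ (√(Y.τ (n i))) (σ i)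
  hσ : ∀ i, σ i ^ 2 = 1
  opp : ∀ i j, i ≠ j → n i = n j → σ j = -σ i

namespace XFam

variable {L₁ L₂ : ℝ} {N W : Type*} {Y : YFam L₂ N} (Z : XFam Y L₁ W)

/-- The squared frequency in the first variable. -/
def t (i : W) : ℝ := Y.τ (Z.n i)

theorem sq_freq (i : W) : √(Y.τ (Z.n i)) ^ 2 = Z.t i := sq_sqrt (Y.τ_pos _).le

theorem t_pos (i : W) : 0 < Z.t i := Y.τ_pos _

theorem t_lt (i : W) : Z.t i < 1 := Y.τ_lt _

/-- The product function attached to an index. -/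
def w (i : W) : C(ℝ × ℝ, ℝ) := tens (Z.X i).g (Y.y (Z.n i))

/-- The Laplacian of `w`. -/
def lw (i : W) : C(ℝ × ℝ, ℝ) :=
  tens (Z.X i).g2 (Y.y (Z.n i)) + tens (Z.X i).g (Y.P (Z.n i)).g2

/-- The residual `(Δ² - 1) w`. -/
def res (i : W) : C(ℝ × ℝ, ℝ) := (8 : ℝ) • tens (Z.X i).e (Y.P (Z.n i)).e

/-- Off-diagonal part of the energy matrix. -/
def a (i j : W) : ℝ :=
  ip L₁ (Z.X i).e (Z.X j).e * (-4 * ip L₂ (Y.P (Z.n i)).e (Y.y (Z.n j)) / (2 - Z.t i + Z.t j))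

theorem ip_opp {k k' σ σ' L : ℝ} (P : Prof L k σ) (P' : Prof L k' σ') (hσ : σ ^ 2 = 1)
    (hk : k' = k) (h : σ' = -σ) : ip L P.e P'.e = 0 ∧ ip L P.e P'.g = 0 := by
  subst hk; subst h
  exact ⟨P.ip_e_e_opp P' hσ, P.ip_e_g_opp P' hσ⟩

theorem energy_entry (h₁ : 0 ≤ L₁) (h₂ : 0 ≤ L₂) [DecidableEq W] (i j : W) :
    ip2 L₁ L₂ (Z.lw i) (Z.lw j) - ip2 L₁ L₂ (Z.w i) (Z.w j)
      = 4 * Z.a i j + if i = j then 2 * (Y.P (Z.n i)).C * (Z.X i).s else 0 := by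
  classical
  have hi := Z.sq_freq i
  have hj := Z.sq_freq j
  have hD : 2 - Z.t i + Z.t j ≠ 0 := by linarith [Z.t_pos j, Z.t_lt i]
  have y1 := Y.ip_g2 (Z.n i) (Z.n j)
  have y2 := Y.ip_g2_y (Z.n i) (Z.n j)
  have y3 := Y.ip_y_g2 (Z.n i) (Z.n j)
  have y4 := Y.ip_e_y (Z.n i) (Z.n j)
  have hA : -4 * ip L₂ (Y.P (Z.n i)).e (Y.y (Z.n j)) / (2 - Z.t i + Z.t j)
      = if Z.n i = Z.n j then 2 * ip L₂ (Y.P (Z.n i)).e (Y.P (Z.n i)).e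
        else ip L₂ (Y.y (Z.n i)) (Y.y (Z.n j)) := by
    rw [div_eq_iff hD]; unfold t; linear_combination -y4
  have hsym : ip L₁ (Z.X i).g2 (Z.X j).g = ip L₁ (Z.X i).g (Z.X j).g2 := by
    rw [Prof.ip_g2_g, ip_comm L₁ _ (Z.X j).g2, Prof.ip_g2_g, ip_comm]
  unfold lw w a
  simp only [map_add, LinearMap.add_apply, ip2_tens h₁ h₂]
  rw [hA]
  simp only [Prof.g2_eq (Z.X i), Prof.g2_eq (Z.X j), map_sub, map_smul, LinearMap.sub_apply,
    LinearMap.smul_apply, smul_eq_mul, hi, hj] at hsym ⊢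
  change ip L₂ (Y.P (Z.n i)).g2 (Y.P (Z.n j)).g2 = (1 + Z.t i * Z.t j) * _ -
    (if Z.n i = Z.n j then Z.t i * (Y.P (Z.n i)).C else 0) at y1
  change 2 * ip L₂ (Y.P (Z.n i)).g2 (Y.y (Z.n j)) = (Z.t i + Z.t j) * _ - _ at y2
  change 2 * ip L₂ (Y.y (Z.n i)) (Y.P (Z.n j)).g2 = (Z.t i + Z.t j) * _ - _ at y3
  have z2 : ip L₂ (Y.P (Z.n i)).g2 (Y.y (Z.n j)) = _ := eq_div_of_mul_eq two_ne_zero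
    ((mul_comm _ _).trans y2)
  have z3 : ip L₂ (Y.y (Z.n i)) (Y.P (Z.n j)).g2 = _ := eq_div_of_mul_eq two_ne_zero
    ((mul_comm _ _).trans y3)
  rw [y1, z2, z3]
  by_cases hn : Z.n i = Z.n j
  · have ht : Z.t i = Z.t j := by unfold t; rw [hn]
    by_cases hij : i = j
    · subst hij
      have h4 := (Z.X i).ip_e_g_self (Z.hσ i)
      simp only [if_true, ip_comm L₁ (Z.X i).g (Z.X i).e, h4]
      have hC : (Y.P (Z.n i)).C = 2 * ip L₂ (Y.y (Z.n i)) (Y.y (Z.n i))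
        - 4 * ip L₂ (Y.P (Z.n i)).e (Y.P (Z.n i)).e := rfl
      rw [hC]; ring
    · obtain ⟨o1, o2⟩ := ip_opp (Z.X i) (Z.X j) (Z.hσ i) (by rw [hn]) (Z.opp i j hij hn)
      obtain ⟨o3, o4⟩ := ip_opp (Z.X j) (Z.X i) (Z.hσ j) (by rw [hn])
        (Z.opp j i (Ne.symm hij) hn.symm)
      rw [ip_comm] at o4
      simp only [hn, if_true, hij, if_false, o1, o2, o4, ht]
      ring
  · have hij : i ≠ j := fun h => hn (by rw [h])
    simp only [hn, hij, if_false]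
    linear_combination ((Z.t i - Z.t j) / 2 * ip L₂ (Y.y (Z.n i)) (Y.y (Z.n j))) * hsym

theorem energy_eq [Fintype W] (h₁ : 0 ≤ L₁) (h₂ : 0 ≤ L₂) (c : W → ℝ) :
    ip2 L₁ L₂ (∑ i, c i • Z.lw i) (∑ i, c i • Z.lw i)
        - ip2 L₁ L₂ (∑ i, c i • Z.w i) (∑ i, c i • Z.w i)
      = (∑ i, 2 * (Y.P (Z.n i)).C * (Z.X i).s * c i ^ 2)
        + 4 * ∑ i, ∑ j, c i * c j * Z.a i j := by
  classical
  rw [bilin_sum_sum, bilin_sum_sum, ← Finset.sum_sub_distrib, Finset.mul_sum,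
    ← Finset.sum_add_distrib]
  refine Finset.sum_congr rfl fun i _ => ?_
  rw [← Finset.sum_sub_distrib, Finset.mul_sum]
  have : ∀ j, c i * c j * ip2 L₁ L₂ (Z.lw i) (Z.lw j) - c i * c j * ip2 L₁ L₂ (Z.w i) (Z.w j)
      = 4 * (c i * c j * Z.a i j)
        + if i = j then 2 * (Y.P (Z.n i)).C * (Z.X i).s * c i ^ 2 else 0 := by
    intro j
    have h := Z.energy_entry h₁ h₂ i j
    split_ifs at h ⊢ with hij
    · subst hij; linear_combination c i * c i * h
    · linear_combination c i * c j * h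
  simp_rw [this, Finset.sum_add_distrib, Finset.sum_ite_eq, Finset.mem_univ, if_true]
  ring

/-- A choice of representatives of nearby indices of equal parities. -/
structure Rep (Z : XFam Y L₁ W) (Δ : ℝ) where
  r : W → W
  hσ : ∀ i, Z.σ (r i) = Z.σ i
  hσY : ∀ i, Y.σ (Z.n (r i)) = Y.σ (Z.n i)
  ht : ∀ i, |Z.t i - Z.t (r i)| ≤ Δ

variable {Z}

theorem norm_ex (h₁ : 0 ≤ L₁) (i : W) : ip L₁ (Z.X i).e (Z.X i).e ≤ 6 :=
  (Z.X i).norm_e h₁ (Z.hσ i) (by rw [Z.sq_freq]; exact (Z.t_lt i).le)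

theorem norm_ey (h₂ : 0 ≤ L₂) (n : N) : ip L₂ (Y.P n).e (Y.P n).e ≤ 6 :=
  (Y.P n).norm_e h₂ (Y.hσ n) (Y.η_sq_lt n).le

theorem norm_e_sub' {L k k' σ σ' : ℝ} (P : Prof L k σ) (P' : Prof L k' σ') (hL : 0 ≤ L)
    (h : σ' = σ) (hσ : σ ^ 2 = 1) (hk : k ^ 2 ≤ 1) (hk' : k' ^ 2 ≤ 1) :
    ip L (P.e - P'.e) (P.e - P'.e) ≤ 6 * (k ^ 2 - k' ^ 2) ^ 2 := by
  subst h; exact P.norm_e_sub P' hL hσ hk hk'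

theorem norm_ex_sub {Δ : ℝ} (h₁ : 0 ≤ L₁) (R : Rep Z Δ) (i : W) :
    ip L₁ ((Z.X i).e - (Z.X (R.r i)).e) ((Z.X i).e - (Z.X (R.r i)).e) ≤ 6 * Δ ^ 2 := by
  have h := norm_e_sub' (Z.X i) (Z.X (R.r i)) h₁ (R.hσ i) (Z.hσ i)
    (by rw [Z.sq_freq]; exact (Z.t_lt i).le) (by rw [Z.sq_freq]; exact (Z.t_lt _).le)
  rw [Z.sq_freq, Z.sq_freq] at h
  have h2 := sq_le_sq' (abs_le.1 (R.ht i)).1 (abs_le.1 (R.ht i)).2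
  linarith

theorem norm_ey_sub {Δ : ℝ} (h₂ : 0 ≤ L₂) (R : Rep Z Δ) (i : W) :
    ip L₂ ((Y.P (Z.n i)).e - (Y.P (Z.n (R.r i))).e) ((Y.P (Z.n i)).e - (Y.P (Z.n (R.r i))).e)
      ≤ 6 * Δ ^ 2 := by
  have h := norm_e_sub' (Y.P (Z.n i)) (Y.P (Z.n (R.r i))) h₂ (R.hσY i) (Y.hσ _)
    (Y.η_sq_lt _).le (Y.η_sq_lt _).le
  have h1 := R.ht i
  unfold t YFam.τ at h1
  rw [show 1 - Y.η (Z.n i) ^ 2 - (1 - Y.η (Z.n (R.r i)) ^ 2)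
    = -(Y.η (Z.n i) ^ 2 - Y.η (Z.n (R.r i)) ^ 2) by ring, abs_neg] at h1
  have h2 := sq_le_sq' (abs_le.1 h1).1 (abs_le.1 h1).2
  linarith

theorem abs_a_sub_le {Δ M : ℝ} (h₁ : 0 ≤ L₁) (h₂ : 0 ≤ L₂) (hM : 0 ≤ M) (R : Rep Z Δ)
    (hY : ∀ i, ip L₂ (Y.y (Z.n i)) (Y.y (Z.n i)) ≤ M ^ 2) (i j : W) :
    |Z.a i j - Z.a (R.r i) j| ≤ 324 * Δ * M := by
  have hΔ : 0 ≤ Δ := (abs_nonneg _).trans (R.ht i)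
  set r := R.r i
  have hE' : |ip L₁ (Z.X r).e (Z.X j).e| ≤ 3 * 3 :=
    abs_ip_le h₁ (by norm_num) (by norm_num) ((norm_ex h₁ _).trans (by norm_num))
      ((norm_ex h₁ _).trans (by norm_num))
  have hZ : |ip L₂ (Y.P (Z.n i)).e (Y.y (Z.n j))| ≤ 3 * M :=
    abs_ip_le h₂ (by norm_num) hM ((norm_ey h₂ _).trans (by norm_num)) (hY j)
  have hZ' : |ip L₂ (Y.P (Z.n r)).e (Y.y (Z.n j))| ≤ 3 * M :=
    abs_ip_le h₂ (by norm_num) hM ((norm_ey h₂ _).trans (by norm_num)) (hY j)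
  have hdE : |ip L₁ (Z.X i).e (Z.X j).e - ip L₁ (Z.X r).e (Z.X j).e| ≤ (3 * Δ) * 3 := by
    have := abs_ip_le h₁ (A := 3 * Δ) (B := 3) (f := (Z.X i).e - (Z.X r).e) (g := (Z.X j).e)
      (by positivity) (by norm_num)
      ((norm_ex_sub h₁ R i).trans (by nlinarith)) ((norm_ex h₁ _).trans (by norm_num))
    simpa only [map_sub, LinearMap.sub_apply] using this
  have hdZ : |ip L₂ (Y.P (Z.n i)).e (Y.y (Z.n j)) - ip L₂ (Y.P (Z.n r)).e (Y.y (Z.n j))|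
      ≤ (3 * Δ) * M := by
    have := abs_ip_le h₂ (A := 3 * Δ) (B := M) (f := (Y.P (Z.n i)).e - (Y.P (Z.n r)).e)
      (g := Y.y (Z.n j)) (by positivity) hM
      ((norm_ey_sub h₂ R i).trans (by nlinarith)) (hY j)
    simpa only [map_sub, LinearMap.sub_apply] using this
  have hD : 1 ≤ 2 - Z.t i + Z.t j := by linarith [Z.t_pos j, Z.t_lt i]
  have hD' : 1 ≤ 2 - Z.t r + Z.t j := by linarith [Z.t_pos j, Z.t_lt r]
  have hdD : |(2 - Z.t i + Z.t j)⁻¹ - (2 - Z.t r + Z.t j)⁻¹| ≤ Δ := by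
    have ht := R.ht i
    rw [inv_sub_inv (by linarith) (by linarith), abs_div, div_le_iff₀ (by positivity),
      show 2 - Z.t r + Z.t j - (2 - Z.t i + Z.t j) = Z.t i - Z.t r by ring]
    have : 1 ≤ |(2 - Z.t i + Z.t j) * (2 - Z.t r + Z.t j)| := by
      rw [abs_of_pos (by positivity)]; nlinarith
    nlinarith
  have hI : |(2 - Z.t i + Z.t j)⁻¹| ≤ 1 := by
    rw [abs_of_pos (by positivity)]; exact inv_le_one_of_one_le₀ hD
  unfold a
  simp only [div_eq_mul_inv]
  generalize (2 - Z.t i + Z.t j)⁻¹ = v at *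
  generalize (2 - Z.t r + Z.t j)⁻¹ = v' at *
  generalize ip L₁ (Z.X i).e (Z.X j).e = E at *
  generalize ip L₁ (Z.X r).e (Z.X j).e = E' at *
  generalize ip L₂ (Y.P (Z.n i)).e (Y.y (Z.n j)) = T at *
  generalize ip L₂ (Y.P (Z.n r)).e (Y.y (Z.n j)) = T' at *
  have : E * (-4 * T * v) - E' * (-4 * T' * v')
      = -4 * ((E - E') * T * v + E' * (T - T') * v + E' * T' * (v - v')) := by ring
  rw [this, abs_mul]
  have b1 : |(E - E') * T * v| ≤ 3 * Δ * 3 * (3 * M) * 1 := by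
    rw [abs_mul, abs_mul]; gcongr
  have b2 : |E' * (T - T') * v| ≤ 3 * 3 * (3 * Δ * M) * 1 := by
    rw [abs_mul, abs_mul]; gcongr
  have b3 : |E' * T' * (v - v')| ≤ 3 * 3 * (3 * M) * Δ := by
    rw [abs_mul, abs_mul]; gcongr
  have b4 := abs_add_three ((E - E') * T * v) (E' * (T - T') * v) (E' * T' * (v - v'))
  rw [show |(-4 : ℝ)| = 4 by norm_num]
  linarith

variable [Fintype W]

theorem abs_sum_a_le [DecidableEq W] {Δ M : ℝ} (h₁ : 0 ≤ L₁) (h₂ : 0 ≤ L₂) (hM : 0 ≤ M)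
    (R : Rep Z Δ) (hY : ∀ i, ip L₂ (Y.y (Z.n i)) (Y.y (Z.n i)) ≤ M ^ 2) (c : W → ℝ)
    (hc : ∀ j, ∑ i with R.r i = j, c i = 0) :
    |∑ i, ∑ j, c i * c j * Z.a i j| ≤ 324 * Δ * M * (Fintype.card W * ∑ i, c i ^ 2) := by
  have : ∑ i, ∑ j, c i * c j * Z.a i j = ∑ i, ∑ j, c i * c j * (Z.a i j - Z.a (R.r i) j) := by
    simp_rw [mul_sub, Finset.sum_sub_distrib]
    rw [eq_comm, sub_eq_self]
    have := sum_rep_eq_zero c R.r hc (fun i => ∑ j, c j * Z.a i j)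
    simpa only [smul_eq_mul, Finset.mul_sum, mul_assoc] using this
  rw [this]
  exact sum_mul_sum_le c _ (abs_a_sub_le h₁ h₂ hM R hY)

theorem norm_res_le [DecidableEq W] {Δ : ℝ} (h₁ : 0 ≤ L₁) (h₂ : 0 ≤ L₂) (R : Rep Z Δ)
    (c : W → ℝ) (hc : ∀ j, ∑ i with R.r i = j, c i = 0) :
    ip2 L₁ L₂ (∑ i, c i • Z.res i) (∑ i, c i • Z.res i)
      ≤ 9216 * Δ ^ 2 * (Fintype.card W * ∑ i, c i ^ 2) := by
  set v : W → C(ℝ × ℝ, ℝ) := fun i => Z.res i - Z.res (R.r i) with hv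
  have e1 : ∑ i, c i • Z.res i = ∑ i, c i • v i := by
    simp_rw [hv, smul_sub, Finset.sum_sub_distrib]
    rw [sum_rep_eq_zero c R.r hc Z.res, sub_zero]
  have hvv : ∀ i, ip2 L₁ L₂ (v i) (v i) ≤ 9216 * Δ ^ 2 := by
    intro i
    have e2 : v i = (8 : ℝ) • (tens ((Z.X i).e - (Z.X (R.r i)).e) (Y.P (Z.n i)).e
        + tens (Z.X (R.r i)).e ((Y.P (Z.n i)).e - (Y.P (Z.n (R.r i))).e)) := by
      simp only [hv, res, map_sub, LinearMap.sub_apply, ← smul_sub]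
      congr 1; abel
    rw [e2]
    set A := tens ((Z.X i).e - (Z.X (R.r i)).e) (Y.P (Z.n i)).e with hA
    set B := tens (Z.X (R.r i)).e ((Y.P (Z.n i)).e - (Y.P (Z.n (R.r i))).e) with hB
    have h3 := two_ip2_le L₁ L₂ one_pos A B
    have hAA : ip2 L₁ L₂ A A ≤ 6 * Δ ^ 2 * 6 := by
      rw [hA, ip2_tens h₁ h₂]
      exact mul_le_mul (norm_ex_sub h₁ R i) (norm_ey h₂ _) (ip_self_nonneg h₂ _) (by positivity)
    have hBB : ip2 L₁ L₂ B B ≤ 6 * (6 * Δ ^ 2) := by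
      rw [hB, ip2_tens h₁ h₂]
      exact mul_le_mul (norm_ex h₁ _) (norm_ey_sub h₂ R i) (ip_self_nonneg h₂ _) (by norm_num)
    simp only [map_add, map_smul, LinearMap.add_apply, LinearMap.smul_apply, smul_eq_mul,
      ip2_comm L₁ L₂ B A]
    linarith
  rw [e1, bilin_sum_sum]
  refine (le_abs_self _).trans (sum_mul_sum_le c _ fun i j => abs_le.2 ⟨?_, ?_⟩)
  · have := two_ip2_le L₁ L₂ one_pos (v i) (-v j)
    simp only [map_neg, LinearMap.neg_apply] at this
    linarith [hvv i, hvv j]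
  · have := two_ip2_le L₁ L₂ one_pos (v i) (v j)
    linarith [hvv i, hvv j]

end XFam

/-- The frequency of the `m`-th Dirichlet mode of an interval. -/
def fr (L : ℝ) (m : ℕ) : ℝ := m * π / L

/-- The `m`-th Dirichlet mode of an interval. -/
def sn (L : ℝ) (m : ℕ) : C(ℝ, ℝ) := ⟨fun x => sin (fr L m * x), by fun_prop⟩

@[simp]
theorem sn_apply (L : ℝ) (m : ℕ) (x : ℝ) : sn L m x = sin (fr L m * x) := rfl

theorem sn_zero_left (L : ℝ) (m : ℕ) : sn L m 0 = 0 := by simp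

theorem sn_right {L : ℝ} (hL : L ≠ 0) (m : ℕ) : sn L m L = 0 := by
  rw [sn_apply, fr, div_mul_cancel₀ _ hL, sin_nat_mul_pi]

/-- Odd extension of a function on the half line. -/
def oddExt (f : ℝ → ℝ) (x : ℝ) : ℝ := if 0 < x then f x else -f (-x)

theorem fourierCoeffOn_oddExt {L : ℝ} (hL : 0 < L) (f : C(ℝ, ℝ)) (n : ℤ) :
    fourierCoeffOn (show -L < L by linarith) (fun x => (oddExt f x : ℂ)) n
      = -Complex.I / L * ((∫ x in (0 : ℝ)..L, f x * sin (n * π / L * x) : ℝ) : ℂ) := by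
  have hLc : (L : ℂ) ≠ 0 := by exact_mod_cast hL.ne'
  rw [fourierCoeffOn_eq_integral]
  set E : ℝ → ℂ := fun x => Complex.exp (-(Complex.I * (n * π / L * x : ℝ))) with hE
  have hfour : ∀ x : ℝ, (fourier (-n) (x : AddCircle (L - -L))) = E x := by
    intro x
    rw [fourier_coe_apply, hE]
    congr 1
    push_cast
    field_simp
    ring
  simp_rw [hfour]
  have hEc : Continuous E := by fun_prop
  have hpos : Set.EqOn (fun x => E x • (oddExt f x : ℂ)) (fun x => E x * f x) (Set.Ioc 0 L) := by
    intro x hx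
    simp [oddExt, hx.1]
  have hneg : Set.EqOn (fun x => E x • (oddExt f x : ℂ)) (fun x => -(E x * f (-x)))
      (Set.Ioc (-L) 0) := by
    intro x hx
    simp [oddExt, not_lt.2 hx.2]
  have i1 : IntervalIntegrable (fun x => E x • (oddExt f x : ℂ)) volume (-L) 0 := by
    rw [intervalIntegrable_iff_integrableOn_Ioc_of_le (by linarith)]
    refine IntegrableOn.congr_fun ?_ hneg.symm measurableSet_Ioc
    exact (Continuous.integrableOn_Icc (by fun_prop)).mono_set Set.Ioc_subset_Icc_self
  have i2 : IntervalIntegrable (fun x => E x • (oddExt f x : ℂ)) volume 0 L := by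
    rw [intervalIntegrable_iff_integrableOn_Ioc_of_le hL.le]
    refine IntegrableOn.congr_fun ?_ hpos.symm measurableSet_Ioc
    exact (Continuous.integrableOn_Icc (by fun_prop)).mono_set Set.Ioc_subset_Icc_self
  rw [← intervalIntegral.integral_add_adjacent_intervals i1 i2]
  have e1 : ∫ x in (-L)..0, E x • (oddExt f x : ℂ) = ∫ x in (0 : ℝ)..L, -(E (-x) * f x) := by
    have := intervalIntegral.integral_comp_neg (a := 0) (b := L)
      (fun x => -(E x * (f (-x) : ℂ)))
    simp only [neg_neg, neg_zero] at this
    rw [this, intervalIntegral.integral_of_le (by linarith),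
      intervalIntegral.integral_of_le (by linarith)]
    exact setIntegral_congr_fun measurableSet_Ioc hneg
  have e2 : ∫ x in (0 : ℝ)..L, E x • (oddExt f x : ℂ) = ∫ x in (0 : ℝ)..L, E x * f x := by
    rw [intervalIntegral.integral_of_le hL.le, intervalIntegral.integral_of_le hL.le]
    exact setIntegral_congr_fun measurableSet_Ioc hpos
  rw [e1, e2, ← intervalIntegral.integral_add
    (Continuous.intervalIntegrable (by fun_prop) _ _)
    (Continuous.intervalIntegrable (by fun_prop) _ _)]
  have e3 : ∀ x : ℝ, -(E (-x) * f x) + E x * f x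
      = (-2 * Complex.I) * ((f x * sin (n * π / L * x) : ℝ) : ℂ) := by
    intro x
    have h1 : E (-x) = Complex.exp ((n * π / L * x : ℝ) * Complex.I) := by
      simp only [hE]; congr 1; push_cast; ring
    have h2 : E x = Complex.exp (-(n * π / L * x : ℝ) * Complex.I) := by
      simp only [hE]; congr 1; push_cast; ring
    have h3 := Complex.two_sin ((n * π / L * x : ℝ) : ℂ)
    rw [← h1, ← h2] at h3
    push_cast at h3 ⊢
    linear_combination (f x : ℂ) * Complex.I * h3
      + (f x : ℂ) * (E x - E (-x)) * Complex.I_sq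
  simp_rw [e3]
  rw [intervalIntegral.integral_const_mul, intervalIntegral.integral_ofReal, Complex.real_smul]
  push_cast
  field_simp
  ring

theorem hasSum_ip_sn {L : ℝ} (hL : 0 < L) (f : C(ℝ, ℝ)) :
    HasSum (fun m : ℕ => 2 / L * ip L f (sn L m) ^ 2) (ip L f f) := by
  have hLL : -L < L := by linarith
  have hc : Continuous fun x => f (-x) := by fun_prop
  have hm : MemLp (fun x => (oddExt f x : ℂ)) 2 (volume.restrict (Set.Ioc (-L) L)) := by
    have hmeas : Measurable (oddExt f) :=
      Measurable.ite measurableSet_Ioi f.continuous.measurable hc.measurable.neg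
    obtain ⟨B, hB⟩ := isCompact_Icc (a := -L) (b := L) |>.exists_bound_of_continuousOn
      f.continuous.continuousOn
    refine MemLp.of_bound (Complex.measurable_ofReal.comp hmeas).aestronglyMeasurable B ?_
    refine (ae_restrict_iff' measurableSet_Ioc).2 (Eventually.of_forall fun x hx => ?_)
    rw [Complex.norm_real]
    unfold oddExt
    split_ifs
    · exact hB x ⟨hx.1.le, hx.2⟩
    · rw [norm_neg]; exact hB _ ⟨by linarith [hx.2], by linarith [hx.1]⟩
  have h := (hasSum_sq_fourierCoeffOn hLL hm).nat_add_neg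
  have e0 : ∀ n : ℤ, ‖fourierCoeffOn hLL (fun x => (oddExt f x : ℂ)) n‖ ^ 2
      = (∫ x in (0 : ℝ)..L, f x * sin (n * π / L * x)) ^ 2 / L ^ 2 := by
    intro n
    rw [fourierCoeffOn_oddExt hL]
    simp only [norm_mul, norm_div, norm_neg, Complex.norm_I, Complex.norm_real, norm_eq_abs,
      mul_pow, div_pow, sq_abs]
    ring
  have e1 : ∀ n : ℤ, (∫ x in (0 : ℝ)..L, f x * sin ((-n : ℤ) * π / L * x)) ^ 2
      = (∫ x in (0 : ℝ)..L, f x * sin (n * π / L * x)) ^ 2 := by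
    intro n
    rw [← neg_sq, ← intervalIntegral.integral_neg]
    congr 2; ext x
    rw [← mul_neg, ← sin_neg]; congr 2; push_cast; ring
  simp only [e0, e1] at h
  have e2 : ∫ x in (-L)..L, ‖(oddExt f x : ℂ)‖ ^ 2 = 2 * ip L f f := by
    have a1 : ∀ x, 0 < x → ‖(oddExt f x : ℂ)‖ ^ 2 = f x * f x := fun x hx => by
      rw [Complex.norm_real, norm_eq_abs, sq_abs, oddExt, if_pos hx]; ring
    have a2 : ∀ x, x ≤ 0 → ‖(oddExt f x : ℂ)‖ ^ 2 = f (-x) * f (-x) := fun x hx => by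
      rw [Complex.norm_real, norm_eq_abs, sq_abs, oddExt, if_neg (not_lt.2 hx)]; ring
    have q1 : Set.EqOn (fun x => ‖(oddExt f x : ℂ)‖ ^ 2) (fun x => f (-x) * f (-x))
        (Set.Ioc (-L) 0) := fun x hx => a2 x hx.2
    have q2 : Set.EqOn (fun x => ‖(oddExt f x : ℂ)‖ ^ 2) (fun x => f x * f x)
        (Set.Ioc 0 L) := fun x hx => a1 x hx.1
    have i1 : IntervalIntegrable (fun x => ‖(oddExt f x : ℂ)‖ ^ 2) volume (-L) 0 := by
      rw [intervalIntegrable_iff_integrableOn_Ioc_of_le (by linarith)]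
      refine IntegrableOn.congr_fun ?_ q1.symm measurableSet_Ioc
      exact (Continuous.integrableOn_Icc (by fun_prop)).mono_set Set.Ioc_subset_Icc_self
    have i2 : IntervalIntegrable (fun x => ‖(oddExt f x : ℂ)‖ ^ 2) volume 0 L := by
      rw [intervalIntegrable_iff_integrableOn_Ioc_of_le hL.le]
      refine IntegrableOn.congr_fun ?_ q2.symm measurableSet_Ioc
      exact (Continuous.integrableOn_Icc (by fun_prop)).mono_set Set.Ioc_subset_Icc_self
    rw [← intervalIntegral.integral_add_adjacent_intervals i1 i2,
      intervalIntegral.integral_of_le (by linarith), setIntegral_congr_fun measurableSet_Ioc q1,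
      ← intervalIntegral.integral_of_le (by linarith), intervalIntegral.integral_of_le hL.le,
      setIntegral_congr_fun measurableSet_Ioc q2, ← intervalIntegral.integral_of_le hL.le,
      intervalIntegral.integral_comp_neg (fun x => f x * f x), ip_apply]
    simp only [neg_zero, neg_neg]
    ring
  rw [e2] at h
  have h2 := h.mul_left L
  have e3 : (fun m : ℕ => 2 / L * ip L f (sn L m) ^ 2) = fun m : ℕ =>
      L * ((∫ x in (0 : ℝ)..L, f x * sin ((m : ℤ) * π / L * x)) ^ 2 / L ^ 2
        + (∫ x in (0 : ℝ)..L, f x * sin ((m : ℤ) * π / L * x)) ^ 2 / L ^ 2) := by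
    ext m
    rw [ip_apply]
    simp only [sn_apply, fr, Int.cast_natCast]
    field_simp
    ring
  have e4 : ip L f f = L * ((L - -L)⁻¹ • (2 * ip L f f)
      + (∫ x in (0 : ℝ)..L, f x * sin ((0 : ℤ) * π / L * x)) ^ 2 / L ^ 2) := by
    simp
    field_simp
    ring
  rw [e3, e4]
  exact h2

/-- Restriction of a function of two variables to a horizontal line. -/
def row (f : C(ℝ × ℝ, ℝ)) (y : ℝ) : C(ℝ, ℝ) := ⟨fun x => f (x, y), by fun_prop⟩

/-- Restriction of a function of two variables to a vertical line. -/
def col (f : C(ℝ × ℝ, ℝ)) (x : ℝ) : C(ℝ, ℝ) := ⟨fun y => f (x, y), by fun_prop⟩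

theorem ip2_eq_rows {L₁ L₂ : ℝ} (h₁ : 0 ≤ L₁) (h₂ : 0 ≤ L₂) (f g : C(ℝ × ℝ, ℝ)) :
    ip2 L₁ L₂ f g = ∫ y in (0 : ℝ)..L₂, ip L₁ (row f y) (row g y) := by
  have hi : IntegrableOn (fun p => f p * g p) (Set.Icc 0 L₁ ×ˢ Set.Icc 0 L₂)
      (volume.prod volume) :=
    (Continuous.continuousOn (by fun_prop)).integrableOn_compact (isCompact_Icc.prod isCompact_Icc)
  rw [ip2_apply, Measure.volume_eq_prod, ← Measure.prod_restrict]
  rw [IntegrableOn, ← Measure.prod_restrict] at hi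
  rw [integral_prod_symm _ hi, intervalIntegral.integral_of_le h₂, integral_Icc_eq_integral_Ioc]
  refine integral_congr_ae (Eventually.of_forall fun y => ?_)
  simp only [ip_apply]
  rw [intervalIntegral.integral_of_le h₁, integral_Icc_eq_integral_Ioc]
  rfl

theorem ip2_eq_cols {L₁ L₂ : ℝ} (h₁ : 0 ≤ L₁) (h₂ : 0 ≤ L₂) (f g : C(ℝ × ℝ, ℝ)) :
    ip2 L₁ L₂ f g = ∫ x in (0 : ℝ)..L₁, ip L₂ (col f x) (col g x) := by
  have hi : IntegrableOn (fun p => f p * g p) (Set.Icc 0 L₁ ×ˢ Set.Icc 0 L₂)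
      (volume.prod volume) :=
    (Continuous.continuousOn (by fun_prop)).integrableOn_compact (isCompact_Icc.prod isCompact_Icc)
  rw [ip2_apply, Measure.volume_eq_prod, setIntegral_prod _ hi,
    intervalIntegral.integral_of_le h₁, integral_Icc_eq_integral_Ioc]
  refine integral_congr_ae (Eventually.of_forall fun y => ?_)
  simp only [ip_apply]
  rw [intervalIntegral.integral_of_le h₂, integral_Icc_eq_integral_Ioc]
  rfl

theorem row_tens (f g : C(ℝ, ℝ)) (y : ℝ) : row (tens f g) y = g y • f := by
  ext x; simp [row, mul_comm]

theorem col_tens (f g : C(ℝ, ℝ)) (x : ℝ) : col (tens f g) x = f x • g := by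
  ext y; simp [col]

/-- The coefficients of the rows of `f` against `h`. -/
def rowCoef (L : ℝ) (f : C(ℝ × ℝ, ℝ)) (h : C(ℝ, ℝ)) : C(ℝ, ℝ) :=
  ⟨fun y => ip L (row f y) h, by
    simp only [ip_apply]
    exact intervalIntegral.continuous_parametric_intervalIntegral_of_continuous'
      (f := fun y x => row f y x * h x) (by
        simp only [row, ContinuousMap.coe_mk, Function.uncurry_def]; fun_prop) 0 L⟩

theorem ip2_tens_right {L₁ L₂ : ℝ} (h₁ : 0 ≤ L₁) (h₂ : 0 ≤ L₂) (f : C(ℝ × ℝ, ℝ))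
    (h k : C(ℝ, ℝ)) : ip2 L₁ L₂ f (tens h k) = ip L₂ (rowCoef L₁ f h) k := by
  rw [ip2_eq_rows h₁ h₂, ip_apply]
  congr 1; ext y
  rw [row_tens, map_smul, smul_eq_mul, mul_comm]; rfl

/-- Parseval's identity for the double sine series. -/
theorem ip2_self_eq_tsum {L₁ L₂ : ℝ} (h₁ : 0 < L₁) (h₂ : 0 < L₂) (f : C(ℝ × ℝ, ℝ)) :
    ENNReal.ofReal (ip2 L₁ L₂ f f) = ∑' m, ∑' n, ENNReal.ofReal
      (2 / L₁ * (2 / L₂ * ip2 L₁ L₂ f (tens (sn L₁ m) (sn L₂ n)) ^ 2)) := by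
  have hA : ∀ g : C(ℝ, ℝ), ENNReal.ofReal (ip L₂ g g)
      = ∫⁻ y in Set.Ioc 0 L₂, ENNReal.ofReal (g y * g y) := by
    intro g
    rw [ip_apply, intervalIntegral.integral_of_le h₂.le]
    refine ofReal_integral_eq_lintegral_ofReal ?_
      (Eventually.of_forall fun y => mul_self_nonneg _)
    exact (Continuous.integrableOn_Icc (by fun_prop)).mono_set Set.Ioc_subset_Icc_self
  have hB : ∀ m, ∑' n, ENNReal.ofReal
      (2 / L₁ * (2 / L₂ * ip2 L₁ L₂ f (tens (sn L₁ m) (sn L₂ n)) ^ 2))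
      = ∫⁻ y in Set.Ioc 0 L₂, ENNReal.ofReal (2 / L₁ * (ip L₁ (row f y) (sn L₁ m)) ^ 2) := by
    intro m
    have hs := (hasSum_ip_sn h₂ (rowCoef L₁ f (sn L₁ m))).mul_left (2 / L₁)
    simp_rw [ip2_tens_right h₁.le h₂.le]
    rw [← ENNReal.ofReal_tsum_of_nonneg (fun n => by positivity) hs.summable, hs.tsum_eq,
      ENNReal.ofReal_mul (by positivity), hA]
    rw [← lintegral_const_mul _ (by fun_prop)]
    refine lintegral_congr fun y => ?_
    rw [← ENNReal.ofReal_mul (by positivity), ← pow_two]; rfl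
  simp_rw [hB]
  rw [← lintegral_tsum]
  · have hc : Continuous fun y => ip L₁ (row f y) (row f y) := by
      simp only [ip_apply]
      exact intervalIntegral.continuous_parametric_intervalIntegral_of_continuous'
        (f := fun y x => row f y x * row f y x) (by
        simp only [row, ContinuousMap.coe_mk, Function.uncurry_def]; fun_prop) 0 L₁
    rw [ip2_eq_rows h₁.le h₂.le, intervalIntegral.integral_of_le h₂.le,
      ofReal_integral_eq_lintegral_ofReal]
    · refine lintegral_congr fun y => ?_
      have hs := hasSum_ip_sn h₁ (row f y)
      rw [← hs.tsum_eq, ENNReal.ofReal_tsum_of_nonneg (fun n => by positivity) hs.summable]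
    · exact (Continuous.integrableOn_Icc hc).mono_set Set.Ioc_subset_Icc_self
    · exact Eventually.of_forall fun y => ip_self_nonneg h₁.le _
  · intro m
    have : Continuous fun y => ip L₁ (row f y) (sn L₁ m) := (rowCoef L₁ f (sn L₁ m)).continuous
    exact (ENNReal.measurable_ofReal.comp
      (continuous_const.mul (this.pow 2)).measurable).aemeasurable

/-- `f'` is the partial derivative of `f` in the first variable. -/
def Dx (f f' : C(ℝ × ℝ, ℝ)) : Prop := ∀ y, Der (row f y) (row f' y)

/-- `f'` is the partial derivative of `f` in the second variable. -/
def Dy (f f' : C(ℝ × ℝ, ℝ)) : Prop := ∀ x, Der (col f x) (col f' x)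

theorem ip_der_der {L : ℝ} {f f1 f2 h h1 h2 : C(ℝ, ℝ)} (hf : Der f f1) (hf1 : Der f1 f2)
    (hh : Der h h1) (hh1 : Der h1 h2) (f0 : f 0 = 0) (fL : f L = 0)
    (b0 : f1 0 * h 0 = 0) (bL : f1 L * h L = 0) : ip L f2 h = ip L f h2 := by
  have e1 := ip_parts (L := L) hf1 hh
  have e2 := ip_parts (L := L) hf hh1
  rw [b0, bL] at e1
  rw [f0, fL] at e2
  linarith

/-- Green's formula on the rectangle for a function vanishing on the boundary against a
product function. -/
theorem ip2_lap_tens {L₁ L₂ : ℝ} (h₁ : 0 ≤ L₁) (h₂ : 0 ≤ L₂) {u ux uxx uy uyy : C(ℝ × ℝ, ℝ)}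
    (hx : Dx u ux) (hxx : Dx ux uxx) (hy : Dy u uy) (hyy : Dy uy uyy)
    {f f1 f2 g g1 g2 : C(ℝ, ℝ)} (hf : Der f f1) (hf1 : Der f1 f2) (hg : Der g g1) (hg1 : Der g1 g2)
    (x0 : ∀ y, u (0, y) = 0) (xL : ∀ y, u (L₁, y) = 0)
    (y0 : ∀ x, u (x, 0) = 0) (yL : ∀ x, u (x, L₂) = 0)
    (bx0 : ∀ y, ux (0, y) * f 0 = 0) (bxL : ∀ y, ux (L₁, y) * f L₁ = 0)
    (by0 : ∀ x, uy (x, 0) * g 0 = 0) (byL : ∀ x, uy (x, L₂) * g L₂ = 0) :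
    ip2 L₁ L₂ (uxx + uyy) (tens f g) = ip2 L₁ L₂ u (tens f2 g + tens f g2) := by
  rw [map_add, LinearMap.add_apply, map_add]
  congr 1
  · rw [ip2_eq_rows h₁ h₂, ip2_eq_rows h₁ h₂]
    congr 1; ext y
    rw [row_tens, row_tens, map_smul, map_smul,
      ip_der_der (hx y) (hxx y) hf hf1 (x0 y) (xL y) (bx0 y) (bxL y)]
  · rw [ip2_eq_cols h₁ h₂, ip2_eq_cols h₁ h₂]
    congr 1; ext x
    rw [col_tens, col_tens, map_smul, map_smul,
      ip_der_der (hy x) (hyy x) hg hg1 (y0 x) (yL x) (by0 x) (byL x)]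

theorem Dx_tens {f f1 : C(ℝ, ℝ)} (hf : Der f f1) (g : C(ℝ, ℝ)) : Dx (tens f g) (tens f1 g) := by
  intro y
  rw [row_tens, row_tens]
  exact hf.smul _

theorem Dy_tens (f : C(ℝ, ℝ)) {g g1 : C(ℝ, ℝ)} (hg : Der g g1) : Dy (tens f g) (tens f g1) := by
  intro y
  rw [col_tens, col_tens]
  exact hg.smul _

theorem contDiff_pd {u : ℝ × ℝ → ℝ} (hu : ContDiff ℝ (⊤ : ℕ∞) u) (v : ℝ × ℝ) :
    ContDiff ℝ (⊤ : ℕ∞) (pd v u) := by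
  unfold pd
  exact (hu.fderiv_right (by simp)).clm_apply contDiff_const

theorem hasDerivAt_pd_left {u : ℝ × ℝ → ℝ} (hu : ContDiff ℝ (⊤ : ℕ∞) u) (x y : ℝ) :
    HasDerivAt (fun t => u (t, y)) (pd (1, 0) u (x, y)) x := by
  have h := (hu.differentiable (by simp) (x, y)).hasFDerivAt
  exact h.comp_hasDerivAt x ((hasDerivAt_id x).prodMk (hasDerivAt_const x y))

theorem hasDerivAt_pd_right {u : ℝ × ℝ → ℝ} (hu : ContDiff ℝ (⊤ : ℕ∞) u) (x y : ℝ) :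
    HasDerivAt (fun t => u (x, t)) (pd (0, 1) u (x, y)) y := by
  have h := (hu.differentiable (by simp) (x, y)).hasFDerivAt
  exact h.comp_hasDerivAt y ((hasDerivAt_const y x).prodMk (hasDerivAt_id y))

theorem contDiff_lap {u : ℝ × ℝ → ℝ} (hu : ContDiff ℝ (⊤ : ℕ∞) u) :
    ContDiff ℝ (⊤ : ℕ∞) (lap u) :=
  (contDiff_pd (contDiff_pd hu _) _).add (contDiff_pd (contDiff_pd hu _) _)

theorem Dx_smooth {u : ℝ × ℝ → ℝ} (hu : ContDiff ℝ (⊤ : ℕ∞) u) :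
    Dx ⟨u, hu.continuous⟩ ⟨pd (1, 0) u, (contDiff_pd hu _).continuous⟩ :=
  fun y x => hasDerivAt_pd_left hu x y

theorem Dy_smooth {u : ℝ × ℝ → ℝ} (hu : ContDiff ℝ (⊤ : ℕ∞) u) :
    Dy ⟨u, hu.continuous⟩ ⟨pd (0, 1) u, (contDiff_pd hu _).continuous⟩ :=
  fun x y => hasDerivAt_pd_right hu x y

theorem lap_eq_of_Dx_Dy {u ux vxx uy vyy : C(ℝ × ℝ, ℝ)} (hu : ContDiff ℝ (⊤ : ℕ∞) u)
    (hx : Dx u ux) (hxx : Dx ux vxx) (hy : Dy u uy) (hyy : Dy uy vyy) :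
    lap u = ⇑(vxx + vyy) := by
  have e1 : pd (1, 0) u = ux := by
    ext ⟨x, y⟩; exact (hasDerivAt_pd_left hu x y).unique (hx y x)
  have e2 : pd (0, 1) u = uy := by
    ext ⟨x, y⟩; exact (hasDerivAt_pd_right hu x y).unique (hy x y)
  ext ⟨x, y⟩
  unfold lap uxx uyy
  have s1 := contDiff_pd hu (1, 0)
  have s2 := contDiff_pd hu (0, 1)
  rw [e1] at s1 ⊢
  rw [e2] at s2 ⊢
  exact congrArg₂ (· + ·) ((hasDerivAt_pd_left s1 x y).unique (hxx y x))
    ((hasDerivAt_pd_right s2 x y).unique (hyy x y))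

/-- The quadratic form `∫ (Δu)² - ∫ u²`, polarised, on pairs `(u, Δu)`. -/
def qf (L₁ L₂ : ℝ) : C(ℝ × ℝ, ℝ) × C(ℝ × ℝ, ℝ) →ₗ[ℝ] C(ℝ × ℝ, ℝ) × C(ℝ × ℝ, ℝ) →ₗ[ℝ] ℝ :=
  (ip2 L₁ L₂).compl₁₂ (LinearMap.snd ℝ _ _) (LinearMap.snd ℝ _ _)
    - (ip2 L₁ L₂).compl₁₂ (LinearMap.fst ℝ _ _) (LinearMap.fst ℝ _ _)

theorem qf_apply (L₁ L₂ : ℝ) (p q : C(ℝ × ℝ, ℝ) × C(ℝ × ℝ, ℝ)) :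
    qf L₁ L₂ p q = ip2 L₁ L₂ p.2 q.2 - ip2 L₁ L₂ p.1 q.1 := rfl

theorem qf_comm (L₁ L₂ : ℝ) (p q : C(ℝ × ℝ, ℝ) × C(ℝ × ℝ, ℝ)) :
    qf L₁ L₂ p q = qf L₁ L₂ q p := by
  rw [qf_apply, qf_apply, ip2_comm, ip2_comm L₁ L₂ p.1]

/-- The pair consisting of a product function and its Laplacian. -/
def tp (f f2 g g2 : C(ℝ, ℝ)) : C(ℝ × ℝ, ℝ) × C(ℝ × ℝ, ℝ) :=
  (tens f g, tens f2 g + tens f g2)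

/-- The pair consisting of a smooth function and its Laplacian. -/
def ap (u : ℝ × ℝ → ℝ) (hu : ContDiff ℝ (⊤ : ℕ∞) u) : C(ℝ × ℝ, ℝ) × C(ℝ × ℝ, ℝ) :=
  (⟨u, hu.continuous⟩, ⟨lap u, (contDiff_lap hu).continuous⟩)

theorem Der_sn (L : ℝ) (m : ℕ) :
    Der (sn L m) ⟨fun x => fr L m * cos (fr L m * x), by fun_prop⟩ := by
  intro x
  have := ((hasDerivAt_id x).const_mul (fr L m)).sin
  rw [mul_comm, id, mul_one] at this
  exact this

theorem Der_sn1 (L : ℝ) (m : ℕ) : Der ⟨fun x => fr L m * cos (fr L m * x), by fun_prop⟩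
    (-fr L m ^ 2 • sn L m) := by
  intro x
  have := (((hasDerivAt_id x).const_mul (fr L m)).cos).const_mul (fr L m)
  have e : (-fr L m ^ 2 • sn L m) x = fr L m * (-sin (fr L m * id x) * (fr L m * 1)) := by
    simp; ring
  rw [e]
  exact this

/-- Pairs whose sine coefficients are related as for a function vanishing on the boundary. -/
def hinged (L₁ L₂ : ℝ) : Submodule ℝ (C(ℝ × ℝ, ℝ) × C(ℝ × ℝ, ℝ)) where
  carrier := {p | ∀ m n, ip2 L₁ L₂ p.2 (tens (sn L₁ m) (sn L₂ n))
    = -(fr L₁ m ^ 2 + fr L₂ n ^ 2) * ip2 L₁ L₂ p.1 (tens (sn L₁ m) (sn L₂ n))}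
  add_mem' := by
    intro p q hp hq m n
    simp only [Prod.fst_add, Prod.snd_add, map_add, LinearMap.add_apply, hp m n, hq m n]
    ring
  zero_mem' := by intro m n; simp
  smul_mem' := by
    intro c p hp m n
    simp only [Prod.smul_fst, Prod.smul_snd, map_smul, LinearMap.smul_apply, hp m n, smul_eq_mul]
    ring

theorem mem_hinged_of_lap {L₁ L₂ : ℝ} (h₁ : 0 < L₁) (h₂ : 0 < L₂)
    {u ux vxx uy vyy : C(ℝ × ℝ, ℝ)}
    (hx : Dx u ux) (hxx : Dx ux vxx) (hy : Dy u uy) (hyy : Dy uy vyy)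
    (x0 : ∀ y, u (0, y) = 0) (xL : ∀ y, u (L₁, y) = 0)
    (y0 : ∀ x, u (x, 0) = 0) (yL : ∀ x, u (x, L₂) = 0) :
    (u, vxx + vyy) ∈ hinged L₁ L₂ := by
  intro m n
  have := ip2_lap_tens h₁.le h₂.le hx hxx hy hyy (Der_sn L₁ m) (Der_sn1 L₁ m) (Der_sn L₂ n)
    (Der_sn1 L₂ n) x0 xL y0 yL (by simp) (by simp [-sn_apply, sn_right h₁.ne']) (by simp)
    (by simp [-sn_apply, sn_right h₂.ne'])
  rw [this]
  simp only [map_add, map_smul, LinearMap.smul_apply, smul_eq_mul]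
  ring

theorem tp_mem_hinged {L₁ L₂ : ℝ} (h₁ : 0 < L₁) (h₂ : 0 < L₂) {f f1 f2 g g1 g2 : C(ℝ, ℝ)}
    (hf : Der f f1) (hf1 : Der f1 f2) (hg : Der g g1) (hg1 : Der g1 g2)
    (f0 : f 0 = 0) (fL : f L₁ = 0) (g0 : g 0 = 0) (gL : g L₂ = 0) :
    tp f f2 g g2 ∈ hinged L₁ L₂ :=
  mem_hinged_of_lap h₁ h₂ (Dx_tens hf g) (Dx_tens hf1 g) (Dy_tens f hg) (Dy_tens f hg1)
    (by simp [f0]) (by simp [fL]) (by simp [g0]) (by simp [gL])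

theorem qf_nonneg_of_low {L₁ L₂ : ℝ} (h₁ : 0 < L₁) (h₂ : 0 < L₂)
    {p : C(ℝ × ℝ, ℝ) × C(ℝ × ℝ, ℝ)} (hp : p ∈ hinged L₁ L₂)
    (hlow : ∀ m n, 0 < m → 0 < n → fr L₁ m ^ 2 + fr L₂ n ^ 2 < 1 →
      ip2 L₁ L₂ p.1 (tens (sn L₁ m) (sn L₂ n)) = 0) : 0 ≤ qf L₁ L₂ p p := by
  rw [qf_apply, sub_nonneg, ← ENNReal.ofReal_le_ofReal_iff (ip2_self_nonneg _ _ _),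
    ip2_self_eq_tsum h₁ h₂, ip2_self_eq_tsum h₁ h₂]
  refine ENNReal.tsum_le_tsum fun m => ENNReal.tsum_le_tsum fun n => ENNReal.ofReal_le_ofReal ?_
  have hz : ∀ L, sn L 0 = 0 := fun L => by ext; simp [fr]
  rcases Nat.eq_zero_or_pos m with rfl | hm
  · simp [hz]
  rcases Nat.eq_zero_or_pos n with rfl | hn
  · simp [hz]
  gcongr 2 / L₁ * (2 / L₂ * ?_)
  rw [hp m n]
  by_cases h : fr L₁ m ^ 2 + fr L₂ n ^ 2 < 1
  · simp [hlow m n hm hn h]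
  · rw [mul_pow, neg_sq]
    exact le_mul_of_one_le_left (sq_nonneg _) (one_le_pow₀ (not_lt.1 h))

section Clamped

variable {L₁ L₂ : ℝ} {u : ℝ × ℝ → ℝ}

theorem Adm.zero_of_notMem {Ω : Set (ℝ × ℝ)} (h : Adm Ω u) {p : ℝ × ℝ} (hp : p ∉ Ω) : u p = 0 :=
  image_eq_zero_of_notMem_tsupport fun h' => hp (h.2.2 h')

theorem Adm.pd_zero_of_notMem {Ω : Set (ℝ × ℝ)} (h : Adm Ω u) (v : ℝ × ℝ) {p : ℝ × ℝ}
    (hp : p ∉ Ω) : pd v u p = 0 := by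
  unfold pd
  rw [image_eq_zero_of_notMem_tsupport (f := fderiv ℝ u)
    fun h' => hp (h.2.2 (tsupport_fderiv_subset ℝ h'))]
  simp

theorem Adm.ip2_lap_tens (h : Adm (Set.Ioo 0 L₁ ×ˢ Set.Ioo 0 L₂) u) (h₁ : 0 < L₁) (h₂ : 0 < L₂)
    {f f1 f2 g g1 g2 : C(ℝ, ℝ)} (hf : Der f f1) (hf1 : Der f1 f2) (hg : Der g g1)
    (hg1 : Der g1 g2) : ip2 L₁ L₂ (ap u h.1).2 (tens f g)
      = ip2 L₁ L₂ (ap u h.1).1 (tens f2 g + tens f g2) := by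
  have z : ∀ p : ℝ × ℝ, p ∉ Set.Ioo 0 L₁ ×ˢ Set.Ioo 0 L₂ → u p = 0 := fun p => h.zero_of_notMem
  have zd : ∀ v, ∀ p : ℝ × ℝ, p ∉ Set.Ioo 0 L₁ ×ˢ Set.Ioo 0 L₂ → pd v u p = 0 :=
    fun v p => h.pd_zero_of_notMem v
  refine _root_.ip2_lap_tens h₁.le h₂.le (Dx_smooth h.1) (Dx_smooth (contDiff_pd h.1 _))
    (Dy_smooth h.1) (Dy_smooth (contDiff_pd h.1 _)) hf hf1 hg hg1
    (fun y => z _ ?_) (fun y => z _ ?_) (fun y => z _ ?_) (fun y => z _ ?_)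
    (fun y => mul_eq_zero_of_left (zd _ _ ?_) _) (fun y => mul_eq_zero_of_left (zd _ _ ?_) _)
    (fun y => mul_eq_zero_of_left (zd _ _ ?_) _) (fun y => mul_eq_zero_of_left (zd _ _ ?_) _)
    <;> simp

theorem Adm.ap_mem_hinged (h : Adm (Set.Ioo 0 L₁ ×ˢ Set.Ioo 0 L₂) u) (h₁ : 0 < L₁)
    (h₂ : 0 < L₂) : ap u h.1 ∈ hinged L₁ L₂ := by
  have z : ∀ p : ℝ × ℝ, p ∉ Set.Ioo 0 L₁ ×ˢ Set.Ioo 0 L₂ → u p = 0 := fun p => h.zero_of_notMem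
  refine mem_hinged_of_lap h₁ h₂ (Dx_smooth h.1) (Dx_smooth (contDiff_pd h.1 _))
    (Dy_smooth h.1) (Dy_smooth (contDiff_pd h.1 _))
    (fun y => z _ ?_) (fun y => z _ ?_) (fun y => z _ ?_) (fun y => z _ ?_) <;> simp

/-- Pairs satisfying Green's formula for a function and its Laplacian without boundary terms. -/
def clamped (L₁ L₂ : ℝ) : Submodule ℝ (C(ℝ × ℝ, ℝ) × C(ℝ × ℝ, ℝ)) where
  carrier := {p | ∀ f f1 f2 g g1 g2 : C(ℝ, ℝ), Der f f1 → Der f1 f2 → Der g g1 → Der g1 g2 →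
    ip2 L₁ L₂ p.2 (tens f g) = ip2 L₁ L₂ p.1 (tens f2 g + tens f g2)}
  add_mem' := by
    intro p q hp hq f f1 f2 g g1 g2 h1 h2 h3 h4
    have a := hp _ _ _ _ _ _ h1 h2 h3 h4
    have b := hq _ _ _ _ _ _ h1 h2 h3 h4
    simp only [Prod.fst_add, Prod.snd_add, map_add, LinearMap.add_apply] at a b ⊢
    linarith
  zero_mem' := by intro f f1 f2 g g1 g2 _ _ _ _; simp
  smul_mem' := by
    intro c p hp f f1 f2 g g1 g2 h1 h2 h3 h4
    rw [Prod.smul_fst, Prod.smul_snd, map_smul, map_smul, LinearMap.smul_apply,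
      LinearMap.smul_apply, hp _ _ _ _ _ _ h1 h2 h3 h4]

theorem Adm.ap_mem_clamped (h : Adm (Set.Ioo 0 L₁ ×ˢ Set.Ioo 0 L₂) u) (h₁ : 0 < L₁)
    (h₂ : 0 < L₂) : ap u h.1 ∈ clamped L₁ L₂ :=
  fun _ _ _ _ _ _ hf hf1 hg hg1 => h.ip2_lap_tens h₁ h₂ hf hf1 hg hg1

theorem tp_mem_clamped (h₁ : 0 < L₁) (h₂ : 0 < L₂) {f f1 f2 g g1 g2 : C(ℝ, ℝ)}
    (hf : Der f f1) (hf1 : Der f1 f2) (hg : Der g g1) (hg1 : Der g1 g2)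
    (f0 : f 0 = 0) (fL : f L₁ = 0) (g0 : g 0 = 0) (gL : g L₂ = 0)
    (f10 : f1 0 = 0) (f1L : f1 L₁ = 0) (g10 : g1 0 = 0) (g1L : g1 L₂ = 0) :
    tp f f2 g g2 ∈ clamped L₁ L₂ :=
  fun _ _ _ _ _ _ h1 h2 h3 h4 => _root_.ip2_lap_tens h₁.le h₂.le
    (Dx_tens hf g) (Dx_tens hf1 g) (Dy_tens f hg) (Dy_tens f hg1) h1 h2 h3 h4
    (by simp [f0]) (by simp [fL]) (by simp [g0]) (by simp [gL])
    (by simp [f10]) (by simp [f1L]) (by simp [g10]) (by simp [g1L])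

theorem qf_tp {p : C(ℝ × ℝ, ℝ) × C(ℝ × ℝ, ℝ)} (h : p ∈ clamped L₁ L₂)
    {f f1 f2 f3 f4 g g1 g2 g3 g4 : C(ℝ, ℝ)} (hf : Der f f1) (hf1 : Der f1 f2) (hf2 : Der f2 f3)
    (hf3 : Der f3 f4) (hg : Der g g1) (hg1 : Der g1 g2) (hg2 : Der g2 g3) (hg3 : Der g3 g4) :
    qf L₁ L₂ p (tp f f2 g g2) = ip2 L₁ L₂ p.1
      (tens f4 g + (2 : ℝ) • tens f2 g2 + tens f g4 - tens f g) := by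
  rw [qf_apply, tp, map_add, h _ _ _ _ _ _ hf2 hf3 hg hg1, h _ _ _ _ _ _ hf hf1 hg2 hg3]
  simp only [map_add, map_sub, map_smul, smul_eq_mul]
  ring

end Clamped

theorem tp_eq_lw {L₁ L₂ : ℝ} {N W : Type*} {Y : YFam L₂ N} (Z : XFam Y L₁ W) (i : W) :
    tp (Z.X i).g (Z.X i).g2 (Y.y (Z.n i)) (Y.P (Z.n i)).g2 = (Z.w i, Z.lw i) := rfl

theorem qf_w {L₁ L₂ : ℝ} {N W : Type*} {Y : YFam L₂ N} (Z : XFam Y L₁ W)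
    {p : C(ℝ × ℝ, ℝ) × C(ℝ × ℝ, ℝ)} (h : p ∈ clamped L₁ L₂) (i : W) :
    qf L₁ L₂ p (Z.w i, Z.lw i) = ip2 L₁ L₂ p.1 (Z.res i) := by
  rw [← tp_eq_lw, YFam.y, qf_tp h (Z.X i).der_g (Z.X i).der_g1 (Z.X i).der_g2 (Z.X i).der_g3
    (Y.P _).der_g (Y.P _).der_g1 (Y.P _).der_g2 (Y.P _).der_g3]
  congr 1
  ext ⟨x, y⟩
  have e1 := congrArg (fun f : C(ℝ, ℝ) => f x) (Z.X i).g2_eq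
  have e2 := congrArg (fun f : C(ℝ, ℝ) => f y) (Y.P (Z.n i)).g2_eq
  have e3 := Z.sq_freq i
  have e4 := Y.η_sq (Z.n i)
  simp only [XFam.res, XFam.t, ContinuousMap.sub_apply, ContinuousMap.add_apply,
    ContinuousMap.smul_apply, tens_apply, smul_eq_mul] at e1 e2 e3 ⊢
  rw [e3] at e1 ⊢
  rw [e4] at e2 ⊢
  rw [e1, e2]
  ring

/-- A hinged mode of the rectangle in the first variable completed by a profile in the second
one. -/
def vp {L₁ L₂ k σ : ℝ} (m : ℕ) (P : Prof L₂ k σ) : C(ℝ × ℝ, ℝ) × C(ℝ × ℝ, ℝ) :=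
  tp (sn L₁ m) (-fr L₁ m ^ 2 • sn L₁ m) P.g P.g2

theorem vp_mem_hinged {L₁ L₂ k σ : ℝ} (h₁ : 0 < L₁) (h₂ : 0 < L₂) (m : ℕ) (P : Prof L₂ k σ) :
    vp (L₁ := L₁) m P ∈ hinged L₁ L₂ :=
  tp_mem_hinged h₁ h₂ (Der_sn L₁ m) (Der_sn1 L₁ m) P.der_g P.der_g1 (sn_zero_left _ _)
    (sn_right h₁.ne' _) P.g_zero P.g_L

theorem w_mem_hinged {L₁ L₂ : ℝ} {N W : Type*} {Y : YFam L₂ N} (Z : XFam Y L₁ W) (h₁ : 0 < L₁)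
    (h₂ : 0 < L₂) (i : W) : (Z.w i, Z.lw i) ∈ hinged L₁ L₂ :=
  tp_mem_hinged h₁ h₂ (Z.X i).der_g (Z.X i).der_g1 (Y.P _).der_g (Y.P _).der_g1
    (Z.X i).g_zero (Z.X i).g_L (Y.P _).g_zero (Y.P _).g_L

theorem Adm.qf_vp {L₁ L₂ k σ : ℝ} {u : ℝ × ℝ → ℝ}
    (h : Adm (Set.Ioo 0 L₁ ×ˢ Set.Ioo 0 L₂) u) (h₁ : 0 < L₁) (h₂ : 0 < L₂) (m : ℕ)
    (P : Prof L₂ k σ) (hk : k ^ 2 + fr L₁ m ^ 2 = 1) :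
    qf L₁ L₂ (ap u h.1) (vp (L₁ := L₁) m P) = 0 := by
  rw [vp, qf_tp (h.ap_mem_clamped h₁ h₂) (Der_sn L₁ m) (Der_sn1 L₁ m) ((Der_sn L₁ m).smul _)
    ((Der_sn1 L₁ m).smul _) P.der_g P.der_g1 P.der_g2 P.der_g3]
  rw [show fr L₁ m ^ 2 = 1 - k ^ 2 by linarith]
  refine (congrArg _ ?_).trans (map_zero (ip2 L₁ L₂ (ap u h.1).1))
  ext ⟨x, y⟩
  simp only [ContinuousMap.sub_apply, ContinuousMap.add_apply,
    ContinuousMap.smul_apply, tens_apply, smul_eq_mul, ContinuousMap.zero_apply]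
  ring

theorem ip_sn_der {L : ℝ} (hL : 0 < L) (m : ℕ) {f f1 f2 : C(ℝ, ℝ)} (hf : Der f f1)
    (hf1 : Der f1 f2) (f0 : f 0 = 0) (fL : f L = 0) :
    ip L (sn L m) f2 = -fr L m ^ 2 * ip L (sn L m) f := by
  have := ip_der_der hf hf1 (Der_sn L m) (Der_sn1 L m) f0 fL (by simp)
    (by simp [-sn_apply, sn_right hL.ne'])
  rw [ip_comm, this, map_smul, smul_eq_mul, ip_comm]

theorem qf_vp_w {L₁ L₂ k σ : ℝ} {N W : Type*} {Y : YFam L₂ N} (Z : XFam Y L₁ W) (h₁ : 0 < L₁)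
    (h₂ : 0 < L₂) (m : ℕ) (P : Prof L₂ k σ) (hk : k ^ 2 + fr L₁ m ^ 2 = 1) (i : W) :
    qf L₁ L₂ (vp (L₁ := L₁) m P) (Z.w i, Z.lw i) = 0 := by
  have h := ip_sn_der h₁ m (Z.X i).der_g (Z.X i).der_g1 (Z.X i).g_zero (Z.X i).g_L
  have c1 := P.clamped_left (Y.P (Z.n i)) (Y.hs _)
  have c2 := P.ip_g2_g (Y.P (Z.n i))
  have c3 := (Y.P (Z.n i)).ip_g2_g P
  rw [ip_comm, ip_comm L₂ (Y.P (Z.n i)).g1] at c3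
  rw [← tp_eq_lw, qf_apply]
  simp only [vp, tp, YFam.y, map_add, LinearMap.add_apply, ip2_tens h₁.le h₂.le, map_smul,
    LinearMap.smul_apply, smul_eq_mul, h, c1, c2, c3]
  rw [show fr L₁ m ^ 2 = 1 - k ^ 2 by linarith]
  ring

theorem ip_sn_sn {L : ℝ} (hL : 0 < L) {m n : ℕ} (h : m ≠ n) : ip L (sn L m) (sn L n) = 0 := by
  have e := ip_sn_der hL m (Der_sn L n) (Der_sn1 L n) (sn_zero_left _ _) (sn_right hL.ne' _)
  rw [map_smul, smul_eq_mul] at e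
  have h2 : fr L m ≠ fr L n := by
    unfold fr
    intro h'
    field_simp at h'
    exact h (by exact_mod_cast h')
  have h3 : fr L m ^ 2 ≠ fr L n ^ 2 := by
    intro h'
    exact h2 ((pow_left_inj₀ (by unfold fr; positivity) (by unfold fr; positivity) two_ne_zero).1 h')
  have h4 : (fr L m ^ 2 - fr L n ^ 2) * ip L (sn L m) (sn L n) = 0 := by linarith
  exact (mul_eq_zero.1 h4).resolve_left (sub_ne_zero.2 h3)

theorem ip_sn_self_pos {L : ℝ} (hL : 0 < L) {m : ℕ} (h : 0 < m) : 0 < ip L (sn L m) (sn L m) := by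
  rw [ip_apply]
  have hm : (1 : ℝ) ≤ m := by exact_mod_cast h
  refine intervalIntegral.integral_pos hL (by fun_prop) (fun x _ => mul_self_nonneg _)
    ⟨L / (2 * m), ⟨by positivity, ?_⟩, ?_⟩
  · rw [div_le_iff₀ (by positivity)]; nlinarith
  · rw [sn_apply, fr, show m * π / L * (L / (2 * m)) = π / 2 by field_simp, sin_pi_div_two]
    norm_num

theorem qf_vp_vp {L₁ L₂ k σ k' σ' : ℝ} (h₁ : 0 < L₁) (h₂ : 0 < L₂) {m n : ℕ} (hmn : m ≠ n)
    (P : Prof L₂ k σ) (P' : Prof L₂ k' σ') :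
    qf L₁ L₂ (vp (L₁ := L₁) m P) (vp (L₁ := L₁) n P') = 0 := by
  rw [qf_apply]
  simp [vp, tp, ip2_tens h₁.le h₂.le, ip_sn_sn h₁ hmn]

theorem qf_vp_self {L₁ L₂ k σ : ℝ} (h₁ : 0 < L₁) (h₂ : 0 < L₂) (m : ℕ)
    (P : Prof L₂ k σ) (hσ : σ ^ 2 = 1) (hk : k ^ 2 + fr L₁ m ^ 2 = 1) :
    qf L₁ L₂ (vp (L₁ := L₁) m P) (vp (L₁ := L₁) m P) = 4 * ip L₁ (sn L₁ m) (sn L₁ m) * P.s := by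
  have h := P.ip_e_g_self hσ
  rw [qf_apply]
  simp only [vp, tp, map_add, LinearMap.add_apply, ip2_tens h₁.le h₂.le, map_smul, P.g2_eq,
    LinearMap.smul_apply, smul_eq_mul, map_sub, LinearMap.sub_apply, ip_comm L₂ P.g P.e, h]
  rw [show fr L₁ m ^ 2 = 1 - k ^ 2 by linarith]
  ring

theorem exists_ker_of_card_lt {K V W I J : Type*} [Fintype K] [Fintype V] [Fintype W] [Fintype I]
    [Fintype J]
    (T : ((K → ℝ) × (V → ℝ) × (W → ℝ)) →ₗ[ℝ] (I → ℝ) × (J → ℝ))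
    (h : Fintype.card I + Fintype.card J < Fintype.card K + Fintype.card V + Fintype.card W) :
    ∃ x, x ≠ 0 ∧ T x = 0 := by
  have h2 : Module.finrank ℝ ((I → ℝ) × (J → ℝ))
      < Module.finrank ℝ ((K → ℝ) × (V → ℝ) × (W → ℝ)) := by
    simp only [Module.finrank_prod, Module.finrank_fintype_fun_eq_card]
    omega
  obtain ⟨x, hx, hx0⟩ := (Submodule.ne_bot_iff _).1 (LinearMap.ker_ne_bot_of_finrank_lt h2 (f := T))
  exact ⟨x, hx0, hx⟩

/-- A linear combination with real coefficients as a linear map in the coefficients. -/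
def comb {ι M : Type*} [Fintype ι] [AddCommGroup M] [Module ℝ M] (f : ι → M) : (ι → ℝ) →ₗ[ℝ] M :=
  Fintype.linearCombination ℝ f

theorem comb_apply {ι M : Type*} [Fintype ι] [AddCommGroup M] [Module ℝ M] (f : ι → M)
    (c : ι → ℝ) : comb f c = ∑ i, c i • f i := Fintype.linearCombination_apply ..

theorem comb_mem {ι M : Type*} [Fintype ι] [AddCommGroup M] [Module ℝ M] (f : ι → M)
    (S : Submodule ℝ M) (h : ∀ i, f i ∈ S) (c : ι → ℝ) : comb f c ∈ S := by
  rw [comb_apply]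
  exact S.sum_mem fun i _ => S.smul_mem _ (h i)

/-- A uniform bound for the contribution of the error terms of a family of product functions. -/
def blockError (L₁ L₂ Δ M δ C₀ ε : ℝ) (card : ℕ) : Prop :=
  4 * (324 * Δ * M * card) + 9216 * Δ ^ 2 * card / δ < 2 * C₀ * ε ∧ 0 < δ ∧ 0 ≤ M ∧ 0 < L₁ ∧ 0 < L₂

set_option maxHeartbeats 1000000 in
theorem upper_core {L₁ L₂ Δ M δ C₀ ε : ℝ} {K V W N : Type*} [Fintype K] [Fintype V] [Fintype W]
    [DecidableEq W] {Y : YFam L₂ N} {Z : XFam Y L₁ W} (R : Z.Rep Δ)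
    (hE : blockError L₁ L₂ Δ M δ C₀ ε (Fintype.card W))
    (ψ : K → ℝ × ℝ → ℝ) (hψ : ∀ i, Adm (Set.Ioo 0 L₁ ×ˢ Set.Ioo 0 L₂) (ψ i))
    (hneg : ∀ a : K → ℝ, a ≠ 0 →
      qf L₁ L₂ (comb (fun i => ap (ψ i) (hψ i).1) a) (comb (fun i => ap (ψ i) (hψ i).1) a)
        + δ * ip2 L₁ L₂ (comb (fun i => ap (ψ i) (hψ i).1) a).1
          (comb (fun i => ap (ψ i) (hψ i).1) a).1 < 0)
    (m : V → ℕ) (hm : ∀ v, 0 < m v) (hinj : Function.Injective m) (κ σ : V → ℝ)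
    (P : ∀ v, Prof L₂ (κ v) (σ v)) (hσ : ∀ v, σ v ^ 2 = 1)
    (hκ : ∀ v, κ v ^ 2 + fr L₁ (m v) ^ 2 = 1) (hs : ∀ v, (P v).s < 0)
    (hC₀ : ∀ i, C₀ ≤ (Y.P (Z.n i)).C) (hC₀' : 0 ≤ C₀) (hε : 0 ≤ ε)
    (hsW : ∀ i, (Z.X i).s ≤ -ε)
    (hM : ∀ i, ip L₂ (Y.y (Z.n i)) (Y.y (Z.n i)) ≤ M ^ 2)
    (low : Finset (ℕ × ℕ))
    (hlow : ∀ m n, 0 < m → 0 < n → fr L₁ m ^ 2 + fr L₂ n ^ 2 < 1 → (m, n) ∈ low) :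
    Fintype.card K + Fintype.card V + Fintype.card W
      ≤ low.card + (Finset.univ.image R.r).card := by
  obtain ⟨hE, hδ, hM0, h₁, h₂⟩ := hE
  by_contra! hcon
  set p := fun i => ap (ψ i) (hψ i).1
  set v : V → C(ℝ × ℝ, ℝ) × C(ℝ × ℝ, ℝ) := fun i => vp (L₁ := L₁) (m i) (P i)
  set w : W → C(ℝ × ℝ, ℝ) × C(ℝ × ℝ, ℝ) := fun i => (Z.w i, Z.lw i)
  let U : ((K → ℝ) × (V → ℝ) × (W → ℝ)) →ₗ[ℝ] C(ℝ × ℝ, ℝ) × C(ℝ × ℝ, ℝ) :=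
    (comb p).coprod ((comb v).coprod (comb w))
  let T : ((K → ℝ) × (V → ℝ) × (W → ℝ)) →ₗ[ℝ] (low → ℝ) × (Finset.univ.image R.r → ℝ) :=
    (LinearMap.pi fun q : low => ((ip2 L₁ L₂).flip (tens (sn L₁ q.1.1) (sn L₂ q.1.2))) ∘ₗ
        LinearMap.fst ℝ _ _ ∘ₗ U).prod
      ((LinearMap.pi fun j : Finset.univ.image R.r =>
          ∑ i with R.r i = j.1, LinearMap.proj i) ∘ₗ LinearMap.snd ℝ _ _ ∘ₗ LinearMap.snd ℝ _ _)
  obtain ⟨⟨a, b, c⟩, hx, hT⟩ := exists_ker_of_card_lt T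
    (by simpa only [Fintype.card_coe] using hcon)
  have hT1 : ∀ q : low, ip2 L₁ L₂ (U (a, b, c)).1 (tens (sn L₁ q.1.1) (sn L₂ q.1.2)) = 0 :=
    fun q => congrFun (congrArg Prod.fst hT) q
  have hT2 : ∀ j, ∑ i with R.r i = j, c i = 0 := by
    intro j
    by_cases hj : j ∈ Finset.univ.image R.r
    · have := congrFun (congrArg Prod.snd hT) ⟨j, hj⟩
      simpa [T] using this
    · rw [Finset.sum_filter]
      refine Finset.sum_eq_zero fun i _ => if_neg fun h => hj ?_
      exact Finset.mem_image.2 ⟨i, Finset.mem_univ _, h⟩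
  have hU : U (a, b, c) = comb p a + (comb v b + comb w c) := rfl
  have hnn : 0 ≤ qf L₁ L₂ (U (a, b, c)) (U (a, b, c)) := by
    refine qf_nonneg_of_low h₁ h₂ ?_ fun m n hm hn hmn => hT1 ⟨(m, n), hlow m n hm hn hmn⟩
    rw [hU]
    refine add_mem (comb_mem _ _ (fun i => (hψ i).ap_mem_hinged h₁ h₂) _) (add_mem ?_ ?_)
    · exact comb_mem _ _ (fun i => vp_mem_hinged h₁ h₂ _ _) _
    · exact comb_mem _ _ (fun i => w_mem_hinged Z h₁ h₂ _) _
  have q12 : qf L₁ L₂ (comb p a) (comb v b) = 0 := by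
    rw [comb_apply, comb_apply, bilin_sum_sum]
    refine Finset.sum_eq_zero fun i _ => Finset.sum_eq_zero fun j _ => ?_
    rw [(hψ i).qf_vp h₁ h₂ _ _ (hκ j), mul_zero]
  have q23 : qf L₁ L₂ (comb v b) (comb w c) = 0 := by
    rw [comb_apply, comb_apply, bilin_sum_sum]
    refine Finset.sum_eq_zero fun i _ => Finset.sum_eq_zero fun j _ => ?_
    rw [qf_vp_w Z h₁ h₂ _ _ (hκ i), mul_zero]
  set S := ∑ i, c i • Z.res i with hS
  have q13 : qf L₁ L₂ (comb p a) (comb w c) = ip2 L₁ L₂ (comb p a).1 S := by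
    have e : (comb p a).1 = ∑ i, a i • (p i).1 := by
      rw [comb_apply, Prod.fst_sum]; rfl
    rw [e, comb_apply, comb_apply, bilin_sum_sum, hS, bilin_sum_sum]
    refine Finset.sum_congr rfl fun i _ => Finset.sum_congr rfl fun j _ => ?_
    rw [qf_w Z ((hψ i).ap_mem_clamped h₁ h₂)]
  have q22 : qf L₁ L₂ (comb v b) (comb v b)
      = ∑ i, 4 * ip L₁ (sn L₁ (m i)) (sn L₁ (m i)) * (P i).s * b i ^ 2 := by
    classical
    rw [comb_apply, bilin_sum_sum]
    refine Finset.sum_congr rfl fun i _ => ?_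
    rw [Finset.sum_eq_single i]
    · rw [qf_vp_self h₁ h₂ _ _ (hσ i) (hκ i)]; ring
    · intro j _ hj
      rw [qf_vp_vp h₁ h₂ (fun h => hj (hinj h).symm), mul_zero]
    · simp
  have q33 : qf L₁ L₂ (comb w c) (comb w c) = (∑ i, 2 * (Y.P (Z.n i)).C * (Z.X i).s * c i ^ 2)
        + 4 * ∑ i, ∑ j, c i * c j * Z.a i j := by
    rw [← Z.energy_eq h₁.le h₂.le, qf_apply, comb_apply, Prod.fst_sum, Prod.snd_sum]; rfl
  have hsplit : qf L₁ L₂ (U (a, b, c)) (U (a, b, c))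
      = qf L₁ L₂ (comb p a) (comb p a) + qf L₁ L₂ (comb v b) (comb v b)
        + qf L₁ L₂ (comb w c) (comb w c) + 2 * ip2 L₁ L₂ (comb p a).1 S := by
    rw [hU]
    simp only [map_add, LinearMap.add_apply, q12, q23, q13, qf_comm L₁ L₂ (comb v b) (comb p a),
      qf_comm L₁ L₂ (comb w c) (comb p a), qf_comm L₁ L₂ (comb w c) (comb v b)]
    ring
  have b1 := two_ip2_le L₁ L₂ hδ (comb p a).1 S
  have b2 := XFam.norm_res_le h₁.le h₂.le R c hT2
  have b3 := (abs_le.1 (XFam.abs_sum_a_le h₁.le h₂.le hM0 R hM c hT2)).2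
  have b4 : ∑ i, 2 * (Y.P (Z.n i)).C * (Z.X i).s * c i ^ 2 ≤ -(2 * C₀ * ε) * ∑ i, c i ^ 2 := by
    rw [Finset.mul_sum]
    refine Finset.sum_le_sum fun i _ => ?_
    have := mul_le_mul (hC₀ i) (neg_le_neg (hsW i)) (by linarith) (hC₀'.trans (hC₀ i))
    have h3 := mul_le_mul_of_nonneg_right this (sq_nonneg (c i))
    linarith
  have b5 : ip2 L₁ L₂ S S / δ ≤ 9216 * Δ ^ 2 * Fintype.card W / δ * ∑ i, c i ^ 2 := by
    rw [div_mul_eq_mul_div]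
    gcongr
    linarith
  have hc2 : 0 ≤ ∑ i, c i ^ 2 := Finset.sum_nonneg fun i _ => sq_nonneg _
  have B : qf L₁ L₂ (comb w c) (comb w c) + ip2 L₁ L₂ S S / δ
      ≤ (4 * (324 * Δ * M * Fintype.card W) + 9216 * Δ ^ 2 * Fintype.card W / δ - 2 * C₀ * ε)
        * ∑ i, c i ^ 2 := by
    rw [q33]; linarith
  have hv2 : qf L₁ L₂ (comb v b) (comb v b) ≤ 0 := by
    rw [q22]
    refine Finset.sum_nonpos fun i _ => ?_
    have := ip_sn_self_pos h₁ (hm i)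
    have h3 := mul_nonneg this.le (sq_nonneg (b i))
    nlinarith [hs i]
  have hp2 : qf L₁ L₂ (comb p a) (comb p a) + δ * ip2 L₁ L₂ (comb p a).1 (comb p a).1 ≤ 0 := by
    by_cases ha : a = 0
    · simp [ha]
    · exact (hneg a ha).le
  rw [hsplit] at hnn
  clear hsplit hU hT1 hT q12 q23 q13
  have hc0 : c = 0 := by
    by_contra hc
    have : 0 < ∑ i, c i ^ 2 := by
      obtain ⟨i, hi⟩ := Function.ne_iff.1 hc
      exact Finset.sum_pos' (fun i _ => sq_nonneg _) ⟨i, Finset.mem_univ _, by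
        have : c i ≠ 0 := hi
        positivity⟩
    nlinarith
  have hS0 : qf L₁ L₂ (comb w c) (comb w c) + ip2 L₁ L₂ S S / δ ≤ 0 := by
    refine B.trans (mul_nonpos_of_nonpos_of_nonneg (by linarith) hc2)
  have ha0 : a = 0 := by
    by_contra ha
    have := hneg a ha
    linarith
  have hb0 : b ≠ 0 := by
    rintro rfl
    exact hx (by rw [ha0, hc0]; rfl)
  have : qf L₁ L₂ (comb v b) (comb v b) < 0 := by
    rw [q22]
    obtain ⟨i, hi⟩ := Function.ne_iff.1 hb0
    have h4 : ∀ i, 4 * ip L₁ (sn L₁ (m i)) (sn L₁ (m i)) * (P i).s * b i ^ 2 ≤ 0 := fun i => by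
      have := ip_sn_self_pos h₁ (hm i)
      have h3 := mul_nonneg this.le (sq_nonneg (b i))
      nlinarith [hs i]
    refine Finset.sum_neg' (fun i _ => h4 i) ⟨i, Finset.mem_univ _, ?_⟩
    have := ip_sn_self_pos h₁ (hm i)
    have h5 : 0 < b i ^ 2 := by have : b i ≠ 0 := hi
                                positivity
    nlinarith [mul_pos (mul_pos this h5) (neg_pos.2 (hs i))]
  linarith

theorem Der.mul {f f' g g' : C(ℝ, ℝ)} (hf : Der f f') (hg : Der g g') :
    Der (f * g) (f' * g + f * g') :=
  fun x => (hf x).mul (hg x)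

/-- Composition with the affine map `x ↦ a + b * x`. -/
def aff (a b : ℝ) (f : C(ℝ, ℝ)) : C(ℝ, ℝ) := ⟨fun x => f (a + b * x), by fun_prop⟩

theorem aff_apply (a b : ℝ) (f : C(ℝ, ℝ)) (x : ℝ) : aff a b f x = f (a + b * x) := rfl

theorem Der.aff (a b : ℝ) {f f' : C(ℝ, ℝ)} (hf : Der f f') :
    Der (aff a b f) (b • aff a b f') := by
  intro x
  have h : HasDerivAt (fun x => a + b * x) b x := by
    simpa using ((hasDerivAt_id x).const_mul b).const_add a
  have := (hf (a + b * x)).comp x h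
  rw [mul_comm] at this
  exact this

theorem contDiff_aff (a b : ℝ) {f : C(ℝ, ℝ)} (hf : ContDiff ℝ (⊤ : ℕ∞) f) :
    ContDiff ℝ (⊤ : ℕ∞) (aff a b f) :=
  hf.comp (contDiff_const.add (contDiff_const.mul contDiff_id))

theorem ip_reflect (L : ℝ) (f g : C(ℝ, ℝ)) : ip L (aff L (-1) f) (aff L (-1) g) = ip L f g := by
  have := intervalIntegral.integral_comp_sub_left (a := 0) (b := L) (fun x => f x * g x) L
  simp only [sub_self, sub_zero] at this
  rw [ip_apply, ip_apply, ← this]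
  simp only [aff_apply, neg_mul, one_mul, sub_eq_add_neg]

theorem exists_der {f : C(ℝ, ℝ)} (hf : ContDiff ℝ (⊤ : ℕ∞) f) :
    ∃ f' : C(ℝ, ℝ), Der f f' ∧ ContDiff ℝ (⊤ : ℕ∞) f' := by
  have h := (contDiff_infty_iff_deriv.1 hf)
  exact ⟨⟨deriv f, h.2.continuous⟩, fun x => (h.1 x).hasDerivAt, h.2⟩

theorem Der.eq_zero {f f' : C(ℝ, ℝ)} (hf : Der f f') {a x : ℝ} (h : ∀ z, a ≤ z → f z = 0)
    (hx : a ≤ x) : f' x = 0 := by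
  have h1 := (hf x).hasDerivWithinAt (s := Set.Ici x)
  have h2 : HasDerivWithinAt f 0 (Set.Ici x) x :=
    (hasDerivWithinAt_const x _ (0 : ℝ)).congr (fun z hz => h z (hx.trans hz)) (h x hx)
  exact (uniqueDiffWithinAt_Ici x).eq_deriv _ h1 h2

/-- A smooth cut-off function equal to `1` on `(-∞, 1]` and vanishing on `[2, ∞)`. -/
def cutoff : C(ℝ, ℝ) :=
  ⟨fun z => 1 - smoothTransition (z - 1), by
    fun_prop⟩

theorem cutoff_smooth : ContDiff ℝ (⊤ : ℕ∞) cutoff :=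
  contDiff_const.sub (smoothTransition.contDiff.comp (contDiff_id.sub contDiff_const))

theorem cutoff_one {z : ℝ} (h : z ≤ 1) : cutoff z = 1 := by
  have : smoothTransition (z - 1) = 0 := smoothTransition.zero_of_nonpos (by linarith)
  simp [cutoff, this]

theorem cutoff_zero {z : ℝ} (h : 2 ≤ z) : cutoff z = 0 := by
  have : smoothTransition (z - 1) = 1 := smoothTransition.one_of_one_le (by linarith)
  simp [cutoff, this]

theorem abs_le_mul_of_der {f f' : C(ℝ, ℝ)} (hf : Der f f') (h0 : f 0 = 0) {B x : ℝ} (hx : 0 ≤ x)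
    (h : ∀ z ∈ Set.Icc 0 x, |f' z| ≤ B) : |f x| ≤ B * x := by
  have := (convex_Icc 0 x).norm_image_sub_le_of_norm_hasDerivWithin_le
    (fun z _ => (hf z).hasDerivWithinAt) h (Set.left_mem_Icc.2 hx) (Set.right_mem_Icc.2 hx)
  simpa [h0, abs_of_nonneg hx] using this

theorem ip_self_le_of_vanish {L t K : ℝ} (ht : 0 ≤ t) (htL : 2 * t ≤ L) (f : C(ℝ, ℝ))
    (h : ∀ x, 0 ≤ x → x ≤ 2 * t → |f x| ≤ K) (h0 : ∀ x, 2 * t ≤ x → f x = 0) :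
    ip L f f ≤ K ^ 2 * (2 * t) := by
  rw [ip_apply, ← intervalIntegral.integral_add_adjacent_intervals (b := 2 * t)
    (Continuous.intervalIntegrable (by fun_prop) _ _)
    (Continuous.intervalIntegrable (by fun_prop) _ _)]
  have e2 : ∫ x in (2 * t)..L, f x * f x = 0 := by
    rw [← intervalIntegral.integral_zero (μ := volume) (a := 2 * t) (b := L)]
    refine intervalIntegral.integral_congr fun x hx => ?_
    rw [Set.uIcc_of_le htL] at hx
    simp [h0 x hx.1]
  have e1 := intervalIntegral.norm_integral_le_of_norm_le_const (a := 0) (b := 2 * t) (C := K ^ 2)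
    (f := fun x => f x * f x) (fun x hx => by
      rw [Set.uIoc_of_le (by linarith)] at hx
      have := h x hx.1.le hx.2
      rw [norm_mul, norm_eq_abs, ← sq]
      gcongr)
  rw [e2, add_zero]
  refine (le_abs_self _).trans (e1.trans_eq ?_)
  rw [sub_zero, abs_of_nonneg (by linarith)]

theorem exists_edge {f f1 f2 : C(ℝ, ℝ)} (hf : Der f f1) (hf1 : Der f1 f2)
    (hs : ContDiff ℝ (⊤ : ℕ∞) f) (f0 : f 0 = 0) (f10 : f1 0 = 0) :
    ∃ K, ∀ t L, 0 < t → t ≤ 1 → 2 * t ≤ L → ∃ E E1 E2 : C(ℝ, ℝ), Der E E1 ∧ Der E1 E2 ∧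
      ContDiff ℝ (⊤ : ℕ∞) E ∧ (∀ x, x ≤ t → E x = f x) ∧ (∀ x, 2 * t ≤ x → E x = 0) ∧
      ip L E E ≤ K * t ∧ ip L E2 E2 ≤ K * t := by
  obtain ⟨c1, hc, hcs⟩ := exists_der cutoff_smooth
  obtain ⟨c2, hc1, -⟩ := exists_der hcs
  have bd : ∀ g : C(ℝ, ℝ), ∃ B, ∀ z ∈ Set.Icc (0 : ℝ) 2, |g z| ≤ B := fun g =>
    isCompact_Icc.exists_bound_of_continuousOn g.continuous.continuousOn
  obtain ⟨A0, hA0⟩ := bd cutoff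
  obtain ⟨A1, hA1⟩ := bd c1
  obtain ⟨A2, hA2⟩ := bd c2
  obtain ⟨M, hM⟩ := bd f2
  have hM0 : 0 ≤ M := (abs_nonneg _).trans (hM 0 ⟨le_refl _, zero_le_two⟩)
  have hM1 : ∀ x, 0 ≤ x → x ≤ 2 → |f1 x| ≤ M * x := fun x hx hx2 =>
    abs_le_mul_of_der hf1 f10 hx fun z hz => hM z ⟨hz.1, hz.2.trans hx2⟩
  have hM2 : ∀ x, 0 ≤ x → x ≤ 2 → |f x| ≤ M * x * x := fun x hx hx2 =>
    abs_le_mul_of_der hf f0 hx fun z hz => (hM1 z hz.1 (hz.2.trans hx2)).trans (by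
      gcongr; exact hz.2)
  have p0 : 0 ≤ A0 := (abs_nonneg _).trans (hA0 0 ⟨le_refl _, zero_le_two⟩)
  have p1 : 0 ≤ A1 := (abs_nonneg _).trans (hA1 0 ⟨le_refl _, zero_le_two⟩)
  have p2 : 0 ≤ A2 := (abs_nonneg _).trans (hA2 0 ⟨le_refl _, zero_le_two⟩)
  set Q := A0 * (M * 4) + A2 * (M * 4) + 2 * (A1 * (M * 2)) + A0 * M
  refine ⟨2 * Q ^ 2, fun t L ht ht1 htL => ?_⟩
  set d0 := aff 0 t⁻¹ cutoff
  set d1 := t⁻¹ • aff 0 t⁻¹ c1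
  set d2 := t⁻¹ • (t⁻¹ • aff 0 t⁻¹ c2)
  have D0 : Der d0 d1 := hc.aff _ _
  have D1 : Der d1 d2 := (hc1.aff _ _).smul _
  set E := d0 * f
  set E1 := d1 * f + d0 * f1
  set E2 := (d2 * f + d1 * f1) + (d1 * f1 + d0 * f2)
  have H1 : Der E E1 := D0.mul hf
  have H2 : Der E1 E2 := (D1.mul hf).add (D0.mul hf1)
  have z0 : ∀ x, 2 * t ≤ x → E x = 0 := by
    intro x hx
    have : d0 x = 0 := by
      rw [aff_apply, zero_add]
      apply cutoff_zero
      rw [inv_mul_eq_div, le_div_iff₀ ht]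
      exact hx
    simp [E, this]
  have z1 : ∀ x, 2 * t ≤ x → E1 x = 0 := fun x hx => H1.eq_zero z0 hx
  have z2 : ∀ x, 2 * t ≤ x → E2 x = 0 := fun x hx => H2.eq_zero z1 hx
  have hmem : ∀ x, 0 ≤ x → x ≤ 2 * t → 0 + t⁻¹ * x ∈ Set.Icc (0 : ℝ) 2 := fun x hx hx2 => by
    rw [zero_add, inv_mul_eq_div]
    exact ⟨by positivity, (div_le_iff₀ ht).2 hx2⟩
  have b0 : ∀ x, 0 ≤ x → x ≤ 2 * t → |d0 x| ≤ A0 := fun x hx hx2 => hA0 _ (hmem x hx hx2)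
  have b1 : ∀ x, 0 ≤ x → x ≤ 2 * t → |d1 x| ≤ t⁻¹ * A1 := fun x hx hx2 => by
    simp only [d1, ContinuousMap.smul_apply, smul_eq_mul, abs_mul, abs_of_pos (inv_pos.2 ht)]
    gcongr
    exact hA1 _ (hmem x hx hx2)
  have b2 : ∀ x, 0 ≤ x → x ≤ 2 * t → |d2 x| ≤ t⁻¹ * (t⁻¹ * A2) := fun x hx hx2 => by
    simp only [d2, ContinuousMap.smul_apply, smul_eq_mul, abs_mul, abs_of_pos (inv_pos.2 ht)]
    gcongr
    exact hA2 _ (hmem x hx hx2)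
  have m1 : ∀ x, 0 ≤ x → x ≤ 2 * t → |f1 x| ≤ t * (M * 2) := fun x hx hx2 =>
    (hM1 x hx (by linarith)).trans (by nlinarith)
  have m2 : ∀ x, 0 ≤ x → x ≤ 2 * t → |f x| ≤ t * (t * (M * 4)) := fun x hx hx2 =>
    (hM2 x hx (by linarith)).trans (by
      calc M * x * x ≤ M * (2 * t) * (2 * t) := by gcongr
        _ = _ := by ring)
  refine ⟨E, E1, E2, H1, H2, ?_, ?_, z0, ?_, ?_⟩
  · exact (contDiff_aff _ _ cutoff_smooth).mul hs
  · intro x hx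
    have : d0 x = 1 := by
      rw [aff_apply, zero_add]
      apply cutoff_one
      rw [inv_mul_eq_div, div_le_iff₀ ht, one_mul]
      exact hx
    simp [E, this]
  · refine (ip_self_le_of_vanish (K := Q) ht.le htL E (fun x hx hx2 => ?_) z0).trans_eq (by ring)
    have : |E x| ≤ A0 * (t * (t * (M * 4))) := by
      simp only [E, ContinuousMap.mul_apply, abs_mul]
      exact mul_le_mul (b0 x hx hx2) (m2 x hx hx2) (abs_nonneg _) p0
    have h2 : A0 * (t * (t * (M * 4))) ≤ A0 * (M * 4) := by
      refine mul_le_mul_of_nonneg_left ?_ p0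
      calc t * (t * (M * 4)) ≤ 1 * (1 * (M * 4)) := by gcongr
        _ = _ := by ring
    have : 0 ≤ A2 * (M * 4) + 2 * (A1 * (M * 2)) + A0 * M := by positivity
    linarith
  · refine (ip_self_le_of_vanish (K := Q) ht.le htL E2 (fun x hx hx2 => ?_) z2).trans_eq (by ring)
    have e : E2 x = d2 x * f x + 2 * (d1 x * f1 x) + d0 x * f2 x := by
      simp [E2]; ring
    have h1 : |d2 x * f x| ≤ A2 * (M * 4) := by
      rw [abs_mul]
      calc _ ≤ (t⁻¹ * (t⁻¹ * A2)) * (t * (t * (M * 4))) :=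
            mul_le_mul (b2 x hx hx2) (m2 x hx hx2) (abs_nonneg _) (by positivity)
        _ = _ := by field_simp
    have h2 : |d1 x * f1 x| ≤ A1 * (M * 2) := by
      rw [abs_mul]
      calc _ ≤ (t⁻¹ * A1) * (t * (M * 2)) :=
            mul_le_mul (b1 x hx hx2) (m1 x hx hx2) (abs_nonneg _) (by positivity)
        _ = _ := by field_simp
    have h3 : |d0 x * f2 x| ≤ A0 * M := by
      rw [abs_mul]
      exact mul_le_mul (b0 x hx hx2) (hM x ⟨hx, by linarith⟩) (abs_nonneg _) p0
    rw [e]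
    rw [abs_le] at h1 h2 h3 ⊢
    constructor <;> linarith

/-- A sequence of continuous functions converges in `L²(0, L)`. -/
def L2Tendsto (L : ℝ) (F : ℕ → C(ℝ, ℝ)) (f : C(ℝ, ℝ)) : Prop :=
  Tendsto (fun k => ip L (F k - f) (F k - f)) atTop (nhds 0)

theorem L2Tendsto.ip {L : ℝ} (hL : 0 ≤ L) {F G : ℕ → C(ℝ, ℝ)} {f g : C(ℝ, ℝ)}
    (hF : L2Tendsto L F f) (hG : L2Tendsto L G g) :
    Tendsto (fun k => ip L (F k) (G k)) atTop (nhds (ip L f g)) := by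
  have key : ∀ {H : ℕ → C(ℝ, ℝ)} {h : C(ℝ, ℝ)} (u : C(ℝ, ℝ)), L2Tendsto L H h →
      Tendsto (fun k => _root_.ip L (H k - h) u) atTop (nhds 0) := by
    intro H h u hH
    have h2 : Tendsto (fun k => (_root_.ip L (H k - h) u) ^ 2) atTop (nhds 0) := by
      refine squeeze_zero (fun k => sq_nonneg _) (fun k => ip_mul_self_le hL _ _) ?_
      simpa using hH.mul_const (_root_.ip L u u)
    have h3 := (continuous_sqrt.tendsto _).comp h2
    rw [tendsto_zero_iff_abs_tendsto_zero]
    simpa [Function.comp_def, sqrt_sq_eq_abs] using h3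
  have h4 : Tendsto (fun k => _root_.ip L (F k - f) (G k - g)) atTop (nhds 0) := by
    have h2 : Tendsto (fun k => (_root_.ip L (F k - f) (G k - g)) ^ 2) atTop (nhds 0) := by
      refine squeeze_zero (fun k => sq_nonneg _) (fun k => ip_mul_self_le hL _ _) ?_
      simpa using Tendsto.mul hF hG
    have h3 := (continuous_sqrt.tendsto _).comp h2
    rw [tendsto_zero_iff_abs_tendsto_zero]
    simpa [Function.comp_def, sqrt_sq_eq_abs] using h3
  have h5 := ((h4.add (key g hF)).add (key f hG)).add_const (_root_.ip L f g)
  simp only [zero_add] at h5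
  refine h5.congr fun k => ?_
  simp only [map_sub, LinearMap.sub_apply, ip_comm L (G k) f, ip_comm L g f]
  ring

/-- A smooth function clamped at both end points is a limit of compactly supported smooth
functions, together with its second derivative. -/
theorem exists_clamped_approx {L : ℝ} (hL : 0 < L) {f f1 f2 : C(ℝ, ℝ)} (hf : Der f f1)
    (hf1 : Der f1 f2) (hs : ContDiff ℝ (⊤ : ℕ∞) f) (f0 : f 0 = 0) (f10 : f1 0 = 0)
    (fL : f L = 0) (f1L : f1 L = 0) :
    ∃ F F1 F2 : ℕ → C(ℝ, ℝ), (∀ k, Der (F k) (F1 k) ∧ Der (F1 k) (F2 k) ∧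
      ContDiff ℝ (⊤ : ℕ∞) (F k) ∧ ∃ t, 0 < t ∧ ∀ x, x ∉ Set.Icc t (L - t) → F k x = 0) ∧
      L2Tendsto L F f ∧ L2Tendsto L F2 f2 := by
  obtain ⟨K, hK⟩ := exists_edge hf hf1 hs f0 f10
  obtain ⟨K', hK'⟩ := exists_edge (hf.aff L (-1)) ((hf1.aff L (-1)).smul (-1))
    (contDiff_aff _ _ hs) (by simp [aff_apply, fL]) (by simp [aff_apply, f1L])
  set t : ℕ → ℝ := fun k => min 1 (L / 3) * (1 / (k + 1)) with ht
  have hm : 0 < min 1 (L / 3) := lt_min one_pos (by positivity)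
  have tpos : ∀ k, 0 < t k := fun k => by simp only [ht]; positivity
  have tle : ∀ k, t k ≤ min 1 (L / 3) := fun k => by
    refine mul_le_of_le_one_right hm.le ?_
    rw [div_le_one (by positivity)]
    linarith
  have t1 : ∀ k, t k ≤ 1 := fun k => (tle k).trans (min_le_left _ _)
  have t3 : ∀ k, 3 * t k ≤ L := fun k => by
    have := (tle k).trans (min_le_right _ _)
    linarith
  have tlim : Tendsto t atTop (nhds 0) := by
    have := (tendsto_one_div_add_atTop_nhds_zero_nat (𝕜 := ℝ)).const_mul (min 1 (L / 3))
    rw [mul_zero] at this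
    exact this
  choose E E1 E2 h1 h2 h3 h4 h5 h6 h7 using fun k => hK (t k) L (tpos k) (t1 k) (by linarith [t3 k, tpos k])
  choose R R1 R2 r1 r2 r3 r4 r5 r6 r7 using
    fun k => hK' (t k) L (tpos k) (t1 k) (by linarith [t3 k, tpos k])
  refine ⟨fun k => f - E k - aff L (-1) (R k), fun k => f1 - E1 k - (-1 : ℝ) • aff L (-1) (R1 k),
    fun k => f2 - E2 k - (-1 : ℝ) • (-1 : ℝ) • aff L (-1) (R2 k), fun k =>
    ⟨(hf.sub (h1 k)).sub ((r1 k).aff L (-1)), (hf1.sub (h2 k)).sub (((r2 k).aff L (-1)).smul _),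
      (hs.sub (h3 k)).sub (contDiff_aff _ _ (r3 k)), t k, tpos k, ?_⟩, ?_, ?_⟩
  · intro x hx
    simp only [ContinuousMap.sub_apply, aff_apply]
    have a2 := t3 k
    rcases lt_or_ge x (t k) with hx1 | hx1
    · rw [h4 k x hx1.le, r5 k _ (by linarith)]; ring
    · have hx2 : L - t k < x := by
        by_contra h
        exact hx ⟨hx1, not_lt.1 h⟩
      rw [h5 k x (by linarith), r4 k _ (by linarith), aff_apply]
      ring_nf
  all_goals
    have lim : Tendsto (fun k => 2 * (K * t k) + 2 * (K' * t k)) atTop (nhds 0) := by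
      simpa using ((tlim.const_mul K).const_mul 2).add ((tlim.const_mul K').const_mul 2)
    refine squeeze_zero (fun k => ip_self_nonneg hL.le _) (fun k => ?_) lim
  · have e : f - E k - aff L (-1) (R k) - f = -(E k + aff L (-1) (R k)) := by abel
    have p := ip_self_nonneg hL.le (E k - aff L (-1) (R k))
    have q : ip L (aff L (-1) (R k)) (aff L (-1) (R k)) = ip L (R k) (R k) := ip_reflect ..
    rw [e]
    simp only [map_neg, map_add, map_sub, LinearMap.neg_apply, LinearMap.add_apply,
      LinearMap.sub_apply, q] at p ⊢
    linarith [h6 k, r6 k]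
  · have e : f2 - E2 k - (-1 : ℝ) • (-1 : ℝ) • aff L (-1) (R2 k) - f2
        = -(E2 k + aff L (-1) (R2 k)) := by simp; abel
    have p := ip_self_nonneg hL.le (E2 k - aff L (-1) (R2 k))
    have q : ip L (aff L (-1) (R2 k)) (aff L (-1) (R2 k)) = ip L (R2 k) (R2 k) := ip_reflect ..
    rw [e]
    simp only [map_neg, map_add, map_sub, LinearMap.neg_apply, LinearMap.add_apply,
      LinearMap.sub_apply, q] at p ⊢
    linarith [h7 k, r7 k]

theorem pd_lincomb {ι : Type*} (s : Finset ι) (c : ι → ℝ) {u : ι → ℝ × ℝ → ℝ}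
    (hu : ∀ i, ContDiff ℝ (⊤ : ℕ∞) (u i)) (v : ℝ × ℝ) :
    pd v (fun q => ∑ i ∈ s, c i * u i q) = fun q => ∑ i ∈ s, c i * pd v (u i) q := by
  funext p
  have h : HasFDerivAt (fun q => ∑ i ∈ s, c i * u i q) (∑ i ∈ s, c i • fderiv ℝ (u i) p) p :=
    HasFDerivAt.fun_sum fun i _ =>
      (((hu i).differentiable (by simp)).differentiableAt.hasFDerivAt).const_mul (c i)
  rw [pd, h.fderiv]
  simp [pd]

theorem lap_lincomb {ι : Type*} (s : Finset ι) (c : ι → ℝ) {u : ι → ℝ × ℝ → ℝ}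
    (hu : ∀ i, ContDiff ℝ (⊤ : ℕ∞) (u i)) :
    lap (fun q => ∑ i ∈ s, c i * u i q) = fun q => ∑ i ∈ s, c i * lap (u i) q := by
  funext p
  unfold lap uxx uyy
  rw [pd_lincomb s c hu, pd_lincomb s c hu, pd_lincomb s c fun i => contDiff_pd (hu i) _,
    pd_lincomb s c fun i => contDiff_pd (hu i) _, ← Finset.sum_add_distrib]
  simp only [mul_add]

theorem Adm.zero (Ω : Set (ℝ × ℝ)) : Adm Ω fun _ => 0 :=
  ⟨contDiff_const, HasCompactSupport.zero, by
    rw [show tsupport (fun _ : ℝ × ℝ => (0 : ℝ)) = ∅ by rw [tsupport_eq_empty_iff]; rfl]; simp⟩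

theorem Adm.add {Ω : Set (ℝ × ℝ)} {u v : ℝ × ℝ → ℝ} (hu : Adm Ω u) (hv : Adm Ω v) :
    Adm Ω (fun q => u q + v q) :=
  ⟨hu.1.add hv.1, hu.2.1.add hv.2.1,
    (tsupport_add u v).trans (Set.union_subset hu.2.2 hv.2.2)⟩

theorem Adm.const_mul {Ω : Set (ℝ × ℝ)} {u : ℝ × ℝ → ℝ} (hu : Adm Ω u) (c : ℝ) :
    Adm Ω (fun q => c * u q) :=
  ⟨contDiff_const.mul hu.1, hu.2.1.mul_left,
    (tsupport_mul_subset_right (f := fun _ => c) (g := u)).trans hu.2.2⟩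

theorem Adm.lincomb {Ω : Set (ℝ × ℝ)} {ι : Type*} (s : Finset ι) (c : ι → ℝ)
    {u : ι → ℝ × ℝ → ℝ} (hu : ∀ i, Adm Ω (u i)) : Adm Ω (fun q => ∑ i ∈ s, c i * u i q) := by
  classical
  induction s using Finset.induction_on with
  | empty => simpa using Adm.zero Ω
  | insert a s ha ih =>
    simp only [Finset.sum_insert ha]
    exact ((hu a).const_mul _).add ih

theorem ap_lincomb {ι : Type*} (s : Finset ι) (c : ι → ℝ) {u : ι → ℝ × ℝ → ℝ}
    (hu : ∀ i, ContDiff ℝ (⊤ : ℕ∞) (u i))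
    (h : ContDiff ℝ (⊤ : ℕ∞) (fun q => ∑ i ∈ s, c i * u i q)) :
    ap _ h = ∑ i ∈ s, c i • ap (u i) (hu i) := by
  refine Prod.ext ?_ ?_
  · rw [Prod.fst_sum]
    ext p
    simp [ap]
  · rw [Prod.snd_sum]
    ext p
    simp [ap, lap_lincomb s c hu]

theorem Adm.tens {L₁ L₂ t t' : ℝ} {f g : C(ℝ, ℝ)} (hf : ContDiff ℝ (⊤ : ℕ∞) f)
    (hg : ContDiff ℝ (⊤ : ℕ∞) g) (ht : 0 < t) (ht' : 0 < t')
    (h : ∀ x, x ∉ Set.Icc t (L₁ - t) → f x = 0) (h' : ∀ x, x ∉ Set.Icc t' (L₂ - t') → g x = 0) :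
    Adm (Set.Ioo 0 L₁ ×ˢ Set.Ioo 0 L₂) (tens f g) := by
  have hz : ∀ p, p ∉ Set.Icc t (L₁ - t) ×ˢ Set.Icc t' (L₂ - t') → _root_.tens f g p = 0 := by
    rintro ⟨x, y⟩ hp
    rw [tens_apply]
    rw [Set.mem_prod, not_and_or] at hp
    rcases hp with hp | hp
    · rw [h x hp, zero_mul]
    · rw [h' y hp, mul_zero]
  refine ⟨(hf.comp contDiff_fst).mul (hg.comp contDiff_snd),
    HasCompactSupport.intro (isCompact_Icc.prod isCompact_Icc) hz, ?_⟩
  have h1 : tsupport (_root_.tens f g) ⊆ Set.Icc t (L₁ - t) ×ˢ Set.Icc t' (L₂ - t') :=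
    closure_minimal (fun p hp => by_contra fun h => hp (hz p h)) (isClosed_Icc.prod isClosed_Icc)
  refine h1.trans (Set.prod_mono ?_ ?_)
  · exact Set.Icc_subset_Ioo ht (by linarith)
  · exact Set.Icc_subset_Ioo ht' (by linarith)

theorem ap_tens {f f1 f2 g g1 g2 : C(ℝ, ℝ)} (hf : Der f f1) (hf1 : Der f1 f2) (hg : Der g g1)
    (hg1 : Der g1 g2) (h : ContDiff ℝ (⊤ : ℕ∞) (tens f g)) : ap (tens f g) h = tp f f2 g g2 := by
  refine Prod.ext rfl (ContinuousMap.ext fun p => ?_)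
  exact congrFun (lap_eq_of_Dx_Dy h (Dx_tens hf g) (Dx_tens hf1 g) (Dy_tens f hg)
    (Dy_tens f hg1)) p

theorem eventually_neg_of_tendsto {K : Type*} [Fintype K] {M : ℕ → K → K → ℝ} {M0 : K → K → ℝ}
    (hM : ∀ i j, Tendsto (fun k => M k i j) atTop (nhds (M0 i j)))
    (h0 : ∀ a : K → ℝ, a ≠ 0 → ∑ i, ∑ j, a i * a j * M0 i j < 0) :
    ∀ᶠ k in atTop, ∀ a : K → ℝ, a ≠ 0 → ∑ i, ∑ j, a i * a j * M k i j < 0 := by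
  rcases isEmpty_or_nonempty K with hK | hK
  · exact Eventually.of_forall fun k a ha => absurd (Subsingleton.elim a 0) ha
  have hne : (Metric.sphere (0 : K → ℝ) 1).Nonempty := NormedSpace.sphere_nonempty.2 zero_le_one
  obtain ⟨b, hb, hmax⟩ := (isCompact_sphere (0 : K → ℝ) 1).exists_isMaxOn hne
    (f := fun a : K → ℝ => ∑ i, ∑ j, a i * a j * M0 i j) (by fun_prop)
  have hb0 : b ≠ 0 := by
    rintro rfl
    simp at hb
  have hneg := h0 b hb0
  set m := ∑ i, ∑ j, b i * b j * M0 i j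
  have hlim : Tendsto (fun k => ∑ i, ∑ j, |M k i j - M0 i j|) atTop (nhds 0) := by
    have : Tendsto (fun k => ∑ i, ∑ j, |M k i j - M0 i j|) atTop
        (nhds (∑ i : K, ∑ j : K, (0 : ℝ))) :=
      tendsto_finsetSum _ fun i _ => tendsto_finsetSum _ fun j _ => by
        simpa using ((hM i j).sub_const (M0 i j)).abs
    simpa using this
  filter_upwards [hlim.eventually (gt_mem_nhds (neg_pos.2 hneg))] with k hk a ha
  have hn : 0 < ‖a‖ := norm_pos_iff.2 ha
  set c := ‖a‖⁻¹ • a with hc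
  have hcs : c ∈ Metric.sphere (0 : K → ℝ) 1 := by
    simp [hc, norm_smul, hn.ne']
  have hc1 : ∀ i, |c i| ≤ 1 := fun i => by
    have := norm_le_pi_norm c i
    rwa [mem_sphere_zero_iff_norm.1 hcs] at this
  have h1 : ∑ i, ∑ j, c i * c j * M0 i j ≤ m := hmax hcs
  have h2 : ∑ i, ∑ j, c i * c j * M k i j - ∑ i, ∑ j, c i * c j * M0 i j
      ≤ ∑ i, ∑ j, |M k i j - M0 i j| := by
    rw [← Finset.sum_sub_distrib]
    refine Finset.sum_le_sum fun i _ => ?_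
    rw [← Finset.sum_sub_distrib]
    refine Finset.sum_le_sum fun j _ => ?_
    rw [← mul_sub]
    refine (le_abs_self _).trans ?_
    rw [abs_mul, abs_mul]
    have := mul_le_mul (hc1 i) (hc1 j) (abs_nonneg _) zero_le_one
    rw [one_mul] at this
    exact mul_le_of_le_one_left (abs_nonneg _) this
  have h3 : ∑ i, ∑ j, a i * a j * M k i j = ‖a‖ ^ 2 * ∑ i, ∑ j, c i * c j * M k i j := by
    rw [Finset.mul_sum]
    refine Finset.sum_congr rfl fun i _ => ?_
    rw [Finset.mul_sum]
    refine Finset.sum_congr rfl fun j _ => ?_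
    simp only [hc, Pi.smul_apply, smul_eq_mul]
    field_simp
  rw [h3]
  exact mul_neg_of_pos_of_neg (by positivity) (by linarith)

/-- Sums of products of clamped functions on which a perturbed energy is negative can be
replaced by admissible functions. -/
theorem exists_adm_of_clamped {L₁ L₂ δ : ℝ} (h₁ : 0 < L₁) (h₂ : 0 < L₂) {K N : Type*} [Fintype K]
    [Fintype N] {F F1 F2 : K → N → C(ℝ, ℝ)} {G G1 G2 : N → C(ℝ, ℝ)}
    (hF : ∀ k n, Der (F k n) (F1 k n)) (hF1 : ∀ k n, Der (F1 k n) (F2 k n))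
    (hFs : ∀ k n, ContDiff ℝ (⊤ : ℕ∞) (F k n))
    (hFc : ∀ k n, F k n 0 = 0 ∧ F1 k n 0 = 0 ∧ F k n L₁ = 0 ∧ F1 k n L₁ = 0)
    (hG : ∀ n, Der (G n) (G1 n)) (hG1 : ∀ n, Der (G1 n) (G2 n))
    (hGs : ∀ n, ContDiff ℝ (⊤ : ℕ∞) (G n))
    (hGc : ∀ n, G n 0 = 0 ∧ G1 n 0 = 0 ∧ G n L₂ = 0 ∧ G1 n L₂ = 0)
    (p : K → C(ℝ × ℝ, ℝ) × C(ℝ × ℝ, ℝ)) (hp : ∀ k, p k = ∑ n, tp (F k n) (F2 k n) (G n) (G2 n))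
    (hneg : ∀ a : K → ℝ, a ≠ 0 →
      qf L₁ L₂ (comb p a) (comb p a) - δ * ip2 L₁ L₂ (comb p a).1 (comb p a).1 < 0) :
    ∃ (ψ : K → ℝ × ℝ → ℝ) (hψ : ∀ i, Adm (Set.Ioo 0 L₁ ×ˢ Set.Ioo 0 L₂) (ψ i)),
      ∀ a : K → ℝ, a ≠ 0 →
      qf L₁ L₂ (comb (fun i => ap (ψ i) (hψ i).1) a) (comb (fun i => ap (ψ i) (hψ i).1) a)
        - δ * ip2 L₁ L₂ (comb (fun i => ap (ψ i) (hψ i).1) a).1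
          (comb (fun i => ap (ψ i) (hψ i).1) a).1 < 0 := by
  choose f f1 f2 hf lf lf2 using fun k n => exists_clamped_approx h₁ (hF k n) (hF1 k n) (hFs k n)
    (hFc k n).1 (hFc k n).2.1 (hFc k n).2.2.1 (hFc k n).2.2.2
  choose g g1 g2 hg lg lg2 using fun n => exists_clamped_approx h₂ (hG n) (hG1 n) (hGs n)
    (hGc n).1 (hGc n).2.1 (hGc n).2.2.1 (hGc n).2.2.2
  have hadm : ∀ t k n, Adm (Set.Ioo 0 L₁ ×ˢ Set.Ioo 0 L₂) (tens (f k n t) (g n t)) := by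
    intro t k n
    obtain ⟨-, -, hs, r, hr, hz⟩ := hf k n t
    obtain ⟨-, -, hs', r', hr', hz'⟩ := hg n t
    exact Adm.tens hs hs' hr hr' hz hz'
  set P : ℕ → K → C(ℝ × ℝ, ℝ) × C(ℝ × ℝ, ℝ) :=
    fun t k => ∑ n, tp (f k n t) (f2 k n t) (g n t) (g2 n t) with hP
  let B : (C(ℝ × ℝ, ℝ) × C(ℝ × ℝ, ℝ)) →ₗ[ℝ] (C(ℝ × ℝ, ℝ) × C(ℝ × ℝ, ℝ)) →ₗ[ℝ] ℝ :=
    qf L₁ L₂ - δ • (ip2 L₁ L₂).compl₁₂ (LinearMap.fst ℝ _ _) (LinearMap.fst ℝ _ _)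
  have hB : ∀ p q, B p q = qf L₁ L₂ p q - δ * ip2 L₁ L₂ p.1 q.1 := fun p q => rfl
  have hBt : ∀ a b c d a' b' c' d', B (tp a b c d) (tp a' b' c' d')
      = ip L₁ b b' * ip L₂ c c' + ip L₁ b a' * ip L₂ c d' + ip L₁ a b' * ip L₂ d c'
        + ip L₁ a a' * ip L₂ d d' - (1 + δ) * (ip L₁ a a' * ip L₂ c c') := by
    intros
    rw [hB, qf_apply]
    simp only [tp, map_add, LinearMap.add_apply, ip2_tens h₁.le h₂.le]
    ring
  have hlim : ∀ i j, Tendsto (fun t => B (P t i) (P t j)) atTop (nhds (B (p i) (p j))) := by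
    intro i j
    simp only [hp, hP, map_sum, LinearMap.sum_apply, hBt]
    refine tendsto_finsetSum _ fun n _ => tendsto_finsetSum _ fun m _ => ?_
    have l₁ := h₁.le
    have l₂ := h₂.le
    exact ((((((lf2 _ _).ip l₁ (lf2 _ _)).mul ((lg _).ip l₂ (lg _))).add
      (((lf2 _ _).ip l₁ (lf _ _)).mul ((lg _).ip l₂ (lg2 _)))).add
      (((lf _ _).ip l₁ (lf2 _ _)).mul ((lg2 _).ip l₂ (lg _)))).add
      (((lf _ _).ip l₁ (lf _ _)).mul ((lg2 _).ip l₂ (lg2 _)))).sub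
      ((((lf _ _).ip l₁ (lf _ _)).mul ((lg _).ip l₂ (lg _))).const_mul _)
  obtain ⟨t, ht⟩ := (eventually_neg_of_tendsto hlim fun a ha => by
    rw [← bilin_sum_sum, ← comb_apply, hB]
    exact hneg a ha).exists
  refine ⟨fun k q => ∑ n, 1 * tens (f k n t) (g n t) q,
    fun k => Adm.lincomb Finset.univ _ fun n => hadm t k n, fun a ha => ?_⟩
  have e : (fun k => ap _ (Adm.lincomb Finset.univ (fun _ => 1) fun n => hadm t k n).1) = P t := by
    funext k
    rw [ap_lincomb _ _ fun n => (hadm t k n).1]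
    refine Finset.sum_congr rfl fun n _ => ?_
    rw [one_smul, ap_tens (hf k n t).1 (hf k n t).2.1 (hg n t).1 (hg n t).2.1]
  rw [e, ← hB, comb_apply, bilin_sum_sum]
  exact ht a ha

/-- The derivative of `sn`. -/
def cn (L : ℝ) (m : ℕ) : C(ℝ, ℝ) := ⟨fun x => fr L m * cos (fr L m * x), by fun_prop⟩

theorem sn_smooth (L : ℝ) (m : ℕ) : ContDiff ℝ (⊤ : ℕ∞) (sn L m) :=
  (contDiff_const.mul contDiff_id).sin

theorem comb_comp_der {ι : Type*} [Fintype ι] {f f' : ι → C(ℝ, ℝ)} (h : ∀ i, Der (f i) (f' i))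
    (c : ι → ℝ) : Der (comb f c) (comb f' c) := by
  rw [comb_apply, comb_apply]
  exact Der.sum _ fun i _ => (h i).smul _

theorem comb_smooth {ι : Type*} [Fintype ι] {f : ι → C(ℝ, ℝ)}
    (h : ∀ i, ContDiff ℝ (⊤ : ℕ∞) (f i)) (c : ι → ℝ) : ContDiff ℝ (⊤ : ℕ∞) (comb f c) := by
  rw [comb_apply, ContinuousMap.coe_sum, Finset.sum_fn]
  exact ContDiff.sum fun i _ => contDiff_const.mul (h i)

/-- Negativity of the energy on sine polynomials in the first variable with coefficients in the
span of clamped modes of larger complementary frequency. -/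
theorem qf_sine_neg {L₁ L₂ : ℝ} {N : Type*} [Fintype N] (h₁ : 0 < L₁) (h₂ : 0 < L₂)
    (Y : YFam L₂ N) (S : Finset (ℕ × N)) (hS : ∀ q ∈ S, 0 < q.1 ∧ fr L₁ q.1 ^ 2 < Y.τ q.2)
    (c : S → ℝ) (hc : c ≠ 0)
    (V : S → C(ℝ × ℝ, ℝ) × C(ℝ × ℝ, ℝ))
    (hV : ∀ q : S, V q = tp (sn L₁ q.1.1) (-fr L₁ q.1.1 ^ 2 • sn L₁ q.1.1) (Y.y q.1.2)
      (Y.P q.1.2).g2) :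
    qf L₁ L₂ (comb V c) (comb V c) < 0 := by
  classical
  set V' : ℕ × N → C(ℝ × ℝ, ℝ) × C(ℝ × ℝ, ℝ) := fun q =>
    tp (sn L₁ q.1) (-fr L₁ q.1 ^ 2 • sn L₁ q.1) (Y.y q.2) (Y.P q.2).g2 with hV'
  set c' : ℕ → N → ℝ := fun m n => if h : (m, n) ∈ S then c ⟨(m, n), h⟩ else 0 with hc'
  have hcz : ∀ m n, (m, n) ∉ S → c' m n = 0 := fun m n h => by simp [hc', h]
  set Ms := S.image Prod.fst
  set U : ℕ → C(ℝ × ℝ, ℝ) × C(ℝ × ℝ, ℝ) := fun m => ∑ n, c' m n • V' (m, n) with hU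
  have e : comb V c = ∑ m ∈ Ms, (1 : ℝ) • U m := by
    simp only [hU, one_smul]
    rw [← Finset.sum_product' Ms Finset.univ (fun m n => c' m n • V' (m, n)), comb_apply]
    have : ∑ q : S, c q • V q = ∑ q ∈ S, c' q.1 q.2 • V' q := by
      rw [← Finset.sum_coe_sort S]
      refine Finset.sum_congr rfl fun q _ => ?_
      rw [hV]
      simp [hc', hV']
    rw [this]
    refine Finset.sum_subset (fun q hq => ?_) fun q _ hq => ?_
    · exact Finset.mem_product.2 ⟨Finset.mem_image_of_mem _ hq, Finset.mem_univ _⟩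
    · rw [hcz _ _ hq, zero_smul]
  have hoff : ∀ m m', m ≠ m' → qf L₁ L₂ (U m) (U m') = 0 := by
    intro m m' h
    rw [hU, bilin_sum_sum]
    refine Finset.sum_eq_zero fun i _ => Finset.sum_eq_zero fun j _ => ?_
    rw [qf_apply]
    simp [hV', tp, ip2_tens h₁.le h₂.le, ip_sn_sn h₁ h]
  have hdiag : ∀ m, qf L₁ L₂ (U m) (U m) = ip L₁ (sn L₁ m) (sn L₁ m) *
      (ip L₂ (∑ n, c' m n • ((Y.P n).g2 - fr L₁ m ^ 2 • Y.y n))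
          (∑ n, c' m n • ((Y.P n).g2 - fr L₁ m ^ 2 • Y.y n))
        - ip L₂ (∑ n, c' m n • Y.y n) (∑ n, c' m n • Y.y n)) := by
    intro m
    rw [hU, bilin_sum_sum, bilin_sum_sum, bilin_sum_sum, mul_sub, Finset.mul_sum, Finset.mul_sum,
      ← Finset.sum_sub_distrib]
    refine Finset.sum_congr rfl fun i _ => ?_
    rw [Finset.mul_sum, Finset.mul_sum, ← Finset.sum_sub_distrib]
    refine Finset.sum_congr rfl fun j _ => ?_
    rw [qf_apply]
    simp only [hV', tp, map_add, LinearMap.add_apply, ip2_tens h₁.le h₂.le, map_smul, map_sub,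
      LinearMap.sub_apply, LinearMap.smul_apply, smul_eq_mul]
    ring
  have hneg : ∀ m ∈ Ms, c' m ≠ 0 → qf L₁ L₂ (U m) (U m) < 0 := by
    intro m hm h
    rw [hdiag]
    obtain ⟨q, hq, rfl⟩ := Finset.mem_image.1 hm
    refine mul_neg_of_pos_of_neg (ip_sn_self_pos h₁ (hS q hq).1) (Y.energy_neg h₂ _ _ ?_ h)
    intro n hn
    by_contra h'
    exact hn (hcz _ _ fun hmem => h' (hS _ hmem).2)
  have hnp : ∀ m ∈ Ms, qf L₁ L₂ (U m) (U m) ≤ 0 := by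
    intro m hm
    by_cases h : c' m = 0
    · simp [hU, h]
    · exact (hneg m hm h).le
  have hsum : qf L₁ L₂ (comb V c) (comb V c) = ∑ m ∈ Ms, qf L₁ L₂ (U m) (U m) := by
    rw [e, bilin_sum_sum]
    refine Finset.sum_congr rfl fun m hm => ?_
    rw [Finset.sum_eq_single_of_mem m hm fun m' _ h => by rw [hoff m m' h.symm, mul_zero]]
    ring
  rw [hsum]
  obtain ⟨q, hq⟩ := Function.ne_iff.1 hc
  have hqm : q.1.1 ∈ Ms := Finset.mem_image_of_mem _ q.2
  refine Finset.sum_neg' hnp ⟨q.1.1, hqm, hneg _ hqm ?_⟩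
  refine Function.ne_iff.2 ⟨q.1.2, ?_⟩
  simpa [hc'] using hq

theorem sum_tens_comb_ite {ι N : Type*} [Fintype ι] [Fintype N] [DecidableEq N] (ν : ι → N)
    (f : ι → C(ℝ, ℝ)) (g : N → C(ℝ, ℝ)) (c : ι → ℝ) :
    ∑ n, tens (comb (fun i => if ν i = n then f i else 0) c) (g n)
      = ∑ i, c i • tens (f i) (g (ν i)) := by
  simp only [comb_apply, map_sum, LinearMap.sum_apply]
  rw [Finset.sum_comm]
  refine Finset.sum_congr rfl fun i _ => ?_
  rw [Finset.sum_eq_single (ν i)]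
  · simp
  · intro n _ hn
    simp [hn.symm]
  · simp

theorem der_ite {p : Prop} [Decidable p] {f f' : C(ℝ, ℝ)} (h : Der f f') :
    Der (if p then f else 0) (if p then f' else 0) := by
  split_ifs
  · exact h
  · exact fun x => hasDerivAt_const x (0 : ℝ)

theorem smooth_ite {p : Prop} [Decidable p] {f : C(ℝ, ℝ)} (h : ContDiff ℝ (⊤ : ℕ∞) f) :
    ContDiff ℝ (⊤ : ℕ∞) (if p then f else 0 : C(ℝ, ℝ)) := by
  split_ifs
  · exact h
  · exact contDiff_const

set_option maxHeartbeats 1000000 in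
theorem lower_core {L₁ L₂ Δ M δ C₀ ε : ℝ} {W N : Type*} [Fintype W] [Fintype N]
    [DecidableEq W] {Y : YFam L₂ N} {Z : XFam Y L₁ W} (R : Z.Rep Δ)
    (hE : blockError L₁ L₂ Δ M δ C₀ ε (Fintype.card W))
    (S : Finset (ℕ × N)) (hS : ∀ q ∈ S, 0 < q.1 ∧ fr L₁ q.1 ^ 2 < Y.τ q.2)
    (hC₀ : ∀ i, C₀ ≤ (Y.P (Z.n i)).C) (hC₀' : 0 ≤ C₀) (hε : 0 ≤ ε)
    (hsW : ∀ i, ε ≤ (Z.X i).s)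
    (hM : ∀ i, ip L₂ (Y.y (Z.n i)) (Y.y (Z.n i)) ≤ M ^ 2) :
    ∃ (K : ℕ) (ψ : Fin K → ℝ × ℝ → ℝ) (hψ : ∀ i, Adm (Set.Ioo 0 L₁ ×ˢ Set.Ioo 0 L₂) (ψ i)),
      (∀ a : Fin K → ℝ, a ≠ 0 →
        qf L₁ L₂ (comb (fun i => ap (ψ i) (hψ i).1) a) (comb (fun i => ap (ψ i) (hψ i).1) a)
        - δ * ip2 L₁ L₂ (comb (fun i => ap (ψ i) (hψ i).1) a).1
          (comb (fun i => ap (ψ i) (hψ i).1) a).1 < 0) ∧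
      S.card + Fintype.card W ≤ K + 2 * Fintype.card N + (Finset.univ.image R.r).card := by
  classical
  obtain ⟨hE, hδ, hM0, h₁, h₂⟩ := hE
  let A : N → ((S → ℝ) × (W → ℝ)) →ₗ[ℝ] C(ℝ, ℝ) := fun n =>
    (comb fun q : S => if q.1.2 = n then sn L₁ q.1.1 else 0) ∘ₗ LinearMap.fst ℝ _ _
      - (comb fun i => if Z.n i = n then (Z.X i).g else 0) ∘ₗ LinearMap.snd ℝ _ _
  let A1 : N → ((S → ℝ) × (W → ℝ)) →ₗ[ℝ] C(ℝ, ℝ) := fun n =>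
    (comb fun q : S => if q.1.2 = n then cn L₁ q.1.1 else 0) ∘ₗ LinearMap.fst ℝ _ _
      - (comb fun i => if Z.n i = n then (Z.X i).g1 else 0) ∘ₗ LinearMap.snd ℝ _ _
  let A2 : N → ((S → ℝ) × (W → ℝ)) →ₗ[ℝ] C(ℝ, ℝ) := fun n =>
    (comb fun q : S => if q.1.2 = n then -fr L₁ q.1.1 ^ 2 • sn L₁ q.1.1 else 0)
        ∘ₗ LinearMap.fst ℝ _ _
      - (comb fun i => if Z.n i = n then (Z.X i).g2 else 0) ∘ₗ LinearMap.snd ℝ _ _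
  have dA : ∀ n x, Der (A n x) (A1 n x) := fun n x =>
    (comb_comp_der (fun q : S => der_ite (Der_sn L₁ q.1.1)) x.1).sub
      (comb_comp_der (fun i => der_ite (Z.X i).der_g) x.2)
  have dA1 : ∀ n x, Der (A1 n x) (A2 n x) := fun n x =>
    (comb_comp_der (fun q : S => der_ite (Der_sn1 L₁ q.1.1)) x.1).sub
      (comb_comp_der (fun i => der_ite (Z.X i).der_g1) x.2)
  have sA : ∀ n x, ContDiff ℝ (⊤ : ℕ∞) (A n x) := fun n x =>
    (comb_smooth (fun q : S => smooth_ite (sn_smooth L₁ q.1.1)) x.1).sub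
      (comb_smooth (fun i => smooth_ite (Z.X i).g_smooth) x.2)
  have vA : ∀ z, (∀ m, sn L₁ m z = 0) → (∀ i, (Z.X i).g z = 0) → ∀ n x, A n x z = 0 := by
    intro z hz hz' n x
    have : A n x z = comb (fun q : S => if q.1.2 = n then sn L₁ q.1.1 else 0) x.1 z
      - comb (fun i => if Z.n i = n then (Z.X i).g else 0) x.2 z := rfl
    rw [this, comb_apply, comb_apply, ContinuousMap.sum_apply, ContinuousMap.sum_apply,
      Finset.sum_eq_zero, Finset.sum_eq_zero, sub_zero]
    · intro i _
      split_ifs <;> simp [hz']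
    · intro q _
      split_ifs
      · rw [ContinuousMap.smul_apply, hz, smul_zero]
      · simp
  let ev : ℝ → C(ℝ, ℝ) →ₗ[ℝ] ℝ := fun z =>
    { toFun := fun f => f z, map_add' := fun _ _ => rfl, map_smul' := fun _ _ => rfl }
  let T : ((S → ℝ) × (W → ℝ)) →ₗ[ℝ]
      ((N → ℝ) × (N → ℝ)) × (Finset.univ.image R.r → ℝ) :=
    ((LinearMap.pi fun n => ev 0 ∘ₗ A1 n).prod (LinearMap.pi fun n => ev L₁ ∘ₗ A1 n)).prod
      ((LinearMap.pi fun j : Finset.univ.image R.r =>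
          ∑ i with R.r i = j.1, LinearMap.proj i) ∘ₗ LinearMap.snd ℝ _ _)
  have hT0 : ∀ x ∈ LinearMap.ker T, ∀ n, A1 n x 0 = 0 := fun x hx n =>
    congrFun (congrArg (fun y => y.1.1) (LinearMap.mem_ker.1 hx)) n
  have hTL : ∀ x ∈ LinearMap.ker T, ∀ n, A1 n x L₁ = 0 := fun x hx n =>
    congrFun (congrArg (fun y => y.1.2) (LinearMap.mem_ker.1 hx)) n
  have hTR : ∀ x ∈ LinearMap.ker T, ∀ j, ∑ i with R.r i = j, x.2 i = 0 := by
    intro x hx j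
    by_cases hj : j ∈ Finset.univ.image R.r
    · have := congrFun (congrArg Prod.snd (LinearMap.mem_ker.1 hx)) ⟨j, hj⟩
      simpa [T] using this
    · rw [Finset.sum_filter]
      refine Finset.sum_eq_zero fun i _ => if_neg fun h => hj ?_
      exact Finset.mem_image.2 ⟨i, Finset.mem_univ _, h⟩
  set V : S → C(ℝ × ℝ, ℝ) × C(ℝ × ℝ, ℝ) := fun q =>
    tp (sn L₁ q.1.1) (-fr L₁ q.1.1 ^ 2 • sn L₁ q.1.1) (Y.y q.1.2) (Y.P q.1.2).g2
  set w : W → C(ℝ × ℝ, ℝ) × C(ℝ × ℝ, ℝ) := fun i => (Z.w i, Z.lw i)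
  let U : ((S → ℝ) × (W → ℝ)) →ₗ[ℝ] C(ℝ × ℝ, ℝ) × C(ℝ × ℝ, ℝ) :=
    comb V ∘ₗ LinearMap.fst ℝ _ _ - comb w ∘ₗ LinearMap.snd ℝ _ _
  have hU0 : ∀ x, U x = comb V x.1 - comb w x.2 := fun x => rfl
  have hUA : ∀ x, U x = ∑ n, tp (A n x) (A2 n x) (Y.y n) (Y.P n).g2 := by
    intro x
    have eA : ∀ n, A n x = comb (fun q : S => if q.1.2 = n then sn L₁ q.1.1 else 0) x.1
      - comb (fun i => if Z.n i = n then (Z.X i).g else 0) x.2 := fun n => rfl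
    have eA2 : ∀ n, A2 n x
      = comb (fun q : S => if q.1.2 = n then -fr L₁ q.1.1 ^ 2 • sn L₁ q.1.1 else 0) x.1
      - comb (fun i => if Z.n i = n then (Z.X i).g2 else 0) x.2 := fun n => rfl
    rw [hU0]
    refine Prod.ext ?_ ?_
    · rw [Prod.fst_sub, Prod.fst_sum]
      simp only [tp, eA, map_sub, LinearMap.sub_apply, Finset.sum_sub_distrib,
        sum_tens_comb_ite, comb_apply V, comb_apply w, Prod.fst_sum]
      rfl
    · rw [Prod.snd_sub, Prod.snd_sum]
      simp only [tp, eA, eA2, map_sub, LinearMap.sub_apply, Finset.sum_sub_distrib,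
        Finset.sum_add_distrib, sum_tens_comb_ite, comb_apply V, comb_apply w, Prod.snd_sum]
      rw [sub_add_sub_comm, ← Finset.sum_add_distrib, ← Finset.sum_add_distrib]
      simp only [← smul_add]
      rfl
  have key : ∀ x ∈ LinearMap.ker T, x ≠ 0 →
      qf L₁ L₂ (U x) (U x) - δ * ip2 L₁ L₂ (U x).1 (U x).1 < 0 := by
    intro x hx hx0
    have hcl : U x ∈ clamped L₁ L₂ := by
      rw [hUA]
      refine Submodule.sum_mem _ fun n _ => ?_
      exact tp_mem_clamped h₁ h₂ (dA n x) (dA1 n x) (Y.P n).der_g (Y.P n).der_g1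
        (vA 0 (fun m => sn_zero_left _ _) (fun i => (Z.X i).g_zero) n x)
        (vA L₁ (fun m => sn_right h₁.ne' _) (fun i => (Z.X i).g_L) n x)
        (Y.P n).g_zero (Y.P n).g_L (hT0 x hx n) (hTL x hx n)
        (by rw [Prof.g1_zero, Y.hs]) (by rw [Prof.g1_L, Y.hs, mul_zero])
    set Sr := ∑ i, x.2 i • Z.res i with hSr
    have q1 : qf L₁ L₂ (U x) (comb w x.2) = ip2 L₁ L₂ (U x).1 Sr := by
      rw [comb_apply, hSr, map_sum, map_sum]
      refine Finset.sum_congr rfl fun i _ => ?_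
      rw [map_smul, map_smul, qf_w Z hcl]
    have q33 : qf L₁ L₂ (comb w x.2) (comb w x.2)
        = (∑ i, 2 * (Y.P (Z.n i)).C * (Z.X i).s * x.2 i ^ 2)
          + 4 * ∑ i, ∑ j, x.2 i * x.2 j * Z.a i j := by
      rw [← Z.energy_eq h₁.le h₂.le, qf_apply, comb_apply, Prod.fst_sum, Prod.snd_sum]; rfl
    have hsplit : qf L₁ L₂ (U x) (U x) = qf L₁ L₂ (comb V x.1) (comb V x.1)
        - 2 * ip2 L₁ L₂ (U x).1 Sr - qf L₁ L₂ (comb w x.2) (comb w x.2) := by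
      have : comb V x.1 = U x + comb w x.2 := by rw [hU0]; abel
      rw [this]
      simp only [map_add, LinearMap.add_apply, q1, qf_comm L₁ L₂ (comb w x.2) (U x)]
      ring
    have b1 := two_ip2_le L₁ L₂ hδ (U x).1 (-Sr)
    have b2 := XFam.norm_res_le h₁.le h₂.le R x.2 (hTR x hx)
    have b3 := (abs_le.1 (XFam.abs_sum_a_le h₁.le h₂.le hM0 R hM x.2 (hTR x hx))).1
    have b4 : (2 * C₀ * ε) * ∑ i, x.2 i ^ 2
        ≤ ∑ i, 2 * (Y.P (Z.n i)).C * (Z.X i).s * x.2 i ^ 2 := by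
      rw [Finset.mul_sum]
      refine Finset.sum_le_sum fun i _ => ?_
      have := mul_le_mul (hC₀ i) (hsW i) hε (hC₀'.trans (hC₀ i))
      have h3 := mul_le_mul_of_nonneg_right this (sq_nonneg (x.2 i))
      linarith
    have b5 : ip2 L₁ L₂ Sr Sr / δ ≤ 9216 * Δ ^ 2 * Fintype.card W / δ * ∑ i, x.2 i ^ 2 := by
      rw [div_mul_eq_mul_div]
      gcongr
      linarith
    have hc2 : 0 ≤ ∑ i, x.2 i ^ 2 := Finset.sum_nonneg fun i _ => sq_nonneg _
    have n2 : ip2 L₁ L₂ (-Sr) (-Sr) = ip2 L₁ L₂ Sr Sr := by simp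
    have n1 : ip2 L₁ L₂ (U x).1 (-Sr) = -ip2 L₁ L₂ (U x).1 Sr := by simp
    rw [n2, n1] at b1
    rw [hsplit]
    by_cases hd : x.2 = 0
    · have hc : x.1 ≠ 0 := fun h => hx0 (Prod.ext h hd)
      have := qf_sine_neg h₁ h₂ Y S hS x.1 hc V fun q => rfl
      have := mul_nonpos_of_nonpos_of_nonneg (sub_nonpos.2 hE.le) hc2
      linarith
    · have h6 : 0 < ∑ i, x.2 i ^ 2 := by
        obtain ⟨i, hi⟩ := Function.ne_iff.1 hd
        refine Finset.sum_pos' (fun i _ => sq_nonneg _) ⟨i, Finset.mem_univ _, ?_⟩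
        have : x.2 i ≠ 0 := hi
        positivity
      have h7 := mul_neg_of_neg_of_pos (sub_neg.2 hE) h6
      have h8 : qf L₁ L₂ (comb V x.1) (comb V x.1) ≤ 0 := by
        by_cases hc : x.1 = 0
        · simp [hc]
        · exact (qf_sine_neg h₁ h₂ Y S hS x.1 hc V fun q => rfl).le
      linarith
  let b := Module.finBasis ℝ (LinearMap.ker T)
  have hcomb : ∀ a, comb (fun k => U (b k).1) a = U (comb b a).1 := by
    intro a
    rw [comb_apply, comb_apply, Submodule.coe_sum, map_sum]
    simp
  obtain ⟨ψ, hψ, hneg⟩ := exists_adm_of_clamped (δ := δ) h₁ h₂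
    (F := fun k n => A n (b k).1) (F1 := fun k n => A1 n (b k).1) (F2 := fun k n => A2 n (b k).1)
    (G := Y.y) (G1 := fun n => (Y.P n).g1) (G2 := fun n => (Y.P n).g2)
    (fun k n => dA n _) (fun k n => dA1 n _) (fun k n => sA n _)
    (fun k n => ⟨vA 0 (fun m => sn_zero_left _ _) (fun i => (Z.X i).g_zero) n _,
      hT0 _ (b k).2 n, vA L₁ (fun m => sn_right h₁.ne' _) (fun i => (Z.X i).g_L) n _,
      hTL _ (b k).2 n⟩)
    (fun n => (Y.P n).der_g) (fun n => (Y.P n).der_g1) (fun n => (Y.P n).g_smooth)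
    (fun n => ⟨(Y.P n).g_zero, by rw [Prof.g1_zero, Y.hs], (Y.P n).g_L,
      by rw [Prof.g1_L, Y.hs, mul_zero]⟩)
    (fun k => U (b k).1) (fun k => hUA _) (fun a ha => by
      rw [hcomb]
      refine key _ (comb b a).2 fun h0 => ha ?_
      have h1 : comb b a = 0 := Subtype.ext h0
      rw [comb_apply] at h1
      exact funext (Fintype.linearIndependent_iff.1 b.linearIndependent a h1))
  refine ⟨_, ψ, hψ, hneg, ?_⟩
  have hrank := LinearMap.finrank_range_add_finrank_ker T
  have hr2 := Submodule.finrank_le (LinearMap.range T)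
  simp only [Module.finrank_prod, Module.finrank_fintype_fun_eq_card, Fintype.card_coe] at hrank hr2
  omega

namespace Prof

variable {L k σ : ℝ}

theorem e1_nonpos (P : Prof L k σ) (hL : 0 ≤ L) (hσ : σ ^ 2 = 1) (hk : k ^ 2 ≤ 1) :
    P.e1 0 ≤ 0 := by
  have h := ip_parts (L := L) P.he1 P.he
  have h1 := ip_self_nonneg hL P.e
  have h2 := ip_self_nonneg hL P.e1
  simp only [map_smul, LinearMap.smul_apply, smul_eq_mul, P.e1L, P.eL, P.e0] at h
  nlinarith

theorem norm_g_eq (P : Prof L k σ) (hσ : σ ^ 2 = 1) (h : P.s = 0) :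
    ip L P.g P.g = ip L P.c P.c + ip L P.e P.e := by
  have h1 := P.ip_e_g_self hσ
  have h2 : P.c = P.g + P.e := by simp [g]
  rw [h2]
  simp only [map_add, LinearMap.add_apply, ip_comm L P.g P.e]
  rw [h] at h1
  linarith

theorem norm_g_le {γ : ℝ} (P : Prof L k σ) (hL : 1 ≤ L) (hσ : σ ^ 2 = 1) (hk : k ^ 2 ≤ 1)
    (h : P.s = 0) (hγ : 0 < γ) (hγk : γ ≤ k) : ip L P.g P.g ≤ (4 / γ * √L) ^ 2 := by
  have h1 := P.norm_c hσ
  have h2 := P.norm_e (by linarith) hσ hk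
  have h3 := P.e1_nonpos (by linarith) hσ hk
  have h4 := P.e1_lb
  have h5 : P.c1 0 = P.e1 0 := by unfold s at h; linarith
  rw [P.norm_g_eq hσ h, mul_pow, sq_sqrt (by linarith), div_pow, div_mul_eq_mul_div,
    le_div_iff₀ (by positivity)]
  have h6 : P.c1 0 ^ 2 ≤ 9 := by rw [h5]; nlinarith
  have h7 : γ ^ 2 ≤ k ^ 2 := by gcongr
  have h8 := ip_self_nonneg (by linarith : (0 : ℝ) ≤ L) P.c
  nlinarith

theorem le_C {γ : ℝ} (P : Prof L k σ) (hL : 0 < L) (hσ : σ ^ 2 = 1) (hk : k ^ 2 ≤ 1)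
    (h : P.s = 0) (hγ : 0 < γ) (hγk : γ ≤ k) (hLγ : 1 / γ ^ 2 ≤ L ^ 2 / 4) (hL2 : 50 ≤ L) :
    L / 5 ≤ P.C := by
  have h1 := P.norm_c hσ
  have h2 := P.norm_e (by linarith) hσ hk
  have h7 : γ ^ 2 ≤ k ^ 2 := by gcongr
  have h8 : 1 ≤ L ^ 2 / 4 * γ ^ 2 := by rwa [div_le_iff₀ (by positivity)] at hLγ
  have h10 : L * (2 * k ^ 2 * ip L P.c P.c) ≥ L * (2 * k ^ 2 * (3 / 8 * L)) := by
    rw [h1]; nlinarith [sq_nonneg (L * P.c1 0 + 1), mul_pos hL hL]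
  have hk0 : 0 < k ^ 2 := lt_of_lt_of_le (by positivity) h7
  have h11 : 3 / 8 * L ≤ ip L P.c P.c := by
    have := le_of_mul_le_mul_left h10 hL
    exact le_of_mul_le_mul_left this (by positivity)
  unfold C
  rw [P.norm_g_eq hσ h]
  linarith

end Prof

theorem continuousOn_bslope {L : ℝ} (hL : 0 < L) (j : ℕ) {s : Set ℝ}
    (hs : ∀ k ∈ s, j * π / L < k ∧ k ≤ (j + 1) * π / L ∧ k ≤ 1) :
    ContinuousOn (bslope L j) s := by
  have h1 : ∀ k ∈ s, sin (k * L / 2 - j * (π / 2)) ≠ 0 := by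
    intro k hk
    obtain ⟨h1, h2, -⟩ := hs k hk
    rw [div_lt_iff₀ hL] at h1
    rw [le_div_iff₀ hL] at h2
    exact (sin_pos_of_pos_of_lt_pi (by linarith) (by linarith [pi_pos])).ne'
  have h2 : ∀ k ∈ s, sinh (√(2 - k ^ 2) * L / 2) ≠ 0 := by
    intro k hk
    obtain ⟨h1, h2, h3⟩ := hs k hk
    have h0 : 0 ≤ j * π / L := by positivity
    have : 0 < √(2 - k ^ 2) := sqrt_pos.2 (by nlinarith)
    exact (sinh_pos_iff.2 (by positivity)).ne'
  unfold bslope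
  refine ContinuousOn.add ?_ ?_
  · exact (by fun_prop : Continuous fun k : ℝ => -k).continuousOn.mul
      (ContinuousOn.div (by fun_prop) (by fun_prop) h1)
  · refine (by fun_prop : Continuous fun k : ℝ => √(2 - k ^ 2)).continuousOn.mul ?_
    split_ifs
    · exact ContinuousOn.div (continuous_cosh.comp (by fun_prop)).continuousOn
        (continuous_sinh.comp (by fun_prop)).continuousOn h2
    · exact ContinuousOn.div (continuous_sinh.comp (by fun_prop)).continuousOn
        (continuous_cosh.comp (by fun_prop)).continuousOn fun k _ => (cosh_pos _).ne'

theorem le_theta {k : ℝ} (hk0 : 0 ≤ k) (hk : k ≤ 1) : √2 / π * k ≤ theta k := by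
  have h2 : (√2) ^ 2 = 2 := sq_sqrt (by norm_num)
  have h : k / √2 ≤ arcsin (k / √2) := by
    conv_lhs => rw [← sin_arcsin (x := k / √2) (by linarith [show 0 ≤ k / √2 by positivity])
      (by rw [div_le_one (by positivity)]; nlinarith [one_le_sqrt.2 (show (1 : ℝ) ≤ 2 by norm_num)])]
    exact sin_le (arcsin_nonneg.2 (by positivity))
  unfold theta
  calc √2 / π * k = 2 / π * (k / √2) := by
        have : (√2) ≠ 0 := by positivity
        field_simp; rw [h2]; ring
    _ ≤ _ := by gcongr

theorem bslope_neg_near {L k : ℝ} (hL : 4 ≤ L) (hk : k ≤ 1) (j : ℕ) (hj : 1 ≤ j) (f : ℝ)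
    (hf : k * L / π = j + f) (hf0 : 0 < f) (hf1 : f ≤ 1 / (4 * L)) : bslope L j k < 0 := by
  have hπ := pi_pos
  have hj' : (1 : ℝ) ≤ j := by exact_mod_cast hj
  have hk0 : π / L ≤ k := by
    rw [div_eq_iff hπ.ne'] at hf
    rw [div_le_iff₀ (by linarith)]
    nlinarith
  have hk00 : 0 ≤ k := le_trans (by positivity) hk0
  have hs2 : 1.4 ≤ √2 := le_sqrt_of_sq_le (by norm_num)
  have hθ : 1.4 / L ≤ theta k := by
    refine le_trans ?_ (le_theta hk00 hk)
    calc 1.4 / L ≤ √2 / L := by gcongr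
      _ = √2 / π * (π / L) := by field_simp
      _ ≤ _ := by gcongr
  have hf1' : f ≤ 1 / 4 * (1 / L) := by rw [show 1 / 4 * (1 / L) = 1 / (4 * L) by field_simp]; exact hf1
  have hL1 : 1 / L ≤ 1 / 4 := by gcongr
  rw [show 1.4 / L = 1.4 * (1 / L) by ring] at hθ
  have h1 := bslope_near hL hk00 hk j f hf hf0 (by linarith)
  have hhalf := theta_le_half hk
  have h2 := le_abs_sin_half_pi (x := theta k - f) (by linarith) (by linarith)
  have h3 : 0 < sin (π / 2 * f) :=
    sin_pos_of_pos_of_lt_pi (by positivity) (by nlinarith [pi_pos])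
  have h4 : sin (π / 2 * f) ≤ 1 / 2 * (1 / L) := by
    refine (sin_le (by positivity)).trans ?_
    nlinarith [pi_lt_four]
  have h5 : sin (π / 2 * (f - theta k)) = -sin (π / 2 * (theta k - f)) := by
    rw [← sin_neg]; congr 1; ring
  rw [h5, neg_div] at h1
  have h6 : 2 ≤ sin (π / 2 * (theta k - f)) / sin (π / 2 * f) := by
    rw [le_div_iff₀ h3]; linarith
  have h7 := (abs_le.1 h1).2
  have : 2 / L = 2 * (1 / L) := by ring
  nlinarith

theorem exists_first_root {L : ℝ} (hL : 4 ≤ L) (j : ℕ) (hj : 1 ≤ j) :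
    (∃ k, j * π / L < k ∧ k ≤ (j + 1) * π / L ∧ k ≤ 1 ∧ 0 < bslope L j k) →
    ∃ η, (j * π / L < η ∧ η ≤ (j + 1) * π / L ∧ η < 1 ∧ bslope L j η = 0) ∧
      ∀ k, j * π / L < k → k ≤ (j + 1) * π / L → k ≤ 1 → 0 < bslope L j k → η < k := by
  have hπ := pi_pos
  have hL0 : 0 < L := by linarith
  set a := (j + 1 / (4 * L)) * π / L with ha
  have hja : j * π / L < a := by
    rw [ha]; gcongr; linarith [show 0 < 1 / (4 * L) by positivity]
  have hneg : ∀ k, j * π / L < k → k ≤ a → k ≤ 1 → bslope L j k < 0 := by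
    intro k h1 h2 h3
    rw [div_lt_iff₀ hL0] at h1
    rw [ha, le_div_iff₀ hL0] at h2
    refine bslope_neg_near hL h3 j hj (k * L / π - j) (by ring) ?_ ?_
    · rw [sub_pos, lt_div_iff₀ hπ]; exact h1
    · rw [sub_le_iff_le_add', div_le_iff₀ hπ]; exact h2
  have hroot : ∀ k, j * π / L < k → k ≤ (j + 1) * π / L → k ≤ 1 → 0 < bslope L j k →
      ∃ r ∈ Set.Icc a k, bslope L j r = 0 ∧ r < k := by
    intro k h1 h2 h3 h4
    have hak : a ≤ k := by
      by_contra! hcon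
      exact absurd (hneg k h1 hcon.le h3) (by linarith)
    have hcont : ContinuousOn (bslope L j) (Set.Icc a k) := continuousOn_bslope hL0 j
      fun x hx => ⟨hja.trans_le hx.1, hx.2.trans h2, hx.2.trans h3⟩
    obtain ⟨r, hr, hr0⟩ := intermediate_value_Icc hak hcont
      (show (0 : ℝ) ∈ _ from ⟨(hneg a hja le_rfl (hak.trans h3)).le, h4.le⟩)
    refine ⟨r, hr, hr0, lt_of_le_of_ne hr.2 ?_⟩
    rintro rfl
    linarith
  rintro ⟨k₀, h1, h2, h3, h4⟩
  obtain ⟨r₀, hr₀, hr₀0, hlt⟩ := hroot k₀ h1 h2 h3 h4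
  have hcont : ContinuousOn (bslope L j) (Set.Icc a k₀) := continuousOn_bslope hL0 j
    fun x hx => ⟨hja.trans_le hx.1, hx.2.trans h2, hx.2.trans h3⟩
  have hcpt : IsCompact (Set.Icc a k₀ ∩ bslope L j ⁻¹' {0}) :=
    isCompact_Icc.of_isClosed_subset
      (hcont.preimage_isClosed_of_isClosed isClosed_Icc isClosed_singleton) Set.inter_subset_left
  obtain ⟨η, hη, hmin⟩ := hcpt.exists_isLeast ⟨r₀, hr₀, hr₀0⟩
  have hηr : η ≤ r₀ := hmin ⟨hr₀, hr₀0⟩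
  refine ⟨η, ⟨hja.trans_le hη.1.1, hη.1.2.trans h2, by linarith, hη.2⟩, ?_⟩
  intro k g1 g2 g3 g4
  obtain ⟨r, hr, hr0, hrk⟩ := hroot k g1 g2 g3 g4
  rcases le_total r k₀ with h | h
  · exact (hmin ⟨⟨hr.1, h⟩, hr0⟩).trans_lt hrk
  · exact hη.1.2.trans_lt (h.trans_lt hrk)

/-- Indices of the branches of the slope function which take a positive value on `[0, 1]`. -/
def modes (L : ℝ) : Set ℕ :=
  {j | 1 ≤ j ∧ ∃ k, j * π / L < k ∧ k ≤ (j + 1) * π / L ∧ k ≤ 1 ∧ 0 < bslope L j k}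

theorem mem_modes_of_le {L : ℝ} (hL : 4 ≤ L) {i j : ℕ} (hj : j ∈ modes L) (hi : 1 ≤ i)
    (hij : i ≤ j) : i ∈ modes L := by
  rcases hij.eq_or_lt with rfl | hlt
  · exact hj
  obtain ⟨h1, k, h2, h3, h4, h5⟩ := hj
  have hlt' : (i : ℝ) + 1 ≤ j := by exact_mod_cast hlt
  have h6 : (i + 1 : ℝ) * π / L ≤ j * π / L := by gcongr
  refine ⟨hi, (i + 1) * π / L, by gcongr; linarith, le_rfl, by linarith, ?_⟩
  have hk1 : (i + 1 : ℝ) * π / L ≤ 1 := by linarith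
  have hθ := theta_le_half hk1
  have h1 := bslope_near hL (by positivity) hk1 i 1 (by field_simp) one_pos le_rfl
  have h7 := le_abs_sin_half_pi (x := 1 - theta ((i + 1 : ℝ) * π / L)) (by linarith)
    (by linarith [theta_nonneg (show 0 ≤ (i + 1 : ℝ) * π / L by positivity)])
  rw [mul_one, sin_pi_div_two, div_one] at h1
  have hs2 : 1.4 ≤ √2 := le_sqrt_of_sq_le (by norm_num)
  have h8 : 2 / L ≤ 1 / 2 := by rw [div_le_div_iff₀ (by linarith) (by norm_num)]; linarith
  have h9 := (abs_le.1 h1).1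
  nlinarith

theorem exists_first_mode {L : ℝ} (hL : 4 ≤ L) (j : modes L) :
    ∃ η, (j * π / L < η ∧ η ≤ (j + 1) * π / L ∧ η < 1 ∧ bslope L j η = 0) ∧
      ∀ k, j * π / L < k → k ≤ (j + 1) * π / L → k ≤ 1 → 0 < bslope L j k → η < k :=
  exists_first_root hL j j.2.1 j.2.2

theorem modes_lt {L : ℝ} {j : ℕ} (hj : j ∈ modes L) : j * π / L < 1 := by
  obtain ⟨-, k, h1, -, h2, -⟩ := hj
  linarith

theorem modes_finite {L : ℝ} (hL : 0 < L) : (modes L).Finite := by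
  refine (Set.finite_Iio ⌈L⌉₊).subset fun j hj => ?_
  have h := modes_lt hj
  rw [div_lt_one hL] at h
  have : (j : ℝ) < L := by nlinarith [pi_gt_three, (Nat.cast_nonneg j : (0 : ℝ) ≤ j)]
  exact_mod_cast this.trans_le (Nat.le_ceil L)

/-- The frequency of a mode. -/
def freq {L : ℝ} (hL : 4 ≤ L) (j : modes L) : ℝ := (exists_first_mode hL j).choose

section freq

variable {L : ℝ} (hL : 4 ≤ L) (j : modes L)

theorem lt_freq : j * π / L < freq hL j := (exists_first_mode hL j).choose_spec.1.1

theorem freq_le : freq hL j ≤ (j + 1) * π / L := (exists_first_mode hL j).choose_spec.1.2.1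

theorem freq_lt_one : freq hL j < 1 := (exists_first_mode hL j).choose_spec.1.2.2.1

theorem bslope_freq : bslope L j (freq hL j) = 0 := (exists_first_mode hL j).choose_spec.1.2.2.2

theorem freq_lt {k : ℝ} (h1 : j * π / L < k) (h2 : k ≤ (j + 1) * π / L) (h3 : k ≤ 1)
    (h4 : 0 < bslope L j k) : freq hL j < k :=
  (exists_first_mode hL j).choose_spec.2 k h1 h2 h3 h4

theorem freq_pos : 0 < freq hL j := by
  refine lt_of_le_of_lt ?_ (lt_freq hL j)
  positivity

/-- The phase of a mode. -/
def phase : ℝ := freq hL j * L / π - j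

theorem phase_pos : 0 < phase hL j := by
  have := lt_freq hL j
  rw [div_lt_iff₀ (by linarith)] at this
  rw [phase, sub_pos, lt_div_iff₀ pi_pos]; exact this

theorem phase_le_one : phase hL j ≤ 1 := by
  have := freq_le hL j
  rw [le_div_iff₀ (by linarith)] at this
  rw [phase, sub_le_iff_le_add', div_le_iff₀ pi_pos]; exact this

theorem freq_eq : freq hL j = (j + phase hL j) * (π / L) := by
  have : L ≠ 0 := by linarith
  unfold phase; field_simp; ring

theorem abs_phase_sub_le : |phase hL j - theta (freq hL j)| ≤ 4 / L :=
  bslope_zero_phase hL (freq_pos hL j).le (freq_lt_one hL j).le j _ (by unfold phase; ring)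
    (phase_pos hL j) (phase_le_one hL j) (bslope_freq hL j)

theorem exists_freq_prof : ∃ P : Prof L (freq hL j) ((-1) ^ ((j : ℕ) + 1)), P.s = 0 := by
  have h1 := lt_freq hL j
  have h2 := freq_le hL j
  rw [div_lt_iff₀ (by linarith)] at h1
  rw [le_div_iff₀ (by linarith)] at h2
  obtain ⟨P, hP⟩ := exists_prof_branch hL
    (by nlinarith [freq_pos hL j, freq_lt_one hL j] : freq hL j ^ 2 ≤ 1) j
    (sin_pos_of_pos_of_lt_pi (by linarith) (by linarith [pi_pos])).ne'
  exact ⟨P, hP.trans (bslope_freq hL j)⟩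

end freq

theorem freq_strictMono {L : ℝ} (hL : 4 ≤ L) : StrictMono (freq hL) := by
  intro i j hij
  have : ((i : ℕ) : ℝ) + 1 ≤ (j : ℕ) := by exact_mod_cast hij
  calc freq hL i ≤ _ := freq_le hL i
    _ ≤ j * π / L := by have := pi_pos; gcongr
    _ < _ := lt_freq hL j

/-- The family of all clamped modes. -/
def modeFam {L : ℝ} (hL : 4 ≤ L) : YFam L (modes L) where
  η := freq hL
  σ j := (-1) ^ ((j : ℕ) + 1)
  P j := (exists_freq_prof hL j).choose
  hσ j := by rw [← pow_mul, mul_comm, pow_mul]; norm_num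
  hs j := (exists_freq_prof hL j).choose_spec
  η0 := freq_pos hL
  η1 := freq_lt_one hL
  inj := (freq_strictMono hL).injective

/-- The number of modes below a given frequency. -/
theorem floor_le_card_modes {L k ε : ℝ} (hL : 4 ≤ L) (hk0 : 0 ≤ k) (hk : k ≤ 1) (hε : 0 ≤ ε)
    (hLε : 2 / L ≤ ε) (s : Finset (modes L)) (hs : ∀ j, freq hL j < k → j ∈ s) :
    ⌊k * L / π - theta k - 2 * ε⌋ ≤ (s.card : ℤ) := by
  have hπ := pi_pos
  have hL0 : 0 < L := by linarith
  have hεp : 0 < ε := lt_of_lt_of_le (by positivity) hLε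
  have hθ := theta_nonneg hk0
  have key : ∀ i : ℕ, 1 ≤ i → (i : ℝ) ≤ k * L / π - theta k - 2 * ε →
      ∃ j : modes L, (j : ℕ) = i ∧ freq hL j < k := by
    intro i hi hle
    have h1 : (i * π / L : ℝ) < k := by
      have : (i : ℝ) < k * L / π := by linarith
      rw [lt_div_iff₀ hπ] at this
      rwa [div_lt_iff₀ hL0]
    rcases le_total k ((i + 1) * π / L) with h | h
    · have hpos : 0 < bslope L i k := hεp.trans_le
        (bslope_pos_of hL hk0 hk i (k * L / π - i) (by ring) (by linarith)
          (by rw [sub_le_iff_le_add', div_le_iff₀ hπ]; rwa [le_div_iff₀ hL0] at h) hε hLε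
          (by linarith))
      have hm : i ∈ modes L := ⟨hi, k, h1, h, hk, hpos⟩
      exact ⟨⟨i, hm⟩, rfl, freq_lt hL ⟨i, hm⟩ h1 h hk hpos⟩
    · have hk1 := h.trans hk
      have h8 : 2 / L ≤ 1 / 2 := by rw [div_le_div_iff₀ (by linarith) (by norm_num)]; linarith
      have hpos : 0 < bslope L i ((i + 1) * π / L) := by
        have h1 := bslope_near hL (by positivity) hk1 i 1 (by field_simp) one_pos le_rfl
        have hθ' := theta_le_half hk1
        have h7 := le_abs_sin_half_pi (x := 1 - theta ((i + 1 : ℝ) * π / L)) (by linarith)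
          (by linarith [theta_nonneg (show 0 ≤ (i + 1 : ℝ) * π / L by positivity)])
        rw [mul_one, sin_pi_div_two, div_one] at h1
        have hs2 : 1.4 ≤ √2 := le_sqrt_of_sq_le (by norm_num)
        have h9 := (abs_le.1 h1).1
        nlinarith
      have h2 : (i * π / L : ℝ) < (i + 1) * π / L := by gcongr; linarith
      have hm : i ∈ modes L := ⟨hi, _, h2, le_rfl, hk1, hpos⟩
      exact ⟨⟨i, hm⟩, rfl, (freq_lt hL ⟨i, hm⟩ h2 le_rfl hk1 hpos).trans_le h⟩
  by_contra! hcon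
  have h1 : (s.card + 1 : ℤ) ≤ ⌊k * L / π - theta k - 2 * ε⌋ := hcon
  rw [Int.le_floor] at h1
  push_cast at h1
  have hsub : Finset.Icc 1 (s.card + 1) ⊆ s.image (fun j : modes L => (j : ℕ)) := by
    intro i hi
    obtain ⟨h2, h3⟩ := Finset.mem_Icc.1 hi
    have h3' : (i : ℝ) ≤ s.card + 1 := by exact_mod_cast h3
    obtain ⟨j, hj, hjk⟩ := key i h2 (by linarith)
    exact Finset.mem_image.2 ⟨j, hs j hjk, hj⟩
  have h4 := (Finset.card_le_card hsub).trans Finset.card_image_le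
  rw [Nat.card_Icc] at h4
  omega

theorem exists_prof_neg {L k ε : ℝ} (hL : 4 ≤ L) (hk0 : 0 ≤ k) (hk : k ≤ 1) (hε : 0 ≤ ε)
    (hLε : 2 / L ≤ ε) (j : ℕ) (h0 : j < k * L / π) (h : k * L / π - j ≤ theta k - 2 * ε) :
    ∃ P : Prof L k ((-1) ^ (j + 1)), P.s ≤ -ε := by
  have hθ := theta_le_half hk
  rw [lt_div_iff₀ pi_pos] at h0
  have h1 : k * L / π ≤ j + 1 := by linarith
  rw [div_le_iff₀ pi_pos] at h1
  obtain ⟨P, hP⟩ := exists_prof_branch hL (by nlinarith : k ^ 2 ≤ 1) j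
    (sin_pos_of_pos_of_lt_pi (by linarith) (by linarith [pi_pos])).ne'
  refine ⟨P, hP.trans_le (bslope_neg_of hL hk0 hk j (k * L / π - j) (by ring) ?_ hε hLε h)⟩
  rw [sub_pos, lt_div_iff₀ pi_pos]; exact h0

theorem exists_prof_pos {L k ε : ℝ} (hL : 4 ≤ L) (hk0 : 0 ≤ k) (hk : k ≤ 1) (hε : 0 < ε)
    (hLε : 2 / L ≤ ε) (j : ℕ) (h1 : k * L / π ≤ j + 1) (h : theta k + 2 * ε ≤ k * L / π - j) :
    ∃ P : Prof L k ((-1) ^ (j + 1)), ε ≤ P.s := by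
  have hθ := theta_nonneg hk0
  have h0 : (j : ℝ) < k * L / π := by linarith
  rw [lt_div_iff₀ pi_pos] at h0
  obtain ⟨P, hP⟩ := exists_prof_branch hL (by nlinarith : k ^ 2 ≤ 1) j
    (sin_pos_of_pos_of_lt_pi (by linarith)
      (by rw [div_le_iff₀ pi_pos] at h1; linarith [pi_pos])).ne'
  refine ⟨P, (bslope_pos_of hL hk0 hk j (k * L / π - j) (by ring) ?_ ?_ hε.le hLε h).trans hP.ge⟩
  · rw [sub_pos, lt_div_iff₀ pi_pos]; exact h0
  · linarith

theorem XFam.exists_of {L₁ L₂ : ℝ} {N W : Type*} (Y : YFam L₂ N) (n : W → N) (σ : W → ℝ)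
    (hσ : ∀ i, σ i ^ 2 = 1) (opp : ∀ i j, i ≠ j → n i = n j → σ j = -σ i) (Q : ℝ → Prop)
    (h : ∀ i, ∃ P : Prof L₁ (√(Y.τ (n i))) (σ i), Q P.s) :
    ∃ Z : XFam Y L₁ W, Z.n = n ∧ ∀ i, Q (Z.X i).s := by
  choose X hX using h
  exact ⟨⟨n, σ, X, hσ, opp⟩, rfl, hX⟩

theorem eq_or_eq_neg_of_sq {a : ℝ} (h : a ^ 2 = 1) : a = 1 ∨ a = -1 := by
  rwa [← one_pow 2, sq_eq_sq_iff_eq_or_eq_neg] at h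

theorem XFam.exists_rep {L₁ L₂ Δ : ℝ} {N W : Type*} [Fintype W] [DecidableEq W] {Y : YFam L₂ N}
    (Z : XFam Y L₁ W) (hΔ : 0 < Δ) :
    ∃ R : Z.Rep Δ, ((Finset.univ.image R.r).card : ℝ) ≤ 4 * (1 / Δ + 1) := by
  classical
  let key : W → ℕ × Bool × Bool :=
    fun i => (⌊Z.t i / Δ⌋₊, decide (Z.σ i = 1), decide (Y.σ (Z.n i) = 1))
  have hsign : ∀ a b : ℝ, a ^ 2 = 1 → b ^ 2 = 1 → decide (a = 1) = decide (b = 1) → a = b := by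
    intro a b ha hb hab
    have hab' : a = 1 ↔ b = 1 := by simpa using hab
    rcases eq_or_eq_neg_of_sq ha with h | h <;>
      rcases eq_or_eq_neg_of_sq hb with h' | h' <;> simp_all
  let r : W → W := fun i => Function.surjInv Set.rangeFactorization_surjective
    (Set.rangeFactorization key i)
  have hr : ∀ i, key (r i) = key i := fun i => congrArg Subtype.val
    (Function.surjInv_eq Set.rangeFactorization_surjective (Set.rangeFactorization key i))
  refine ⟨⟨r, fun i => hsign _ _ (Z.hσ _) (Z.hσ _) (congrArg (fun q => q.2.1) (hr i)),
    fun i => hsign _ _ (Y.hσ _) (Y.hσ _) (congrArg (fun q => q.2.2) (hr i)), fun i => ?_⟩, ?_⟩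
  · have h : ⌊Z.t (r i) / Δ⌋₊ = ⌊Z.t i / Δ⌋₊ := congrArg Prod.fst (hr i)
    have h1 := Nat.floor_le (show 0 ≤ Z.t i / Δ from div_nonneg (Z.t_pos i).le hΔ.le)
    have h2 := Nat.lt_floor_add_one (Z.t i / Δ)
    have h3 := Nat.floor_le (show 0 ≤ Z.t (r i) / Δ from div_nonneg (Z.t_pos _).le hΔ.le)
    have h4 := Nat.lt_floor_add_one (Z.t (r i) / Δ)
    rw [h] at h3 h4
    rw [le_div_iff₀ hΔ] at h1 h3
    rw [div_lt_iff₀ hΔ] at h2 h4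
    rw [abs_le]
    constructor <;> nlinarith
  · have hinj : Set.InjOn key (Finset.univ.image r : Finset W) := by
      rintro _ hx _ hy hxy
      obtain ⟨i, -, rfl⟩ := Finset.mem_image.1 hx
      obtain ⟨j, -, rfl⟩ := Finset.mem_image.1 hy
      rw [hr, hr] at hxy
      exact congrArg (Function.surjInv Set.rangeFactorization_surjective) (Subtype.ext hxy)
    have hmaps : ∀ x ∈ Finset.univ.image r,
        key x ∈ Finset.range (⌊1 / Δ⌋₊ + 1) ×ˢ (Finset.univ : Finset (Bool × Bool)) := by
      intro x _
      simp only [Finset.mem_product, Finset.mem_range, Finset.mem_univ, and_true, key]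
      rw [Nat.lt_succ_iff]
      exact Nat.floor_le_floor (by gcongr; exact (Z.t_lt x).le)
    have h := Finset.card_le_card_of_injOn key hmaps hinj
    rw [Finset.card_product, Finset.card_range, Finset.card_univ, Fintype.card_prod,
      Fintype.card_bool] at h
    have h' : ((Finset.univ.image r).card : ℝ) ≤ (⌊1 / Δ⌋₊ + 1) * (2 * 2) := by exact_mod_cast h
    have := Nat.floor_le (show 0 ≤ 1 / Δ by positivity)
    linarith

/-- The span of `K` admissible functions on which the quadratic form is less than `-δ` times the
squared norm. -/
def NegSpan (L₁ L₂ δ : ℝ) (K : ℕ) : Prop :=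
  ∃ (ψ : Fin K → ℝ × ℝ → ℝ) (hψ : ∀ i, Adm (Set.Ioo 0 L₁ ×ˢ Set.Ioo 0 L₂) (ψ i)),
    ∀ a : Fin K → ℝ, a ≠ 0 →
      qf L₁ L₂ (comb (fun i => ap (ψ i) (hψ i).1) a) (comb (fun i => ap (ψ i) (hψ i).1) a)
        + δ * ip2 L₁ L₂ (comb (fun i => ap (ψ i) (hψ i).1) a).1
          (comb (fun i => ap (ψ i) (hψ i).1) a).1 < 0

/-- The complementary frequency. -/
def cof (x : ℝ) : ℝ := √(1 - x ^ 2)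

theorem cof_nonneg (x : ℝ) : 0 ≤ cof x := sqrt_nonneg _

theorem cof_le_one (x : ℝ) : cof x ≤ 1 := by
  exact sqrt_le_one.2 (by nlinarith)

theorem lt_ceil_sub_one {n : ℕ} {z : ℝ} (hn : 0 < n) : n ≤ ⌈z⌉₊ - 1 ↔ (n : ℝ) < z := by
  rw [← Nat.lt_ceil]; omega

theorem ceil_sub_one_lt {z : ℝ} (hz : 0 < z) : ((⌈z⌉₊ - 1 : ℕ) : ℝ) < z := by
  have := Nat.ceil_pos.2 hz
  rw [← Nat.lt_ceil]; omega

theorem le_ceil_sub_one_add_one (z : ℝ) : z ≤ ((⌈z⌉₊ - 1 : ℕ) : ℝ) + 1 := by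
  refine (Nat.le_ceil z).trans ?_
  have : ⌈z⌉₊ ≤ (⌈z⌉₊ - 1) + 1 := by omega
  exact_mod_cast this

theorem exists_blockError {γ ε η : ℝ} (hγ : 0 < γ) (hε : 0 < ε) (hη : 0 < η) :
    ∃ θ, 0 < θ ∧ ∀ L₁ L₂ : ℝ, 0 < L₁ → 0 < L₂ → ∀ card : ℕ, (card : ℝ) ≤ 2 * L₂ →
      blockError L₁ L₂ (θ / √L₂) (4 / γ * √L₂) (η / L₂) (L₂ / 5) ε card := by
  set S := 1 / γ + 1 / η with hS
  have hSp : 0 < S := by positivity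
  refine ⟨ε / (100000 * S + ε), by positivity, fun L₁ L₂ h₁ h₂ card hcard => ?_⟩
  set θ := ε / (100000 * S + ε) with hθ
  have hθ0 : 0 < θ := by positivity
  have hθ1 : θ ≤ 1 := by rw [hθ, div_le_one (by positivity)]; linarith
  have hθS : 100000 * (θ * S) ≤ ε := by
    have : θ * (100000 * S + ε) = ε := by rw [hθ]; field_simp
    nlinarith
  refine ⟨?_, by positivity, by positivity, h₁, h₂⟩
  have hs : √L₂ ≠ 0 := (sqrt_pos.2 h₂).ne'
  have hs2 : √L₂ ^ 2 = L₂ := sq_sqrt h₂.le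
  have e1 : 4 * (324 * (θ / √L₂) * (4 / γ * √L₂) * card) = 5184 * (θ * (1 / γ)) * card := by
    field_simp; ring
  have e2 : 9216 * (θ / √L₂) ^ 2 * card / (η / L₂) = 9216 * (θ * θ * (1 / η)) * card := by
    rw [div_pow, hs2]; field_simp
  rw [e1, e2]
  have h3 : θ * θ * (1 / η) ≤ θ * (1 / η) := by
    have : 0 < 1 / η := by positivity
    nlinarith [mul_pos hθ0 this]
  have hg : 0 ≤ θ * (1 / γ) := by positivity
  have h4 : 5184 * (θ * (1 / γ)) * card + 9216 * (θ * θ * (1 / η)) * card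
      ≤ 9216 * (θ * S) * card := by rw [hS]; nlinarith
  nlinarith

theorem card_modes_le {L : ℝ} (hL : 0 < L) (s : Finset (modes L)) : (s.card : ℝ) ≤ L / π := by
  have hπ := pi_pos
  have hsub : s.image (fun j : modes L => (j : ℕ)) ⊆ Finset.Icc 1 ⌊L / π⌋₊ := by
    intro i hi
    obtain ⟨j, -, rfl⟩ := Finset.mem_image.1 hi
    refine Finset.mem_Icc.2 ⟨j.2.1, Nat.le_floor ?_⟩
    have := modes_lt j.2
    rw [div_lt_one hL] at this
    rw [le_div_iff₀ hπ]; exact this.le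
  have h := Finset.card_le_card hsub
  rw [Finset.card_image_of_injective _ Subtype.val_injective, Nat.card_Icc] at h
  have h' : s.card ≤ ⌊L / π⌋₊ := by omega
  exact (Nat.cast_le.2 h').trans (Nat.floor_le (by positivity))

theorem card_modes_le' {L : ℝ} (hL : 0 < L) (s : Finset (modes L)) : (s.card : ℝ) ≤ L := by
  refine (card_modes_le hL s).trans (div_le_self hL.le (by linarith [pi_gt_three]))

theorem neg_one_pow_sq (n : ℕ) : ((-1 : ℝ) ^ n) ^ 2 = 1 := by
  rw [← pow_mul, mul_comm, pow_mul]; norm_num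

theorem sqrt_tau {L : ℝ} (hL : 4 ≤ L) (j : modes L) :
    √((modeFam hL).τ j) = cof (freq hL j) := rfl

theorem fr_nonneg {L : ℝ} (hL : 0 < L) (m : ℕ) : 0 ≤ fr L m := by
  unfold fr; positivity

theorem fr_lt_one_iff {L : ℝ} (hL : 0 < L) (m : ℕ) : fr L m < 1 ↔ (m : ℝ) < L / π := by
  unfold fr
  rw [div_lt_one hL, lt_div_iff₀ pi_pos]

/-- Bound for the dimension of a negative subspace in terms of phase counting functions. -/
theorem upper_floor {γ ε η : ℝ} (hγ : 0 < γ) (hε : 0 < ε) (hη : 0 < η) :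
    ∃ L₀ B : ℝ, ∀ L₁ L₂ : ℝ, L₀ ≤ L₁ → L₀ ≤ L₂ → ∀ (hL : 4 ≤ L₂) (G : Finset (modes L₂)),
      (∀ j ∈ G, γ ≤ freq hL j) → ∀ K, NegSpan L₁ L₂ (η / L₂) K →
      (K : ℝ) ≤ (∑ m ∈ Finset.Icc 1 ⌊L₁ / π⌋₊,
          (⌊cof (fr L₁ m) * L₂ / π - theta (cof (fr L₁ m)) + 2 * ε⌋ : ℝ))
        + (∑ j ∈ G, ((⌊cof (freq hL j) * L₁ / π - theta (cof (freq hL j)) + 2 * ε⌋ : ℝ)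
          + ⌊-(cof (freq hL j) * L₁ / π)⌋ + 1)) + B * √L₂ := by
  classical
  obtain ⟨θ, hθ, hblock⟩ := exists_blockError hγ hε hη
  refine ⟨max (max 50 (2 / ε)) (2 / γ), 4 / θ + 4, fun L₁ L₂ h₁ h₂ hL G hG K hK => ?_⟩
  simp only [max_le_iff] at h₁ h₂
  obtain ⟨⟨h₁, h₁ε⟩, -⟩ := h₁
  obtain ⟨⟨h₂, h₂ε⟩, h₂γ⟩ := h₂
  have h₁p : 0 < L₁ := by linarith
  have h₂p : 0 < L₂ := by linarith
  have hε₁ : 2 / L₁ ≤ ε := by rw [div_le_iff₀ hε] at h₁ε; rw [div_le_iff₀ h₁p]; linarith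
  have hε₂ : 2 / L₂ ≤ ε := by rw [div_le_iff₀ hε] at h₂ε; rw [div_le_iff₀ h₂p]; linarith
  have hγ₂ : 1 / γ ^ 2 ≤ L₂ ^ 2 / 4 := by
    have : (2 / γ) ^ 2 ≤ L₂ ^ 2 := by gcongr
    rw [div_pow] at this
    linarith [show (2 : ℝ) ^ 2 / γ ^ 2 = 4 * (1 / γ ^ 2) by ring]
  have hπ := pi_pos
  obtain ⟨ψ, hψ, hneg⟩ := hK
  set z : ℕ → ℝ := fun m => cof (fr L₁ m) * L₂ / π with hz
  set x : modes L₂ → ℝ := fun j => cof (freq hL j) * L₁ / π with hx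
  let VF : Finset ℕ := (Finset.Icc 1 ⌊L₁ / π⌋₊).filter fun m =>
    0 < z m ∧ z m - (⌈z m⌉₊ - 1 : ℕ) ≤ theta (cof (fr L₁ m)) - 2 * ε
  let WF : Finset (modes L₂) := G.filter fun j =>
    x j - (⌈x j⌉₊ - 1 : ℕ) ≤ theta (cof (freq hL j)) - 2 * ε
  have hxpos : ∀ j, 0 < x j := fun j => by
    have : 0 < cof (freq hL j) := sqrt_pos.2 ((modeFam hL).τ_pos j)
    simp only [hx]; positivity
  obtain ⟨Z, hZn, hZs⟩ := XFam.exists_of (L₁ := L₁) (modeFam hL) (fun i : WF => i.1)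
    (fun i => (-1) ^ ((⌈x i.1⌉₊ - 1) + 1)) (fun i => neg_one_pow_sq _)
    (fun i j hij h => absurd (Subtype.ext h) hij) (fun s => s ≤ -ε) (fun i =>
      exists_prof_neg (by linarith) (cof_nonneg _) (cof_le_one _) hε.le hε₁ _
        (ceil_sub_one_lt (hxpos i.1)) (Finset.mem_filter.1 i.2).2)
  obtain ⟨R, hR⟩ := Z.exists_rep (div_pos hθ (sqrt_pos.2 h₂p))
  have hV : ∀ m : VF, ∃ P : Prof L₂ (cof (fr L₁ m.1)) ((-1) ^ ((⌈z m.1⌉₊ - 1) + 1)), P.s ≤ -ε :=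
    fun m => exists_prof_neg hL (cof_nonneg _) (cof_le_one _) hε.le hε₂ _
      (ceil_sub_one_lt (Finset.mem_filter.1 m.2).2.1) (Finset.mem_filter.1 m.2).2.2
  choose P hP using hV
  let low : Finset (ℕ × ℕ) := ((Finset.Icc 1 ⌊L₁ / π⌋₊).sigma
    fun m => Finset.Icc 1 (⌈z m⌉₊ - 1)).map (Equiv.sigmaEquivProd ℕ ℕ).toEmbedding
  have hcardW : ((Fintype.card WF : ℕ) : ℝ) ≤ 2 * L₂ := by
    rw [Fintype.card_coe]
    linarith [card_modes_le' h₂p WF]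
  have hgood : ∀ i : WF, γ ≤ freq hL (Z.n i) := fun i => by
    rw [hZn]; exact hG _ (Finset.mem_filter.1 i.2).1
  have hmain := upper_core R (hblock L₁ L₂ h₁p h₂p _ hcardW) ψ hψ hneg (fun m : VF => m.1)
    (fun m => (Finset.mem_Icc.1 (Finset.mem_filter.1 m.2).1).1) Subtype.val_injective _ _ P
    (fun m => neg_one_pow_sq _) (fun m => ?_) (fun m => by linarith [hP m])
    (fun i => ((modeFam hL).P (Z.n i)).le_C h₂p ((modeFam hL).hσ _) ((modeFam hL).η_sq_lt _).le
      ((modeFam hL).hs _) hγ (hgood i) hγ₂ h₂) (by positivity) hε.le hZs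
    (fun i => ((modeFam hL).P (Z.n i)).norm_g_le (by linarith) ((modeFam hL).hσ _)
      ((modeFam hL).η_sq_lt _).le ((modeFam hL).hs _) hγ (hgood i)) low ?_
  rotate_left
  · have hzm := (Finset.mem_filter.1 m.2).2.1
    have hc : 0 < cof (fr L₁ m.1) := by
      rcases (cof_nonneg (fr L₁ m.1)).eq_or_lt with h | h
      · simp only [hz, ← h] at hzm; simp at hzm
      · exact h
    have := sqrt_pos.1 hc
    rw [cof, sq_sqrt this.le]; ring
  · intro m n hm hn hmn
    refine Finset.mem_map.2 ⟨⟨m, n⟩, Finset.mem_sigma.2 ⟨Finset.mem_Icc.2 ⟨hm, Nat.le_floor ?_⟩,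
      Finset.mem_Icc.2 ⟨hn, (lt_ceil_sub_one hn).2 ?_⟩⟩, rfl⟩
    · refine ((fr_lt_one_iff h₁p m).1 ?_).le
      nlinarith [fr_nonneg h₁p m, sq_nonneg (fr L₂ n)]
    · have h3 : fr L₂ n < cof (fr L₁ m) := lt_sqrt_of_sq_lt (by linarith)
      rw [fr, div_lt_iff₀ h₂p] at h3
      simp only [hz]
      rw [lt_div_iff₀ hπ]; exact h3
  simp only [Fintype.card_fin, Fintype.card_coe] at hmain
  have hlowc : low.card = ∑ m ∈ Finset.Icc 1 ⌊L₁ / π⌋₊, (⌈z m⌉₊ - 1) := by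
    simp only [low, Finset.card_map, Finset.card_sigma, Nat.card_Icc, Nat.add_sub_cancel]
  have hVc : VF.card = ∑ m ∈ Finset.Icc 1 ⌊L₁ / π⌋₊,
      if 0 < z m ∧ z m - (⌈z m⌉₊ - 1 : ℕ) ≤ theta (cof (fr L₁ m)) - 2 * ε then 1 else 0 :=
    Finset.card_filter _ _
  have hWc : WF.card = ∑ j ∈ G,
      if x j - (⌈x j⌉₊ - 1 : ℕ) ≤ theta (cof (freq hL j)) - 2 * ε then 1 else 0 :=
    Finset.card_filter _ _
  have hmain' : (K : ℝ) + VF.card + WF.card ≤ low.card + (Finset.univ.image R.r).card := by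
    exact_mod_cast hmain
  have hth : ∀ u, theta (cof u) ≤ 1 / 2 := fun u => theta_le_half (cof_le_one u)
  have hS1 : (low.card : ℝ) - VF.card ≤ ∑ m ∈ Finset.Icc 1 ⌊L₁ / π⌋₊,
      (⌊z m - theta (cof (fr L₁ m)) + 2 * ε⌋ : ℝ) := by
    rw [hlowc, hVc]
    push_cast
    rw [← Finset.sum_sub_distrib]
    refine Finset.sum_le_sum fun m _ => ?_
    have hz0 : 0 ≤ z m := by have := cof_nonneg (fr L₁ m); simp only [hz]; positivity
    have hint : ∀ a : ℤ, (a : ℝ) ≤ z m - theta (cof (fr L₁ m)) + 2 * ε →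
        (a : ℝ) ≤ (⌊z m - theta (cof (fr L₁ m)) + 2 * ε⌋ : ℝ) := fun a ha => by
      exact_mod_cast Int.le_floor.2 ha
    rcases hz0.eq_or_lt with h0 | h0
    · have hcof : cof (fr L₁ m) = 0 := by
        simp only [hz] at h0
        have := h0.symm
        rw [div_eq_zero_iff, mul_eq_zero] at this
        rcases this with (h | h) | h
        · exact h
        · linarith
        · linarith
      have := hint 0 (by rw [← h0, hcof]; simp [theta]; linarith)
      simpa [← h0] using this
    · have h5 := ceil_sub_one_lt h0
      have h6 := hth (fr L₁ m)
      split_ifs with hc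
      · have := hint ((⌈z m⌉₊ - 1 : ℕ) - 1) (by push_cast; linarith)
        push_cast at this ⊢; exact this
      · have hc' : ¬ (z m - (⌈z m⌉₊ - 1 : ℕ) ≤ theta (cof (fr L₁ m)) - 2 * ε) := fun h => hc ⟨h0, h⟩
        push Not at hc'
        have := hint ((⌈z m⌉₊ - 1 : ℕ)) (by push_cast; linarith)
        push_cast at this ⊢; linarith
  have hS2 : -(WF.card : ℝ) ≤ ∑ j ∈ G, ((⌊x j - theta (cof (freq hL j)) + 2 * ε⌋ : ℝ)
      + ⌊-x j⌋ + 1) := by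
    rw [hWc]
    push_cast
    rw [← Finset.sum_neg_distrib]
    refine Finset.sum_le_sum fun j _ => ?_
    have hint : ∀ a : ℤ, (a : ℝ) ≤ x j - theta (cof (freq hL j)) + 2 * ε →
        (a : ℝ) ≤ (⌊x j - theta (cof (freq hL j)) + 2 * ε⌋ : ℝ) := fun a ha => by
      exact_mod_cast Int.le_floor.2 ha
    have h5 := ceil_sub_one_lt (hxpos j)
    have h6 := hth (freq hL j)
    have h7 : -((⌈x j⌉₊ - 1 : ℕ) : ℝ) - 1 ≤ ⌊-x j⌋ := by
      have : (-((⌈x j⌉₊ - 1 : ℕ) : ℤ) - 1) ≤ ⌊-x j⌋ :=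
        Int.le_floor.2 (by push_cast; linarith [le_ceil_sub_one_add_one (x j)])
      exact_mod_cast this
    split_ifs with hc
    · have := hint ((⌈x j⌉₊ - 1 : ℕ) - 1) (by push_cast; linarith)
      push_cast at this; linarith
    · push Not at hc
      have := hint ((⌈x j⌉₊ - 1 : ℕ)) (by push_cast; linarith)
      push_cast at this; linarith
  have hJ : ((Finset.univ.image R.r).card : ℝ) ≤ (4 / θ + 4) * √L₂ := by
    refine hR.trans ?_
    have h1 : 1 ≤ √L₂ := one_le_sqrt.2 (by linarith)
    rw [one_div_div]
    calc 4 * (√L₂ / θ + 1) ≤ 4 * (√L₂ / θ + √L₂) := by gcongr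
      _ = _ := by ring
  simp only [hx, hz] at hS1 hS2
  linarith

/-- Existence of a nearly negative subspace of large dimension in terms of phase counting
functions. -/
theorem lower_floor {γ ε η : ℝ} (hγ : 0 < γ) (hε : 0 < ε) (hε2 : ε ≤ 1 / 2) (hη : 0 < η) :
    ∃ L₀ B : ℝ, ∀ L₁ L₂ : ℝ, L₀ ≤ L₁ → L₀ ≤ L₂ → ∀ (hL : 4 ≤ L₂) (A G : Finset (modes L₂)),
      (∀ j, j ∈ A) → (∀ j ∈ G, γ ≤ freq hL j) → ∃ K, NegSpan L₁ L₂ (-(η / L₂)) K ∧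
      (∑ m ∈ Finset.Icc 1 ⌊L₁ / π⌋₊,
          (⌊cof (fr L₁ m) * L₂ / π - theta (cof (fr L₁ m)) - 2 * ε⌋ : ℝ))
        + (∑ j ∈ G, ((⌊cof (freq hL j) * L₁ / π - theta (cof (freq hL j)) - 2 * ε⌋ : ℝ)
          - ⌊cof (freq hL j) * L₁ / π⌋)) - 2 * (A.card - G.card) - B * √L₂ ≤ K := by
  classical
  obtain ⟨θ, hθ, hblock⟩ := exists_blockError hγ hε hη
  refine ⟨max (max 50 (2 / ε)) (2 / γ), 4 / θ + 4, fun L₁ L₂ h₁ h₂ hL A G hA hG => ?_⟩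
  simp only [max_le_iff] at h₁ h₂
  obtain ⟨⟨h₁, h₁ε⟩, -⟩ := h₁
  obtain ⟨⟨h₂, h₂ε⟩, h₂γ⟩ := h₂
  have h₁p : 0 < L₁ := by linarith
  have h₂p : 0 < L₂ := by linarith
  have hε₁ : 2 / L₁ ≤ ε := by rw [div_le_iff₀ hε] at h₁ε; rw [div_le_iff₀ h₁p]; linarith
  have hε₂ : 2 / L₂ ≤ ε := by rw [div_le_iff₀ hε] at h₂ε; rw [div_le_iff₀ h₂p]; linarith
  have hγ₂ : 1 / γ ^ 2 ≤ L₂ ^ 2 / 4 := by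
    have : (2 / γ) ^ 2 ≤ L₂ ^ 2 := by gcongr
    rw [div_pow] at this
    linarith [show (2 : ℝ) ^ 2 / γ ^ 2 = 4 * (1 / γ ^ 2) by ring]
  have hπ := pi_pos
  have : Fintype (modes L₂) := ⟨A, hA⟩
  set z : ℕ → ℝ := fun m => cof (fr L₁ m) * L₂ / π with hz
  set x : modes L₂ → ℝ := fun j => cof (freq hL j) * L₁ / π with hx
  have hx0 : ∀ j, 0 ≤ x j := fun j => by
    have := cof_nonneg (freq hL j)
    simp only [hx]; positivity
  have hth0 : ∀ u, 0 ≤ theta (cof u) := fun u => theta_nonneg (cof_nonneg u)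
  let cnd : modes L₂ → Prop := fun j => theta (cof (freq hL j)) + 2 * ε ≤ x j - ⌊x j⌋₊
  let WF : Finset (modes L₂ × Bool) := (G ×ˢ Finset.univ).filter fun p => p.2 = true → cnd p.1
  let sg : Bool → ℝ := fun b => if b then 1 else -1
  obtain ⟨Z, hZn, hZs⟩ := XFam.exists_of (L₁ := L₁) (modeFam hL) (fun i : WF => i.1.1)
    (fun i => sg i.1.2 * (-1) ^ (⌊x i.1.1⌋₊ + 1))
    (fun i => by
      rw [mul_pow, neg_one_pow_sq, mul_one]
      simp only [sg]; split_ifs <;> norm_num)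
    (fun i j hij h => by
      have h2 : i.1.2 ≠ j.1.2 := fun h2 => hij (Subtype.ext (Prod.ext h h2))
      rw [h]
      cases hi : i.1.2 <;> cases hj : j.1.2 <;> simp_all [sg])
    (fun s => ε ≤ s) (fun i => by
      obtain ⟨⟨j, b⟩, hi⟩ := i
      have hi2 := (Finset.mem_filter.1 hi).2
      have hfl := Nat.floor_le (hx0 j)
      have hfl2 := Nat.lt_floor_add_one (x j)
      rw [sqrt_tau]
      cases b
      · obtain ⟨P, hP⟩ := exists_prof_other (L := L₁) (by linarith) (cof_nonneg (freq hL j))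
          (by nlinarith [cof_nonneg (freq hL j), cof_le_one (freq hL j)]) ⌊x j⌋₊
          (by rw [show x j = cof (freq hL j) * L₁ / π from rfl, le_div_iff₀ hπ] at hfl; linarith)
          (by
            have h := hfl2
            conv_lhs at h => rw [show x j = cof (freq hL j) * L₁ / π from rfl]
            rw [div_lt_iff₀ hπ] at h
            linarith)
        have : sg false * (-1) ^ (⌊x j⌋₊ + 1) = -(-1) ^ (⌊x j⌋₊ + 1) := by simp [sg]
        change ∃ P : Prof L₁ (cof (freq hL j)) (sg false * (-1) ^ (⌊x j⌋₊ + 1)), ε ≤ P.s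
        rw [this]
        exact ⟨P, hε2.trans hP⟩
      · have : sg true * (-1) ^ (⌊x j⌋₊ + 1) = (-1) ^ (⌊x j⌋₊ + 1) := by simp [sg]
        change ∃ P : Prof L₁ (cof (freq hL j)) (sg true * (-1) ^ (⌊x j⌋₊ + 1)), ε ≤ P.s
        rw [this]
        exact exists_prof_pos (by linarith) (cof_nonneg _) (cof_le_one _) hε hε₁ _ hfl2.le
          (hi2 rfl))
  obtain ⟨R, hR⟩ := Z.exists_rep (div_pos hθ (sqrt_pos.2 h₂p))
  let S : Finset (ℕ × modes L₂) := ((Finset.Icc 1 ⌊L₁ / π⌋₊).sigma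
    fun m => A.filter fun j => freq hL j < cof (fr L₁ m)).map
      (Equiv.sigmaEquivProd ℕ (modes L₂)).toEmbedding
  have hWc : WF.card = ∑ j ∈ G, (1 + if cnd j then 1 else 0) := by
    rw [Finset.card_filter, Finset.sum_product]
    refine Finset.sum_congr rfl fun j _ => ?_
    rw [Fintype.sum_bool, add_comm]
    simp
  have hWcard : ((Fintype.card WF : ℕ) : ℝ) ≤ 2 * L₂ := by
    have h : WF.card ≤ 2 * G.card := by
      have h := Finset.sum_le_card_nsmul G (fun j => 1 + if cnd j then 1 else 0) 2 fun j _ => by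
        split_ifs <;> norm_num
      rw [hWc]
      linarith [h, smul_eq_mul G.card 2]
    have h' : (WF.card : ℝ) ≤ 2 * G.card := by exact_mod_cast h
    rw [Fintype.card_coe]
    linarith [card_modes_le' h₂p G]
  have hgood : ∀ i : WF, γ ≤ freq hL (Z.n i) := fun i => by
    rw [hZn]; exact hG _ (Finset.mem_product.1 (Finset.mem_filter.1 i.2).1).1
  obtain ⟨K, ψ, hψ, hneg, hK⟩ := lower_core R (hblock L₁ L₂ h₁p h₂p _ hWcard) S (fun q hq => by
      obtain ⟨⟨m, j⟩, hmj, rfl⟩ := Finset.mem_map.1 hq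
      obtain ⟨hm, hj⟩ := Finset.mem_sigma.1 hmj
      refine ⟨(Finset.mem_Icc.1 hm).1, ?_⟩
      have h := (Finset.mem_filter.1 hj).2
      have h2 := (lt_sqrt (freq_pos hL j).le).1 h
      change fr L₁ m ^ 2 < 1 - freq hL j ^ 2
      linarith)
    (fun i => ((modeFam hL).P (Z.n i)).le_C h₂p ((modeFam hL).hσ _) ((modeFam hL).η_sq_lt _).le
      ((modeFam hL).hs _) hγ (hgood i) hγ₂ h₂) (by positivity) hε.le hZs
    (fun i => ((modeFam hL).P (Z.n i)).norm_g_le (by linarith) ((modeFam hL).hσ _)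
      ((modeFam hL).η_sq_lt _).le ((modeFam hL).hs _) hγ (hgood i))
  refine ⟨K, ⟨ψ, hψ, fun a ha => by linarith [hneg a ha]⟩, ?_⟩
  rw [Fintype.card_coe] at hK
  have hA' : Fintype.card (modes L₂) = A.card := by
    rw [Finset.eq_univ_of_forall hA, Finset.card_univ]
  rw [hA'] at hK
  have hK' : (S.card : ℝ) + WF.card ≤ K + 2 * A.card + (Finset.univ.image R.r).card := by
    exact_mod_cast hK
  have hJ : ((Finset.univ.image R.r).card : ℝ) ≤ (4 / θ + 4) * √L₂ := by
    refine hR.trans ?_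
    have h1 : 1 ≤ √L₂ := one_le_sqrt.2 (by linarith)
    rw [one_div_div]
    calc 4 * (√L₂ / θ + 1) ≤ 4 * (√L₂ / θ + √L₂) := by gcongr
      _ = _ := by ring
  have hS1 : (∑ m ∈ Finset.Icc 1 ⌊L₁ / π⌋₊,
      (⌊z m - theta (cof (fr L₁ m)) - 2 * ε⌋ : ℝ)) ≤ S.card := by
    simp only [S, Finset.card_map, Finset.card_sigma]
    push_cast
    refine Finset.sum_le_sum fun m _ => ?_
    exact_mod_cast floor_le_card_modes hL (cof_nonneg (fr L₁ m)) (cof_le_one _) hε.le hε₂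
      (A.filter fun j => freq hL j < cof (fr L₁ m))
      fun j hj => Finset.mem_filter.2 ⟨hA j, hj⟩
  have hS2 : (∑ j ∈ G, ((⌊x j - theta (cof (freq hL j)) - 2 * ε⌋ : ℝ) - ⌊x j⌋))
      + 2 * G.card ≤ WF.card := by
    rw [hWc, mul_comm 2 (G.card : ℝ), ← nsmul_eq_mul, ← Finset.sum_const, ← Finset.sum_add_distrib]
    push_cast
    refine Finset.sum_le_sum fun j _ => ?_
    have h6 := hth0 (freq hL j)
    have hfl : ((⌊x j⌋₊ : ℕ) : ℝ) = ⌊x j⌋ := by exact_mod_cast (natCast_floor_eq_intCast_floor (hx0 j))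
    split_ifs with hc
    · have : ⌊x j - theta (cof (freq hL j)) - 2 * ε⌋ ≤ ⌊x j⌋ := Int.floor_le_floor (by linarith)
      have : (⌊x j - theta (cof (freq hL j)) - 2 * ε⌋ : ℝ) ≤ ⌊x j⌋ := by exact_mod_cast this
      linarith
    · have hc' : x j - ⌊x j⌋₊ < theta (cof (freq hL j)) + 2 * ε := not_le.1 hc
      rw [hfl] at hc'
      have : ⌊x j - theta (cof (freq hL j)) - 2 * ε⌋ < ⌊x j⌋ := Int.floor_lt.2 (by linarith)
      have : (⌊x j - theta (cof (freq hL j)) - 2 * ε⌋ : ℝ) + 1 ≤ ⌊x j⌋ := by exact_mod_cast this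
      linarith
  simp only [hx, hz] at hS1 hS2
  linarith

/-- The centred integer part error. -/
def saw (y : ℝ) : ℝ := ⌊y⌋ - y + 1 / 2

theorem abs_saw_le (y : ℝ) : |saw y| ≤ 1 / 2 := by
  have h := Int.floor_le y
  have h2 := Int.lt_floor_add_one y
  rw [saw, abs_le]
  constructor <;> linarith

theorem abs_sum_saw_le {ι : Type*} (s : Finset ι) (f : ι → ℝ) :
    |∑ i ∈ s, saw (f i)| ≤ s.card / 2 := by
  refine (Finset.abs_sum_le_sum_abs _ _).trans ((Finset.sum_le_card_nsmul s _ _ fun i _ =>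
    abs_saw_le (f i)).trans_eq ?_)
  rw [nsmul_eq_mul]; ring

theorem saw_mono_add {x y ε : ℝ} (h : |y - x| ≤ ε) :
    saw (x - ε) - 2 * ε ≤ saw y ∧ saw y ≤ saw (x + ε) + 2 * ε := by
  rw [abs_le] at h
  have h1 : ⌊x - ε⌋ ≤ ⌊y⌋ := Int.floor_le_floor (by linarith)
  have h2 : ⌊y⌋ ≤ ⌊x + ε⌋ := Int.floor_le_floor (by linarith)
  have h1' : (⌊x - ε⌋ : ℝ) ≤ ⌊y⌋ := by exact_mod_cast h1
  have h2' : (⌊y⌋ : ℝ) ≤ ⌊x + ε⌋ := by exact_mod_cast h2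
  simp only [saw]
  constructor <;> linarith

/-- Sums of the centred integer part over a complete rational progression. -/
theorem sum_saw_progression {p : ℤ} {q : ℕ} (hq : 0 < q) (hpq : IsCoprime p (q : ℤ)) (u : ℝ) :
    ∑ i ∈ Finset.range q, saw (u + i * (p / q)) = saw (q * u) := by
  have hq' : (0 : ℝ) < q := by exact_mod_cast hq
  have hqz : (0 : ℤ) < q := by exact_mod_cast hq
  set N := ⌊q * u⌋ with hN
  set f := Int.fract (q * u)
  have hu : q * u = N + f := (Int.floor_add_fract _).symm
  have hf1 := Int.fract_lt_one (q * u)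
  let r : ℕ → ℕ := fun i => ((N + i * p) % q).toNat
  have hr : ∀ i, ((r i : ℕ) : ℤ) = (N + i * p) % q := fun i =>
    Int.toNat_of_nonneg (Int.emod_nonneg _ hqz.ne')
  have hrq : ∀ i, r i < q := fun i => by
    have := Int.emod_lt_of_pos (N + i * p) hqz
    rw [← hr] at this
    exact_mod_cast this
  have key : ∀ i : ℕ, saw (u + i * (p / q)) = 1 / 2 - (r i + f) / q := fun i => by
    have hdiv := Int.emod_add_mul_ediv (N + i * p) q
    rw [← hr] at hdiv
    have hdiv' : (r i : ℝ) + q * ((N + i * p) / (q : ℤ) : ℤ) = N + i * p := by exact_mod_cast hdiv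
    have hx : u + i * (p / q) = ((N + i * p) / (q : ℤ) : ℤ) + (r i + f) / q := by
      field_simp
      linarith
    have hfl : ⌊u + i * (p / q)⌋ = (N + i * p) / (q : ℤ) := by
      rw [Int.floor_eq_iff, hx]
      constructor
      · have : 0 ≤ (r i + f) / q := by positivity
        linarith
      · have : (r i + f) / q < 1 := by
          rw [div_lt_one hq']
          have : (r i : ℝ) + 1 ≤ q := by exact_mod_cast hrq i
          linarith
        linarith
    rw [saw, hfl, hx]
    ring
  have hinj : Set.InjOn r (Finset.range q) := fun i hi j hj hij => by
    have h1 : (N + i * p) % q = (N + j * p) % q := by rw [← hr, ← hr, hij]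
    have h2 : (q : ℤ) ∣ ((i : ℤ) - j) * p := by
      have h3 := Int.dvd_of_emod_eq_zero (Int.emod_eq_emod_iff_emod_sub_eq_zero.1 h1)
      rwa [show N + i * p - (N + j * p) = ((i : ℤ) - j) * p by ring] at h3
    have h3 : (q : ℤ) ∣ ((i : ℤ) - j) := hpq.symm.dvd_of_dvd_mul_right h2
    have hi' := Finset.mem_range.1 (Finset.mem_coe.1 hi)
    have hj' := Finset.mem_range.1 (Finset.mem_coe.1 hj)
    have := Int.eq_zero_of_abs_lt_dvd h3 (by rw [abs_lt]; omega)
    omega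
  have himg : (Finset.range q).image r = Finset.range q := by
    refine Finset.eq_of_subset_of_card_le (fun x hx => ?_) ?_
    · obtain ⟨i, -, rfl⟩ := Finset.mem_image.1 hx
      exact Finset.mem_range.2 (hrq i)
    · rw [Finset.card_image_of_injOn hinj]
  have hsum : ∑ i ∈ Finset.range q, (r i : ℝ) = ∑ i ∈ Finset.range q, (i : ℝ) := by
    rw [← Finset.sum_image (f := fun i : ℕ => (i : ℝ)) hinj, himg]
  have hgauss : ∑ i ∈ Finset.range q, (i : ℝ) = q * (q - 1) / 2 := by
    clear * -
    induction q with
    | zero => simp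
    | succ n ih => rw [Finset.sum_range_succ, ih]; push_cast; ring
  rw [Finset.sum_congr rfl fun i _ => key i, Finset.sum_sub_distrib, ← Finset.sum_div _ _ (q : ℝ),
    Finset.sum_add_distrib, hsum, hgauss]
  simp only [Finset.sum_const, Finset.card_range, nsmul_eq_mul]
  rw [saw, ← hN, hu]
  field_simp
  ring

theorem abs_sum_saw_block {p : ℤ} {q : ℕ} (hq : 0 < q) (hpq : IsCoprime p (q : ℤ)) {u ε : ℝ}
    {y : ℕ → ℝ} (hy : ∀ i < q, |y i - (u + i * (p / q))| ≤ ε) :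
    |∑ i ∈ Finset.range q, saw (y i)| ≤ 1 / 2 + 2 * ε * q := by
  have hb : ∀ v, |∑ i ∈ Finset.range q, saw (v + i * (p / q))| ≤ 1 / 2 := fun v => by
    rw [sum_saw_progression hq hpq]
    exact abs_saw_le _
  have h1 : ∑ i ∈ Finset.range q, saw (y i)
      ≤ ∑ i ∈ Finset.range q, (saw (u + ε + i * (p / q)) + 2 * ε) :=
    Finset.sum_le_sum fun i hi => by
      have := (saw_mono_add (hy i (Finset.mem_range.1 hi))).2
      rwa [show u + i * (p / q) + ε = u + ε + i * ((p : ℝ) / q) by ring] at this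
  have h2 : ∑ i ∈ Finset.range q, (saw (u - ε + i * (p / q)) - 2 * ε)
      ≤ ∑ i ∈ Finset.range q, saw (y i) :=
    Finset.sum_le_sum fun i hi => by
      have := (saw_mono_add (hy i (Finset.mem_range.1 hi))).1
      rwa [show u + i * (p / q) - ε = u - ε + i * ((p : ℝ) / q) by ring] at this
  rw [Finset.sum_add_distrib] at h1
  rw [Finset.sum_sub_distrib] at h2
  simp only [Finset.sum_const, Finset.card_range, nsmul_eq_mul] at h1 h2
  have h3 := abs_le.1 (hb (u + ε))
  have h4 := abs_le.1 (hb (u - ε))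
  rw [abs_le]
  constructor <;> linarith

theorem card_le_of_diam {s : Finset ℕ} {D : ℝ} (hD : 0 ≤ D)
    (h : ∀ n ∈ s, ∀ m ∈ s, n < m → (m - n : ℝ) ≤ D) : (s.card : ℝ) ≤ D + 1 := by
  rcases s.eq_empty_or_nonempty with rfl | hs
  · simp; linarith
  set n := s.min' hs
  have hsub : s ⊆ Finset.Icc n (n + ⌊D⌋₊) := fun m hm => by
    have hnm := s.min'_le m hm
    refine Finset.mem_Icc.2 ⟨hnm, ?_⟩
    rcases hnm.eq_or_lt with h' | h'
    · change n = m at h'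
      omega
    · have h1 := h n (s.min'_mem hs) m hm h'
      have : m - n ≤ ⌊D⌋₊ := Nat.le_floor (by
        rw [Nat.cast_sub hnm]; exact h1)
      omega
  have := Finset.card_le_card hsub
  rw [Nat.card_Icc] at this
  have h2 : s.card ≤ ⌊D⌋₊ + 1 := by omega
  have h3 : (s.card : ℝ) ≤ ⌊D⌋₊ + 1 := by exact_mod_cast h2
  linarith [Nat.floor_le hD]

theorem abs_sum_saw_le_of_slopes {q₀ Q n₀ n₁ : ℕ} (hq₀ : 0 < q₀) (hQ : 0 < Q) {y s : ℕ → ℝ}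
    (E : Finset ℕ)
    (hlin : ∀ n i, n₀ ≤ n → n + i < n₁ → i ≤ Q → |y (n + i) - y n - i * s n| ≤ 1 / Q)
    (hE : ∀ n ∈ Finset.Ico n₀ n₁, n ∉ E → ∀ r : ℚ, r.den < q₀ → 1 / (Q : ℝ) < |s n - r|)
    (d n : ℕ) (hn : n₀ ≤ n) (hd : n + d = n₁) :
    |∑ j ∈ Finset.Ico n n₁, saw (y j)|
      ≤ (1 / (2 * q₀) + 4 / Q) * d + (E.filter (n ≤ ·)).card / 2 + Q / 2 := by
  have hq₀' : (0 : ℝ) < q₀ := by exact_mod_cast hq₀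
  have hQ' : (0 : ℝ) < Q := by exact_mod_cast hQ
  have hc : 0 ≤ 1 / (2 * (q₀ : ℝ)) + 4 / Q := by positivity
  induction d using Nat.strong_induction_on generalizing n with
  | _ d ih =>
  rcases Nat.lt_or_ge d (Q + 1) with hdQ | hdQ
  · refine (abs_sum_saw_le _ _).trans ?_
    have h1 : ((Finset.Ico n n₁).card : ℝ) ≤ Q := by
      rw [Nat.card_Ico]; exact_mod_cast (by omega)
    have h2 : 0 ≤ (1 / (2 * (q₀ : ℝ)) + 4 / Q) * d := by positivity
    have h3 : (0 : ℝ) ≤ (E.filter (n ≤ ·)).card / 2 := by positivity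
    linarith
  · by_cases hnE : n ∈ E
    · have h := ih (d - 1) (by omega) (n + 1) (by omega) (by omega)
      have hsub : (E.filter (n + 1 ≤ ·)).card + 1 ≤ (E.filter (n ≤ ·)).card := by
        rw [← Finset.card_insert_of_notMem (a := n) (by simp)]
        refine Finset.card_le_card fun x hx => ?_
        rcases Finset.mem_insert.1 hx with rfl | hx
        · exact Finset.mem_filter.2 ⟨hnE, le_rfl⟩
        · have := Finset.mem_filter.1 hx
          exact Finset.mem_filter.2 ⟨this.1, by omega⟩
      have hsub' : ((E.filter (n + 1 ≤ ·)).card : ℝ) + 1 ≤ (E.filter (n ≤ ·)).card := by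
        exact_mod_cast hsub
      have hd' : ((d - 1 : ℕ) : ℝ) ≤ d := by exact_mod_cast Nat.sub_le _ _
      rw [Finset.sum_eq_sum_Ico_succ_bot (by omega)]
      have h1 := abs_saw_le (y n)
      have h2 := abs_add_le (saw (y n)) (∑ j ∈ Finset.Ico (n + 1) n₁, saw (y j))
      have h3 := mul_le_mul_of_nonneg_left hd' hc
      linarith
    · obtain ⟨r, hr, hrQ⟩ := Real.exists_rat_abs_sub_le_and_den_le (s n) hQ
      have hden : (0 : ℝ) < r.den := by exact_mod_cast r.den_pos
      have hle1 : 1 / (((Q : ℝ) + 1) * r.den) ≤ 1 / Q := by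
        refine one_div_le_one_div_of_le hQ' ?_
        have : (1 : ℝ) ≤ r.den := by exact_mod_cast r.den_pos
        nlinarith
      have hq : q₀ ≤ r.den := by
        by_contra hlt
        exact absurd (hE n (Finset.mem_Ico.2 ⟨hn, by omega⟩) hnE r (not_le.1 hlt))
          (not_lt.2 (hr.trans hle1))
      have hq' : (q₀ : ℝ) ≤ r.den := by exact_mod_cast hq
      have hblock := abs_sum_saw_block (q := r.den) (p := r.num) r.den_pos
        (Int.isCoprime_iff_gcd_eq_one.2 r.reduced) (u := y n) (ε := 2 / Q)
        (y := fun i => y (n + i)) fun i hi => by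
          have h1 := hlin n i hn (by omega) (by omega)
          have h2 : |i * (s n - r)| ≤ 1 / Q := by
            rw [abs_mul, Nat.abs_cast]
            calc (i : ℝ) * |s n - r| ≤ r.den * (1 / ((Q + 1) * r.den)) := by
                  gcongr
              _ = 1 / (Q + 1) := by field_simp
              _ ≤ 1 / Q := one_div_le_one_div_of_le hQ' (by linarith)
          have h3 : (r : ℝ) = r.num / r.den := Rat.cast_def r
          rw [← h3, show y (n + i) - (y n + i * (r : ℝ))
            = (y (n + i) - y n - i * s n) + i * (s n - r) by ring]
          refine (abs_add_le _ _).trans ?_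
          rw [show (2 : ℝ) / Q = 1 / Q + 1 / Q by ring]
          exact add_le_add h1 h2
      have h := ih (d - r.den) (by have := r.den_pos; omega) (n + r.den) (by omega) (by omega)
      have hcard : ((E.filter (n + r.den ≤ ·)).card : ℝ) ≤ (E.filter (n ≤ ·)).card := by
        exact_mod_cast Finset.card_le_card fun x hx => by
          have := Finset.mem_filter.1 hx
          exact Finset.mem_filter.2 ⟨this.1, by omega⟩
      rw [← Finset.sum_Ico_consecutive _ (show n ≤ n + r.den by omega) (by omega),
        Finset.sum_Ico_eq_sum_range]
      simp only [Nat.add_sub_cancel_left]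
      have h2 := abs_add_le (∑ i ∈ Finset.range r.den, saw (y (n + i)))
        (∑ j ∈ Finset.Ico (n + r.den) n₁, saw (y j))
      have hd' : ((d - r.den : ℕ) : ℝ) = d - r.den := Nat.cast_sub (by omega)
      rw [hd'] at h
      have h4 : (1 : ℝ) / 2 ≤ 1 / (2 * q₀) * r.den := by
        rw [div_mul_eq_mul_div, one_mul, div_le_div_iff₀ (by norm_num) (by positivity)]
        linarith
      have h5 : 2 * (2 / (Q : ℝ)) * r.den = 4 / Q * r.den := by ring
      nlinarith

/-- Equidistribution of a slowly varying sequence with separated slopes. -/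
theorem abs_sum_saw_le_mul {C S η : ℝ} (hC : 0 < C) (hS : 0 ≤ S) (hη : 0 < η) :
    ∃ L₀ : ℝ, 0 < L₀ ∧ ∀ L, L₀ ≤ L → ∀ n₀ n₁ : ℕ, (n₁ : ℝ) ≤ C * L → ∀ y s : ℕ → ℝ,
      (∀ n ∈ Finset.Ico n₀ n₁, |s n| ≤ S) →
      (∀ n i, n₀ ≤ n → n + i < n₁ → |y (n + i) - y n - i * s n| ≤ C * i ^ 2 / L) →
      (∀ n ∈ Finset.Ico n₀ n₁, ∀ m ∈ Finset.Ico n₀ n₁, n < m →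
        (m - n : ℝ) ≤ C * L * |s n - s m|) →
      |∑ n ∈ Finset.Ico n₀ n₁, saw (y n)| ≤ η * L := by
  classical
  obtain ⟨q₀, hq₀⟩ := exists_nat_gt (2 * C / η)
  have hq₀p : (0 : ℝ) < q₀ := lt_trans (by positivity) hq₀
  let N : ℤ := ⌈(S + 1) * q₀⌉
  let T : Finset ℚ := (Finset.Icc (-N) N ×ˢ Finset.range q₀).image fun p => (p.1 : ℚ) / p.2
  obtain ⟨Q, hQ⟩ := exists_nat_gt (max (16 * C / η) (4 * T.card * C / η))
  rw [max_lt_iff] at hQ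
  have hQp : (0 : ℝ) < Q := lt_trans (by positivity) hQ.1
  have hQ1 : (1 : ℝ) ≤ Q := by exact_mod_cast (show 0 < Q by exact_mod_cast hQp)
  refine ⟨max (C * Q ^ 3) ((2 * T.card + 2 * Q) / η), lt_max_of_lt_left (by positivity),
    fun L hL n₀ n₁ hn₁ y s hs hlin hsep => ?_⟩
  rw [max_le_iff] at hL
  have hLp : 0 < L := lt_of_lt_of_le (by positivity) hL.1
  rcases le_or_gt n₁ n₀ with h01 | h01
  · rw [Finset.Ico_eq_empty (by omega)]; simp; positivity
  let E : Finset ℕ := T.biUnion fun r => (Finset.Ico n₀ n₁).filter fun n => |s n - r| ≤ 1 / Q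
  have hEcard : (E.card : ℝ) ≤ T.card * (C * L * (2 / Q) + 1) := by
    have h1 : (E.card : ℝ) ≤ ∑ r ∈ T,
        (((Finset.Ico n₀ n₁).filter fun n => |s n - r| ≤ 1 / Q).card : ℝ) := by
      exact_mod_cast Finset.card_biUnion_le
    refine h1.trans ((Finset.sum_le_card_nsmul _ _ (C * L * (2 / Q) + 1) fun r _ =>
      card_le_of_diam (by positivity) fun n hn m hm hnm => ?_).trans_eq (nsmul_eq_mul _ _))
    rw [Finset.mem_filter] at hn hm
    refine (hsep n hn.1 m hm.1 hnm).trans ?_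
    gcongr
    have h2 := abs_le.1 hn.2
    have h3 := abs_le.1 hm.2
    rw [abs_le, show (2 : ℝ) / Q = 1 / Q + 1 / Q by ring]
    constructor <;> linarith
  have main := abs_sum_saw_le_of_slopes (q₀ := q₀) (Q := Q) (n₀ := n₀) (n₁ := n₁)
    (by exact_mod_cast hq₀p) (by exact_mod_cast hQp) (y := y) (s := s) E
    (fun n i hn hi hiQ => by
      refine (hlin n i hn hi).trans ?_
      have : (i : ℝ) ≤ Q := by exact_mod_cast hiQ
      rw [div_le_div_iff₀ hLp hQp]
      calc C * (i : ℝ) ^ 2 * Q ≤ C * Q ^ 2 * Q := by gcongr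
        _ ≤ 1 * L := by linarith [hL.1])
    (fun n hn hnE r hr => by
      by_contra hle
      refine hnE (Finset.mem_biUnion.2 ⟨r, ?_, Finset.mem_filter.2 ⟨hn, not_lt.1 hle⟩⟩)
      refine Finset.mem_image.2 ⟨(r.num, r.den), Finset.mem_product.2 ⟨?_, Finset.mem_range.2 hr⟩,
        Rat.num_div_den r⟩
      have hden : (0 : ℝ) < r.den := by exact_mod_cast r.den_pos
      have h1 : |(r : ℝ)| ≤ S + 1 := by
        have h2 := abs_sub_abs_le_abs_sub (r : ℝ) (s n)
        rw [abs_sub_comm] at h2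
        have h3 : 1 / (Q : ℝ) ≤ 1 := by rw [div_le_one hQp]; exact hQ1
        linarith [not_lt.1 hle, hs n hn]
      rw [Rat.cast_def, abs_div, Nat.abs_cast, div_le_iff₀ hden] at h1
      have h2 : |(r.num : ℝ)| ≤ N := by
        refine (h1.trans ?_).trans (Int.le_ceil _)
        have : (r.den : ℝ) ≤ q₀ := by exact_mod_cast hr.le
        gcongr
      have h3 : |r.num| ≤ N := by exact_mod_cast h2
      exact Finset.mem_Icc.2 (abs_le.1 h3))
    (n₁ - n₀) n₀ le_rfl (by omega)
  refine main.trans ?_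
  have h1 : ((E.filter (n₀ ≤ ·)).card : ℝ) ≤ E.card := by
    exact_mod_cast Finset.card_filter_le _ _
  have h2 : ((n₁ - n₀ : ℕ) : ℝ) ≤ C * L := le_trans (by exact_mod_cast Nat.sub_le _ _) hn₁
  have h3 : (1 / (2 * (q₀ : ℝ)) + 4 / Q) * (n₁ - n₀ : ℕ) ≤ (1 / (2 * (q₀ : ℝ)) + 4 / Q) * (C * L) := by
    gcongr
  have h4 : C / (2 * (q₀ : ℝ)) ≤ η / 4 := by
    rw [div_lt_iff₀ hη] at hq₀
    rw [div_le_iff₀ (by positivity)]; linarith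
  have h5 : 4 * C / (Q : ℝ) ≤ η / 4 := by
    have := hQ.1
    rw [div_lt_iff₀ hη] at this
    rw [div_le_iff₀ (by positivity)]; linarith
  have h6 : T.card * C / (Q : ℝ) ≤ η / 4 := by
    have := hQ.2
    rw [div_lt_iff₀ hη] at this
    rw [div_le_iff₀ (by positivity)]; linarith
  have h7 : 2 * (T.card : ℝ) + 2 * Q ≤ L * η := (div_le_iff₀ hη).1 hL.2
  have h8 := mul_le_mul_of_nonneg_right (add_le_add (add_le_add h4 h5) h6) hLp.le
  have h9 : (C / (2 * (q₀ : ℝ)) + 4 * C / Q + T.card * C / Q) * L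
    = (1 / (2 * (q₀ : ℝ)) + 4 / Q) * (C * L) + T.card * (C * L * (2 / Q)) / 2 := by ring
  linarith

theorem cof_sq {p : ℝ} (h : 0 < cof p) : cof p ^ 2 = 1 - p ^ 2 :=
  sq_sqrt (sqrt_pos.1 h).le

theorem cof_sub_bound {γ p q : ℝ} (hγ : 0 < γ) (hp : γ ≤ cof p)
    (hq : γ ≤ cof q) :
    |cof q - cof p + (q - p) * (p / cof p)| ≤ (1 + 1 / γ ^ 2) / (2 * γ) * (q - p) ^ 2 := by
  have hA : 0 < cof p := hγ.trans_le hp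
  have hB : 0 < cof q := hγ.trans_le hq
  have hA2 := cof_sq hA
  have hB2 := cof_sq hB
  set A := cof p
  set B := cof q
  have h1 : B - A + (q - p) * (p / A) = -((A - B) ^ 2 + (q - p) ^ 2) / (2 * A) := by
    field_simp
    linear_combination -hA2 + hB2
  have h2 : (A - B) ^ 2 ≤ 1 / γ ^ 2 * (q - p) ^ 2 := by
    have h3 : (A - B) * (A + B) = (q - p) * (q + p) := by linear_combination hA2 - hB2
    have h4 : ((A - B) * (A + B)) ^ 2 ≤ (q - p) ^ 2 * 4 := by
      rw [h3, mul_pow]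
      gcongr
      nlinarith
    have h5 : 4 * γ ^ 2 ≤ (A + B) ^ 2 := by nlinarith
    rw [div_mul_eq_mul_div, one_mul, le_div_iff₀ (by positivity)]
    nlinarith [mul_le_mul_of_nonneg_left h5 (sq_nonneg (A - B))]
  rw [h1, abs_div, abs_neg, abs_of_nonneg (by positivity : 0 ≤ (A - B) ^ 2 + (q - p) ^ 2),
    abs_of_pos (by positivity : 0 < 2 * A), div_mul_eq_mul_div]
  gcongr
  linarith

theorem sub_le_slope_sub {p q : ℝ} (hp0 : 0 ≤ p) (hpq : p ≤ q) (hq : 0 < cof q) :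
    q - p ≤ q / cof q - p / cof p := by
  have hle : cof q ≤ cof p := sqrt_le_sqrt (by nlinarith)
  have h1 : p / cof p ≤ p / cof q := by gcongr
  have h2 : (q - p) * 1 ≤ (q - p) * (1 / cof q) :=
    mul_le_mul_of_nonneg_left (by rw [le_div_iff₀ hq]; linarith [cof_le_one q]) (by linarith)
  have h3 : (q - p) * (1 / cof q) = q / cof q - p / cof q := by ring
  linarith

set_option maxHeartbeats 1000000 in
/-- Equidistribution of the lattice heights over nearly uniform nodes. -/
theorem abs_sum_saw_nodes {D γ C η : ℝ} (hD : 1 ≤ D) (hγ : 0 < γ) (hC : 0 ≤ C) (hη : 0 < η) :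
    ∃ L₀ : ℝ, 0 < L₀ ∧ ∀ L, L₀ ≤ L → ∀ L₁ L₂, L / D ≤ L₁ → L₁ ≤ D * L → L / D ≤ L₂ → L₂ ≤ D * L →
      ∀ n₀ n₁ : ℕ, (n₁ : ℝ) ≤ D * L → ∀ p t : ℕ → ℝ,
      (∀ n ∈ Finset.Ico n₀ n₁, 0 ≤ p n ∧ γ ≤ cof (p n)) →
      (∀ n i, n₀ ≤ n → n + i < n₁ → |p (n + i) - p n - i * (π / L₁)| ≤ C * i / L ^ 2) →
      (∀ n i, n₀ ≤ n → n + i < n₁ → |t (n + i) - t n| ≤ C * i / L) → ∀ σ : ℝ, |σ| = 1 →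
      |∑ n ∈ Finset.Ico n₀ n₁, saw (σ * (cof (p n) * L₂ / π) + t n)| ≤ η * L := by
  have hπ := pi_pos
  have hπ3 := pi_gt_three
  have hD0 : 0 < D := by linarith
  set K₁ := (1 + 1 / γ ^ 2) / (2 * γ)
  set C₁ := π * D + C with hC₁
  set C₂ := D / π * (C / γ + K₁ * C₁ ^ 2) + C with hC₂
  have hC₂0 : 0 ≤ C₂ := by positivity
  obtain ⟨L₀, hL₀, H⟩ := abs_sum_saw_le_mul (C := D + D ^ 3 + C₂) (S := D ^ 2 / γ) (η := η)
    (by positivity) (by positivity) hη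
  refine ⟨max (max L₀ 1) (C * D), by positivity, fun L hL L₁ L₂ h₁ h₁' h₂ h₂' n₀ n₁ hn₁ p t hp hpn
    ht σ hσ => ?_⟩
  simp only [max_le_iff] at hL
  obtain ⟨⟨hL1, hL2⟩, hL3⟩ := hL
  have hLp : 0 < L := by linarith
  have h₁p : 0 < L₁ := lt_of_lt_of_le (by positivity) h₁
  have h₂p : 0 < L₂ := lt_of_lt_of_le (by positivity) h₂
  have hh : π / L₁ ≤ π * D / L := by
    rw [div_le_div_iff₀ h₁p hLp]
    rw [div_le_iff₀ hD0] at h₁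
    nlinarith
  have hratio : L₂ / L₁ ≤ D ^ 2 := by
    rw [div_le_iff₀ h₁p]
    rw [div_le_iff₀ hD0] at h₁
    nlinarith
  have hratio' : 1 / D ^ 2 ≤ L₂ / L₁ := by
    rw [div_le_div_iff₀ (by positivity) h₁p]
    rw [div_le_iff₀ hD0] at h₂
    nlinarith
  have hslope : ∀ n ∈ Finset.Ico n₀ n₁, 0 ≤ p n / cof (p n) ∧ p n / cof (p n) ≤ 1 / γ :=
    fun n hn => by
      obtain ⟨h0, hg⟩ := hp n hn
      have hc : 0 < cof (p n) := by linarith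
      refine ⟨by positivity, ?_⟩
      have := cof_sq hc
      gcongr
      nlinarith
  refine H L hL1 n₀ n₁ (hn₁.trans ?_) _ (fun n => -(σ * (L₂ / L₁ * (p n / cof (p n))))) ?_ ?_ ?_
  · have : 0 ≤ (D ^ 3 + C₂) * L := by positivity
    nlinarith
  · intro n hn
    obtain ⟨h0, hg⟩ := hslope n hn
    rw [abs_neg, abs_mul, hσ, one_mul, abs_of_nonneg (by positivity),
      show D ^ 2 / γ = D ^ 2 * (1 / γ) by ring]
    gcongr
  · intro n i hn hi
    have hmn : n ∈ Finset.Ico n₀ n₁ := Finset.mem_Ico.2 ⟨hn, by omega⟩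
    have hmi : n + i ∈ Finset.Ico n₀ n₁ := Finset.mem_Ico.2 ⟨by omega, hi⟩
    obtain ⟨h0, hg⟩ := hslope n hmn
    have hi2 : (i : ℝ) ≤ i ^ 2 := by
      have : i ≤ i ^ 2 := Nat.le_self_pow (by norm_num) i
      exact_mod_cast this
    have e1 := hpn n i hn hi
    have e2 := ht n i hn hi
    have e3 := cof_sub_bound hγ (hp n hmn).2 (hp _ hmi).2
    have e4 : |p (n + i) - p n| ≤ C₁ * i / L := by
      have h1 := abs_add_le (p (n + i) - p n - i * (π / L₁)) (i * (π / L₁))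
      rw [sub_add_cancel, abs_of_nonneg (by positivity : 0 ≤ (i : ℝ) * (π / L₁))] at h1
      have h2 : C * i / L ^ 2 ≤ C * i / L := by
        gcongr
        rw [pow_two]
        exact le_mul_of_one_le_left hLp.le hL2
      have h3 : (i : ℝ) * (π / L₁) ≤ i * (π * D / L) := by gcongr
      have h4 : C₁ * i / L = i * (π * D / L) + C * i / L := by rw [hC₁]; ring
      linarith
    have e5 : (p (n + i) - p n) ^ 2 ≤ (C₁ * i / L) ^ 2 := by
      rw [← sq_abs]; gcongr
    set a := p (n + i) - p n - i * (π / L₁) with ha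
    set R := cof (p (n + i)) - cof (p n) + (p (n + i) - p n) * (p n / cof (p n)) with hR
    have key : σ * (cof (p (n + i)) * L₂ / π) + t (n + i) - (σ * (cof (p n) * L₂ / π) + t n)
        - i * -(σ * (L₂ / L₁ * (p n / cof (p n))))
        = σ * (L₂ / π * (R - a * (p n / cof (p n)))) + (t (n + i) - t n) := by
      rw [hR, ha]
      field_simp
      ring
    rw [key]
    refine (abs_add_le _ _).trans ?_
    rw [abs_mul, hσ, one_mul, abs_mul, abs_of_pos (by positivity : 0 < L₂ / π)]
    have e6 : |R - a * (p n / cof (p n))| ≤ K₁ * (C₁ * i / L) ^ 2 + C * i / L ^ 2 * (1 / γ) := by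
      refine (abs_sub _ _).trans ?_
      rw [abs_mul, abs_of_nonneg h0]
      refine add_le_add (e3.trans ?_) ?_ <;> gcongr
    have e7 : L₂ / π ≤ D * L / π := by gcongr
    calc L₂ / π * |R - a * (p n / cof (p n))| + |t (n + i) - t n|
        ≤ D * L / π * (K₁ * (C₁ * i / L) ^ 2 + C * i / L ^ 2 * (1 / γ)) + C * i / L := by
          gcongr
      _ = D / π * (C / γ * i + K₁ * C₁ ^ 2 * i ^ 2) / L + C * i / L := by field_simp; ring
      _ ≤ D / π * (C / γ * i ^ 2 + K₁ * C₁ ^ 2 * i ^ 2) / L + C * i ^ 2 / L := by gcongr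
      _ = C₂ * i ^ 2 / L := by rw [hC₂]; ring
      _ ≤ _ := by
        gcongr
        have : 0 ≤ D + D ^ 3 := by positivity
        linarith
  · intro n hn m hm hnm
    obtain ⟨i, rfl⟩ := Nat.exists_eq_add_of_lt hnm
    rw [show n + i + 1 = n + (i + 1) by ring] at hm ⊢
    have e1 := (abs_le.1 (hpn n (i + 1) (Finset.mem_Ico.1 hn).1 (Finset.mem_Ico.1 hm).2)).1
    set d : ℝ := ((i + 1 : ℕ) : ℝ) with hd
    have hd0 : 0 < d := by positivity
    have hh2 : π / (D * L) ≤ π / L₁ := by gcongr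
    have e2 : d / (D * L) ≤ p (n + (i + 1)) - p n := by
      have h1 : d * (π / (D * L)) ≤ d * (π / L₁) := by gcongr
      have h2 : C * d / L ^ 2 ≤ d * (2 / (D * L)) := by
        rw [mul_div_assoc', div_le_div_iff₀ (by positivity) (by positivity)]
        nlinarith [mul_pos hd0 (mul_pos hLp hLp)]
      have h3 : d / (D * L) + d * (2 / (D * L)) ≤ d * (π / (D * L)) := by
        rw [← mul_one_div d, ← mul_add, ← add_div]
        gcongr
        linarith
      linarith
    have e2' : 0 ≤ d / (D * L) := by positivity
    have e3 := sub_le_slope_sub (hp n hn).1 (show p n ≤ p (n + (i + 1)) by linarith)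
      (hγ.trans_le (hp _ hm).2)
    have e4 : |-(σ * (L₂ / L₁ * (p n / cof (p n))))
        - -(σ * (L₂ / L₁ * (p (n + (i + 1)) / cof (p (n + (i + 1))))))|
        = L₂ / L₁ * (p (n + (i + 1)) / cof (p (n + (i + 1))) - p n / cof (p n)) := by
      rw [show ∀ x y : ℝ, -(σ * (L₂ / L₁ * x)) - -(σ * (L₂ / L₁ * y)) = σ * (L₂ / L₁ * (y - x)) by
        intro x y; ring, abs_mul, hσ, one_mul, abs_of_nonneg]
      exact mul_nonneg (by positivity) (by linarith)
    rw [e4]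
    have e5 : 1 / D ^ 2 * (d / (D * L)) ≤
        L₂ / L₁ * (p (n + (i + 1)) / cof (p (n + (i + 1))) - p n / cof (p n)) := by
      gcongr
      linarith
    calc ((n + (i + 1) : ℕ) : ℝ) - n = d := by rw [hd]; push_cast; ring
      _ = D ^ 3 * L * (1 / D ^ 2 * (d / (D * L))) := by field_simp
      _ ≤ _ := by
        gcongr
        linarith

theorem continuous_cof : Continuous cof := by unfold cof; fun_prop

theorem cof_zero : cof 0 = 1 := by simp [cof]

theorem cof_anti {p q : ℝ} (hp : 0 ≤ p) (hpq : p ≤ q) : cof q ≤ cof p :=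
  sqrt_le_sqrt (by nlinarith)

theorem cof_sq' {p : ℝ} (hp : 0 ≤ p) (hp1 : p ≤ 1) : cof p ^ 2 = 1 - p ^ 2 :=
  sq_sqrt (by nlinarith)

theorem cof_le_sqrt {p : ℝ} : cof p ≤ √(2 * (1 - p)) :=
  sqrt_le_sqrt (by nlinarith [sq_nonneg (1 - p)])

theorem integral_cof : ∫ x in (0 : ℝ)..1, cof x = π / 4 := by
  have h := integral_sqrt_one_sub_sq
  have h1 : ∫ x in (-1 : ℝ)..0, cof x = ∫ x in (0 : ℝ)..1, cof x := by
    have := intervalIntegral.integral_comp_neg (f := cof) (a := 0) (b := 1)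
    rw [neg_zero] at this
    rw [← this]
    simp [cof]
  have h2 := intervalIntegral.integral_add_adjacent_intervals
    (continuous_cof.intervalIntegrable (-1) 0 (μ := volume)) (continuous_cof.intervalIntegrable 0 1)
  change ∫ x in (-1 : ℝ)..1, cof x = π / 2 at h
  linarith

theorem chord_le_integral_cof {a b : ℝ} (ha : 0 ≤ a) (hab : a ≤ b) (hb : b ≤ 1) :
    (b - a) * (cof a + cof b) / 2 ≤ ∫ x in a..b, cof x := by
  rcases hab.eq_or_lt with rfl | hlt
  · simp
  have hA := cof_sq' ha (by linarith)
  have hB := cof_sq' (ha.trans hab) hb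
  have h1 : ∫ x in a..b, ((b - x) * cof a + (x - a) * cof b) / (b - a)
      = (b - a) * (cof a + cof b) / 2 := by
    rw [intervalIntegral.integral_div, intervalIntegral.integral_add
      ((by fun_prop : Continuous fun x : ℝ => (b - x) * cof a).intervalIntegrable _ _)
      ((by fun_prop : Continuous fun x : ℝ => (x - a) * cof b).intervalIntegrable _ _),
      intervalIntegral.integral_mul_const, intervalIntegral.integral_mul_const,
      intervalIntegral.integral_sub (by simp) (by simp),
      intervalIntegral.integral_sub (by simp) (by simp)]
    simp only [intervalIntegral.integral_const, integral_id, smul_eq_mul]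
    field_simp
    ring
  rw [← h1]
  refine intervalIntegral.integral_mono_on hab
    ((by fun_prop : Continuous fun x : ℝ => ((b - x) * cof a + (x - a) * cof b) / (b - a)).intervalIntegrable _ _)
    (continuous_cof.intervalIntegrable _ _) fun x hx => ?_
  refine le_sqrt_of_sq_le ?_
  rw [div_pow, div_le_iff₀ (by positivity)]
  have hu : 0 ≤ b - x := by linarith [hx.2]
  have hv : 0 ≤ x - a := by linarith [hx.1]
  have h2 : cof a * cof b + a * b ≤ 1 := by nlinarith [sq_nonneg (cof a - cof b), sq_nonneg (a - b)]
  have h3 := mul_le_mul_of_nonneg_left h2 (mul_nonneg hu hv)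
  have h4 : (1 - x ^ 2) * (b - a) ^ 2 - ((b - x) * cof a + (x - a) * cof b) ^ 2
    = 2 * ((b - x) * (x - a) * 1 - (b - x) * (x - a) * (cof a * cof b + a * b)) := by
    linear_combination (-(b - x) ^ 2) * hA - (x - a) ^ 2 * hB
  linarith

theorem integral_cof_le_tangent {a b : ℝ} (ha : 0 ≤ a) (hab : a < b) (hb : b ≤ 1) :
    ∫ x in a..b, cof x ≤ (b - a) * cof ((a + b) / 2) := by
  set c := (a + b) / 2 with hc
  have hc0 : 0 < c := by linarith
  have hc1 : c < 1 := by linarith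
  have hC : 0 < cof c := sqrt_pos.2 (by nlinarith)
  have hC2 := cof_sq hC
  have h1 : ∫ x in a..b, (1 - x * c) / cof c = (b - a) * cof c := by
    rw [intervalIntegral.integral_div, intervalIntegral.integral_sub (by simp)
      ((by fun_prop : Continuous fun x : ℝ => x * c).intervalIntegrable _ _),
      intervalIntegral.integral_mul_const]
    simp only [intervalIntegral.integral_const, integral_id, smul_eq_mul]
    rw [div_eq_iff hC.ne']
    rw [mul_assoc, ← pow_two, hC2, hc]
    ring
  rw [← h1]
  refine intervalIntegral.integral_mono_on hab.le (continuous_cof.intervalIntegrable _ _)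
    ((by fun_prop : Continuous fun x : ℝ => (1 - x * c) / cof c).intervalIntegrable _ _) fun x hx => ?_
  have hx0 : 0 ≤ x := ha.trans hx.1
  have hx1 : x ≤ 1 := hx.2.trans hb
  have hX := cof_sq' hx0 hx1
  rw [le_div_iff₀ hC]
  nlinarith [sq_nonneg (cof x - cof c), sq_nonneg (x - c)]

theorem integral_cof_nonneg {a b : ℝ} (hab : a ≤ b) : 0 ≤ ∫ x in a..b, cof x :=
  intervalIntegral.integral_nonneg hab fun x _ => cof_nonneg x

theorem integral_cof_le {a b : ℝ} (ha : 0 ≤ a) (hab : a ≤ b) :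
    ∫ x in a..b, cof x ≤ (b - a) * cof a := by
  have := intervalIntegral.integral_mono_on hab (continuous_cof.intervalIntegrable a b (μ := volume))
    (by simp : IntervalIntegrable (fun _ => cof a) volume a b) fun x hx => cof_anti ha hx.1
  simpa using this

theorem integral_cof_add (a b c : ℝ) :
    (∫ x in a..b, cof x) + ∫ x in b..c, cof x = ∫ x in a..c, cof x :=
  intervalIntegral.integral_add_adjacent_intervals (continuous_cof.intervalIntegrable _ _)
    (continuous_cof.intervalIntegrable _ _)

theorem sum_cof_le {h : ℝ} (hh : 0 < h) {N : ℕ} (hN : N * h ≤ 1) :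
    ∑ m ∈ Finset.Icc 1 N, cof (m * h) ≤ π / (4 * h) - 1 / 2 + cof (N * h) / 2 := by
  have key : ∀ M : ℕ, M ≤ N → h * ∑ m ∈ Finset.Icc 1 M, cof (m * h) + h / 2 - h / 2 * cof (M * h)
      ≤ ∫ x in (0 : ℝ)..M * h, cof x := fun M => by
    induction M with
    | zero => simp [cof_zero]
    | succ M ih =>
      intro hM
      have h1 := ih (by omega)
      have hM' : ((M + 1 : ℕ) : ℝ) * h ≤ 1 := le_trans (by gcongr) hN
      have h2 := chord_le_integral_cof (a := M * h) (b := (M + 1 : ℕ) * h) (by positivity)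
        (by push_cast; nlinarith) hM'
      rw [← integral_cof_add 0 (M * h), Finset.sum_Icc_succ_top (by omega)]
      rw [show ((M + 1 : ℕ) : ℝ) * h - M * h = h by push_cast; ring] at h2
      linarith
  have h1 := key N le_rfl
  have h2 := integral_cof_add 0 (N * h) 1
  have h3 := integral_cof_nonneg hN
  rw [integral_cof] at h2
  have h4 : h * ∑ m ∈ Finset.Icc 1 N, cof (m * h) ≤ h * (π / (4 * h) - 1 / 2 + cof (N * h) / 2) := by
    have : h * (π / (4 * h) - 1 / 2 + cof (N * h) / 2) = π / 4 - h / 2 + h / 2 * cof (N * h) := by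
      field_simp
    linarith
  exact le_of_mul_le_mul_left h4 hh

theorem le_sum_cof {h : ℝ} (hh : 0 < h) {N : ℕ} (hN0 : 1 ≤ N) (hN : N * h ≤ 1) (hN1 : 1 < (N + 1) * h) :
    π / (4 * h) - 1 / 2 - 3 * √h ≤ ∑ m ∈ Finset.Icc 1 N, cof (m * h) := by
  have key : ∀ M : ℕ, M + 1 ≤ N → ∫ x in (h / 2)..(M + 1 / 2) * h, cof x
      ≤ h * ∑ m ∈ Finset.Icc 1 M, cof (m * h) := fun M => by
    induction M with
    | zero => intro _; simp [show (2 : ℝ)⁻¹ * h = h / 2 by ring]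
    | succ M ih =>
      intro hM
      have h1 := ih (by omega)
      have hM' : ((M + 1 + 1 : ℕ) : ℝ) * h ≤ 1 := le_trans (by gcongr) hN
      push_cast at hM' ⊢
      have h2 := integral_cof_le_tangent (a := (M + 1 / 2) * h) (b := (M + 1 + 1 / 2) * h)
        (by positivity) (by nlinarith) (by nlinarith)
      rw [← integral_cof_add _ ((M + 1 / 2) * h), Finset.sum_Icc_succ_top (by omega)]
      rw [show ((M : ℝ) + 1 + 1 / 2) * h - (M + 1 / 2) * h = h by ring,
        show (((M : ℝ) + 1 / 2) * h + (M + 1 + 1 / 2) * h) / 2 = (M + 1) * h by ring] at h2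
      push_cast
      linarith
  obtain ⟨M, rfl⟩ : ∃ M, N = M + 1 := ⟨N - 1, by omega⟩
  push_cast at hN hN1
  have h1 := key M le_rfl
  have h2 := integral_cof_add 0 (h / 2) 1
  have h3 := integral_cof_add (h / 2) ((M + 1 / 2) * h) 1
  have h4 := integral_cof_le (a := 0) (b := h / 2) le_rfl (by linarith)
  have h5 := integral_cof_le (a := (M + 1 / 2) * h) (b := 1) (by positivity) (by nlinarith)
  rw [cof_zero] at h4
  rw [integral_cof] at h2
  have h6 : cof ((M + 1 / 2) * h) ≤ 2 * √h := by
    refine cof_le_sqrt.trans ?_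
    rw [show 2 * √h = √(4 * h) by
      rw [sqrt_mul (by norm_num), show (4 : ℝ) = 2 ^ 2 by norm_num, sqrt_sq (by norm_num)]]
    exact sqrt_le_sqrt (by nlinarith)
  have h7 : (1 - (M + 1 / 2) * h) * cof ((M + 1 / 2) * h) ≤ 3 / 2 * h * (2 * √h) := by
    gcongr
    · exact cof_nonneg _
    · nlinarith
  rw [Finset.sum_Icc_succ_top (by omega)]
  have h8 := cof_nonneg ((M + 1 : ℕ) * h)
  have h9 : h * (π / (4 * h) - 1 / 2 - 3 * √h) ≤ h * ∑ m ∈ Finset.Icc 1 M, cof (m * h) := by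
    have : h * (π / (4 * h) - 1 / 2 - 3 * √h) = π / 4 - h / 2 - 3 / 2 * h * (2 * √h) := by
      field_simp
    linarith
  linarith [le_of_mul_le_mul_left h9 hh]

/-- The mean phase loss. -/
def meanPhase : ℝ := ∫ x in (0 : ℝ)..1, theta (cof x)

theorem theta_mono {k l : ℝ} (h : k ≤ l) : theta k ≤ theta l := by
  unfold theta
  gcongr

theorem continuous_theta_cof : Continuous fun x => theta (cof x) := by
  unfold theta
  have := continuous_cof
  fun_prop

theorem theta_cof_nonneg (x : ℝ) : 0 ≤ theta (cof x) := theta_nonneg (cof_nonneg x)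

theorem theta_cof_le_half (x : ℝ) : theta (cof x) ≤ 1 / 2 := theta_le_half (cof_le_one x)

theorem theta_cof_anti {p q : ℝ} (hp : 0 ≤ p) (hpq : p ≤ q) : theta (cof q) ≤ theta (cof p) :=
  theta_mono (cof_anti hp hpq)

theorem meanPhase_nonneg : 0 ≤ meanPhase :=
  intervalIntegral.integral_nonneg zero_le_one fun _ _ => theta_cof_nonneg _

theorem integral_theta_bounds {a b : ℝ} (hab : a ≤ b) :
    0 ≤ ∫ x in a..b, theta (cof x) ∧ ∫ x in a..b, theta (cof x) ≤ (b - a) / 2 := by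
  refine ⟨intervalIntegral.integral_nonneg hab fun _ _ => theta_cof_nonneg _, ?_⟩
  have := intervalIntegral.integral_mono_on hab
    (continuous_theta_cof.intervalIntegrable a b (μ := volume))
    (by simp : IntervalIntegrable (fun _ => (1 / 2 : ℝ)) volume a b) fun x _ => theta_cof_le_half x
  simpa [div_eq_mul_inv] using this

theorem integral_theta_add (a b c : ℝ) :
    (∫ x in a..b, theta (cof x)) + ∫ x in b..c, theta (cof x) = ∫ x in a..c, theta (cof x) :=
  intervalIntegral.integral_add_adjacent_intervals (continuous_theta_cof.intervalIntegrable _ _)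
    (continuous_theta_cof.intervalIntegrable _ _)

theorem meanPhase_le_half : meanPhase ≤ 1 / 2 := by
  have := (integral_theta_bounds (zero_le_one (α := ℝ))).2
  simpa [meanPhase] using this

theorem antitoneOn_theta_scaled {h : ℝ} (hh : 0 < h) (a b : ℕ) :
    AntitoneOn (fun x => theta (cof (x * h))) (Set.Icc (a : ℝ) b) := fun x hx y _ hxy => by
  have : (0 : ℝ) ≤ x := (Nat.cast_nonneg a).trans hx.1
  exact theta_cof_anti (by positivity) (by gcongr)

theorem sum_theta_le {h : ℝ} (hh : 0 < h) {a b : ℕ} (hab : a ≤ b) :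
    ∑ j ∈ Finset.Ico a b, theta (cof ((j + 1 : ℕ) * h)) ≤ h⁻¹ * ∫ x in (a * h)..(b * h), theta (cof x) := by
  have := (antitoneOn_theta_scaled hh a b).sum_le_integral_Ico hab
  rwa [intervalIntegral.integral_comp_mul_right (fun x => theta (cof x)) hh.ne', smul_eq_mul] at this

theorem le_sum_theta {h : ℝ} (hh : 0 < h) {a b : ℕ} (hab : a ≤ b) :
    h⁻¹ * ∫ x in (a * h)..(b * h), theta (cof x) ≤ ∑ j ∈ Finset.Ico a b, theta (cof (j * h)) := by
  have := (antitoneOn_theta_scaled hh a b).integral_le_sum_Ico hab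
  rwa [intervalIntegral.integral_comp_mul_right (fun x => theta (cof x)) hh.ne', smul_eq_mul] at this

theorem abs_theta_sub_le {k l : ℝ} (hk0 : 0 ≤ k) (hk : k ≤ 1) (hl0 : 0 ≤ l) (hl : l ≤ 1) :
    |theta k - theta l| ≤ |k - l| := by
  have hπ := pi_gt_three
  have hs : (√2 : ℝ) ^ 2 = 2 := sq_sqrt (by norm_num)
  have hb : ∀ x ∈ Set.Icc (0 : ℝ) 1, 1 / 2 ≤ 1 - (x / √2) ^ 2 := fun x hx => by
    rw [div_pow, hs]
    nlinarith [hx.1, hx.2]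
  have h := (convex_Icc (0 : ℝ) 1).norm_image_sub_le_of_norm_hasDerivWithin_le (f := theta)
    (f' := fun x => 2 / π * (1 / √(1 - (x / √2) ^ 2) * (1 / √2))) (C := 1) (fun x hx => by
      have hx' := hb x hx
      have h1 : x / √2 ≠ -1 := fun h => by rw [h] at hx'; norm_num at hx'
      have h3 : x / √2 ≠ 1 := fun h => by rw [h] at hx'; norm_num at hx'
      exact (((hasDerivAt_arcsin h1 h3).comp x ((hasDerivAt_id x).div_const √2)).const_mul
        (2 / π)).hasDerivWithinAt) (fun x hx => by
      have hx' := hb x hx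
      have h3 : 1 / √2 ≤ √(1 - (x / √2) ^ 2) := by
        refine le_sqrt_of_sq_le ?_
        rw [div_pow, hs]; linarith
      rw [norm_eq_abs, abs_of_nonneg (by positivity)]
      calc 2 / π * (1 / √(1 - (x / √2) ^ 2) * (1 / √2)) ≤ 1 * (1 / (1 / √2) * (1 / √2)) := by
            gcongr
            rw [div_le_one (by positivity)]; linarith
        _ = 1 := by field_simp) ⟨hl0, hl⟩ ⟨hk0, hk⟩
  simpa [norm_eq_abs] using h

theorem abs_cof_sub_le {γ p q : ℝ} (hγ : 0 < γ) (hp0 : 0 ≤ p) (hq0 : 0 ≤ q) (hp : γ ≤ cof p)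
    (hq : γ ≤ cof q) : |cof p - cof q| ≤ 1 / γ * |p - q| := by
  have hA2 := cof_sq (hγ.trans_le hp)
  have hB2 := cof_sq (hγ.trans_le hq)
  have hp1 : p ≤ 1 := by nlinarith
  have hq1 : q ≤ 1 := by nlinarith
  have h1 : |cof p - cof q| * (cof p + cof q) = |p - q| * (p + q) := by
    have h := congrArg abs (show (cof p - cof q) * (cof p + cof q) = -((p - q) * (p + q)) by
      linear_combination hA2 - hB2)
    rwa [abs_neg, abs_mul, abs_mul, abs_of_pos (by linarith : 0 < cof p + cof q),
      abs_of_nonneg (by linarith : 0 ≤ p + q)] at h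
  rw [div_mul_eq_mul_div, one_mul, le_div_iff₀ hγ]
  have h2 := abs_nonneg (cof p - cof q)
  have h3 := abs_nonneg (p - q)
  nlinarith

theorem abs_theta_cof_sub_le {γ p q : ℝ} (hγ : 0 < γ) (hp0 : 0 ≤ p) (hq0 : 0 ≤ q)
    (hp : γ ≤ cof p) (hq : γ ≤ cof q) :
    |theta (cof p) - theta (cof q)| ≤ 1 / γ * |p - q| :=
  (abs_theta_sub_le (cof_nonneg p) (cof_le_one p) (cof_nonneg q) (cof_le_one q)).trans
    (abs_cof_sub_le hγ hp0 hq0 hp hq)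

theorem cof_cof {p : ℝ} (hp : 0 ≤ p) (hp1 : p ≤ 1) : cof (cof p) = p := by
  rw [cof, cof_sq' hp hp1, sub_sub_cancel, sqrt_sq hp]

theorem one_sub_cof_le {p : ℝ} (hp : 0 ≤ p) (hp1 : p ≤ 1) : 1 - cof p ≤ p ^ 2 := by
  have h1 := cof_sq' hp hp1
  have h2 := cof_nonneg p
  have h3 := cof_le_one p
  nlinarith

theorem sum_floor_eq {ι : Type*} (s : Finset ι) (f : ι → ℝ) :
    ∑ i ∈ s, (⌊f i⌋ : ℝ) = ∑ i ∈ s, f i - s.card / 2 + ∑ i ∈ s, saw (f i) := by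
  have : ∀ i ∈ s, (⌊f i⌋ : ℝ) = f i - 1 / 2 + saw (f i) := fun i _ => by rw [saw]; ring
  rw [Finset.sum_congr rfl this, Finset.sum_add_distrib, Finset.sum_sub_distrib, Finset.sum_const,
    nsmul_eq_mul]
  ring

/-- The centred integer part errors over uniform nodes. -/
theorem abs_sum_saw_uniform {D η : ℝ} (hD : 1 ≤ D) (hη : 0 < η) :
    ∃ L₀ : ℝ, 0 < L₀ ∧ ∀ L, L₀ ≤ L → ∀ L₁ L₂, L / D ≤ L₁ → L₁ ≤ D * L → L / D ≤ L₂ → L₂ ≤ D * L →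
      ∀ c : ℝ, |∑ m ∈ Finset.Icc 1 ⌊L₁ / π⌋₊,
        saw (cof (fr L₁ m) * L₂ / π - theta (cof (fr L₁ m)) + c)| ≤ η * L := by
  have hπ := pi_pos
  have hπ3 := pi_gt_three
  have hD0 : 0 < D := by linarith
  obtain ⟨γ, hγ0, hγ1, hγ⟩ : ∃ γ : ℝ, 0 < γ ∧ γ ≤ 1 ∧ γ ^ 2 * D ≤ η / 2 := by
    refine ⟨min 1 (η / (2 * D)), by positivity, min_le_left _ _, ?_⟩
    have h1 : min 1 (η / (2 * D)) ^ 2 ≤ 1 * (η / (2 * D)) := by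
      rw [pow_two]
      exact mul_le_mul (min_le_left _ _) (min_le_right _ _) (by positivity) zero_le_one
    calc _ ≤ 1 * (η / (2 * D)) * D := by gcongr
      _ = η / 2 := by field_simp
  obtain ⟨L₀, hL₀, H⟩ := abs_sum_saw_nodes (D := D) (γ := γ) (C := 1 / γ * (π * D)) (η := η / 2) hD hγ0
    (by positivity) (by positivity)
  refine ⟨max L₀ (2 / η), by positivity, fun L hL L₁ L₂ h₁ h₁' h₂ h₂' c => ?_⟩
  rw [max_le_iff] at hL
  have hLp : 0 < L := by linarith
  have h₁p : 0 < L₁ := lt_of_lt_of_le (by positivity) h₁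
  have hc0 := cof_nonneg γ
  have hc1 := cof_le_one γ
  have hfr : ∀ m, fr L₁ m = m * π / L₁ := fun m => rfl
  set N := ⌊L₁ / π⌋₊
  set n₁ := ⌊cof γ * (L₁ / π)⌋₊ + 1 with hn₁
  have hNle : (N : ℝ) ≤ L₁ / π := Nat.floor_le (by positivity)
  have hn₁N : n₁ ≤ N + 1 := by
    rw [hn₁]
    have := Nat.floor_le_floor (mul_le_of_le_one_left (by positivity : 0 ≤ L₁ / π) hc1)
    omega
  have hh : π / L₁ ≤ π * D / L := by
    rw [div_le_div_iff₀ h₁p hLp]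
    rw [div_le_iff₀ hD0] at h₁
    nlinarith
  have hLπ : L₁ / π ≤ D * L / 3 := by gcongr
  have hgood : ∀ n ∈ Finset.Ico 1 n₁, 0 ≤ fr L₁ n ∧ γ ≤ cof (fr L₁ n) := fun n hn => by
    have h0 : 0 ≤ fr L₁ n := fr_nonneg h₁p n
    refine ⟨h0, ?_⟩
    have h1 : n ≤ ⌊cof γ * (L₁ / π)⌋₊ := by have := (Finset.mem_Ico.1 hn).2; omega
    have h2 : (n : ℝ) ≤ cof γ * (L₁ / π) := (Nat.cast_le.2 h1).trans (Nat.floor_le (by positivity))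
    rw [← cof_cof hγ0.le hγ1]
    refine cof_anti h0 ?_
    rw [hfr, div_le_iff₀ h₁p]
    rw [mul_div_assoc', le_div_iff₀ hπ] at h2
    linarith
  have hmain := H L hL.1 L₁ L₂ h₁ h₁' h₂ h₂'
  have hsplit : Finset.Icc 1 N = Finset.Ico 1 (N + 1) := rfl
  rw [hsplit, ← Finset.sum_Ico_consecutive _ (show 1 ≤ n₁ by omega) hn₁N]
  refine (abs_add_le _ _).trans ?_
  have hB : |∑ m ∈ Finset.Ico n₁ (N + 1),
      saw (cof (fr L₁ m) * L₂ / π - theta (cof (fr L₁ m)) + c)| ≤ η / 2 * L := by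
    refine (abs_sum_saw_le _ _).trans ?_
    rw [Nat.card_Ico, Nat.cast_sub hn₁N]
    have h3 := Nat.lt_floor_add_one (cof γ * (L₁ / π))
    have h4 : cof γ * (L₁ / π) < n₁ := by rw [hn₁]; push_cast; exact h3
    have h5 := mul_le_mul_of_nonneg_right (one_sub_cof_le hγ0.le hγ1) (by positivity : 0 ≤ L₁ / π)
    have h6 : γ ^ 2 * (L₁ / π) ≤ γ ^ 2 * (D * L / 3) := by gcongr
    have h7 : 2 ≤ L * η := (div_le_iff₀ hη).1 hL.2
    have h8 := mul_le_mul_of_nonneg_right hγ hLp.le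
    push_cast
    nlinarith
  have hA : |∑ m ∈ Finset.Ico 1 n₁,
      saw (cof (fr L₁ m) * L₂ / π - theta (cof (fr L₁ m)) + c)| ≤ η / 2 * L := by
    rcases le_or_gt (n₁ : ℝ) (D * L) with hn | hn
    · have := hmain 1 n₁ hn (fun n => fr L₁ n) (fun n => -theta (cof (fr L₁ n)) + c) hgood
        (fun n i hn hi => by
          rw [hfr, hfr]
          push_cast
          rw [show ((n : ℝ) + i) * π / L₁ - n * π / L₁ - i * (π / L₁) = 0 by ring, abs_zero]
          positivity)
        (fun n i hn hi => by
          have e1 := hgood n (Finset.mem_Ico.2 ⟨hn, by omega⟩)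
          have e2 := hgood (n + i) (Finset.mem_Ico.2 ⟨by omega, hi⟩)
          have e3 := abs_theta_cof_sub_le hγ0 e1.1 e2.1 e1.2 e2.2
          rw [show -theta (cof (fr L₁ (n + i))) + c - (-theta (cof (fr L₁ n)) + c)
            = theta (cof (fr L₁ n)) - theta (cof (fr L₁ (n + i))) by ring]
          refine e3.trans ?_
          have e4 : |fr L₁ n - fr L₁ (n + i)| = i * (π / L₁) := by
            rw [hfr, hfr, abs_sub_comm]
            push_cast
            rw [show ((n : ℝ) + i) * π / L₁ - n * π / L₁ = i * (π / L₁) by ring,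
              abs_of_nonneg (by positivity)]
          rw [e4]
          calc 1 / γ * (i * (π / L₁)) ≤ 1 / γ * (i * (π * D / L)) := by gcongr
            _ = _ := by ring) 1 abs_one
      refine le_trans (le_of_eq ?_) this
      congr 1
      refine Finset.sum_congr rfl fun m _ => ?_
      congr 1
      ring
    · have h3 : (n₁ : ℝ) ≤ D * L / 3 + 1 := by
        have : (n₁ : ℝ) ≤ N + 1 := by exact_mod_cast hn₁N
        linarith
      refine (abs_sum_saw_le _ _).trans ?_
      rw [Nat.card_Ico, Nat.cast_sub (by omega)]
      have h7 : 2 ≤ L * η := (div_le_iff₀ hη).1 hL.2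
      push_cast
      nlinarith
  linarith

set_option maxHeartbeats 1000000 in
/-- The lattice count with uniform nodes. -/
theorem abs_sum_floor_uniform {D η : ℝ} (hD : 1 ≤ D) (hη : 0 < η) :
    ∃ L₀ : ℝ, 0 < L₀ ∧ ∀ L, L₀ ≤ L → ∀ L₁ L₂, L / D ≤ L₁ → L₁ ≤ D * L → L / D ≤ L₂ → L₂ ≤ D * L →
      ∀ c : ℝ, |c| ≤ 1 → |∑ m ∈ Finset.Icc 1 ⌊L₁ / π⌋₊,
        (⌊cof (fr L₁ m) * L₂ / π - theta (cof (fr L₁ m)) + c⌋ : ℝ)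
        - (L₁ * L₂ / (4 * π) - L₂ / (2 * π) - (1 / 2 + meanPhase - c) * (L₁ / π))| ≤ η * L := by
  have hπ := pi_pos
  have hπ3 := pi_gt_three
  have hD0 : 0 < D := by linarith
  obtain ⟨L₀, hL₀, H⟩ := abs_sum_saw_uniform (η := η / 2) hD (by positivity)
  refine ⟨max (max L₀ (8 * D)) (max (12 / η) (48 * D ^ 2 * D / η ^ 2 * 4 * D ^ 2)), by positivity,
    fun L hL L₁ L₂ h₁ h₁' h₂ h₂' c hc => ?_⟩
  simp only [max_le_iff] at hL
  obtain ⟨⟨hL1, hL2⟩, hL3, hL4⟩ := hL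
  have hLp : 0 < L := by linarith
  have h₁p : 0 < L₁ := lt_of_lt_of_le (by positivity) h₁
  have h₂p : 0 < L₂ := lt_of_lt_of_le (by positivity) h₂
  have h8 : 8 ≤ L₁ := by
    refine le_trans ?_ h₁
    rw [le_div_iff₀ hD0]; exact hL2
  have hS := H L hL1 L₁ L₂ h₁ h₁' h₂ h₂' c
  set N := ⌊L₁ / π⌋₊
  set h := π / L₁ with hh
  have hh0 : 0 < h := by positivity
  have hinv : h⁻¹ = L₁ / π := by rw [hh, inv_div]
  have hNle : (N : ℝ) ≤ L₁ / π := Nat.floor_le (by positivity)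
  have hNlt : L₁ / π < N + 1 := Nat.lt_floor_add_one _
  have hN1 : 1 ≤ N := Nat.le_floor (by
    rw [le_div_iff₀ hπ]; push_cast; linarith [pi_lt_four])
  have hNh : N * h ≤ 1 := by
    rw [hh, mul_div_assoc', div_le_one h₁p]
    rwa [le_div_iff₀ hπ] at hNle
  have hNh1 : 1 < (N + 1) * h := by
    rw [hh, mul_div_assoc', one_lt_div h₁p]
    rwa [div_lt_iff₀ hπ] at hNlt
  have hfr : ∀ m : ℕ, fr L₁ m = m * h := fun m => by rw [hh, fr]; ring
  rw [sum_floor_eq, Finset.sum_add_distrib, Finset.sum_sub_distrib]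
  simp only [hfr] at hS ⊢
  have hc1 := sum_cof_le hh0 hNh
  have hc2 := le_sum_cof hh0 hN1 hNh hNh1
  have hcN : cof (N * h) / 2 ≤ 3 * √h := by
    have := cof_le_sqrt (p := N * h)
    have h3 : √(2 * (1 - N * h)) ≤ √(4 * h) := sqrt_le_sqrt (by nlinarith)
    have h4 : √(4 * h) = 2 * √h := by
      rw [sqrt_mul (by norm_num), show (4 : ℝ) = 2 ^ 2 by norm_num, sqrt_sq (by norm_num)]
    linarith [sqrt_nonneg h]
  have h4h : π / (4 * h) = L₁ / 4 := by rw [hh]; field_simp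
  rw [h4h] at hc1 hc2
  have ht1 : ∑ m ∈ Finset.Icc 1 N, theta (cof (m * h)) ≤ meanPhase * (L₁ / π) := by
    have h3 := sum_theta_le hh0 (Nat.zero_le N)
    rw [Finset.sum_Ico_add' (fun j : ℕ => theta (cof (j * h))) 0 N 1, hinv, Nat.cast_zero, zero_mul]
      at h3
    have h5 := integral_theta_add 0 (N * h) 1
    have h6 := (integral_theta_bounds hNh).1
    refine h3.trans ?_
    rw [mul_comm]
    gcongr
    rw [meanPhase]; linarith
  have ht2 : meanPhase * (L₁ / π) - 1 ≤ ∑ m ∈ Finset.Icc 1 N, theta (cof (m * h)) := by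
    have h3 := le_sum_theta hh0 (show 1 ≤ N + 1 by omega)
    push_cast at h3
    rw [hinv, one_mul] at h3
    refine le_trans ?_ h3
    have h5 := integral_theta_add 0 h 1
    have h6 := integral_theta_add h 1 ((N + 1) * h)
    have h7 := (integral_theta_bounds hNh1.le).1
    have h9 := (integral_theta_bounds hh0.le).2
    have h10 : (meanPhase - h / 2) * (L₁ / π) ≤ (∫ x in h..(N + 1) * h, theta (cof x)) * (L₁ / π) := by
      gcongr
      rw [meanPhase]; linarith
    have h11 : h / 2 * (L₁ / π) = 1 / 2 := by rw [hh]; field_simp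
    linarith
  have hsumc : ∑ m ∈ Finset.Icc 1 N, cof (m * h) * L₂ / π
      = L₂ / π * ∑ m ∈ Finset.Icc 1 N, cof (m * h) := by
    rw [Finset.mul_sum]; exact Finset.sum_congr rfl fun _ _ => by ring
  rw [hsumc, Finset.sum_const, Nat.card_Icc, nsmul_eq_mul, Nat.add_sub_cancel]
  have hL2π : 0 < L₂ / π := by positivity
  have hE1 := mul_le_mul_of_nonneg_left (hc1.trans (by linarith :
    _ ≤ L₁ / 4 - 1 / 2 + 3 * √h)) hL2π.le
  have hE2 := mul_le_mul_of_nonneg_left hc2 hL2π.le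
  have hid : L₂ / π * (L₁ / 4 - 1 / 2) = L₁ * L₂ / (4 * π) - L₂ / (2 * π) := by field_simp
  have hsm : L₂ / π * (3 * √h) ≤ η / 4 * L := by
    have h3 : L₂ / π ≤ D * L / 3 := by gcongr
    have h4 : h ≤ (η / (4 * D)) ^ 2 := by
      rw [hh, div_le_iff₀ h₁p]
      rw [div_le_iff₀ hD0] at h₁
      have e1 : 48 * D ^ 2 * D / η ^ 2 * 4 * D ^ 2 ≤ L₁ * D := hL4.trans h₁
      have e2 : 48 * D ^ 2 * D / η ^ 2 * 4 * D ^ 2 = 192 * D ^ 4 / η ^ 2 * D := by ring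
      rw [e2] at e1
      have e3 := le_of_mul_le_mul_right e1 hD0
      rw [div_le_iff₀ (by positivity)] at e3
      rw [div_pow, mul_pow, div_mul_eq_mul_div, le_div_iff₀ (by positivity)]
      have e4 : D ^ 2 ≤ D ^ 4 := pow_le_pow_right₀ hD (by norm_num)
      have e5 : π * (4 ^ 2 * D ^ 2) ≤ 4 * (4 ^ 2 * D ^ 2) := by gcongr; exact pi_lt_four.le
      linarith [sq_nonneg D]
    have h5 : √h ≤ η / (4 * D) := (sqrt_le_sqrt h4).trans_eq (sqrt_sq (by positivity))
    calc L₂ / π * (3 * √h) ≤ D * L / 3 * (3 * (η / (4 * D))) := by gcongr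
      _ = η / 4 * L := by field_simp
  have hcN1 : |(N : ℝ) * (c - 1 / 2) - (c - 1 / 2) * (L₁ / π)| ≤ 3 / 2 := by
    rw [show (N : ℝ) * (c - 1 / 2) - (c - 1 / 2) * (L₁ / π) = -((c - 1 / 2) * (L₁ / π - N)) by ring,
      abs_neg, abs_mul]
    have e1 : |c - 1 / 2| ≤ 3 / 2 := by
      rw [abs_le] at hc ⊢; constructor <;> linarith
    have e2 : |L₁ / π - N| ≤ 1 := by rw [abs_le]; constructor <;> linarith
    nlinarith [abs_nonneg (c - 1 / 2), abs_nonneg (L₁ / π - N)]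
  have h12 : 12 ≤ L * η := (div_le_iff₀ hη).1 hL3
  have hS' := abs_le.1 hS
  have hcN2 := abs_le.1 hcN1
  rw [abs_le]
  constructor <;> nlinarith

theorem exists_mem_modes {L : ℝ} (hL : 8 ≤ L) : ∃ j ∈ modes L, L / π - 2 < j := by
  have hπ := pi_pos
  have hL4 : 4 ≤ L := by linarith
  have : Finite (modes L) := (modes_finite (by linarith)).to_subtype
  have : Fintype (modes L) := Fintype.ofFinite _
  have h := floor_le_card_modes (L := L) (k := 1) (ε := 1 / 4) hL4 zero_le_one le_rfl (by norm_num)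
    (by rw [div_le_iff₀ (by linarith)]; linarith) Finset.univ (fun j _ => Finset.mem_univ j)
  have h1 := theta_le_half (le_refl (1 : ℝ))
  have h2 := Int.sub_one_lt_floor (1 * L / π - theta 1 - 2 * (1 / 4))
  have h3 : L / π - 2 < (Fintype.card (modes L) : ℝ) := by
    have : (⌊1 * L / π - theta 1 - 2 * (1 / 4)⌋ : ℝ) ≤ (Fintype.card (modes L) : ℝ) := by
      exact_mod_cast h
    rw [one_mul] at h2 this
    linarith
  by_contra! hcon
  have h5 : ∀ j : modes L, (j : ℕ) ∈ Finset.Ico 1 (Fintype.card (modes L)) := fun j => by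
    have e := hcon j j.2
    rw [Finset.mem_Ico]
    refine ⟨j.2.1, ?_⟩
    exact_mod_cast e.trans_lt h3
  have h6 := Finset.card_le_card_of_injOn (s := (Finset.univ : Finset (modes L)))
    (fun j => (j : ℕ)) (fun j _ => h5 j) (fun i _ j _ hij => Subtype.ext hij)
  rw [Nat.card_Ico, Finset.card_univ] at h6
  have h7 : (Fintype.card (modes L) : ℝ) ≤ 0 := by
    have : Fintype.card (modes L) = 0 := by omega
    rw [this]; norm_num
  have h8 : 2 ≤ L / π := by
    rw [le_div_iff₀ hπ]; linarith [pi_lt_four]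
  linarith

set_option maxHeartbeats 1000000 in
/-- A large set of hinged modes over which all the required averages are controlled. -/
theorem exists_good_modes {D γ η : ℝ} (hD : 1 ≤ D) (hγ : 0 < γ) (hγ1 : γ ≤ 1 / 4) (hη : 0 < η) :
    ∃ L₀ : ℝ, 0 < L₀ ∧ ∀ L, L₀ ≤ L → ∀ L₁ L₂, L / D ≤ L₁ → L₁ ≤ D * L → L / D ≤ L₂ → L₂ ≤ D * L →
      ∀ hL : 4 ≤ L₂, ∃ G : Finset (modes L₂), (∀ j ∈ G, γ ≤ freq hL j) ∧
        L₂ / π - γ * L₂ - 2 ≤ G.card ∧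
        ∑ j ∈ G, theta (cof (freq hL j)) ≤ meanPhase * (L₂ / π) ∧
        meanPhase * (L₂ / π) - γ * L₂ - 1 ≤ ∑ j ∈ G, theta (cof (freq hL j)) ∧
        ∀ σ : ℝ, |σ| = 1 → ∀ b : ℝ, |b| ≤ 1 → ∀ c : ℝ,
          |∑ j ∈ G, saw (σ * (cof (freq hL j) * L₁ / π) - b * theta (cof (freq hL j)) + c)|
            ≤ η * L := by
  have hπ := pi_pos
  have hπ3 := pi_gt_three
  have hD0 : 0 < D := by linarith
  obtain ⟨L₀, hL₀, H⟩ := abs_sum_saw_nodes (D := D) (γ := γ)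
    (C := D ^ 2 * (2 * π + 8) * π + 1 / γ * (2 * π * D)) (η := η) hD hγ (by positivity) hη
  refine ⟨max L₀ (max (8 * D) (2 * π * 4 / γ ^ 2 * D)), by positivity,
    fun L hLL L₁ L₂ h₁ h₁' h₂ h₂' hL => ?_⟩
  simp only [max_le_iff] at hLL
  have hLp : 0 < L := by linarith
  have h₂p : 0 < L₂ := by linarith
  have h8 : 8 ≤ L₂ := le_trans ((le_div_iff₀ hD0).2 hLL.2.1) h₂
  have hγL : 4 ≤ γ ^ 2 / 2 * (L₂ / π) := by
    have := le_trans ((le_div_iff₀ hD0).2 hLL.2.2) h₂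
    rw [div_le_iff₀ (by positivity)] at this
    rw [mul_div_assoc', le_div_iff₀ hπ]
    linarith
  set h := π / L₂ with hh
  have hh0 : 0 < h := by positivity
  have hinv : h⁻¹ = L₂ / π := by rw [hh, inv_div]
  have hhD : h ≤ π * D / L := by
    rw [hh, div_le_div_iff₀ h₂p hLp]
    rw [div_le_iff₀ hD0] at h₂
    nlinarith
  have hX : 0 < L₂ / π := by positivity
  have hXh : L₂ / π * h = 1 := by rw [hh]; field_simp
  set X := L₂ / π with hXdef
  set n₀ := ⌈γ * X⌉₊
  set n₁ := ⌊cof γ * X⌋₊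
  have hcγ : 1 - γ ^ 2 ≤ cof γ := by linarith [one_sub_cof_le hγ.le (by linarith)]
  have hcγ' : cof γ ≤ 1 - γ ^ 2 / 2 := by
    have e1 := cof_sq' hγ.le (by linarith)
    nlinarith [cof_nonneg γ, sq_nonneg γ, sq_nonneg (γ ^ 2)]
  have hn₀1 : 1 ≤ n₀ := Nat.one_le_ceil_iff.2 (by positivity)
  have hn₀le : (n₀ : ℝ) ≤ γ * X + 1 := (Nat.ceil_lt_add_one (by positivity)).le
  have hn₀ge : γ * X ≤ n₀ := Nat.le_ceil _
  have hn₁le : (n₁ : ℝ) ≤ cof γ * X := Nat.floor_le (mul_nonneg (cof_nonneg γ) hX.le)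
  have hn₁ge : cof γ * X - 1 ≤ n₁ := by
    have := Nat.lt_floor_add_one (cof γ * X); linarith
  have hn₁le' : (n₁ : ℝ) ≤ X - 4 := by nlinarith
  have hn₁ge' : X - γ ^ 2 * X - 1 ≤ n₁ := by nlinarith
  have hγX : γ ^ 2 * X ≤ 1 / 4 * (γ * X) := by
    nlinarith
  have h01 : n₀ ≤ n₁ := by
    have : (n₀ : ℝ) ≤ n₁ := by nlinarith
    exact_mod_cast this
  have hmem : ∀ n ∈ Finset.Ico n₀ n₁, n ∈ modes L₂ := fun n hn => by
    obtain ⟨j, hj, hj'⟩ := exists_mem_modes h8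
    rw [Finset.mem_Ico] at hn
    refine mem_modes_of_le hL hj (hn₀1.trans hn.1) ?_
    have : (n : ℝ) ≤ n₁ := by exact_mod_cast hn.2.le
    have : (n : ℝ) ≤ j := by linarith
    exact_mod_cast this
  classical
  set p : ℕ → ℝ := fun n => if hn : n ∈ modes L₂ then freq hL ⟨n, hn⟩ else 0 with hp
  have hpj : ∀ j : modes L₂, p j = freq hL j := fun j => dif_pos j.2
  set G : Finset (modes L₂) := (Finset.Ico n₀ n₁).subtype (· ∈ modes L₂)
  have hsum : ∀ f : ℝ → ℝ, ∑ j ∈ G, f (freq hL j) = ∑ n ∈ Finset.Ico n₀ n₁, f (p n) := fun f => by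
    rw [← Finset.sum_subtype_of_mem (fun n => f (p n)) hmem]
    exact Finset.sum_congr rfl fun j _ => by rw [hpj]
  have hcard : (G.card : ℝ) = n₁ - n₀ := by
    have := hsum (fun _ => 1)
    simp only [Finset.sum_const, nsmul_eq_mul, mul_one, Nat.card_Ico] at this
    rw [this, Nat.cast_sub h01]
  have hlow : ∀ n ∈ Finset.Ico n₀ n₁, n * h ≤ p n := fun n hn => by
    rw [hp]; simp only [hmem n hn, dite_true]
    refine le_trans (le_of_eq ?_) (lt_freq hL ⟨n, hmem n hn⟩).le
    rw [hh]; ring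
  have hupp : ∀ n ∈ Finset.Ico n₀ n₁, p n ≤ (n + 1 : ℕ) * h := fun n hn => by
    rw [hp]; simp only [hmem n hn, dite_true]
    refine (freq_le hL ⟨n, hmem n hn⟩).trans (le_of_eq ?_)
    rw [hh]; push_cast; ring
  have hγp : ∀ n ∈ Finset.Ico n₀ n₁, γ ≤ p n := fun n hn => by
    refine le_trans ?_ (hlow n hn)
    have e1 : (n₀ : ℝ) ≤ n := by exact_mod_cast (Finset.mem_Ico.1 hn).1
    have e2 : γ * X ≤ n := hn₀ge.trans e1
    calc γ = γ * X * h := by rw [mul_assoc, hXh, mul_one]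
      _ ≤ n * h := by gcongr
  have hpγ : ∀ n ∈ Finset.Ico n₀ n₁, p n ≤ cof γ := fun n hn => by
    refine (hupp n hn).trans ?_
    have e1 : ((n + 1 : ℕ) : ℝ) ≤ n₁ := by exact_mod_cast (Finset.mem_Ico.1 hn).2
    calc ((n + 1 : ℕ) : ℝ) * h ≤ cof γ * X * h := by gcongr; exact e1.trans hn₁le
      _ = cof γ := by rw [mul_assoc, hXh, mul_one]
  have hgood : ∀ n ∈ Finset.Ico n₀ n₁, 0 ≤ p n ∧ γ ≤ cof (p n) := fun n hn => by
    have e := hγ.le.trans (hγp n hn)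
    refine ⟨e, ?_⟩
    have := cof_anti e (hpγ n hn)
    rwa [cof_cof hγ.le (by linarith)] at this
  have hstep : ∀ n i, n₀ ≤ n → n + i < n₁ → |p (n + i) - p n| ≤ 2 * i * h := fun n i hn hi => by
    rcases Nat.eq_zero_or_pos i with rfl | hi0
    · simp
    · have m1 : n ∈ Finset.Ico n₀ n₁ := Finset.mem_Ico.2 ⟨hn, by omega⟩
      have m2 : n + i ∈ Finset.Ico n₀ n₁ := Finset.mem_Ico.2 ⟨by omega, hi⟩
      have a1 := hlow _ m1
      have a2 := hlow _ m2
      have a3 := hupp _ m1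
      have a4 := hupp _ m2
      push_cast at a1 a2 a3 a4
      have hi1 : (1 : ℝ) ≤ i := by exact_mod_cast hi0
      have hi1h : h ≤ i * h := by nlinarith
      rw [abs_le]; constructor <;> nlinarith
  refine ⟨G, fun j hj => ?_, ?_, ?_, ?_, ?_⟩
  · rw [← hpj]; exact hγp _ (Finset.mem_subtype.1 hj)
  · rw [hcard]
    have : γ * X * 3 ≤ γ * L₂ := by
      rw [hXdef, mul_assoc]
      gcongr
      rw [div_mul_eq_mul_div, div_le_iff₀ hπ]; nlinarith
    linarith
  · rw [hsum (fun x => theta (cof x))]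
    have e1 : ∑ n ∈ Finset.Ico n₀ n₁, theta (cof (p n))
        ≤ ∑ n ∈ Finset.Ico n₀ n₁, theta (cof (n * h)) :=
      Finset.sum_le_sum fun n hn => theta_cof_anti (by positivity) (hlow n hn)
    have e2 := sum_theta_le hh0 (show n₀ - 1 ≤ n₁ - 1 by omega)
    rw [Finset.sum_Ico_add' (fun j : ℕ => theta (cof (j * h))) _ _ 1, Nat.sub_add_cancel hn₀1,
      Nat.sub_add_cancel (hn₀1.trans h01), hinv] at e2
    refine e1.trans (e2.trans ?_)
    rw [mul_comm]
    gcongr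
    have i1 := integral_theta_add 0 ((n₀ - 1 : ℕ) * h) ((n₁ - 1 : ℕ) * h)
    have i2 := integral_theta_add 0 ((n₁ - 1 : ℕ) * h) 1
    have i3 := (integral_theta_bounds (show (0 : ℝ) ≤ (n₀ - 1 : ℕ) * h by positivity)).1
    have i4 := (integral_theta_bounds (show ((n₁ - 1 : ℕ) : ℝ) * h ≤ 1 by
      rw [← hXh]
      gcongr
      rw [Nat.cast_sub (hn₀1.trans h01)]; push_cast; linarith)).1
    rw [meanPhase]; linarith
  · rw [hsum (fun x => theta (cof x))]
    have e1 : ∑ n ∈ Finset.Ico n₀ n₁, theta (cof ((n + 1 : ℕ) * h))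
        ≤ ∑ n ∈ Finset.Ico n₀ n₁, theta (cof (p n)) :=
      Finset.sum_le_sum fun n hn => theta_cof_anti (hgood n hn).1 (hupp n hn)
    have e2 := le_sum_theta hh0 (show n₀ + 1 ≤ n₁ + 1 by omega)
    rw [Finset.sum_Ico_add' (fun j : ℕ => theta (cof (j * h))) _ _ 1] at e1
    refine le_trans ?_ (e2.trans e1)
    rw [hinv]
    push_cast
    have i1 := integral_theta_add 0 ((n₀ + 1) * h) ((n₁ + 1) * h)
    have i2 := integral_theta_add 0 ((n₁ + 1) * h) 1
    have i3 := (integral_theta_bounds (show (0 : ℝ) ≤ (n₀ + 1) * h by positivity)).2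
    have i4 := (integral_theta_bounds (show ((n₁ : ℝ) + 1) * h ≤ 1 by
      rw [← hXh]
      gcongr
      linarith)).2
    have i5 : meanPhase - (n₀ + 1) * h / 2 - (1 - (n₁ + 1) * h) / 2
        ≤ ∫ x in ((n₀ + 1) * h)..((n₁ + 1) * h), theta (cof x) := by
      rw [meanPhase]; linarith
    have i6 := mul_le_mul_of_nonneg_left i5 hX.le
    have i7 : X * (meanPhase - (n₀ + 1) * h / 2 - (1 - (n₁ + 1) * h) / 2)
        = meanPhase * X - (n₀ + 1) / 2 - (X - (n₁ + 1)) / 2 := by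
      linear_combination (-(n₀ + 1 : ℝ) / 2 + (n₁ + 1) / 2) * hXh
    have i8 : γ * X * 3 ≤ γ * L₂ := by
      rw [hXdef, mul_assoc]
      gcongr
      rw [div_mul_eq_mul_div, div_le_iff₀ hπ]; nlinarith
    linarith
  · intro σ hσ b hb c
    rw [hsum (fun x => saw (σ * (cof x * L₁ / π) - b * theta (cof x) + c))]
    have hn₁D : (n₁ : ℝ) ≤ D * L := by
      have : X ≤ L₂ := by rw [hXdef, div_le_iff₀ hπ]; nlinarith
      linarith
    have := H L hLL.1 L₂ L₁ h₂ h₂' h₁ h₁' n₀ n₁ hn₁D p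
      (fun n => -b * theta (cof (p n)) + c) hgood
      (fun n i hn hi => by
        rcases Nat.eq_zero_or_pos i with rfl | hi0
        · simp
        have m1 : n ∈ Finset.Ico n₀ n₁ := Finset.mem_Ico.2 ⟨hn, by omega⟩
        have m2 : n + i ∈ Finset.Ico n₀ n₁ := Finset.mem_Ico.2 ⟨by omega, hi⟩
        have q1 : p n = (n + phase hL ⟨n, hmem n m1⟩) * h := by
          rw [hp]; simp only [hmem n m1, dite_true]; exact freq_eq hL _
        have q2 : p (n + i) = ((n + i : ℕ) + phase hL ⟨n + i, hmem _ m2⟩) * h := by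
          rw [hp]; simp only [hmem _ m2, dite_true]; exact freq_eq hL _
        have q3 := abs_le.1 (abs_phase_sub_le hL ⟨n, hmem n m1⟩)
        have q4 := abs_le.1 (abs_phase_sub_le hL ⟨n + i, hmem _ m2⟩)
        have q5 := hstep n i hn hi
        have f1 : freq hL ⟨n, hmem n m1⟩ = p n := (hpj ⟨n, hmem n m1⟩).symm
        have f2 : freq hL ⟨n + i, hmem _ m2⟩ = p (n + i) := (hpj ⟨n + i, hmem _ m2⟩).symm
        rw [f1] at q3
        rw [f2] at q4
        have b1 : p n ≤ 1 := (hpγ n m1).trans (cof_le_one γ)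
        have b2 : p (n + i) ≤ 1 := (hpγ _ m2).trans (cof_le_one γ)
        have q6 := abs_le.1 (abs_theta_sub_le (hgood _ m2).1 b2 (hgood _ m1).1 b1)
        have hi1 : (1 : ℝ) ≤ i := by exact_mod_cast hi0
        set φ₁ := phase hL ⟨n, hmem n m1⟩
        set φ₂ := phase hL ⟨n + i, hmem _ m2⟩
        have q7 : |φ₂ - φ₁| ≤ (2 * π + 8) * i / L₂ := by
          have : (2 * π + 8) * i / L₂ = 2 * i * h + 8 * i / L₂ := by rw [hh]; ring
          have z1 : 8 / L₂ ≤ 8 * i / L₂ := by gcongr; linarith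
          have z2 : 8 / L₂ = 4 / L₂ + 4 / L₂ := by ring
          rw [abs_le]; constructor <;> linarith
        have q8 : p (n + i) - p n - i * (π / L₂) = (φ₂ - φ₁) * h := by
          rw [q1, q2, hh]; push_cast; ring
        rw [q8, abs_mul, abs_of_pos hh0]
        have z3 : 1 / L₂ ≤ D / L := by
          rw [div_le_div_iff₀ h₂p hLp]
          rw [div_le_iff₀ hD0] at h₂
          linarith
        calc |φ₂ - φ₁| * h ≤ (2 * π + 8) * i / L₂ * (π * D / L) := by gcongr
          _ = (2 * π + 8) * i * (1 / L₂) * (π * D / L) := by ring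
          _ ≤ (2 * π + 8) * i * (D / L) * (π * D / L) := by gcongr
          _ = D ^ 2 * (2 * π + 8) * π * i / L ^ 2 := by field_simp
          _ ≤ _ := by
            gcongr
            have : 0 < 1 / γ * (2 * π * D) := by positivity
            linarith)
      (fun n i hn hi => by
        have m1 : n ∈ Finset.Ico n₀ n₁ := Finset.mem_Ico.2 ⟨hn, by omega⟩
        have m2 : n + i ∈ Finset.Ico n₀ n₁ := Finset.mem_Ico.2 ⟨by omega, hi⟩
        have e1 := hgood _ m1
        have e2 := hgood _ m2
        have e3 := abs_theta_cof_sub_le hγ e2.1 e1.1 e2.2 e1.2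
        rw [show -b * theta (cof (p (n + i))) + c - (-b * theta (cof (p n)) + c)
          = -b * (theta (cof (p (n + i))) - theta (cof (p n))) by ring, abs_mul, abs_neg]
        calc |b| * |theta (cof (p (n + i))) - theta (cof (p n))|
            ≤ 1 * (1 / γ * (2 * i * h)) := by
              gcongr
              exact e3.trans (by gcongr; exact hstep n i hn hi)
          _ ≤ 1 * (1 / γ * (2 * i * (π * D / L))) := by gcongr
          _ = 1 / γ * (2 * π * D) * i / L := by ring
          _ ≤ _ := by
            gcongr
            have : 0 < D ^ 2 * (2 * π + 8) * π := by positivity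
            linarith) σ hσ
    refine le_trans (le_of_eq ?_) this
    congr 1
    refine Finset.sum_congr rfl fun n _ => ?_
    congr 1
    ring

theorem mul_sqrt_le_mul {B D η L L₂ : ℝ} (hη : 0 < η) (hL : 0 < L) (h₂ : L₂ ≤ D * L)
    (hBL : 64 * B ^ 2 * D / η ^ 2 ≤ L) : B * √L₂ ≤ η / 8 * L := by
  refine (le_abs_self _).trans (abs_le_of_sq_le_sq ?_ (by positivity))
  have h1 : √L₂ ^ 2 ≤ max (D * L) 0 := by
    rcases le_total 0 L₂ with h | h
    · rw [sq_sqrt h]; exact h₂.trans (le_max_left _ _)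
    · rw [sqrt_eq_zero_of_nonpos h]; simp
  rw [div_le_iff₀ (by positivity)] at hBL
  rw [mul_pow]
  rcases le_total 0 (D * L) with h | h
  · rw [max_eq_left h] at h1
    have h2 : B ^ 2 * √L₂ ^ 2 ≤ B ^ 2 * (D * L) := by gcongr
    nlinarith
  · rw [max_eq_right h] at h1
    have h2 : B ^ 2 * √L₂ ^ 2 ≤ B ^ 2 * 0 := by gcongr
    nlinarith [sq_nonneg (η / 8 * L)]

/-- Two-term Weyl asymptotics of the counting function, up to `o(L)`. -/
def weyl (L₁ L₂ : ℝ) : ℝ :=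
  L₁ * L₂ / (4 * π) - (1 / 2 + meanPhase) * ((L₁ + L₂) / π)

set_option maxHeartbeats 1000000 in
theorem upper_weyl {D η κ : ℝ} (hD : 1 ≤ D) (hη : 0 < η) (hκ : 0 < κ) :
    ∃ L₀ : ℝ, 0 < L₀ ∧ ∀ L, L₀ ≤ L → ∀ L₁ L₂, L / D ≤ L₁ → L₁ ≤ D * L → L / D ≤ L₂ → L₂ ≤ D * L →
      ∀ K, NegSpan L₁ L₂ (κ / L₂) K → (K : ℝ) ≤ weyl L₁ L₂ + η * L := by
  have hπ3 := pi_gt_three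
  have hD0 : 0 < D := by linarith
  obtain ⟨ε, hε, hε4, hεη⟩ : ∃ ε : ℝ, 0 < ε ∧ ε ≤ 1 / 4 ∧ ε * D ≤ η / 8 := by
    refine ⟨min (1 / 4) (η / (8 * D)), by positivity, min_le_left _ _, ?_⟩
    calc _ ≤ η / (8 * D) * D := by gcongr; exact min_le_right _ _
      _ = η / 8 := by field_simp
  obtain ⟨L₀, B, H⟩ := upper_floor hε hε hκ
  obtain ⟨La, hLa, Ha⟩ := abs_sum_floor_uniform hD (by positivity : 0 < η / 24)
  obtain ⟨Lb, hLb, Hb⟩ := exists_good_modes hD hε hε4 (by positivity : 0 < η / 24)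
  refine ⟨max (max La Lb) (max (max (D * L₀) (4 * D)) (max (8 / η) (64 * B ^ 2 * D / η ^ 2))),
    by positivity, fun L hLL L₁ L₂ h₁ h₁' h₂ h₂' K hK => ?_⟩
  simp only [max_le_iff] at hLL
  obtain ⟨⟨g1, g2⟩, ⟨g3, g4⟩, g5, g6⟩ := hLL
  have hLp : 0 < L := by linarith
  have g3' : L₀ ≤ L / D := by rw [le_div_iff₀ hD0]; linarith
  have hL : 4 ≤ L₂ := le_trans (by rw [le_div_iff₀ hD0]; linarith) h₂
  obtain ⟨G, G1, G2, G3, G4, G5⟩ := Hb L g2 L₁ L₂ h₁ h₁' h₂ h₂' hL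
  have hu := H L₁ L₂ (g3'.trans h₁) (g3'.trans h₂) hL G G1 K hK
  have ha := (abs_le.1 (Ha L g1 L₁ L₂ h₁ h₁' h₂ h₂' (2 * ε)
    (by rw [abs_of_pos (by positivity)]; linarith))).2
  have hb1 := (abs_le.1 (G5 1 abs_one 1 abs_one.le (2 * ε))).2
  have hb2 := (abs_le.1 (G5 (-1) (by simp) 0 (by simp) 0)).2
  have hGc := card_modes_le (by linarith : 0 < L₂) G
  have hs : ∑ j ∈ G, ((⌊cof (freq hL j) * L₁ / π - theta (cof (freq hL j)) + 2 * ε⌋ : ℝ)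
          + ⌊-(cof (freq hL j) * L₁ / π)⌋ + 1)
      = ∑ j ∈ G, saw (1 * (cof (freq hL j) * L₁ / π) - 1 * theta (cof (freq hL j)) + 2 * ε)
        + ∑ j ∈ G, saw (-1 * (cof (freq hL j) * L₁ / π) - 0 * theta (cof (freq hL j)) + 0)
        - ∑ j ∈ G, theta (cof (freq hL j)) + G.card * (2 * ε) := by
    rw [← nsmul_eq_mul, ← Finset.sum_const, ← Finset.sum_add_distrib, ← Finset.sum_sub_distrib,
      ← Finset.sum_add_distrib]
    refine Finset.sum_congr rfl fun j _ => ?_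
    rw [saw, saw, show -1 * (cof (freq hL j) * L₁ / π) - 0 * theta (cof (freq hL j)) + 0
      = -(cof (freq hL j) * L₁ / π) by ring, one_mul, one_mul]
    ring
  have hB := mul_sqrt_le_mul (B := B) hη hLp h₂' g6
  have g5' := (div_le_iff₀ hη).1 g5
  have x1 : ε * (L₁ / π) ≤ η / 8 * L / 3 := by
    calc ε * (L₁ / π) ≤ ε * (D * L / 3) := by gcongr
      _ = ε * D * L / 3 := by ring
      _ ≤ _ := by gcongr
  have x2 : ε * (L₂ / π) ≤ η / 8 * L / 3 := by
    calc ε * (L₂ / π) ≤ ε * (D * L / 3) := by gcongr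
      _ = ε * D * L / 3 := by ring
      _ ≤ _ := by gcongr
  have x3 : ε * L₂ ≤ η / 8 * L := by
    calc ε * L₂ ≤ ε * (D * L) := by gcongr
      _ = ε * D * L := by ring
      _ ≤ _ := by gcongr
  have x4 : (G.card : ℝ) * (2 * ε) ≤ 2 * (ε * (L₂ / π)) := by nlinarith
  rw [hs] at hu
  have hw : weyl L₁ L₂ = (L₁ * L₂ / (4 * π) - L₂ / (2 * π) - (1 / 2 + meanPhase - 2 * ε) * (L₁ / π))
      - meanPhase * (L₂ / π) - 2 * (ε * (L₁ / π)) := by rw [weyl]; ring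
  rw [hw]
  linarith

set_option maxHeartbeats 1000000 in
theorem lower_weyl {D η κ : ℝ} (hD : 1 ≤ D) (hη : 0 < η) (hκ : 0 < κ) :
    ∃ L₀ : ℝ, 0 < L₀ ∧ ∀ L, L₀ ≤ L → ∀ L₁ L₂, L / D ≤ L₁ → L₁ ≤ D * L → L / D ≤ L₂ → L₂ ≤ D * L →
      ∃ K, NegSpan L₁ L₂ (-(κ / L₂)) K ∧ weyl L₁ L₂ - η * L ≤ K := by
  have hπ3 := pi_gt_three
  have hD0 : 0 < D := by linarith
  obtain ⟨ε, hε, hε4, hεη⟩ : ∃ ε : ℝ, 0 < ε ∧ ε ≤ 1 / 4 ∧ ε * D ≤ η / 16 := by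
    refine ⟨min (1 / 4) (η / (16 * D)), by positivity, min_le_left _ _, ?_⟩
    calc _ ≤ η / (16 * D) * D := by gcongr; exact min_le_right _ _
      _ = η / 16 := by field_simp
  obtain ⟨L₀, B, H⟩ := lower_floor hε hε (by linarith) hκ
  obtain ⟨La, hLa, Ha⟩ := abs_sum_floor_uniform hD (by positivity : 0 < η / 24)
  obtain ⟨Lb, hLb, Hb⟩ := exists_good_modes hD hε hε4 (by positivity : 0 < η / 24)
  refine ⟨max (max La Lb) (max (max (D * L₀) (4 * D)) (max (32 / η) (64 * B ^ 2 * D / η ^ 2))),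
    by positivity, fun L hLL L₁ L₂ h₁ h₁' h₂ h₂' => ?_⟩
  simp only [max_le_iff] at hLL
  obtain ⟨⟨g1, g2⟩, ⟨g3, g4⟩, g5, g6⟩ := hLL
  have hLp : 0 < L := by linarith
  have g3' : L₀ ≤ L / D := by rw [le_div_iff₀ hD0]; linarith
  have hL : 4 ≤ L₂ := le_trans (by rw [le_div_iff₀ hD0]; linarith) h₂
  obtain ⟨G, G1, G2, G3, G4, G5⟩ := Hb L g2 L₁ L₂ h₁ h₁' h₂ h₂' hL
  have : Finite (modes L₂) := (modes_finite (by linarith)).to_subtype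
  have : Fintype (modes L₂) := Fintype.ofFinite _
  obtain ⟨K, hK, hu⟩ := H L₁ L₂ (g3'.trans h₁) (g3'.trans h₂) hL Finset.univ G
    (fun j => Finset.mem_univ j) G1
  refine ⟨K, hK, ?_⟩
  have ha := (abs_le.1 (Ha L g1 L₁ L₂ h₁ h₁' h₂ h₂' (-(2 * ε))
    (by rw [abs_neg, abs_of_pos (by positivity)]; linarith))).1
  have hb1 := (abs_le.1 (G5 1 abs_one 1 abs_one.le (-(2 * ε)))).1
  have hb2 := (abs_le.1 (G5 1 abs_one 0 (by simp) 0)).2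
  have hGc := card_modes_le (by linarith : 0 < L₂) G
  have hAc := card_modes_le (by linarith : 0 < L₂) (Finset.univ : Finset (modes L₂))
  have hs : ∑ j ∈ G, ((⌊cof (freq hL j) * L₁ / π - theta (cof (freq hL j)) - 2 * ε⌋ : ℝ)
          - ⌊cof (freq hL j) * L₁ / π⌋)
      = ∑ j ∈ G, saw (1 * (cof (freq hL j) * L₁ / π) - 1 * theta (cof (freq hL j)) + -(2 * ε))
        - ∑ j ∈ G, saw (1 * (cof (freq hL j) * L₁ / π) - 0 * theta (cof (freq hL j)) + 0)
        - ∑ j ∈ G, theta (cof (freq hL j)) - G.card * (2 * ε) := by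
    rw [← nsmul_eq_mul, ← Finset.sum_const, ← Finset.sum_sub_distrib, ← Finset.sum_sub_distrib,
      ← Finset.sum_sub_distrib]
    refine Finset.sum_congr rfl fun j _ => ?_
    rw [saw, saw, show 1 * (cof (freq hL j) * L₁ / π) - 0 * theta (cof (freq hL j)) + 0
      = cof (freq hL j) * L₁ / π by ring, one_mul, one_mul, ← sub_eq_add_neg]
    ring
  have hB := mul_sqrt_le_mul (B := B) hη hLp h₂' g6
  have g5' := (div_le_iff₀ hη).1 g5
  have x1 : ε * (L₁ / π) ≤ η / 16 * L / 3 := by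
    calc ε * (L₁ / π) ≤ ε * (D * L / 3) := by gcongr
      _ = ε * D * L / 3 := by ring
      _ ≤ _ := by gcongr
  have x2 : ε * (L₂ / π) ≤ η / 16 * L / 3 := by
    calc ε * (L₂ / π) ≤ ε * (D * L / 3) := by gcongr
      _ = ε * D * L / 3 := by ring
      _ ≤ _ := by gcongr
  have x3 : ε * L₂ ≤ η / 16 * L := by
    calc ε * L₂ ≤ ε * (D * L) := by gcongr
      _ = ε * D * L := by ring
      _ ≤ _ := by gcongr
  have x4 : (G.card : ℝ) * (2 * ε) ≤ 2 * (ε * (L₂ / π)) := by nlinarith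
  simp only [← sub_eq_add_neg (_ - _) (2 * ε)] at ha
  rw [hs] at hu
  have hw : weyl L₁ L₂ = (L₁ * L₂ / (4 * π) - L₂ / (2 * π)
      - (1 / 2 + meanPhase - -(2 * ε)) * (L₁ / π))
      - meanPhase * (L₂ / π) + 2 * (ε * (L₁ / π)) := by rw [weyl]; ring
  rw [hw]
  linarith

/-- There is a `K`-dimensional space of admissible functions with Rayleigh quotient below `μ`. -/
def NegOn (Ω : Set (ℝ × ℝ)) (μ : ℝ) (K : ℕ) : Prop :=
  ∃ u : Fin K → ℝ × ℝ → ℝ, (∀ i, Adm Ω (u i)) ∧ ∀ c : Fin K → ℝ, c ≠ 0 →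
    ∫ p, (lap (fun q => ∑ i, c i * u i q) p) ^ 2 < μ * ∫ p, (∑ i, c i * u i p) ^ 2

theorem Adm.pd {Ω : Set (ℝ × ℝ)} {u : ℝ × ℝ → ℝ} (h : Adm Ω u) (v : ℝ × ℝ) : Adm Ω (pd v u) :=
  ⟨contDiff_pd h.1 v, h.2.1.fderiv_apply (𝕜 := ℝ) v,
    (tsupport_fderiv_apply_subset ℝ v).trans h.2.2⟩

theorem Adm.lap {Ω : Set (ℝ × ℝ)} {u : ℝ × ℝ → ℝ} (h : Adm Ω u) : Adm Ω (lap u) :=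
  ((h.pd _).pd _).add ((h.pd _).pd _)

theorem Adm.ip2_self {L₁ L₂ : ℝ} {u : ℝ × ℝ → ℝ} (h : Adm (Set.Ioo 0 L₁ ×ˢ Set.Ioo 0 L₂) u)
    (hc : Continuous u) : ip2 L₁ L₂ ⟨u, hc⟩ ⟨u, hc⟩ = ∫ p, u p ^ 2 := by
  rw [ip2_apply, setIntegral_eq_integral_of_forall_compl_eq_zero fun p hp => ?_]
  · exact integral_congr_ae (Eventually.of_forall fun p => (pow_two _).symm)
  · have : u p = 0 := h.zero_of_notMem fun h' =>
      hp (Set.prod_mono Set.Ioo_subset_Icc_self Set.Ioo_subset_Icc_self h')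
    simp [this]

theorem negSpan_iff_negOn {L₁ L₂ δ : ℝ} {K : ℕ} :
    NegSpan L₁ L₂ δ K ↔ NegOn (Set.Ioo 0 L₁ ×ˢ Set.Ioo 0 L₂) (1 - δ) K := by
  have key : ∀ (ψ : Fin K → ℝ × ℝ → ℝ)
      (hψ : ∀ i, Adm (Set.Ioo 0 L₁ ×ˢ Set.Ioo 0 L₂) (ψ i)) (a : Fin K → ℝ),
      qf L₁ L₂ (comb (fun i => ap (ψ i) (hψ i).1) a) (comb (fun i => ap (ψ i) (hψ i).1) a)
        + δ * ip2 L₁ L₂ (comb (fun i => ap (ψ i) (hψ i).1) a).1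
          (comb (fun i => ap (ψ i) (hψ i).1) a).1 =
      (∫ p, (lap (fun q => ∑ i, a i * ψ i q) p) ^ 2) - (1 - δ) * ∫ p, (∑ i, a i * ψ i p) ^ 2 := by
    intro ψ hψ a
    have hA := Adm.lincomb Finset.univ a hψ
    rw [comb_apply, ← ap_lincomb Finset.univ a (fun i => (hψ i).1) hA.1, qf_apply, ap,
      hA.ip2_self, hA.lap.ip2_self]
    ring
  constructor
  · rintro ⟨ψ, hψ, h⟩
    exact ⟨ψ, hψ, fun c hc => sub_neg.1 ((key ψ hψ c).symm.trans_lt (h c hc))⟩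
  · rintro ⟨ψ, hψ, h⟩
    exact ⟨ψ, hψ, fun c hc => (key ψ hψ c).trans_lt (sub_neg.2 (h c hc))⟩

theorem pd_dilate {u : ℝ × ℝ → ℝ} (hu : ContDiff ℝ (⊤ : ℕ∞) u) (s : ℝ) (v : ℝ × ℝ) :
    pd v (fun p => u (s • p)) = fun p => s * pd v u (s • p) := by
  funext p
  have h : HasFDerivAt (fun p : ℝ × ℝ => u (s • p))
      ((fderiv ℝ u (s • p)).comp (s • ContinuousLinearMap.id ℝ (ℝ × ℝ))) p :=
    ((hu.differentiable (by simp)).differentiableAt.hasFDerivAt).comp p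
      ((hasFDerivAt_id p).const_smul s)
  rw [pd, h.fderiv]
  simp [pd]

theorem pd_const_mul {u : ℝ × ℝ → ℝ} (hu : ContDiff ℝ (⊤ : ℕ∞) u) (s : ℝ) (v : ℝ × ℝ) :
    pd v (fun p => s * u p) = fun p => s * pd v u p := by
  funext p
  have h := ((hu.differentiable (by simp)).differentiableAt.hasFDerivAt (x := p)).const_mul s
  rw [pd, h.fderiv]
  simp [pd]

theorem lap_dilate {u : ℝ × ℝ → ℝ} (hu : ContDiff ℝ (⊤ : ℕ∞) u) (s : ℝ) :
    lap (fun p => u (s • p)) = fun p => s ^ 2 * lap u (s • p) := by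
  have hd : ∀ w : ℝ × ℝ → ℝ, ContDiff ℝ (⊤ : ℕ∞) w → ContDiff ℝ (⊤ : ℕ∞) fun p => w (s • p) :=
    fun w hw => hw.comp (contDiff_const_smul s)
  have h : ∀ v, pd v (pd v fun p => u (s • p)) = fun p => s ^ 2 * pd v (pd v u) (s • p) := fun v => by
    rw [pd_dilate hu, pd_const_mul (hd _ (contDiff_pd hu v)), pd_dilate (contDiff_pd hu v)]
    funext p; ring
  unfold lap uxx uyy
  rw [h, h]
  funext p; ring

theorem Adm.dilate {Ω Ω' : Set (ℝ × ℝ)} {u : ℝ × ℝ → ℝ} (h : Adm Ω u) {s : ℝ} (hs : 0 < s)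
    (hΩ : ∀ p, s • p ∈ Ω → p ∈ Ω') : Adm Ω' fun p => u (s • p) := by
  refine ⟨h.1.comp (contDiff_const_smul s),
    h.2.1.comp_homeomorph (Homeomorph.smulOfNeZero s hs.ne'), fun p hp => hΩ p (h.2.2 ?_)⟩
  exact (Set.ext_iff.mp (tsupport_comp_eq_preimage u (Homeomorph.smulOfNeZero s hs.ne')) p).mp hp

theorem integral_dilate (f : ℝ × ℝ → ℝ) {s : ℝ} (hs : 0 < s) :
    ∫ p, f (s • p) = (s ^ 2)⁻¹ * ∫ p, f p := by
  rw [Measure.integral_comp_smul, Module.finrank_prod, Module.finrank_self, smul_eq_mul,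
    abs_of_pos (by positivity)]

theorem NegOn.dilate {Ω Ω' : Set (ℝ × ℝ)} {μ s : ℝ} {K : ℕ} (h : NegOn Ω μ K) (hs : 0 < s)
    (hΩ : ∀ p, s • p ∈ Ω → p ∈ Ω') : NegOn Ω' (s ^ 4 * μ) K := by
  obtain ⟨u, hu, H⟩ := h
  refine ⟨fun i p => u i (s • p), fun i => (hu i).dilate hs hΩ, fun c hc => ?_⟩
  have h1 := lap_dilate (Adm.lincomb Finset.univ c hu).1 s
  have h2 := integral_dilate (fun p => (lap (fun q => ∑ i, c i * u i q) p) ^ 2) hs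
  have h3 := integral_dilate (fun p => (∑ i, c i * u i p) ^ 2) hs
  rw [h1]
  simp only [mul_pow]
  rw [integral_const_mul, h2, h3]
  calc (s ^ 2) ^ 2 * ((s ^ 2)⁻¹ * ∫ p, (lap (fun q => ∑ i, c i * u i q) p) ^ 2)
      < (s ^ 2) ^ 2 * ((s ^ 2)⁻¹ * (μ * ∫ p, (∑ i, c i * u i p) ^ 2)) := by
        gcongr; exact H c hc
    _ = _ := by ring

theorem NegOn.of_le {Ω : Set (ℝ × ℝ)} {μ : ℝ} {K K' : ℕ} (h : NegOn Ω μ K) (hK : K' ≤ K) :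
    NegOn Ω μ K' := by
  obtain ⟨u, hu, H⟩ := h
  have hinj : Function.Injective (Fin.castLE hK) := Fin.castLE_injective hK
  refine ⟨fun i => u (Fin.castLE hK i), fun i => hu _, fun c hc => ?_⟩
  have e : ∀ q, ∑ i, Function.extend (Fin.castLE hK) c 0 i * u i q
      = ∑ i, c i * u (Fin.castLE hK i) q := fun q => by
    classical
    have := Finset.sum_subset (Finset.subset_univ (Finset.univ.image (Fin.castLE hK)))
      (f := fun i => Function.extend (Fin.castLE hK) c 0 i * u i q) fun i _ hi => by
        rw [Function.extend_apply' _ _ _ fun ⟨j, hj⟩ => hi (by simp [← hj])]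
        simp
    rw [← this, Finset.sum_image fun _ _ _ _ hij => hinj hij]
    simp [hinj.extend_apply]
  have := H (Function.extend (Fin.castLE hK) c 0) fun h0 => hc (funext fun i => by
    have := congrFun h0 (Fin.castLE hK i)
    rwa [hinj.extend_apply] at this)
  simp only [e] at this
  exact this

theorem NegOn.mono {Ω : Set (ℝ × ℝ)} {μ μ' : ℝ} {K : ℕ} (h : NegOn Ω μ K) (hμ : μ ≤ μ') :
    NegOn Ω μ' K := by
  obtain ⟨u, hu, H⟩ := h
  exact ⟨u, hu, fun c hc => (H c hc).trans_le
    (mul_le_mul_of_nonneg_right hμ (integral_nonneg fun _ => sq_nonneg _))⟩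

theorem linearIndependent_of_rayleigh_lt {μ : ℝ} {K : ℕ} {u : Fin K → ℝ × ℝ → ℝ}
    (H : ∀ c : Fin K → ℝ, c ≠ 0 →
      ∫ p, (lap (fun q => ∑ i, c i * u i q) p) ^ 2 < μ * ∫ p, (∑ i, c i * u i p) ^ 2) :
    LinearIndependent ℝ u := by
  rw [Fintype.linearIndependent_iff]
  intro c hc
  by_contra! hne
  obtain ⟨i, hi⟩ := hne
  have h0 : ∀ p, ∑ i, c i * u i p = 0 := fun p => by
    have := congrFun hc p
    simpa using this
  have h1 := H c fun h => hi (by rw [h]; rfl)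
  have h2 : 0 ≤ ∫ p, (lap (fun q => ∑ i, c i * u i q) p) ^ 2 := integral_nonneg fun _ => sq_nonneg _
  simp only [h0] at h1 h2
  simp at h1
  linarith

theorem lamk_bddBelow (k : ℕ) (a : ℝ) : BddBelow { μ | ∃ u : Fin k → (ℝ × ℝ → ℝ),
    (∀ i, Adm (Rect a) (u i)) ∧ LinearIndependent ℝ u ∧
    μ = sSup { r | ∃ c : Fin k → ℝ, c ≠ 0 ∧
      r = (∫ p, (lap (fun q => ∑ i, c i * u i q) p) ^ 2) /
          (∫ p, (∑ i, c i * u i p) ^ 2) } } := by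
  refine ⟨0, ?_⟩
  rintro μ ⟨u, -, -, rfl⟩
  refine Real.sSup_nonneg ?_
  rintro r ⟨c, -, rfl⟩
  exact div_nonneg (integral_nonneg fun _ => sq_nonneg _) (integral_nonneg fun _ => sq_nonneg _)

theorem integral_lincomb_pos {Ω : Set (ℝ × ℝ)} {K : ℕ} {u : Fin K → ℝ × ℝ → ℝ}
    (hu : ∀ i, Adm Ω (u i)) (hl : LinearIndependent ℝ u) {c : Fin K → ℝ} (hc : c ≠ 0) :
    0 < ∫ p, (∑ i, c i * u i p) ^ 2 := by
  have hA := Adm.lincomb Finset.univ c hu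
  have hne : ∃ p, ∑ i, c i * u i p ≠ 0 := by
    by_contra! h
    exact hc (funext (Fintype.linearIndependent_iff.1 hl c (funext fun p => by simpa using h p)))
  obtain ⟨p, hp⟩ := hne
  refine (hA.1.continuous.pow 2).integral_pos_of_hasCompactSupport_nonneg_nonzero (x := p) ?_
    (fun _ => sq_nonneg _) (pow_ne_zero 2 hp)
  exact hA.2.1.comp_left (g := fun x : ℝ => x ^ 2) (by norm_num)

theorem lamk_le_of_negOn {a μ : ℝ} {K : ℕ} (hK : 0 < K) (h : NegOn (Rect a) μ K) :
    lamk K a ≤ μ := by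
  obtain ⟨u, hu, H⟩ := h
  have hl := linearIndependent_of_rayleigh_lt H
  refine (csInf_le (lamk_bddBelow K a) ⟨u, hu, hl, rfl⟩).trans (csSup_le ?_ ?_)
  · exact ⟨_, fun _ => 1, fun h0 => one_ne_zero (congrFun h0 ⟨0, hK⟩), rfl⟩
  · rintro r ⟨c, hc, rfl⟩
    rw [div_le_iff₀ (integral_lincomb_pos hu hl hc)]
    exact (H c hc).le

theorem bddAbove_rayleigh {L₁ L₂ : ℝ} {K : ℕ} {u : Fin K → ℝ × ℝ → ℝ}
    (hu : ∀ i, Adm (Set.Ioo 0 L₁ ×ˢ Set.Ioo 0 L₂) (u i)) (hl : LinearIndependent ℝ u) :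
    BddAbove { r | ∃ c : Fin K → ℝ, c ≠ 0 ∧
      r = (∫ p, (lap (fun q => ∑ i, c i * u i q) p) ^ 2) / (∫ p, (∑ i, c i * u i p) ^ 2) } := by
  set v : Fin K → C(ℝ × ℝ, ℝ) × C(ℝ × ℝ, ℝ) := fun i => ap (u i) (hu i).1 with hv
  have e : ∀ c : Fin K → ℝ,
      (∫ p, (lap (fun q => ∑ i, c i * u i q) p) ^ 2) / (∫ p, (∑ i, c i * u i p) ^ 2)
        = ip2 L₁ L₂ (comb v c).2 (comb v c).2 / ip2 L₁ L₂ (comb v c).1 (comb v c).1 := fun c => by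
    have hA := Adm.lincomb Finset.univ c hu
    rw [hv, comb_apply, ← ap_lincomb Finset.univ c (fun i => (hu i).1) hA.1, ap,
      hA.ip2_self, hA.lap.ip2_self]
  have hpos : ∀ c : Fin K → ℝ, c ≠ 0 → 0 < ip2 L₁ L₂ (comb v c).1 (comb v c).1 := fun c hc => by
    have hA := Adm.lincomb Finset.univ c hu
    rw [hv, comb_apply, ← ap_lincomb Finset.univ c (fun i => (hu i).1) hA.1, ap, hA.ip2_self]
    exact integral_lincomb_pos hu hl hc
  have hc1 : Continuous fun c : Fin K → ℝ => ip2 L₁ L₂ (comb v c).1 (comb v c).1 := by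
    simp only [comb_apply, Prod.fst_sum, Prod.smul_fst, map_sum, map_smul, LinearMap.sum_apply,
      LinearMap.smul_apply, smul_eq_mul]
    fun_prop
  have hc2 : Continuous fun c : Fin K → ℝ => ip2 L₁ L₂ (comb v c).2 (comb v c).2 := by
    simp only [comb_apply, Prod.snd_sum, Prod.smul_snd, map_sum, map_smul, LinearMap.sum_apply,
      LinearMap.smul_apply, smul_eq_mul]
    fun_prop
  obtain ⟨C, hC⟩ := (isCompact_sphere (0 : Fin K → ℝ) 1).bddAbove_image
    (hc2.continuousOn.div hc1.continuousOn fun c hc => (hpos c fun h0 => by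
      rw [h0] at hc; simp at hc).ne')
  refine ⟨C, ?_⟩
  rintro r ⟨c, hc, rfl⟩
  have hn : 0 < ‖c‖ := norm_pos_iff.2 hc
  have hm := hC ⟨‖c‖⁻¹ • c, by
    rw [mem_sphere_zero_iff_norm, norm_smul, norm_inv, norm_norm, inv_mul_cancel₀ hn.ne'], rfl⟩
  rw [e]
  refine le_trans (le_of_eq ?_) hm
  simp only [Pi.div_apply, map_smul, Prod.smul_fst, Prod.smul_snd, LinearMap.smul_apply, smul_eq_mul]
  rw [← mul_assoc, ← mul_assoc, mul_div_mul_left _ _ (by positivity)]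

theorem negOn_of_lamk_lt {a μ μ₀ : ℝ} {K : ℕ} (h : NegOn (Rect a) μ₀ K) (hlt : lamk K a < μ) :
    NegOn (Rect a) μ K := by
  obtain ⟨u₀, hu₀, H₀⟩ := h
  rw [lamk] at hlt
  obtain ⟨r, ⟨u, hu, hl, rfl⟩, hr⟩ := exists_lt_of_csInf_lt
    (by exact ⟨_, u₀, hu₀, linearIndependent_of_rayleigh_lt H₀, rfl⟩) hlt
  refine ⟨u, hu, fun c hc => ?_⟩
  rw [← div_lt_iff₀ (integral_lincomb_pos hu hl hc)]
  exact (le_csSup (bddAbove_rayleigh hu hl) ⟨c, hc, rfl⟩).trans_lt hr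

theorem negOn_rect_iff {a L μ : ℝ} {K : ℕ} (hL : 0 < L) :
    NegOn (Set.Ioo 0 (a * L) ×ˢ Set.Ioo 0 (L / a)) μ K ↔ NegOn (Rect a) (L ^ 4 * μ) K := by
  have h1 : ∀ p : ℝ × ℝ, p ∈ Rect a ↔ L • p ∈ Set.Ioo 0 (a * L) ×ˢ Set.Ioo 0 (L / a) := fun p => by
    simp only [Rect, Set.mem_prod, Set.mem_Ioo, Prod.smul_fst, Prod.smul_snd, smul_eq_mul,
      mul_pos_iff_of_pos_left hL, mul_comm a L, mul_lt_mul_iff_right₀ hL, div_eq_mul_one_div L a]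
  constructor
  · exact fun h => h.dilate hL fun p => (h1 p).2
  · intro h
    have h2 := h.dilate (Ω' := Set.Ioo 0 (a * L) ×ˢ Set.Ioo 0 (L / a)) (inv_pos.2 hL) fun p hp => by
      have := (h1 _).1 hp
      rwa [smul_inv_smul₀ hL.ne'] at this
    rwa [← mul_assoc, ← mul_pow, inv_mul_cancel₀ hL.ne', one_pow, one_mul] at h2

theorem NegSpan.le_card {L₁ L₂ δ : ℝ} {K : ℕ} (h₁ : 0 < L₁) (h₂ : 0 < L₂) (hδ : 0 ≤ δ)
    (h : NegSpan L₁ L₂ δ K) (low : Finset (ℕ × ℕ))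
    (hlow : ∀ m n, 0 < m → 0 < n → fr L₁ m ^ 2 + fr L₂ n ^ 2 < 1 → (m, n) ∈ low) :
    K ≤ low.card := by
  by_contra! hlt
  obtain ⟨ψ, hψ, H⟩ := h
  set v := fun i => ap (ψ i) (hψ i).1
  set T : (Fin K → ℝ) →ₗ[ℝ] (low → ℝ) := LinearMap.pi fun q =>
    ((ip2 L₁ L₂).flip (tens (sn L₁ q.1.1) (sn L₂ q.1.2))).comp
      ((LinearMap.fst ℝ C(ℝ × ℝ, ℝ) C(ℝ × ℝ, ℝ)).comp (comb v))
  have hr : Module.finrank ℝ (low → ℝ) < Module.finrank ℝ (Fin K → ℝ) := by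
    simpa [Module.finrank_fintype_fun_eq_card] using hlt
  obtain ⟨c, hc, hc0⟩ := (Submodule.ne_bot_iff _).1 (LinearMap.ker_ne_bot_of_finrank_lt hr (f := T))
  have hm : comb v c ∈ hinged L₁ L₂ := comb_mem v _ (fun i => (hψ i).ap_mem_hinged h₁ h₂) c
  have h3 := qf_nonneg_of_low h₁ h₂ hm fun m n hm hn hmn =>
    congrFun (LinearMap.mem_ker.1 hc) ⟨(m, n), hlow m n hm hn hmn⟩
  have h4 := H c hc0
  have h5 := mul_nonneg hδ (ip2_self_nonneg L₁ L₂ (comb v c).1)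
  linarith

/-- A bound on the number of low eigenvalues which is efficient for long rectangles. -/
theorem NegSpan.le_of_thin {L₁ L₂ δ : ℝ} {K : ℕ} (h₁ : 0 < L₁) (h₂ : 0 < L₂) (hδ : 0 ≤ δ)
    (hK : 0 < K) (h : NegSpan L₁ L₂ δ K) :
    (K : ℝ) ≤ L₁ * L₂ / (4 * π) - 13 / 200 * (L₁ / π) := by
  have hπ := pi_pos
  set N := ⌊L₂ / π⌋₊
  set low : Finset (ℕ × ℕ) := (Finset.Icc 1 N).biUnion fun n =>
    (Finset.Icc 1 ⌊cof (fr L₂ n) * L₁ / π⌋₊).image fun m => (m, n) with hlowdef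
  have hle := h.le_card h₁ h₂ hδ low fun m n hm hn hmn => by
    have e1 : fr L₂ n < 1 := by nlinarith [sq_nonneg (fr L₁ m), fr_nonneg h₂ n]
    have e2 : fr L₁ m ≤ cof (fr L₂ n) := le_sqrt_of_sq_le (by linarith)
    have e0 : fr L₁ m = m * π / L₁ := rfl
    have e0' : fr L₂ n = n * π / L₂ := rfl
    simp only [hlowdef, Finset.mem_biUnion, Finset.mem_image, Finset.mem_Icc]
    refine ⟨n, ⟨hn, Nat.le_floor ?_⟩, m, ⟨hm, Nat.le_floor ?_⟩, rfl⟩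
    · rw [le_div_iff₀ hπ]
      rw [e0', div_lt_one h₂] at e1
      exact e1.le
    · rw [le_div_iff₀ hπ, ← div_le_iff₀ h₁, ← e0]
      exact e2
  have hcard : (low.card : ℝ) ≤ L₁ / π * ∑ n ∈ Finset.Icc 1 N, cof (n * (π / L₂)) := by
    have e1 : low.card ≤ ∑ n ∈ Finset.Icc 1 N, ⌊cof (fr L₂ n) * L₁ / π⌋₊ := by
      refine Finset.card_biUnion_le.trans (Finset.sum_le_sum fun n _ => ?_)
      refine Finset.card_image_le.trans (le_of_eq ?_)
      rw [Nat.card_Icc, Nat.add_sub_cancel]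
    rw [Finset.mul_sum]
    calc (low.card : ℝ) ≤ ∑ n ∈ Finset.Icc 1 N, (⌊cof (fr L₂ n) * L₁ / π⌋₊ : ℝ) := by
          exact_mod_cast e1
      _ ≤ _ := Finset.sum_le_sum fun n _ => by
        have e2 : fr L₂ n = n * (π / L₂) := mul_div_assoc ..
        rw [← e2]
        refine (Nat.floor_le (by have := cof_nonneg (fr L₂ n); positivity)).trans (le_of_eq ?_)
        ring
  have hKc : (K : ℝ) ≤ L₁ / π * ∑ n ∈ Finset.Icc 1 N, cof (n * (π / L₂)) :=
    le_trans (by exact_mod_cast hle) hcard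
  have hN1 : 1 ≤ N := by
    by_contra! h0
    have h0' : N = 0 := by omega
    rw [h0'] at hKc
    simp at hKc
    linarith
  have hNle : (N : ℝ) ≤ L₂ / π := Nat.floor_le (by positivity)
  have hNlt : L₂ / π < N + 1 := Nat.lt_floor_add_one _
  have hNh : N * (π / L₂) ≤ 1 := by
    rw [mul_div_assoc', div_le_one h₂]
    rwa [le_div_iff₀ hπ] at hNle
  have hNh2 : 1 / 2 ≤ N * (π / L₂) := by
    have e1 : (1 : ℝ) ≤ N := by exact_mod_cast hN1
    rw [mul_div_assoc', le_div_iff₀ h₂]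
    rw [div_lt_iff₀ hπ] at hNlt
    nlinarith
  have hc : cof (N * (π / L₂)) ≤ 87 / 100 := sqrt_le_iff.2 ⟨by norm_num, by nlinarith⟩
  have hs := sum_cof_le (by positivity : 0 < π / L₂) hNh
  have e4 : π / (4 * (π / L₂)) = L₂ / 4 := by field_simp
  rw [e4] at hs
  have hX : 0 < L₁ / π := by positivity
  have := mul_le_mul_of_nonneg_left (hs.trans (by linarith : _ ≤ L₂ / 4 - 13 / 200)) hX.le
  calc (K : ℝ) ≤ L₁ / π * (L₂ / 4 - 13 / 200) := hKc.trans this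
    _ = _ := by field_simp

theorem exists_negOn_rect {a : ℝ} (ha : 1 ≤ a) (K : ℕ) : ∃ μ, NegOn (Rect a) μ K := by
  have hπ := pi_pos
  have ha0 : 0 < a := by linarith
  obtain ⟨L₀, hL₀, H⟩ := lower_weyl ha one_pos one_pos
  set b := (1 / 2 + meanPhase) * ((a + 1 / a) / π) + 1 with hb
  have hb1 : 0 < b := by have := meanPhase_nonneg; positivity
  set L := max L₀ (4 * π * (b + K))
  have hLp : 0 < L := lt_of_lt_of_le hL₀ (le_max_left _ _)
  have h1 : L / a ≤ a * L := by
    rw [div_le_iff₀ ha0]; nlinarith [mul_le_mul ha ha zero_le_one ha0.le]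
  obtain ⟨K', hK', hle⟩ := H L (le_max_left _ _) (a * L) (L / a) h1 le_rfl le_rfl h1
  have h2 : weyl (a * L) (L / a) - 1 * L = L * (L / (4 * π) - b) := by
    rw [weyl, hb]; field_simp; ring
  have hKL : (b + K : ℝ) ≤ L / (4 * π) := by
    rw [le_div_iff₀ (by positivity)]
    linarith [le_max_right L₀ (4 * π * (b + K))]
  have hL1 : 1 ≤ L := by
    have e1 : (1 : ℝ) ≤ b := by
      have := meanPhase_nonneg
      rw [hb]; have : 0 ≤ (1 / 2 + meanPhase) * ((a + 1 / a) / π) := by positivity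
      linarith
    have e3 : 4 * π * (b + K) ≤ L := le_max_right _ _
    nlinarith [pi_gt_three]
  have hKK : (K : ℝ) ≤ K' := by
    rw [h2] at hle
    nlinarith
  exact ⟨_, (negOn_rect_iff hLp).1
    ((negSpan_iff_negOn.1 hK').of_le (by exact_mod_cast hKK))⟩

theorem lamk_one_le {η : ℝ} (hη : 0 < η) : ∃ L₀ : ℝ, 0 < L₀ ∧ ∀ L, L₀ ≤ L → ∀ K : ℕ, 0 < K →
    (K : ℝ) ≤ weyl L L - η * L → lamk K 1 ≤ L ^ 4 * (1 + η / L) := by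
  obtain ⟨L₀, hL₀, H⟩ := lower_weyl le_rfl hη hη
  refine ⟨L₀, hL₀, fun L hL K hK hKL => ?_⟩
  have hLp : 0 < L := by linarith
  obtain ⟨K', hK', hle⟩ := H L hL L L (by simp) (by simp) (by simp) (by simp)
  have h := (negSpan_iff_negOn.1 hK').of_le (K' := K) (by exact_mod_cast hKL.trans hle)
  have e : Set.Ioo 0 L ×ˢ Set.Ioo 0 L = Set.Ioo 0 (1 * L) ×ˢ Set.Ioo 0 (L / 1) := by simp
  rw [e, negOn_rect_iff hLp, sub_neg_eq_add] at h
  exact lamk_le_of_negOn hK h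

theorem negSpan_of_lamk_le {a L η : ℝ} {K : ℕ} (ha : 1 ≤ a) (hη : 0 < η) (hL : 0 < L)
    (h : lamk K a ≤ L ^ 4 * (1 + η / L)) :
    NegSpan (a * (L + η)) ((L + η) / a) (η / (L + η)) K := by
  have hL' : 0 < L + η := by linarith
  obtain ⟨μ₀, h₀⟩ := exists_negOn_rect ha K
  rw [negSpan_iff_negOn, negOn_rect_iff hL']
  refine negOn_of_lamk_lt h₀ (h.trans_lt ?_)
  have e1 : L ^ 4 * (1 + η / L) = L ^ 3 * (L + η) := by field_simp
  have e2 : (L + η) ^ 4 * (1 - η / (L + η)) = (L + η) ^ 3 * L := by field_simp; ring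
  rw [e1, e2]
  have : L ^ 2 < (L + η) ^ 2 := by gcongr; linarith
  have h3 : 0 < L * (L + η) := by positivity
  nlinarith

set_option maxHeartbeats 1000000 in
theorem eventually_lt_of_minimal {e : ℝ} (he : 0 < e) (he1 : e ≤ 1) :
    ∃ k₀ : ℕ, ∀ K : ℕ, k₀ ≤ K → ∀ a : ℝ, 1 ≤ a → lamk K a ≤ lamk K 1 → a < 1 + e := by
  have hπ3 := pi_gt_three
  have hπ4 := pi_lt_four
  have hm0 := meanPhase_nonneg
  have hm1 := meanPhase_le_half
  set c := 1 / 2 + meanPhase with hc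
  set η := e ^ 2 / 2400 with hη
  have hη0 : 0 < η := by positivity
  have hη1 : η ≤ 1 / 2400 := by rw [hη]; gcongr; exact pow_le_one₀ he.le he1
  obtain ⟨La, hLa, Ha⟩ := lamk_one_le hη0
  obtain ⟨Lb, hLb, Hb⟩ := upper_weyl (D := 100) (by norm_num) hη0 (by positivity : 0 < η / 100)
  refine ⟨⌈max La Lb ^ 2⌉₊ + 1, fun K hK a ha hle => ?_⟩
  have hK0 : 0 < K := by omega
  set q := 4 * c + 2 * π * η with hq
  have hq0 : 0 ≤ q := by positivity
  set L := q + √(q ^ 2 + 4 * π * K) with hLdef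
  have hsq : √(q ^ 2 + 4 * π * K) ^ 2 = q ^ 2 + 4 * π * K := sq_sqrt (by positivity)
  have hM : max La Lb ≤ L := by
    have e1 : max La Lb ≤ √(q ^ 2 + 4 * π * K) := by
      refine le_sqrt_of_sq_le ?_
      have e2 : (⌈max La Lb ^ 2⌉₊ : ℝ) ≤ K := by exact_mod_cast (show _ ≤ K by omega)
      have e3 := (Nat.le_ceil (max La Lb ^ 2)).trans e2
      nlinarith [sq_nonneg q]
    linarith
  rw [max_le_iff] at hM
  have hLp : 0 < L := by linarith
  have hKeq : (K : ℝ) = L ^ 2 / (4 * π) - 2 * c * (L / π) - η * L := by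
    have e1 : L ^ 2 = 2 * q * L + 4 * π * K := by
      rw [hLdef]; linear_combination hsq
    rw [e1, hq]; field_simp; ring
  have hlam := hle.trans (Ha L hM.1 K hK0 (le_of_eq (by rw [hKeq, weyl]; ring)))
  have hneg := negSpan_of_lamk_le ha hη0 hLp hlam
  set L' := L + η with hL'
  have hL'p : 0 < L' := by linarith
  have hX : L / π ≤ L' / π := by gcongr; linarith
  have hprod : a * L' * (L' / a) = L' ^ 2 := by field_simp
  have hdiff : L' ^ 2 / (4 * π) - L ^ 2 / (4 * π) ≤ η * L' / 6 := by
    rw [← sub_div, div_le_iff₀ (by positivity), hL']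
    nlinarith [mul_pos hη0 hLp, mul_pos hη0 hη0]
  have hηL : η * L ≤ η * L' := by gcongr; linarith
  have hXL : L' = L' / π * π := by field_simp
  have hX0 : 0 < L' / π := by positivity
  by_contra! hae
  rcases le_or_gt a 100 with h100 | h100
  · have hs : NegSpan (a * L') (L' / a) (η / 100 / (L' / a)) K := by
      rw [negSpan_iff_negOn] at hneg ⊢
      refine hneg.mono (sub_le_sub_left ?_ 1)
      rw [div_div_eq_mul_div, mul_comm_div, div_le_div_iff_of_pos_right hL'p]
      exact mul_le_of_le_one_right hη0.le (by rwa [div_le_one (by norm_num)])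
    have h1 : L' / 100 ≤ L' / a := by gcongr
    have h2 : L' / a ≤ L' := div_le_self hL'p.le ha
    have h3 : L' ≤ a * L' := le_mul_of_one_le_left hL'p.le ha
    have h4 : a * L' ≤ 100 * L' := by gcongr
    have hu := Hb L' (by linarith) (a * L') (L' / a) (by linarith) h4 h1 (by linarith) K hs
    have hρ : e ^ 2 / 100 ≤ a + 1 / a - 2 := by
      rw [show a + 1 / a - 2 = (a - 1) ^ 2 / a by field_simp; ring]
      have : e ^ 2 ≤ (a - 1) ^ 2 := by gcongr; linarith
      gcongr
    rw [weyl, hprod, ← hc] at hu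
    have e1 : (a * L' + L' / a) / π = (a + 1 / a - 2) * (L' / π) + 2 * (L' / π) := by
      field_simp; ring
    rw [e1] at hu
    have e2 : e ^ 2 / 100 * (L' / π) ≤ (a + 1 / a - 2) * (L' / π) := by gcongr
    have e3 : e ^ 2 / 100 = 24 * η := by rw [hη]; ring
    have e4 : 1 / 2 * (24 * η * (L' / π)) ≤ c * ((a + 1 / a - 2) * (L' / π)) := by
      rw [← e3]; gcongr; linarith
    have e5 : c * (L / π) ≤ c * (L' / π) := by gcongr
    have e6 : η * L' = η * (L' / π) * π := by field_simp
    have e7 : η * (L' / π) * π ≤ η * (L' / π) * 4 := by gcongr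
    have e8 : 0 < η * (L' / π) := by positivity
    nlinarith
  · have hu := hneg.le_of_thin (by positivity) (by positivity) (by positivity) hK0
    rw [hprod] at hu
    have e1 : a * L' / π = a * (L' / π) := by ring
    have e2 : 100 * (L' / π) ≤ a * (L' / π) := by gcongr
    have e3 : c * (L / π) ≤ 1 * (L' / π) := by gcongr; linarith
    have e4 : η * L' ≤ 1 / 2400 * (L' / π * 4) := by
      rw [hXL]
      gcongr
      rw [← hXL]
    rw [e1] at hu
    linarith

/-- The optimal rectangular shapes for `λ_k` converge to the square as
`k → ∞`: any sequence of minimisers `a_k` tends to `1`, equivalently the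
side-length quotients `q_k* = a_k²` tend to `1`. -/
theorem minimisers_converge_to_square (a : ℕ → ℝ)
    (ha : ∀ k : ℕ, 1 ≤ a k ∧ ∀ b : ℝ, 1 ≤ b → lamk (k + 1) (a k) ≤ lamk (k + 1) b) :
    Filter.Tendsto a Filter.atTop (nhds 1) ∧
    Filter.Tendsto (fun k : ℕ => (a k) ^ 2) Filter.atTop (nhds 1) := by
  have h : Filter.Tendsto a Filter.atTop (nhds 1) := by
    rw [Metric.tendsto_atTop]
    intro e he
    obtain ⟨k₀, hk₀⟩ := eventually_lt_of_minimal (e := min e 1) (by positivity) (min_le_right _ _)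
    refine ⟨k₀, fun k hk => ?_⟩
    have h1 := hk₀ (k + 1) (by omega) (a k) (ha k).1 ((ha k).2 1 le_rfl)
    rw [Real.dist_eq, abs_of_nonneg (by linarith [(ha k).1])]
    linarith [min_le_left e 1]
  exact ⟨h, by simpa using h.pow 2⟩
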